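/- For all d ≥ 3, all integers L ≥ 0 and all δ ∈ (0,1), the critical parameters of the noised truncated model coincide: h̃(δ,L) = h*(δ,L) = h**(δ,L). -/

import Mathlib

open MeasureTheory ProbabilityTheory Filter Set

namespace GFFperc

noncomputable section

/-- The lattice `ℤ^d`. -/
abbrev V (d : ℕ) := Fin d → ℤ

/-- Nearest-neighbour adjacency on `ℤ^d`. -/
def adj {d : ℕ} (x y : V d) : Prop := (∑ i, (x i - y i).natAbs) = 1

/-- `ℓ∞` distance between two points. -/
def dinf {d : ℕ} (x y : V d) : ℕ := Finset.univ.sup fun i => (x i - y i).natAbs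

/-- `A` and `B` are joined by a nearest-neighbour path contained in `S`. -/
def ConnIn {d : ℕ} (S A B : Set (V d)) : Prop :=
  ∃ (n : ℕ) (γ : ℕ → V d), γ 0 ∈ A ∧ γ n ∈ B ∧ (∀ k, k ≤ n → γ k ∈ S) ∧
    ∀ k, k < n → adj (γ k) (γ (k + 1))

/-- A set is connected: any two of its points are joined inside it. -/
def IsConnSet {d : ℕ} (S : Set (V d)) : Prop := ∀ x ∈ S, ∀ y ∈ S, ConnIn S {x} {y}

/-- The connected component of `x` in `S`. -/
def comp {d : ℕ} (S : Set (V d)) (x : V d) : Set (V d) := {y | ConnIn S {x} {y}}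

/-- Box of (real) radius `r` centered at `x`. -/
def boxAt {d : ℕ} (x : V d) (r : ℝ) : Set (V d) := {y | ∀ i, |(y i : ℝ) - (x i : ℝ)| ≤ r}

def box (d : ℕ) (r : ℝ) : Set (V d) := boxAt (0 : V d) r

/-- Inner vertex boundary of the box of radius `r` centered at `x`. -/
def bdryAt {d : ℕ} (x : V d) (r : ℝ) : Set (V d) :=
  {y | y ∈ boxAt x r ∧ ∃ z, z ∉ boxAt x r ∧ adj y z}

def bdry (d : ℕ) (r : ℝ) : Set (V d) := bdryAt (0 : V d) r

/-- `A` is connected to infinity within `S`. -/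
def ConnToInf {d : ℕ} (S A : Set (V d)) : Prop := ∀ R : ℕ, 1 ≤ R → ConnIn S A (bdry d R)

/-- The `ℓ∞`-diameter of `S` is at least `r`. -/
def diamGE {d : ℕ} (S : Set (V d)) (r : ℝ) : Prop := ∃ x ∈ S, ∃ y ∈ S, r ≤ (dinf x y : ℝ)

def unitV (d : ℕ) (i : Fin d) : V d := fun j => if j = i then 1 else 0

/-- `k`-step transition probabilities of simple random walk on `ℤ^d`. -/
def srwP (d : ℕ) : ℕ → V d → V d → ℝ
  | 0, x, y => if x = y then 1 else 0
  | (k + 1), x, y =>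
      (1 / (2 * d)) * ∑ i : Fin d, (srwP d k (x + unitV d i) y + srwP d k (x - unitV d i) y)

/-- Green function of simple random walk on `ℤ^d`. -/
def green (d : ℕ) (x y : V d) : ℝ := ∑' k : ℕ, srwP d k x y

/-- `ℓ`-step transition kernel of the lazy simple random walk on `ℤ^d`. -/
def lazyP (d : ℕ) : ℕ → V d → V d → ℝ
  | 0, x, y => if x = y then 1 else 0
  | (k + 1), x, y =>
      (1 / 2) * lazyP d k x y +
        (1 / (4 * d)) * ∑ i : Fin d, (lazyP d k (x + unitV d i) y + lazyP d k (x - unitV d i) y)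

/-- `φ` is a centered Gaussian field with covariance function `C`: every finite linear
combination is a centered Gaussian variable with the corresponding variance. -/
def IsCGF {Ω : Type*} [MeasurableSpace Ω] {d : ℕ} (P : Measure Ω)
    (φ : V d → Ω → ℝ) (C : V d → V d → ℝ) : Prop :=
  (∀ x, Measurable (φ x)) ∧
    ∀ (s : Finset (V d)) (a : V d → ℝ),
      Measure.map (fun ω => ∑ x ∈ s, a x * φ x ω) P =
        gaussianReal 0 (Real.toNNReal (∑ x ∈ s, ∑ y ∈ s, a x * a y * C x y))

/-- `φ` is a Gaussian free field on `ℤ^d`. -/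
def IsGFF {Ω : Type*} [MeasurableSpace Ω] {d : ℕ} (P : Measure Ω) (φ : V d → Ω → ℝ) : Prop :=
  IsCGF P φ (green d)

/-- The level set `{φ ≥ h}`. -/
def lvl {d : ℕ} {Ω : Type*} (φ : V d → Ω → ℝ) (h : ℝ) (ω : Ω) : Set (V d) := {x | h ≤ φ x ω}

/-- The whole field, as one random variable with values in `V d → ℝ`. -/
def proc {Ω : Type*} {d : ℕ} (φ : V d → Ω → ℝ) : Ω → V d → ℝ := fun ω x => φ x ω

/-- The critical parameter `h_*`. -/
def hStar (d : ℕ) {Ω : Type*} [MeasurableSpace Ω] (P : Measure Ω) (φ : V d → Ω → ℝ) : ℝ :=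
  sInf {h : ℝ | P {ω | ConnToInf (lvl φ h ω) {(0 : V d)}} = 0}

/-- The critical parameter `h_{**}`. -/
def hStarStar (d : ℕ) {Ω : Type*} [MeasurableSpace Ω] (P : Measure Ω) (φ : V d → Ω → ℝ) : ℝ :=
  sInf {h : ℝ |
    (⨅ R : ℕ, P {ω | ConnIn (lvl φ h ω) (box d ((R : ℝ) + 1)) (bdry d (2 * ((R : ℝ) + 1)))}) = 0}

/-- `u(R) = exp((log R)^{1/3})`. -/
def ufn (R : ℝ) : ℝ := Real.exp (Real.log R ^ ((1 : ℝ) / 3))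

def tildeSet (d : ℕ) {Ω : Type*} [MeasurableSpace Ω] (P : Measure Ω) (φ : V d → Ω → ℝ) :
    Set ℝ :=
  {h : ℝ |
    (⨅ R : ℕ, ENNReal.ofReal (((R : ℝ) + 1) ^ d) *
        P {ω | ¬ ConnIn (lvl φ h ω) (box d (ufn ((R : ℝ) + 1))) (bdry d ((R : ℝ) + 1))}) = 0}

/-- The critical parameter `h̃`. -/
def hTilde (d : ℕ) {Ω : Type*} [MeasurableSpace Ω] (P : Measure Ω) (φ : V d → Ω → ℝ) : ℝ :=
  sSup (tildeSet d P φ)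

/-- The event `Exist(R,α)`. -/
def ExistEv (d : ℕ) {Ω : Type*} (φ : V d → Ω → ℝ) (R : ℕ) (α : ℝ) : Set Ω :=
  {ω | ∃ x ∈ lvl φ α ω ∩ box d (R : ℝ),
    diamGE (comp (lvl φ α ω ∩ box d (R : ℝ)) x) ((R : ℝ) / 5)}

/-- The event `Unique(R,α)`. -/
def UniqueEv (d : ℕ) {Ω : Type*} (φ : V d → Ω → ℝ) (R : ℕ) (α : ℝ) : Set Ω :=
  {ω | ∀ x ∈ lvl φ α ω ∩ box d (R : ℝ), ∀ y ∈ lvl φ α ω ∩ box d (R : ℝ),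
    diamGE (comp (lvl φ α ω ∩ box d (R : ℝ)) x) ((R : ℝ) / 10) →
    diamGE (comp (lvl φ α ω ∩ box d (R : ℝ)) y) ((R : ℝ) / 10) →
    ConnIn (lvl φ α ω ∩ box d (2 * (R : ℝ))) {x} {y}}

/-- `φ` strongly percolates up to level `h`. -/
def StronglyPerc (d : ℕ) {Ω : Type*} [MeasurableSpace Ω] (P : Measure Ω)
    (φ : V d → Ω → ℝ) (h : ℝ) : Prop :=
  ∃ c : ℝ, 0 < c ∧ ∃ ρ : ℝ, ρ ∈ Set.Ioc (0 : ℝ) 1 ∧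
    ∀ α : ℝ, α ≤ h → ∀ R : ℕ, 1 ≤ R →
      ENNReal.ofReal (1 - Real.exp (-c * (R : ℝ) ^ ρ)) ≤ P (ExistEv d φ R α) ∧
      ENNReal.ofReal (1 - Real.exp (-c * (R : ℝ) ^ ρ)) ≤ P (UniqueEv d φ R α)

/-- The critical parameter `h̄`. -/
def hBar (d : ℕ) {Ω : Type*} [MeasurableSpace Ω] (P : Measure Ω) (φ : V d → Ω → ℝ) : ℝ :=
  sSup {h : ℝ | StronglyPerc d P φ h}


/-- Covariance of the truncated field `φ^L`. -/
def covTrunc (d L : ℕ) (x y : V d) : ℝ := (1 / 2) * ∑ ℓ ∈ Finset.range (L + 1), lazyP d ℓ x y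

/-- Covariance of the tail field `φ - φ^L`. -/
def covTail (d L : ℕ) (x y : V d) : ℝ := (1 / 2) * ∑' ℓ : ℕ, lazyP d (ℓ + L + 1) x y

/-- `U` is a family of i.i.d. uniform-`[0,1]` random variables. -/
def IsIIDUnif {Ω : Type*} [MeasurableSpace Ω] {d : ℕ} (P : Measure Ω)
    (U : V d → Ω → ℝ) : Prop :=
  (∀ x, Measurable (U x)) ∧
    (∀ x, Measure.map (U x) P = volume.restrict (Set.Icc (0 : ℝ) 1)) ∧
    iIndepFun U P

/-- The noised level set `T_δ {φ^L ≥ h}`, driven by the uniform variables `U`. -/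
def TdLvl {Ω : Type*} {d : ℕ} (U φL : V d → Ω → ℝ) (δ h : ℝ) (ω : Ω) : Set (V d) :=
  {x | 1 - δ / 2 ≤ U x ω ∨ (δ / 2 < U x ω ∧ U x ω < 1 - δ / 2 ∧ h ≤ φL x ω)}

/-- `h_*(δ,L)` for the noised truncated model. -/
def hStarT (d : ℕ) {Ω : Type*} [MeasurableSpace Ω] (P : Measure Ω)
    (U φL : V d → Ω → ℝ) (δ : ℝ) : ℝ :=
  sInf {h : ℝ | P {ω | ConnToInf (TdLvl U φL δ h ω) {(0 : V d)}} = 0}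

/-- `h_{**}(δ,L)` for the noised truncated model. -/
def hStarStarT (d : ℕ) {Ω : Type*} [MeasurableSpace Ω] (P : Measure Ω)
    (U φL : V d → Ω → ℝ) (δ : ℝ) : ℝ :=
  sInf {h : ℝ |
    (⨅ R : ℕ, P {ω | ConnIn (TdLvl U φL δ h ω) (box d ((R : ℝ) + 1))
      (bdry d (2 * ((R : ℝ) + 1)))}) = 0}

/-- `h̃(δ,L)` for the noised truncated model. -/
def hTildeT (d : ℕ) {Ω : Type*} [MeasurableSpace Ω] (P : Measure Ω)
    (U φL : V d → Ω → ℝ) (δ : ℝ) : ℝ :=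
  sSup {h : ℝ |
    (⨅ R : ℕ, ENNReal.ofReal (((R : ℝ) + 1) ^ d) *
        P {ω | ¬ ConnIn (TdLvl U φL δ h ω) (box d (ufn ((R : ℝ) + 1)))
          (bdry d ((R : ℝ) + 1))}) = 0}

section

/-- `Rch r S x y`: the point `y` can be reached from `x` by an `r`-path inside `S`. -/
inductive Rch {α : Type*} (r : α → α → Prop) (S : Set α) (x : α) : α → Prop
  | refl : x ∈ S → Rch r S x x
  | step {y z : α} : Rch r S x y → r y z → z ∈ S → Rch r S x z

namespace Rch

variable {α : Type*} {r : α → α → Prop} {S T C : Set α} {x y z : α}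

theorem left_mem (h : Rch r S x y) : x ∈ S := by
  induction h with
  | refl h => exact h
  | step _ _ _ ih => exact ih

theorem right_mem (h : Rch r S x y) : y ∈ S := by
  cases h with
  | refl h => exact h
  | step _ _ h => exact h

theorem mono (hST : S ⊆ T) (h : Rch r S x y) : Rch r T x y := by
  induction h with
  | refl h => exact .refl (hST h)
  | step _ h1 h2 ih => exact .step ih h1 (hST h2)

theorem trans (h : Rch r S x y) (h' : Rch r S y z) : Rch r S x z := by
  induction h' with
  | refl _ => exact h
  | step _ h1 h2 ih => exact .step ih h1 h2

theorem head (hx : x ∈ S) (hxy : r x y) (h : Rch r S y z) : Rch r S x z :=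
  (Rch.step (.refl hx) hxy h.left_mem).trans h

theorem symm (hr : ∀ a b, r a b → r b a) (h : Rch r S x y) : Rch r S y x := by
  induction h with
  | refl h => exact .refl h
  | step _ h1 h2 ih => exact ih.head h2 (hr _ _ h1)

/-- First exit of a path from a set. -/
theorem first_exit (h : Rch r S x y) (hx : x ∈ C) (hy : y ∉ C) :
    ∃ z w, Rch r (S ∩ C) x z ∧ r z w ∧ w ∈ S ∧ w ∉ C ∧ Rch r S w y := by
  induction h with
  | refl _ => exact absurd hx hy
  | @step u v h1 h2 h3 ih =>
    by_cases hu : u ∈ C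
    · have key : Rch r (S ∩ C) x u ∨
          ∃ z w, Rch r (S ∩ C) x z ∧ r z w ∧ w ∈ S ∧ w ∉ C ∧ Rch r S w u := by
        clear ih h2 h3 hy hu
        induction h1 with
        | refl h => exact .inl (.refl ⟨h, hx⟩)
        | @step a b h1 h2 h3 ih =>
          rcases ih with ih | ⟨z, w, q1, q2, q3, q4, q5⟩
          · by_cases hb : b ∈ C
            · exact .inl (ih.step h2 ⟨h3, hb⟩)
            · exact .inr ⟨a, b, ih, h2, h3, hb, .refl h3⟩
          · exact .inr ⟨z, w, q1, q2, q3, q4, q5.step h2 h3⟩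
      rcases key with key | ⟨z, w, q1, q2, q3, q4, q5⟩
      · exact ⟨u, v, key, h2, h3, hy, .refl h3⟩
      · exact ⟨z, w, q1, q2, q3, q4, q5.step h2 h3⟩
    · obtain ⟨z, w, q1, q2, q3, q4, q5⟩ := ih hu
      exact ⟨z, w, q1, q2, q3, q4, q5.step h2 h3⟩

/-- Last exit of a path from a set. -/
theorem last_exit (h : Rch r S x y) (hx : x ∈ C) (hy : y ∉ C) :
    ∃ z w, Rch r S x z ∧ z ∈ C ∧ r z w ∧ Rch r (S \ C) w y := by
  induction h with
  | refl _ => exact absurd hx hy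
  | @step u v h1 h2 h3 ih =>
    by_cases hu : u ∈ C
    · exact ⟨u, v, h1, hu, h2, .refl ⟨h3, hy⟩⟩
    · obtain ⟨z, w, q1, q2, q3, q4⟩ := ih hu
      exact ⟨z, w, q1, q2, q3, q4.step h2 ⟨h3, hy⟩⟩

/-- All points of a path are reachable, so paths stay in the cluster of their start. -/
theorem in_cluster (h : Rch r S x y) : Rch r {z | Rch r S x z} x y := by
  induction h with
  | refl h => exact .refl (.refl h)
  | step h h1 h2 ih => exact ih.step h1 (h.step h1 h2)

end Rch

section lattice

variable {d : ℕ} {S T C A B : Set (V d)} {x y z : V d}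

/-- Connection of two points of the lattice inside `S`. -/
abbrev Cn {d : ℕ} (S : Set (V d)) (x y : V d) : Prop := Rch adj S x y

theorem adj_symm {x y : V d} (h : adj x y) : adj y x := by
  unfold adj at *
  rw [← h]
  exact Finset.sum_congr rfl fun i _ => by omega

theorem Cn.symm (h : Cn S x y) : Cn S y x := Rch.symm (fun _ _ => adj_symm) h

theorem connIn_iff : ConnIn S A B ↔ ∃ x ∈ A, ∃ y ∈ B, Cn S x y := by
  constructor
  · rintro ⟨n, γ, h0, hn, hS, hadj⟩
    refine ⟨γ 0, h0, γ n, hn, ?_⟩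
    clear h0 hn
    induction n with
    | zero => exact .refl (hS 0 le_rfl)
    | succ n ih =>
      exact (ih (fun k hk => hS k (by omega)) (fun k hk => hadj k (by omega))).step
        (hadj n (by omega)) (hS _ le_rfl)
  · rintro ⟨x, hx, y, hy, h⟩
    suffices H : ∃ (n : ℕ) (γ : ℕ → V d), γ 0 = x ∧ γ n = y ∧ (∀ k, k ≤ n → γ k ∈ S) ∧
        ∀ k, k < n → adj (γ k) (γ (k + 1)) by
      obtain ⟨n, γ, rfl, rfl, h3, h4⟩ := H
      exact ⟨n, γ, hx, hy, h3, h4⟩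
    clear hy
    induction h with
    | refl h => exact ⟨0, fun _ => x, rfl, rfl, fun _ _ => h, fun k hk => by omega⟩
    | @step u v h1 h2 h3 ih =>
      obtain ⟨n, γ, g0, gn, g3, g4⟩ := ih
      refine ⟨n + 1, fun k => if k ≤ n then γ k else v, by simpa using g0, by simp, ?_, ?_⟩
      · intro k hk
        by_cases hkn : k ≤ n
        · simpa [hkn] using g3 k hkn
        · simpa [hkn] using h3
      · intro k hk
        by_cases hkn : k < n
        · have : k + 1 ≤ n := hkn
          simpa [this, hkn.le] using g4 k hkn
        · have : k = n := by omega
          subst this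
          simpa [gn] using h2

/-! ### Boxes -/

/-- Integer box. -/
def Bx {d : ℕ} (x : V d) (n : ℕ) : Set (V d) := {y | dinf x y ≤ n}

/-- Integer sphere. -/
def Sph {d : ℕ} (x : V d) (n : ℕ) : Set (V d) := {y | dinf x y = n}

theorem dinf_le_iff {n : ℕ} : dinf x y ≤ n ↔ ∀ i, (x i - y i).natAbs ≤ n := by
  simp [dinf, Finset.sup_le_iff]

theorem natAbs_le_dinf (x y : V d) (i : Fin d) : (x i - y i).natAbs ≤ dinf x y :=
  dinf_le_iff.1 le_rfl i

theorem mem_Bx {n : ℕ} : y ∈ Bx x n ↔ dinf x y ≤ n := Iff.rfl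

theorem mem_Sph {n : ℕ} : y ∈ Sph x n ↔ dinf x y = n := Iff.rfl

@[simp] theorem dinf_self (x : V d) : dinf x x = 0 := by
  rw [← Nat.le_zero, dinf_le_iff]; simp

theorem dinf_comm (x y : V d) : dinf x y = dinf y x := by
  unfold dinf
  exact Finset.sup_congr rfl fun i _ => by omega

theorem dinf_triangle (x y z : V d) : dinf x z ≤ dinf x y + dinf y z := by
  rw [dinf_le_iff]
  intro i
  have := natAbs_le_dinf x y i
  have := natAbs_le_dinf y z i
  omega

theorem dinf_of_adj (h : adj x y) : dinf x y ≤ 1 := by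
  rw [dinf_le_iff]
  intro i
  rw [← h]
  exact Finset.single_le_sum (f := fun i => (x i - y i).natAbs) (fun _ _ => Nat.zero_le _)
    (Finset.mem_univ i)

theorem dinf_adj_le (x : V d) (h : adj y z) : dinf x z ≤ dinf x y + 1 :=
  (dinf_triangle x y z).trans (by have := dinf_of_adj h; omega)

theorem dinf_eq_zero : dinf x y = 0 ↔ x = y := by
  constructor
  · intro h
    funext i
    have := natAbs_le_dinf x y i
    omega
  · rintro rfl
    simp

theorem Bx_subset {n m : ℕ} (h : dinf x y + n ≤ m) : Bx y n ⊆ Bx x m := fun z hz =>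
  (dinf_triangle x y z).trans (by have : dinf y z ≤ n := hz; omega)

theorem Bx_mono (x : V d) {n m : ℕ} (h : n ≤ m) : Bx x n ⊆ Bx x m := fun _ hz => le_trans hz h

theorem self_mem_Bx (x : V d) (n : ℕ) : x ∈ Bx x n := by simp [mem_Bx]

theorem Bx_eq_Icc (x : V d) (n : ℕ) : Bx x n = Set.Icc (fun i => x i - n) (fun i => x i + n) := by
  ext y
  simp only [mem_Bx, dinf_le_iff, Set.mem_Icc, Pi.le_def]
  constructor
  · intro h
    exact ⟨fun i => by have := h i; omega, fun i => by have := h i; omega⟩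
  · rintro ⟨h1, h2⟩ i
    have := h1 i
    have := h2 i
    omega

theorem finite_Bx (x : V d) (n : ℕ) : (Bx x n).Finite := by
  rw [Bx_eq_Icc]; exact Set.finite_Icc _ _

theorem ncard_Bx (x : V d) (n : ℕ) : (Bx x n).ncard = (2 * n + 1) ^ d := by
  rw [Bx_eq_Icc, ← Finset.coe_Icc, Set.ncard_coe_finset, Pi.card_Icc]
  have : ∀ i : Fin d, (Finset.Icc (x i - n) (x i + n)).card = 2 * n + 1 := fun i => by
    rw [Int.card_Icc]; omega
  simp [this]

theorem finite_Sph (x : V d) (n : ℕ) : (Sph x n).Finite :=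
  (finite_Bx x n).subset fun _ h => le_of_eq h

/-- A path leaving a box crosses its sphere. -/
theorem Cn.first_hit {n : ℕ} (a : V d) (h : Cn S x y) (hx : dinf a x ≤ n) (hy : n ≤ dinf a y) :
    ∃ w, Cn (S ∩ Bx a n) x w ∧ w ∈ Sph a n ∧ Cn S w y := by
  by_cases hn : dinf a x = n
  · exact ⟨x, .refl ⟨h.left_mem, hx⟩, hn, h⟩
  · obtain ⟨z, w, h1, h2, h3, h4, h5⟩ := h.first_exit (C := {v | dinf a v < n})
      (lt_of_le_of_ne hx hn) (by simpa using hy)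
    have hz : dinf a z < n := h1.right_mem.2
    have hw : ¬ dinf a w < n := h4
    have := dinf_adj_le a h2
    have hw' : dinf a w = n := by omega
    refine ⟨w, ?_, hw', h5⟩
    exact (h1.mono (Set.inter_subset_inter_right S fun v (hv : dinf a v < n) => hv.le)).step h2 ⟨h3, hw'.le⟩

/-- Subtracting the sign in a non-zero coordinate moves closer to the centre. -/
theorem exists_closer (x y : V d) (hxy : y ≠ x) :
    ∃ z, adj y z ∧ (∀ n, y ∈ Bx x n → z ∈ Bx x n) ∧
      ∑ i, (x i - z i).natAbs + 1 = ∑ i, (x i - y i).natAbs := by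
  obtain ⟨i, hi⟩ : ∃ i, y i ≠ x i := by
    by_contra! h
    exact hxy (funext h)
  set s : ℤ := if y i < x i then 1 else -1 with hs
  have hz : ∀ j, j ≠ i → Function.update y i (y i + s) j = y j := fun j hj => by simp [hj]
  refine ⟨Function.update y i (y i + s), ?_, ?_, ?_⟩
  · unfold adj
    rw [Finset.sum_eq_single i]
    · simp only [Function.update_self]
      split_ifs at hs <;> omega
    · intro j _ hj
      simp [hj]
    · simp
  · intro n hn
    rw [mem_Bx, dinf_le_iff] at *
    intro j
    by_cases hj : j = i
    · subst hj
      have := hn j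
      simp only [Function.update_self]
      split_ifs at hs <;> omega
    · rw [hz j hj]; exact hn j
  · rw [← Finset.add_sum_erase _ _ (Finset.mem_univ i),
      ← Finset.add_sum_erase _ (fun i => (x i - y i).natAbs) (Finset.mem_univ i)]
    rw [Finset.sum_congr rfl fun j hj => by rw [hz j (Finset.ne_of_mem_erase hj)]]
    simp only [Function.update_self]
    split_ifs at hs <;> omega

theorem Bx_connected_center {n : ℕ} (hy : y ∈ Bx x n) : Cn (Bx x n) y x := by
  obtain ⟨k, hk⟩ : ∃ k, ∑ i, (x i - y i).natAbs = k := ⟨_, rfl⟩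
  induction k generalizing y with
  | zero =>
    have : y = x := by
      by_contra hne
      obtain ⟨z, _, _, h⟩ := exists_closer x y hne
      omega
    subst this
    exact .refl hy
  | succ k ih =>
    have hne : y ≠ x := by
      rintro rfl
      simp at hk
    obtain ⟨z, h1, h2, h3⟩ := exists_closer x y hne
    exact (ih (h2 n hy) (by omega)).head hy h1

theorem Bx_connected {n : ℕ} (hy : y ∈ Bx x n) (hz : z ∈ Bx x n) : Cn (Bx x n) y z :=
  (Bx_connected_center hy).trans (Bx_connected_center hz).symm

theorem exists_mem_Sph (hd : 0 < d) (x : V d) (n : ℕ) : ∃ y, y ∈ Sph x n := by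
  refine ⟨fun i => x i + n, ?_⟩
  apply le_antisymm
  · rw [dinf_le_iff]; intro i; simp
  · have := natAbs_le_dinf x (fun i => x i + n) ⟨0, hd⟩
    omega

theorem box_eq_Bx {r : ℝ} (hr : 0 ≤ r) : box d r = Bx 0 ⌊r⌋₊ := by
  ext y
  simp only [box, boxAt, mem_Bx, dinf_le_iff, Set.mem_ofPred_eq]
  refine forall_congr' fun i => ?_
  rw [Nat.le_floor_iff hr]
  simp [Nat.cast_natAbs]

theorem bdry_eq_Sph (hd0 : 0 < d) {r : ℝ} (hr : 0 ≤ r) : bdry d r = Sph 0 ⌊r⌋₊ := by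
  ext y
  have : bdry d r = {y | y ∈ box d r ∧ ∃ z, z ∉ box d r ∧ adj y z} := rfl
  rw [this, box_eq_Bx hr]
  simp only [Set.mem_ofPred_eq, mem_Bx, mem_Sph]
  constructor
  · rintro ⟨h1, z, h2, h3⟩
    have := dinf_adj_le 0 h3
    omega
  · intro h
    refine ⟨h.le, ?_⟩
    by_contra! hall
    have hd : ∀ i, (y i).natAbs < ⌊r⌋₊ := by
      intro i
      have h1 := natAbs_le_dinf 0 y i
      simp only [Pi.zero_apply, zero_sub, Int.natAbs_neg] at h1
      refine lt_of_le_of_ne (h ▸ h1) fun he => ?_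
      set s : ℤ := if 0 ≤ y i then 1 else -1 with hs
      have hadj : adj y (Function.update y i (y i + s)) := by
        unfold adj
        rw [Finset.sum_eq_single i]
        · simp only [Function.update_self]
          split_ifs at hs <;> omega
        · intro j _ hj
          simp [hj]
        · simp
      refine hall _ (not_le.1 ?_) hadj
      intro hle
      have h2 := dinf_le_iff.1 hle i
      simp only [Pi.zero_apply, Function.update_self] at h2
      split_ifs at hs <;> omega
    have : Nonempty (Fin d) := ⟨⟨0, hd0⟩⟩
    obtain ⟨i, _, hi⟩ := Finset.exists_mem_eq_sup (Finset.univ : Finset (Fin d))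
      Finset.univ_nonempty (fun i => ((0 : V d) i - y i).natAbs)
    have h3 : dinf 0 y = ((0 : V d) i - y i).natAbs := hi
    have := hd i
    simp only [Pi.zero_apply] at h3
    omega

end lattice

end

section

/-! ### Local events -/

/-- The event `A` on configurations depends only on the states of the points of `S`. -/
def Loc {J : Type*} (S : Set J) (A : Set (Set J)) : Prop :=
  ∀ X X', X ∩ S = X' ∩ S → X ∈ A → X' ∈ A

/-- The event is decreasing. -/
def Dec {J : Type*} (A : Set (Set J)) : Prop := ∀ X X', X' ⊆ X → X ∈ A → X' ∈ A

/-- The event is increasing. -/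
def Inc {J : Type*} (A : Set (Set J)) : Prop := ∀ X X', X ⊆ X' → X ∈ A → X' ∈ A

section

variable {J : Type*} {S T : Set J} {A B : Set (Set J)}

theorem Loc.mono (h : Loc S A) (hST : S ⊆ T) : Loc T A := fun X X' hX hA =>
  h X X' (by
    have := congrArg (· ∩ S) hX
    simpa [Set.inter_assoc, Set.inter_eq_self_of_subset_right hST] using this) hA

theorem Loc.inter (h : Loc S A) (h' : Loc S B) : Loc S (A ∩ B) :=
  fun X X' hX hA => ⟨h X X' hX hA.1, h' X X' hX hA.2⟩

theorem Loc.compl (h : Loc S A) : Loc S Aᶜ := fun X X' hX hA hA' => hA (h X' X hX.symm hA')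

theorem Loc.iInter {ι : Sort*} {A : ι → Set (Set J)} (h : ∀ i, Loc S (A i)) :
    Loc S (⋂ i, A i) := by
  intro X X' hX hA
  exact Set.mem_iInter.2 fun i => h i X X' hX (Set.mem_iInter.1 hA i)

theorem loc_of_iff (p : Set J → Prop) (h : ∀ X, X ∈ A ↔ p (X ∩ S)) : Loc S A := by
  intro X X' hX hA
  rw [h] at *
  rwa [← hX]

theorem loc_iff_inter (h : Loc S A) (X : Set J) : X ∩ S ∈ A ↔ X ∈ A :=
  ⟨h _ _ (by simp [Set.inter_assoc]), h _ _ (by simp [Set.inter_assoc])⟩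

theorem measurableSet_atom (hS : S.Finite) (w : Set J) : MeasurableSet {X : Set J | X ∩ S = w} := by
  by_cases hw : w ⊆ S
  · have : {X : Set J | X ∩ S = w} =
        (⋂ x ∈ w, {X | x ∈ X}) ∩ ⋂ x ∈ S \ w, {X | x ∉ X} := by
      ext X
      simp only [Set.mem_ofPred_eq, Set.mem_inter_iff, Set.mem_iInter, Set.mem_sdiff]
      constructor
      · rintro rfl
        exact ⟨fun x hx => hx.1, fun x hx h => hx.2 ⟨h, hx.1⟩⟩
      · rintro ⟨h1, h2⟩
        ext x
        exact ⟨fun h => by by_contra hc; exact h2 x ⟨h.2, hc⟩ h.1, fun h => ⟨h1 x h, hw h⟩⟩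
    rw [this]
    exact (MeasurableSet.biInter (hS.subset hw).countable fun x _ => measurableSet_mem x).inter
      (MeasurableSet.biInter (hS.subset Set.sdiff_subset).countable
        fun x _ => measurableSet_notMem x)
  · convert MeasurableSet.empty
    ext X
    simp only [Set.mem_ofPred_eq, Set.mem_empty_iff_false, iff_false]
    rintro rfl
    exact hw Set.inter_subset_right

theorem Loc.eq_iUnion (h : Loc S A) : A = ⋃ w ∈ S.powerset ∩ A, {X : Set J | X ∩ S = w} := by
  ext X
  simp only [Set.mem_iUnion, Set.mem_ofPred_eq, exists_prop, exists_eq_right']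
  exact ⟨fun hX => ⟨Set.inter_subset_right, (loc_iff_inter h X).2 hX⟩,
    fun hX => (loc_iff_inter h X).1 hX.2⟩

theorem Loc.measurableSet (hS : S.Finite) (h : Loc S A) : MeasurableSet A := by
  rw [h.eq_iUnion]
  exact MeasurableSet.biUnion (hS.powerset.subset Set.inter_subset_left).countable
    fun w _ => measurableSet_atom hS w

end

/-- Independence of two finite sets of points under `μ`. -/
def Sep {J : Type*} (μ : Measure (Set J)) (S T : Set J) : Prop :=
  ∀ A B, Loc S A → Loc T B → μ.real (A ∩ B) = μ.real A * μ.real B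

/-! ### Lattice isometries -/

/-- Signed coordinate permutations composed with translations. -/
def LIso {d : ℕ} (e : V d ≃ V d) : Prop :=
  ∃ (a : V d) (s : Fin d → ℤ) (π : Equiv.Perm (Fin d)), (∀ i, s i = 1 ∨ s i = -1) ∧
    ∀ x i, e x i = a i + s i * x (π i)

theorem LIso.adj_iff {d : ℕ} {e : V d ≃ V d} (he : LIso e) (x y : V d) :
    adj (e x) (e y) ↔ adj x y := by
  obtain ⟨a, s, π, hs, h⟩ := he
  unfold adj
  rw [← Equiv.sum_comp π (fun i => (x i - y i).natAbs)]
  rw [Finset.sum_congr rfl fun i _ => ?_]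
  rw [h, h]
  rcases hs i with h1 | h1 <;> rw [h1] <;> omega

theorem LIso.dinf_eq {d : ℕ} {e : V d ≃ V d} (he : LIso e) (x y : V d) :
    dinf (e x) (e y) = dinf x y := by
  obtain ⟨a, s, π, hs, h⟩ := he
  have key : ∀ i, (e x i - e y i).natAbs = (x (π i) - y (π i)).natAbs := by
    intro i
    rw [h, h]
    rcases hs i with h1 | h1 <;> rw [h1] <;> omega
  apply le_antisymm
  · rw [dinf_le_iff]
    intro i
    rw [key]
    exact natAbs_le_dinf x y _
  · rw [dinf_le_iff]
    intro i
    have := natAbs_le_dinf (e x) (e y) (π.symm i)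
    rwa [key, Equiv.apply_symm_apply] at this

theorem LIso.addLeft {d : ℕ} (a : V d) : LIso (Equiv.addLeft a) :=
  ⟨a, fun _ => 1, Equiv.refl _, fun _ => .inl rfl, fun x i => by simp⟩

/-- The properties of the law of the percolation configuration used in the renormalization
arguments: invariance, finite range `ℓ`, positive association and finite energy `c`. -/
structure Good {d : ℕ} (μ : Measure (Set (V d))) (ℓ : ℕ) (c : ℝ) : Prop where
  prob : IsProbabilityMeasure μ
  inv : ∀ e : V d ≃ V d, LIso e → ∀ S A, S.Finite → Loc S A → μ.real {X | e '' X ∈ A} = μ.real A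
  sep : ∀ S T : Set (V d), S.Finite → T.Finite → (∀ x ∈ S, ∀ y ∈ T, ℓ < dinf x y) → Sep μ S T
  fkg : ∀ S A B, S.Finite → Loc S A → Loc S B → Dec A → Dec B →
    μ.real A * μ.real B ≤ μ.real (A ∩ B)
  c_pos : 0 < c
  c_le : c ≤ 1
  close : ∀ S Z A, S.Finite → Z.Finite → Loc S A → Disjoint S Z →
    c ^ Z.ncard * μ.real A ≤ μ.real (A ∩ {X | Disjoint X Z})
  opens : ∀ S Z A, S.Finite → Z.Finite → Loc S A → Disjoint S Z →
    c ^ Z.ncard * μ.real A ≤ μ.real (A ∩ {X | Z ⊆ X})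

end

section

section arm

variable {d : ℕ}

/-- The box of radius `n` around `a` is joined to the sphere of radius `m`. -/
def Arm {d : ℕ} (a : V d) (n m : ℕ) : Set (Set (V d)) :=
  {X | ∃ x ∈ Bx a n, ∃ y ∈ Sph a m, Cn X x y}

theorem mem_Arm {a : V d} {n m : ℕ} {X : Set (V d)} :
    X ∈ Arm a n m ↔ ∃ x ∈ Bx a n, ∃ y ∈ Sph a m, Cn X x y := Iff.rfl

theorem arm_of_conn {a x y : V d} {n m : ℕ} {X : Set (V d)} (hx : x ∈ Bx a n) (hnm : n ≤ m)
    (hy : m ≤ dinf a y) (h : Cn X x y) : X ∩ Bx a m ∈ Arm a n m := by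
  obtain ⟨w, h1, h2, _⟩ := h.first_hit a (le_trans hx hnm) hy
  exact ⟨x, hx, w, h2, h1⟩

theorem arm_iff {a : V d} {n m : ℕ} (hnm : n ≤ m) {X : Set (V d)} :
    X ∈ Arm a n m ↔ X ∩ Bx a m ∈ Arm a n m := by
  constructor
  · rintro ⟨x, hx, y, hy, h⟩
    exact arm_of_conn hx hnm (ge_of_eq hy) h
  · rintro ⟨x, hx, y, hy, h⟩
    exact ⟨x, hx, y, hy, h.mono Set.inter_subset_left⟩

theorem loc_Arm {a : V d} {n m : ℕ} (hnm : n ≤ m) : Loc (Bx a m) (Arm a n m) :=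
  loc_of_iff (· ∈ Arm a n m) fun _ => arm_iff hnm

theorem inc_Arm {a : V d} {n m : ℕ} : Inc (Arm a n m) := by
  rintro X X' hX ⟨x, hx, y, hy, h⟩
  exact ⟨x, hx, y, hy, h.mono hX⟩

theorem arm_anti {a : V d} {n m n' m' : ℕ} (hn : n ≤ n') (hnm : n' ≤ m') (hm : m' ≤ m) :
    Arm a n m ⊆ Arm a n' m' := by
  rintro X ⟨x, hx, y, hy, h⟩
  exact (arm_iff hnm).2 (arm_of_conn (le_trans hx hn) hnm (hm.trans (ge_of_eq hy)) h)

theorem Rch.image {α β : Type*} {r : α → α → Prop} {s : β → β → Prop} (f : α → β)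
    (hf : ∀ a b, r a b → s (f a) (f b)) {S : Set α} {x y : α} (h : Rch r S x y) :
    Rch s (f '' S) (f x) (f y) := by
  induction h with
  | refl h => exact .refl ⟨_, h, rfl⟩
  | step _ h1 h2 ih => exact ih.step (hf _ _ h1) ⟨_, h2, rfl⟩

theorem LIso.cn_image {e : V d ≃ V d} (he : LIso e) {S : Set (V d)} {x y : V d} :
    Cn (e '' S) (e x) (e y) ↔ Cn S x y := by
  constructor
  · intro h
    have := Rch.image (s := adj) e.symm (fun a b hab => by
      rw [← he.adj_iff, e.apply_symm_apply, e.apply_symm_apply]; exact hab) h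
    simpa [Set.image_image] using this
  · intro h
    exact Rch.image e (fun a b hab => (he.adj_iff a b).2 hab) h

theorem LIso.mem_Bx {e : V d ≃ V d} (he : LIso e) {x y : V d} {n : ℕ} :
    e y ∈ Bx (e x) n ↔ y ∈ Bx x n := by
  rw [GFFperc.mem_Bx, GFFperc.mem_Bx, he.dinf_eq]

theorem LIso.mem_Sph {e : V d ≃ V d} (he : LIso e) {x y : V d} {n : ℕ} :
    e y ∈ Sph (e x) n ↔ y ∈ Sph x n := by
  rw [GFFperc.mem_Sph, GFFperc.mem_Sph, he.dinf_eq]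

theorem LIso.arm_iff {e : V d ≃ V d} (he : LIso e) {a : V d} {n m : ℕ} {X : Set (V d)} :
    e '' X ∈ Arm (e a) n m ↔ X ∈ Arm a n m := by
  constructor
  · rintro ⟨x, hx, y, hy, h⟩
    refine ⟨e.symm x, he.mem_Bx.1 (by simpa using hx), e.symm y, he.mem_Sph.1 (by simpa using hy),
      he.cn_image.1 (by simpa using h)⟩
  · rintro ⟨x, hx, y, hy, h⟩
    exact ⟨e x, he.mem_Bx.2 hx, e y, he.mem_Sph.2 hy, he.cn_image.2 h⟩

variable {μ : Measure (Set (V d))} {ℓ : ℕ} {c : ℝ}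

theorem Good.arm_eq (hμ : Good μ ℓ c) (a : V d) {n m : ℕ} (hnm : n ≤ m) :
    μ.real (Arm a n m) = μ.real (Arm 0 n m) := by
  rw [← hμ.inv (Equiv.addLeft a) (LIso.addLeft a) (Bx a m) _ (finite_Bx a m) (loc_Arm hnm)]
  congr 1
  ext X
  have := (LIso.addLeft a).arm_iff (a := 0) (n := n) (m := m) (X := X)
  simpa using this

theorem Good.prob_subset_pos (hμ : Good μ ℓ c) {Z : Set (V d)} (hZ : Z.Finite) :
    0 < μ.real {X | Z ⊆ X} := by
  have := hμ.prob
  have h := hμ.opens ∅ Z Set.univ Set.finite_empty hZ (fun _ _ _ _ => trivial)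
    (Set.empty_disjoint _)
  rw [Set.univ_inter, probReal_univ, mul_one] at h
  exact lt_of_lt_of_le (pow_pos hμ.c_pos _) h

theorem Good.prob_disjoint_pos (hμ : Good μ ℓ c) {Z : Set (V d)} (hZ : Z.Finite) :
    0 < μ.real {X | Disjoint X Z} := by
  have := hμ.prob
  have h := hμ.close ∅ Z Set.univ Set.finite_empty hZ (fun _ _ _ _ => trivial)
    (Set.empty_disjoint _)
  rw [Set.univ_inter, probReal_univ, mul_one] at h
  exact lt_of_lt_of_le (pow_pos hμ.c_pos _) h

theorem Good.arm_pos (hμ : Good μ ℓ c) (hd : 0 < d) (n m : ℕ) :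
    0 < μ.real (Arm 0 n m) := by
  have := hμ.prob
  refine lt_of_lt_of_le (hμ.prob_subset_pos (finite_Bx 0 m)) (measureReal_mono ?_)
  intro X hX
  obtain ⟨y, hy⟩ := exists_mem_Sph hd (0 : V d) m
  exact ⟨0, self_mem_Bx 0 n, y, hy,
    (Bx_connected (self_mem_Bx 0 m) (le_of_eq hy)).mono hX⟩

/-- Rounding to the sublattice of mesh `n`. -/
theorem exists_round {n : ℕ} (hn : 0 < n) (x : V d) {k : ℕ} (hx : dinf 0 x ≤ k * n) :
    ∃ v : V d, v ∈ Bx 0 (k + 1) ∧ dinf ((n : ℤ) • v) x ≤ n := by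
  refine ⟨fun i => x i / n, ?_, ?_⟩
  · rw [mem_Bx, dinf_le_iff]
    intro i
    have h := natAbs_le_dinf 0 x i
    have h1 : |x i| ≤ k * n := by
      simp only [Pi.zero_apply, zero_sub, Int.natAbs_neg] at h
      have : (x i).natAbs ≤ k * n := h.trans hx
      rw [Int.abs_eq_natAbs]
      exact_mod_cast this
    have hn' : (0 : ℤ) < n := by exact_mod_cast hn
    have h2 : x i / n ≤ k := by
      apply Int.ediv_le_of_le_mul hn'
      exact (abs_le.1 h1).2
    have h3 : -(k : ℤ) ≤ x i / n := by
      apply Int.le_ediv_of_mul_le hn'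
      have := (abs_le.1 h1).1
      linarith
    simp only [Pi.zero_apply, zero_sub, Int.natAbs_neg]
    omega
  · rw [dinf_le_iff]
    intro i
    have hn' : (0 : ℤ) < n := by exact_mod_cast hn
    have h1 := Int.mul_ediv_add_emod (x i) n
    have h2 := Int.emod_nonneg (x i) hn'.ne'
    have h3 := Int.emod_lt_of_pos (x i) hn'
    simp only [Pi.smul_apply, smul_eq_mul]
    omega

theorem Good.arm_renorm (hμ : Good μ ℓ c) {n : ℕ} (hn : ℓ < n) :
    μ.real (Arm 0 (8 * n) (16 * n)) ≤
      ((Bx (0 : V d) 9).ncard * (Bx (0 : V d) 17).ncard : ℝ) *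
        μ.real (Arm (0 : V d) n (2 * n)) ^ 2 := by
  have := hμ.prob
  have hn0 : 0 < n := by omega
  set I := (finite_Bx (0 : V d) 9).toFinset with hI
  set I' := (finite_Bx (0 : V d) 17).toFinset with hI'
  have hc : (Bx (0 : V d) 9).ncard = I.card := Set.ncard_eq_toFinset_card _ _
  have hc' : (Bx (0 : V d) 17).ncard = I'.card := Set.ncard_eq_toFinset_card _ _
  set Q : V d → V d → Prop := fun v v' => 6 * n ≤ dinf ((n : ℤ) • v) ((n : ℤ) • v')
  classical
  set F : Finset (V d × V d) := (I ×ˢ I').filter fun p => Q p.1 p.2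
  have hsub : Arm (0 : V d) (8 * n) (16 * n) ⊆
      ⋃ p ∈ F, (Arm ((n : ℤ) • p.1) n (2 * n) ∩ Arm ((n : ℤ) • p.2) n (2 * n)) := by
    rintro X ⟨x, hx, y, hy, h⟩
    obtain ⟨w, _, hw, h⟩ := h.first_hit 0 hx (by rw [mem_Sph] at hy; omega)
    rw [mem_Sph] at hw hy
    obtain ⟨v, hv, hv'⟩ := exists_round hn0 w (k := 8) hw.le
    obtain ⟨u, hu, hu'⟩ := exists_round hn0 y (k := 16) hy.le
    have t1 := dinf_triangle 0 w y
    have t2 := dinf_triangle w ((n : ℤ) • v) y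
    have t3 := dinf_triangle ((n : ℤ) • v) ((n : ℤ) • u) y
    have t4 := dinf_triangle ((n : ℤ) • u) y w
    rw [dinf_comm w ((n : ℤ) • v)] at t2
    rw [dinf_comm y w] at t4
    refine Set.mem_iUnion₂.2 ⟨(v, u), ?_, ?_, ?_⟩
    · simp only [F, Finset.mem_filter, Finset.mem_product, hI, hI', Set.Finite.mem_toFinset]
      exact ⟨⟨hv, hu⟩, by simp only [Q]; omega⟩
    · exact (GFFperc.arm_iff (by omega)).2
        (arm_of_conn hv' (by omega) (by change 2 * n ≤ dinf ((n : ℤ) • v) y; omega) h)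
    · refine (GFFperc.arm_iff (by omega)).2 (arm_of_conn hu' (by omega) ?_ h.symm)
      have := dinf_triangle w ((n : ℤ) • u) y
      rw [dinf_comm w ((n : ℤ) • u)] at this
      change 2 * n ≤ dinf ((n : ℤ) • u) w
      omega
  refine (measureReal_mono hsub (measure_ne_top _ _)).trans ((measureReal_biUnion_finset_le _ _).trans ?_)
  have hle : ∀ p ∈ F, μ.real (Arm ((n : ℤ) • p.1) n (2 * n) ∩ Arm ((n : ℤ) • p.2) n (2 * n)) ≤
      μ.real (Arm (0 : V d) n (2 * n)) ^ 2 := by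
    intro p hp
    have hp2 : 6 * n ≤ dinf ((n : ℤ) • p.1) ((n : ℤ) • p.2) := (Finset.mem_filter.1 hp).2
    have hfar : ∀ x ∈ Bx ((n : ℤ) • p.1) (2 * n), ∀ y ∈ Bx ((n : ℤ) • p.2) (2 * n),
        ℓ < dinf x y := by
      intro x hx y hy
      rw [GFFperc.mem_Bx] at hx hy
      have t1 := dinf_triangle ((n : ℤ) • p.1) x ((n : ℤ) • p.2)
      have t2 := dinf_triangle x y ((n : ℤ) • p.2)
      rw [dinf_comm y] at t2
      omega
    rw [hμ.sep _ _ (finite_Bx _ _) (finite_Bx _ _) hfar _ _ (loc_Arm (by omega))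
      (loc_Arm (by omega)), hμ.arm_eq ((n : ℤ) • p.1) (by omega),
      hμ.arm_eq ((n : ℤ) • p.2) (by omega), sq]
  refine (Finset.sum_le_card_nsmul _ _ _ hle).trans ?_
  rw [nsmul_eq_mul, hc, hc']
  gcongr
  have : F.card ≤ I.card * I'.card := by
    rw [← Finset.card_product]; exact Finset.card_filter_le _ _
  exact_mod_cast this

/-- If crossing probabilities are not bounded below, they decay along a geometric sequence. -/
theorem Good.arm_decay (hμ : Good μ ℓ c) (hd : 0 < d)
    (h : ∀ ε : ℝ, 0 < ε → ∃ n : ℕ, 1 ≤ n ∧ μ.real (Arm (0 : V d) n (2 * n)) < ε) :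
    ∃ n₀ : ℕ, 1 ≤ n₀ ∧ ∀ k : ℕ, μ.real (Arm (0 : V d) (8 ^ k * n₀) (2 * (8 ^ k * n₀))) ≤ 1 / 2 := by
  set N : ℝ := (Bx (0 : V d) 9).ncard * (Bx (0 : V d) 17).ncard with hN
  have hN1 : 1 ≤ N := by
    rw [hN, ncard_Bx, ncard_Bx]
    have h1 : (1 : ℕ) ≤ (2 * 9 + 1) ^ d := Nat.one_le_pow _ _ (by norm_num)
    have h2 : (1 : ℕ) ≤ (2 * 17 + 1) ^ d := Nat.one_le_pow _ _ (by norm_num)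
    have h3 := Nat.mul_le_mul h1 h2
    exact_mod_cast h3
  obtain ⟨ε, hε, hε'⟩ : ∃ ε : ℝ, 0 < ε ∧ ∀ n ≤ ℓ, ε ≤ μ.real (Arm (0 : V d) n (2 * n)) := by
    obtain ⟨n, _, hn⟩ := (Finset.range (ℓ + 1)).exists_min_image
      (fun n => μ.real (Arm (0 : V d) n (2 * n))) ⟨0, by simp⟩
    exact ⟨_, hμ.arm_pos hd n (2 * n), fun m hm => hn m (by simp; omega)⟩
  obtain ⟨n₀, h1, h2⟩ := h (min ε (1 / (2 * N))) (by positivity)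
  have hℓ : ℓ < n₀ := by
    by_contra hc
    have := hε' n₀ (by omega)
    exact absurd (h2.trans_le (min_le_left _ _)) (not_lt.2 this)
  refine ⟨n₀, h1, fun k => ?_⟩
  suffices H : N * μ.real (Arm (0 : V d) (8 ^ k * n₀) (2 * (8 ^ k * n₀))) ≤ 1 / 2 by
    have h0 : (0 : ℝ) ≤ μ.real (Arm (0 : V d) (8 ^ k * n₀) (2 * (8 ^ k * n₀))) :=
      measureReal_nonneg
    nlinarith
  induction k with
  | zero =>
    have h3 := h2.le.trans (min_le_right _ _)
    rw [pow_zero, one_mul]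
    calc N * _ ≤ N * (1 / (2 * N)) := by gcongr
      _ = 1 / 2 := by field_simp
  | succ k ih =>
    have hk : ℓ < 8 ^ k * n₀ := lt_of_lt_of_le hℓ (Nat.le_mul_of_pos_left _ (by positivity))
    have h3 := hμ.arm_renorm hk
    have e1 : 8 * (8 ^ k * n₀) = 8 ^ (k + 1) * n₀ := by ring
    have e2 : 16 * (8 ^ k * n₀) = 2 * (8 ^ (k + 1) * n₀) := by ring
    rw [e1, e2] at h3
    have h0 : (0 : ℝ) ≤ μ.real (Arm (0 : V d) (8 ^ k * n₀) (2 * (8 ^ k * n₀))) :=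
      measureReal_nonneg
    set a := μ.real (Arm (0 : V d) (8 ^ k * n₀) (2 * (8 ^ k * n₀)))
    calc N * _ ≤ N * (N * a ^ 2) := by gcongr
      _ = (N * a) ^ 2 := by ring
      _ ≤ (1 / 2) ^ 2 := by gcongr
      _ ≤ 1 / 2 := by norm_num

theorem ufn_pos (R : ℝ) : 0 < ufn R := Real.exp_pos _

theorem ufn_le {R : ℝ} (hR : Real.exp 8 ≤ R) : 16 * ufn R ≤ R := by
  have hR0 : 0 < R := (Real.exp_pos 8).trans_le hR
  have ht : 8 ≤ Real.log R := (Real.le_log_iff_exp_le hR0).2 hR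
  set t := Real.log R with htdef
  have hs3 : (t ^ ((1 : ℝ) / 3)) ^ 3 = t := by
    rw [← Real.rpow_natCast, ← Real.rpow_mul (by linarith)]; norm_num
  have hs0 : 0 ≤ t ^ ((1 : ℝ) / 3) := Real.rpow_nonneg (by linarith) _
  have hu : ufn R = Real.exp (t ^ ((1 : ℝ) / 3)) := rfl
  rw [hu]
  set s := t ^ ((1 : ℝ) / 3)
  have hs2 : 2 ≤ s := by
    by_contra hc
    have : s ^ 3 < 2 ^ 3 := by gcongr; linarith
    linarith
  have h4 : s + 4 ≤ t := by nlinarith [mul_nonneg hs0 hs0]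
  have h16 : (16 : ℝ) ≤ Real.exp 4 := by
    have h1 : (2 : ℝ) ≤ Real.exp 1 := by have := Real.add_one_le_exp (1 : ℝ); linarith
    calc (16 : ℝ) = 2 ^ 4 := by norm_num
      _ ≤ Real.exp 1 ^ 4 := by gcongr
      _ = Real.exp 4 := by rw [← Real.exp_nat_mul]; norm_num
  calc 16 * Real.exp s ≤ Real.exp 4 * Real.exp s := by gcongr
    _ = Real.exp (s + 4) := by rw [← Real.exp_add, add_comm]
    _ ≤ Real.exp t := Real.exp_le_exp.2 h4
    _ = R := Real.exp_log hR0

theorem connIn_box_iff (hd : 0 < d) {X : Set (V d)} {r : ℝ} (hr : 0 ≤ r) (m : ℕ) :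
    ConnIn X (box d r) (bdry d (m : ℝ)) ↔ X ∈ Arm 0 ⌊r⌋₊ m := by
  rw [connIn_iff, box_eq_Bx hr, bdry_eq_Sph hd (Nat.cast_nonneg m), Nat.floor_natCast, mem_Arm]

/-- Disconnection of the boxes of radius `u(R)` is not summably unlikely if crossing
probabilities are not bounded below. -/
theorem Good.not_tilde (hμ : Good μ ℓ c) (hd : 0 < d)
    (h : ∀ ε : ℝ, 0 < ε → ∃ n : ℕ, 1 ≤ n ∧ μ.real (Arm (0 : V d) n (2 * n)) < ε) :
    ∃ ε : ℝ, 0 < ε ∧ ∀ R : ℕ, 1 ≤ R → ε ≤ (R : ℝ) ^ d * μ.real (Arm 0 ⌊ufn R⌋₊ R)ᶜ := by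
  have := hμ.prob
  obtain ⟨n₀, hn₀, hk⟩ := hμ.arm_decay hd h
  have hbig : ∀ R : ℕ, Real.exp 8 ≤ R → 2 * n₀ ≤ R →
      1 / 2 ≤ (R : ℝ) ^ d * μ.real (Arm (0 : V d) ⌊ufn R⌋₊ R)ᶜ := by
    intro R h8 hR
    have hR1 : 1 ≤ R := by omega
    obtain ⟨k, hk1, hk2⟩ : ∃ k, 2 * (8 ^ k * n₀) ≤ R ∧ R < 16 * (8 ^ k * n₀) := by
      have hex : ∃ k, R < 2 * (8 ^ k * n₀) := by
        obtain ⟨k, hk⟩ := pow_unbounded_of_one_lt R (by norm_num : 1 < 8)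
        exact ⟨k, by nlinarith [Nat.one_le_pow k 8 (by norm_num)]⟩
      classical
      have h1 := Nat.find_spec hex
      have h0 : Nat.find hex ≠ 0 := by
        intro h0
        rw [h0] at h1
        omega
      obtain ⟨k, hk⟩ := Nat.exists_eq_succ_of_ne_zero h0
      refine ⟨k, not_lt.1 (Nat.find_min hex (by omega)), ?_⟩
      rw [hk, Nat.succ_eq_add_one, pow_succ] at h1
      linarith
    have hu : ⌊ufn R⌋₊ ≤ 8 ^ k * n₀ := by
      apply Nat.floor_le_of_le
      have h1 := ufn_le h8
      have h2 : (R : ℝ) ≤ 16 * (8 ^ k * n₀ : ℕ) := by exact_mod_cast hk2.le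
      linarith
    have h1 : μ.real (Arm (0 : V d) ⌊ufn R⌋₊ R) ≤ 1 / 2 :=
      (measureReal_mono (arm_anti hu (by omega) hk1)).trans (hk k)
    have hm : MeasurableSet (Arm (0 : V d) ⌊ufn R⌋₊ R) :=
      (loc_Arm (by omega)).measurableSet (finite_Bx 0 R)
    rw [probReal_compl_eq_one_sub hm]
    have h3 : (1 : ℝ) ≤ (R : ℝ) ^ d := one_le_pow₀ (by exact_mod_cast hR1)
    nlinarith
  obtain ⟨R₀, hR₀⟩ := exists_nat_ge (Real.exp 8)
  obtain ⟨m, hm, hmin⟩ := (Finset.Icc 1 (max R₀ (2 * n₀) + 1)).exists_min_image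
    (fun R : ℕ => (R : ℝ) ^ d * μ.real (Arm (0 : V d) ⌊ufn R⌋₊ R)ᶜ) ⟨1, by simp⟩
  have hm1 : 1 ≤ m := (Finset.mem_Icc.1 hm).1
  refine ⟨min (1 / 2) ((m : ℝ) ^ d * μ.real (Arm (0 : V d) ⌊ufn m⌋₊ m)ᶜ), ?_, fun R hR => ?_⟩
  · refine lt_min (by norm_num) (mul_pos (by positivity) ?_)
    refine lt_of_lt_of_le (hμ.prob_disjoint_pos (finite_Sph 0 m)) (measureReal_mono ?_)
    rintro X hX ⟨x, _, y, hy, h⟩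
    exact Set.disjoint_left.1 hX h.right_mem hy
  · by_cases hRm : R ≤ max R₀ (2 * n₀) + 1
    · exact (min_le_right _ _).trans (hmin R (Finset.mem_Icc.2 ⟨hR, hRm⟩))
    · have h1 := le_max_left R₀ (2 * n₀)
      have h2 := le_max_right R₀ (2 * n₀)
      refine (min_le_left _ _).trans (hbig R (hR₀.trans ?_) (by omega))
      exact_mod_cast (show R₀ ≤ R by omega)

end arm

end

section

section generic

variable {J : Type*} {μ : Measure (Set J)}

/-- Product formula for successively independent local events. -/
theorem real_biInter_eq_prod [IsProbabilityMeasure μ] (S : ℕ → Set J) (A : ℕ → Set (Set J))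
    (hA : ∀ i, Loc (S i) (A i)) (M : ℕ)
    (hsep : ∀ k < M, Sep μ (⋃ i ∈ Finset.range k, S i) (S k)) :
    μ.real (⋂ i ∈ Finset.range M, A i) = ∏ i ∈ Finset.range M, μ.real (A i) := by
  induction M with
  | zero => simp
  | succ M ih =>
    rw [Finset.prod_range_succ, ← ih fun k hk => hsep k (hk.trans (Nat.lt_succ_self M)),
      ← hsep M (Nat.lt_succ_self M) _ _ _ (hA M)]
    · rw [Finset.range_add_one, Finset.set_biInter_insert, Set.inter_comm]
    · exact Loc.iInter fun i => Loc.iInter fun hi =>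
        (hA i).mono (Set.subset_biUnion_of_mem (u := S) hi)

theorem ncard_le_union_of_le {α β : Type*} [Fintype β] {s : Set α} {t : β → Set α} {k : ℕ}
    (hs : s ⊆ ⋃ b, t b) (ht : ∀ b, (s ∩ t b).ncard ≤ k) (hf : s.Finite) :
    s.ncard ≤ Fintype.card β * k := by
  have h1 : s = ⋃ b, s ∩ t b := by rw [← Set.inter_iUnion]; exact (Set.inter_eq_self_of_subset_left hs).symm
  classical
  have h2 : hf.toFinset ⊆ Finset.univ.biUnion fun b => (hf.inter_of_left (t b)).toFinset := by
    intro x hx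
    rw [Set.Finite.mem_toFinset, h1] at hx
    simpa using hx
  rw [Set.ncard_eq_toFinset_card _ hf]
  refine (Finset.card_le_card h2).trans (Finset.card_biUnion_le.trans ?_)
  refine (Finset.sum_le_card_nsmul _ _ k fun b _ => ?_).trans ?_
  · rw [← Set.ncard_eq_toFinset_card _ (hf.inter_of_left (t b))]; exact ht b
  · simp

/-- Closing a small random set of sites which is measurable with respect to the other sites. -/
theorem close_random [IsFiniteMeasure μ] {c : ℝ} {S T : Set J} (hS : S.Finite) (hT : T.Finite)
    (hc0 : 0 ≤ c) (hc1 : c ≤ 1)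
    (hclose : ∀ Z A, Z ⊆ T → Loc S A → c ^ Z.ncard * μ.real A ≤ μ.real (A ∩ {X | Disjoint X Z}))
    (W : Set J → Set J) (hW : ∀ X, W X = W (X ∩ S)) (hWT : ∀ X, W X ⊆ T) {k : ℕ}
    {B : Set (Set J)} (hB : Loc S B) (hBk : ∀ X ∈ B, (W X).ncard ≤ k) :
    c ^ k * μ.real B ≤ μ.real (B ∩ {X | Disjoint X (W X)}) := by
  have hLW : ∀ w, Loc S (B ∩ {X | W X = w}) := fun w =>
    hB.inter (loc_of_iff (fun X => W X = w) fun X => by rw [Set.mem_ofPred_eq, hW X])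
  have hfin := hT.powerset
  have hmT : ∀ w ⊆ T, MeasurableSet {X : Set J | Disjoint X w} := fun w hw => by
    refine Loc.measurableSet (S := w) (hT.subset hw) (loc_of_iff (fun X => Disjoint X w) ?_)
    intro X
    simp only [Set.mem_ofPred_eq, Set.disjoint_iff_inter_eq_empty, Set.inter_assoc, Set.inter_self]
  have e1 : B = ⋃ w ∈ hfin.toFinset, B ∩ {X | W X = w} := by
    ext X
    simp only [Set.mem_iUnion, Set.mem_inter_iff, Set.mem_ofPred_eq, exists_prop,
      Set.Finite.mem_toFinset, Set.mem_powerset_iff]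
    exact ⟨fun h => ⟨W X, hWT X, h, rfl⟩, fun ⟨w, _, h, _⟩ => h⟩
  have e2 : B ∩ {X | Disjoint X (W X)} =
      ⋃ w ∈ hfin.toFinset, (B ∩ {X | W X = w}) ∩ {X | Disjoint X w} := by
    ext X
    simp only [Set.mem_iUnion, Set.mem_inter_iff, Set.mem_ofPred_eq, exists_prop,
      Set.Finite.mem_toFinset, Set.mem_powerset_iff]
    exact ⟨fun h => ⟨W X, hWT X, ⟨h.1, rfl⟩, h.2⟩, fun ⟨w, _, h, h'⟩ => ⟨h.1, h.2 ▸ h'⟩⟩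
  have hd : ∀ w w', w ≠ w' → Disjoint (B ∩ {X | W X = w}) (B ∩ {X | W X = w'}) :=
    fun w w' hne => Set.disjoint_left.2 fun X hX hX' => hne (hX.2.symm.trans hX'.2)
  conv_lhs => rw [e1]
  rw [e2, measureReal_biUnion_finset (fun w _ w' _ h => hd w w' h)
    (fun w _ => (hLW w).measurableSet hS),
    measureReal_biUnion_finset (fun w _ w' _ h => (hd w w' h).mono Set.inter_subset_left
      Set.inter_subset_left)
      (fun w hw => ((hLW w).measurableSet hS).inter (hmT w (by simpa using hw))), Finset.mul_sum]
  refine Finset.sum_le_sum fun w hw => ?_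
  have hwT : w ⊆ T := by simpa using hw
  rcases Set.eq_empty_or_nonempty (B ∩ {X | W X = w}) with h0 | ⟨X, hX⟩
  · simp [h0]
  · refine le_trans ?_ (hclose w _ hwT (hLW w))
    have : w.ncard ≤ k := by have := hBk X hX.1; rwa [hX.2] at this
    exact mul_le_mul_of_nonneg_right (pow_le_pow_of_le_one hc0 hc1 this) measureReal_nonneg

end generic

section faces

variable {d : ℕ} {μ : Measure (Set (V d))} {ℓ : ℕ} {c : ℝ}

theorem antitone_gap {a : ℕ → ℝ} (h0 : ∀ n, 0 ≤ a n) {ε : ℝ} (hε : 0 < ε) :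
    ∃ r, ∀ n, r ≤ n → a r - a n < ε := by
  obtain ⟨r, hr⟩ := exists_lt_of_ciInf_lt (show (⨅ n, a n) < (⨅ n, a n) + ε by linarith)
  refine ⟨r, fun n _ => ?_⟩
  have : (⨅ n, a n) ≤ a n := ciInf_le ⟨0, by rintro _ ⟨n, rfl⟩; exact h0 n⟩ n
  linarith

/-- Percolation implies that large boxes are connected far away with high probability. -/
theorem Good.arm_high (hμ : Good μ ℓ c) (hd : 0 < d) {θ : ℝ} (hθ : 0 < θ)
    (hA : ∀ n, θ ≤ μ.real (Arm (0 : V d) 0 n)) {η : ℝ} (hη : 0 < η) (m₀ : ℕ) :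
    ∃ m, m₀ ≤ m ∧ ∀ n, m ≤ n → 1 - η ≤ μ.real (Arm (0 : V d) m n) := by
  have := hμ.prob
  have hθ1 : θ ≤ 1 := (hA 0).trans measureReal_le_one
  obtain ⟨M, hM⟩ : ∃ M : ℕ, (1 - θ) ^ M < η / 2 :=
    exists_pow_lt_of_lt_one (by linarith) (by linarith)
  obtain ⟨r, hr⟩ := antitone_gap (a := fun n => μ.real (Arm (0 : V d) 0 n))
    (fun _ => measureReal_nonneg)
    (show 0 < η / (2 * (M + 1)) by positivity)
  set D := 2 * r + ℓ + 1
  set x : ℕ → V d := fun i _ => (i * D : ℕ) with hx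
  have hxx : ∀ i k, i < k → D ≤ dinf (x i) (x k) := by
    intro i k hik
    have := natAbs_le_dinf (x i) (x k) ⟨0, hd⟩
    refine le_trans ?_ this
    simp only [hx]
    have h1 : i * D + D ≤ k * D := by nlinarith
    omega
  have hx0 : ∀ i, dinf 0 (x i) ≤ i * D := by
    intro i
    rw [dinf_le_iff]
    intro j
    simp only [hx, Pi.zero_apply, zero_sub, Int.natAbs_neg, Int.natAbs_natCast, le_refl]
  refine ⟨max (max m₀ (M * D)) r, by omega, fun n hn => ?_⟩
  set m := max (max m₀ (M * D)) r
  have hmM : M * D ≤ m := (le_max_right _ _).trans (le_max_left _ _)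
  have hmr : r ≤ m := le_max_right _ _
  set F : ℕ → Set (Set (V d)) := fun i => Arm (x i) 0 r
  set G : ℕ → Set (Set (V d)) := fun i => Arm (x i) 0 (n + m)
  have hFm : ∀ i, MeasurableSet (F i) := fun i =>
    (loc_Arm (Nat.zero_le _)).measurableSet (finite_Bx _ _)
  have hGm : ∀ i, MeasurableSet (G i) := fun i =>
    (loc_Arm (Nat.zero_le _)).measurableSet (finite_Bx _ _)
  have h1 : μ.real (⋂ i ∈ Finset.range M, (F i)ᶜ) ≤ η / 2 := by
    rw [real_biInter_eq_prod (fun i => Bx (x i) r) (fun i => (F i)ᶜ)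
      (fun i => (loc_Arm (Nat.zero_le _)).compl)]
    · refine (Finset.prod_le_prod (g := fun _ => 1 - θ) (fun i _ => measureReal_nonneg)
        fun i _ => ?_).trans ?_
      · rw [probReal_compl_eq_one_sub (hFm i)]
        have := hA r
        rw [← hμ.arm_eq (x i) (Nat.zero_le r)] at this
        simp only [F]; linarith
      · rw [Finset.prod_const, Finset.card_range]; exact hM.le
    · intro k _
      refine hμ.sep _ _ (Set.Finite.biUnion (Finset.finite_toSet _) fun i _ => finite_Bx _ _)
        (finite_Bx _ _) ?_
      intro y hy z hz
      simp only [Set.mem_iUnion, Finset.mem_range, exists_prop] at hy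
      obtain ⟨i, hi, hy⟩ := hy
      rw [mem_Bx] at hy hz
      have h1 := hxx i k hi
      have t1 := dinf_triangle (x i) y (x k)
      have t2 := dinf_triangle y z (x k)
      rw [dinf_comm z (x k)] at t2
      omega
  have h2 : ∀ i, μ.real (F i \ G i) ≤ η / (2 * (M + 1)) := by
    intro i
    rw [measureReal_sdiff (arm_anti le_rfl (Nat.zero_le _) (by omega)) (hGm i)]
    have := hr (n + m) (by omega)
    rw [← hμ.arm_eq (x i) (Nat.zero_le _), ← hμ.arm_eq (x i) (Nat.zero_le _)] at this
    exact this.le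
  have hsub : (Arm (0 : V d) m n)ᶜ ⊆
      (⋂ i ∈ Finset.range M, (F i)ᶜ) ∪ ⋃ i ∈ Finset.range M, (F i \ G i) := by
    intro X hX
    by_cases h : ∃ i ∈ Finset.range M, X ∈ F i
    · right
      obtain ⟨i, hi, hXi⟩ := h
      refine Set.mem_iUnion₂.2 ⟨i, hi, hXi, fun hG => hX ?_⟩
      obtain ⟨y, hy, z, hz, h⟩ := hG
      have hi' : i * D ≤ M * D := Nat.mul_le_mul_right _ (Finset.mem_range.1 hi).le
      have h0 := hx0 i
      rw [mem_Bx] at hy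
      rw [mem_Sph] at hz
      refine (arm_iff hn).2 (arm_of_conn ?_ hn ?_ h)
      · rw [mem_Bx]
        have t := dinf_triangle 0 (x i) y
        omega
      · have t := dinf_triangle (x i) 0 z
        rw [dinf_comm (x i) 0] at t
        omega
    · left
      push Not at h
      exact Set.mem_iInter₂.2 h
  have h3 : μ.real (Arm (0 : V d) m n)ᶜ ≤ η := by
    refine (measureReal_mono hsub (measure_ne_top _ _)).trans ((measureReal_union_le _ _).trans ?_)
    have h4 : μ.real (⋃ i ∈ Finset.range M, (F i \ G i)) ≤ M * (η / (2 * (M + 1))) := by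
      refine (measureReal_biUnion_finset_le _ _).trans
        ((Finset.sum_le_card_nsmul _ _ _ fun i _ => h2 i).trans ?_)
      rw [Finset.card_range, nsmul_eq_mul]
    have h5 : M * (η / (2 * (M + 1))) ≤ η / 2 := by
      rw [mul_div_assoc', div_le_div_iff₀ (by positivity) (by norm_num)]
      nlinarith
    linarith
  rw [probReal_compl_eq_one_sub ((loc_Arm hn).measurableSet (finite_Bx _ _))] at h3
  linarith

/-- Points of the sphere adjacent to the cluster of the inner box inside the open ball. -/
def ZS (b : V d) (m n : ℕ) (X : Set (V d)) : Set (V d) :=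
  {z | z ∈ Sph b n ∧ ∃ w, adj z w ∧ w ∈ Bx b (n - 1) ∧ ∃ x ∈ Bx b m, Cn (X ∩ Bx b (n - 1)) x w}

theorem ZS_subset {b : V d} {m n : ℕ} {X : Set (V d)} : ZS b m n X ⊆ Sph b n := fun _ h => h.1

theorem ZS_mono {b : V d} {m n : ℕ} {X X' : Set (V d)} (h : X ⊆ X') : ZS b m n X ⊆ ZS b m n X' := by
  rintro z ⟨h1, w, h2, h3, x, h4, h5⟩
  exact ⟨h1, w, h2, h3, x, h4, h5.mono (Set.inter_subset_inter_left _ h)⟩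

theorem ZS_inter {b : V d} {m n : ℕ} (X : Set (V d)) :
    ZS b m n X = ZS b m n (X ∩ Bx b (n - 1)) := by
  unfold ZS
  rw [Set.inter_assoc, Set.inter_self]

theorem LIso.mem_ZS {e : V d ≃ V d} (he : LIso e) {b z : V d} {m n : ℕ} {X : Set (V d)} :
    e z ∈ ZS (e b) m n (e '' X) ↔ z ∈ ZS b m n X := by
  have hB : e '' X ∩ Bx (e b) (n - 1) = e '' (X ∩ Bx b (n - 1)) := by
    ext y
    constructor
    · rintro ⟨⟨x, hx, rfl⟩, h⟩
      exact ⟨x, ⟨hx, he.mem_Bx.1 h⟩, rfl⟩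
    · rintro ⟨x, hx, rfl⟩
      exact ⟨⟨x, hx.1, rfl⟩, he.mem_Bx.2 hx.2⟩
  constructor
  · rintro ⟨h1, w, h2, h3, x, h4, h5⟩
    obtain ⟨w, rfl⟩ := e.surjective w
    obtain ⟨x, rfl⟩ := e.surjective x
    rw [hB, he.cn_image] at h5
    exact ⟨he.mem_Sph.1 h1, w, (he.adj_iff _ _).1 h2, he.mem_Bx.1 h3, x, he.mem_Bx.1 h4, h5⟩
  · rintro ⟨h1, w, h2, h3, x, h4, h5⟩
    refine ⟨he.mem_Sph.2 h1, e w, (he.adj_iff _ _).2 h2, he.mem_Bx.2 h3, e x, he.mem_Bx.2 h4, ?_⟩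
    rwa [hB, he.cn_image]

/-- One of the `d 2^d` pieces of the sphere. -/
def Face (b : V d) (n : ℕ) (i : Fin d) (σ : Fin d → ℤˣ) : Set (V d) :=
  {z | (σ i : ℤ) * (z i - b i) = n ∧ ∀ j, 0 ≤ (σ j : ℤ) * (z j - b j)}

theorem exists_face {b z : V d} {n : ℕ} (hd : 0 < d) (hz : z ∈ Sph b n) :
    ∃ i σ, z ∈ Face b n i σ := by
  obtain ⟨i, hi⟩ : ∃ i, (b i - z i).natAbs = n := by
    by_contra! h
    have hn0 : n ≠ 0 := by
      rintro rfl
      have := h ⟨0, hd⟩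
      have h2 := natAbs_le_dinf b z ⟨0, hd⟩
      rw [mem_Sph] at hz
      omega
    have : dinf b z ≤ n - 1 := by
      rw [dinf_le_iff]
      intro i
      have h1 := natAbs_le_dinf b z i
      have h2 := h i
      rw [mem_Sph] at hz
      omega
    rw [mem_Sph] at hz
    omega
  refine ⟨i, fun j => if b j ≤ z j then 1 else -1, ?_, fun j => ?_⟩
  · dsimp only
    split_ifs <;> push_cast <;> omega
  · dsimp only
    split_ifs <;> push_cast <;> omega

theorem dec_ZS_face (b : V d) (m n k : ℕ) (i : Fin d) (σ : Fin d → ℤˣ) :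
    Dec {X | (ZS b m n X ∩ Face b n i σ).ncard ≤ k} := fun _ _ h hX =>
  le_trans (Set.ncard_le_ncard (Set.inter_subset_inter_left _ (ZS_mono h))
    ((finite_Sph b n).subset (Set.inter_subset_left.trans ZS_subset))) hX

theorem loc_ZS (b : V d) (m n : ℕ) (p : Set (V d) → Prop) :
    Loc (Bx b (n - 1)) {X | p (ZS b m n X)} :=
  loc_of_iff (fun X => p (ZS b m n X)) fun X => by rw [Set.mem_ofPred_eq, ZS_inter]

/-- All pieces of all spheres are equivalent. -/
theorem exists_iso_face (b : V d) (n : ℕ) (i i' : Fin d) (σ σ' : Fin d → ℤˣ) :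
    ∃ e : V d ≃ V d, LIso e ∧ e b = 0 ∧ ∀ z, e z ∈ Face 0 n i' σ' ↔ z ∈ Face b n i σ := by
  set π := Equiv.swap i i' with hπ
  have hu : ∀ u : ℤˣ, (u : ℤ) * u = 1 := fun u => by
    rw [← Units.val_mul, Int.units_mul_self, Units.val_one]
  refine ⟨⟨fun x j => (σ' j : ℤ) * σ (π j) * (x (π j) - b (π j)),
    fun y j => b j + (σ' (π j) : ℤ) * σ j * y (π j), ?_, ?_⟩, ?_, ?_, ?_⟩
  · intro x
    funext j
    simp only [hπ, Equiv.swap_apply_self]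
    linear_combination (x j - b j) * ((σ j : ℤ) * σ j) * hu (σ' (π j)) + (x j - b j) * hu (σ j)
  · intro y
    funext j
    simp only [hπ, Equiv.swap_apply_self]
    linear_combination (y j) * ((σ' j : ℤ) * σ' j) * hu (σ (π j)) + (y j) * hu (σ' j)
  · refine ⟨fun j => -((σ' j : ℤ) * σ (π j) * b (π j)), fun j => (σ' j : ℤ) * σ (π j), π, ?_, ?_⟩
    · intro j
      have h := Int.isUnit_iff.1 (σ' j * σ (π j)).isUnit
      simpa using h
    · intro x j
      simp only [Equiv.coe_fn_mk]
      ring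
  · funext j
    simp
  · intro z
    have key : ∀ j, (σ' j : ℤ) * ((σ' j : ℤ) * σ (π j) * (z (π j) - b (π j)) - (0 : V d) j) =
        (σ (π j) : ℤ) * (z (π j) - b (π j)) := by
      intro j
      simp only [Pi.zero_apply, sub_zero]
      linear_combination ((σ (π j) : ℤ) * (z (π j) - b (π j))) * hu (σ' j)
    simp only [Face, Set.mem_ofPred_eq, Equiv.coe_fn_mk, key]
    have h1 : π i' = i := Equiv.swap_apply_right i i'
    rw [h1]
    refine and_congr_right fun _ => ⟨fun h j => ?_, fun h j => h _⟩
    have := h (π.symm j)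
    rwa [Equiv.apply_symm_apply] at this

theorem Good.face_eq (hμ : Good μ ℓ c) (b : V d) (m n k : ℕ) (i i' : Fin d) (σ σ' : Fin d → ℤˣ) :
    μ.real {X | (ZS b m n X ∩ Face b n i σ).ncard ≤ k} =
      μ.real {X | (ZS 0 m n X ∩ Face 0 n i' σ').ncard ≤ k} := by
  obtain ⟨e, he, hb, hf⟩ := exists_iso_face b n i i' σ σ'
  rw [← hμ.inv e he (Bx 0 (n - 1)) _ (finite_Bx _ _)
    (loc_ZS 0 m n fun Z => (Z ∩ Face 0 n i' σ').ncard ≤ k)]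
  congr 1
  ext X
  simp only [Set.mem_ofPred_eq]
  have : ZS 0 m n (e '' X) ∩ Face 0 n i' σ' = e '' (ZS b m n X ∩ Face b n i σ) := by
    ext y
    obtain ⟨z, rfl⟩ := e.surjective y
    have h1 := he.mem_ZS (b := b) (z := z) (m := m) (n := n) (X := X)
    rw [hb] at h1
    rw [Set.mem_inter_iff, h1, hf, e.injective.mem_set_image, Set.mem_inter_iff]
  rw [this, Set.ncard_image_of_injective _ e.injective]

theorem Good.fkg_finset (hμ : Good μ ℓ c) {S : Set (V d)} (hS : S.Finite) {β : Type*}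
    (s : Finset β) (A : β → Set (Set (V d))) (hA : ∀ i, Loc S (A i)) (hD : ∀ i, Dec (A i)) :
    ∏ i ∈ s, μ.real (A i) ≤ μ.real (⋂ i ∈ s, A i) := by
  have := hμ.prob
  classical
  induction s using Finset.induction_on with
  | empty => simp
  | insert a s ha ih =>
    rw [Finset.prod_insert ha, Finset.set_biInter_insert]
    refine le_trans (mul_le_mul_of_nonneg_left ih measureReal_nonneg)
      (hμ.fkg S _ _ hS (hA a) (Loc.iInter fun i => Loc.iInter fun _ => hA i) (hD a) ?_)
    intro X X' h hX
    simp only [Set.mem_iInter] at hX ⊢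
    exact fun i hi => hD i X X' h (hX i hi)

theorem Good.ZS_few (hμ : Good μ ℓ c) {η : ℝ} (hη : 0 < η) {m : ℕ}
    (hA : ∀ n, m ≤ n → 1 - η ≤ μ.real (Arm (0 : V d) m n)) (k n₀ : ℕ) :
    ∃ n, n₀ ≤ n ∧ μ.real {X | (ZS (0 : V d) m n X).ncard ≤ k} ≤ 2 * η := by
  have := hμ.prob
  have hck : 0 < c ^ k := pow_pos hμ.c_pos k
  obtain ⟨r, hr⟩ := antitone_gap (a := fun n => μ.real (Arm (0 : V d) m (m + n)))
    (fun _ => measureReal_nonneg) (show 0 < η * c ^ k by positivity)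
  obtain ⟨n, hn, hnm, hgap⟩ : ∃ n, n₀ ≤ n ∧ m + 1 ≤ n ∧
      μ.real (Arm (0 : V d) m (n - 1)) - μ.real (Arm (0 : V d) m n) ≤ η * c ^ k := by
    refine ⟨m + (r + n₀ + 1), by omega, by omega, ?_⟩
    have h1 := hr (r + n₀ + 1) (by omega)
    have h2 : μ.real (Arm (0 : V d) m (m + (r + n₀ + 1) - 1)) ≤ μ.real (Arm (0 : V d) m (m + r)) :=
      measureReal_mono (arm_anti le_rfl (by omega) (by omega))
    linarith
  refine ⟨n, hn, ?_⟩
  have hfin : ∀ X, (ZS (0 : V d) m n X).Finite := fun X => (finite_Sph 0 n).subset ZS_subset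
  set B : Set (Set (V d)) := {X | (ZS (0 : V d) m n X).Nonempty ∧ (ZS (0 : V d) m n X).ncard ≤ k}
  have hB : Loc (Bx (0 : V d) (n - 1)) B := loc_ZS 0 m n fun Z => Z.Nonempty ∧ Z.ncard ≤ k
  have hdis : Disjoint (Bx (0 : V d) (n - 1)) (Sph 0 n) := by
    refine Set.disjoint_left.2 fun x hx hx' => ?_
    rw [mem_Bx] at hx
    rw [mem_Sph] at hx'
    omega
  have h1 := close_random (μ := μ) (finite_Bx (0 : V d) (n - 1)) (finite_Sph 0 n) hμ.c_pos.le
    hμ.c_le (fun Z A hZ hA => hμ.close _ _ A (finite_Bx _ _) ((finite_Sph 0 n).subset hZ) hA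
      (hdis.mono_right hZ)) (ZS (0 : V d) m n) (fun X => ZS_inter X) (fun X => ZS_subset) hB
    (fun X hX => hX.2)
  have hsub : B ∩ {X | Disjoint X (ZS (0 : V d) m n X)} ⊆
      Arm (0 : V d) m (n - 1) \ Arm (0 : V d) m n := by
    rintro X ⟨⟨⟨z, hz, w, hzw, hw, x, hx, hxw⟩, _⟩, hdisj⟩
    constructor
    · refine ⟨x, hx, w, ?_, hxw.mono Set.inter_subset_left⟩
      rw [mem_Sph] at hz ⊢
      rw [mem_Bx] at hw
      have := dinf_adj_le 0 (adj_symm hzw)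
      omega
    · rintro ⟨x, hx, y, hy, h⟩
      have hx' : x ∈ Bx (0 : V d) (n - 1) := Bx_mono _ (by omega) hx
      have hy' : y ∉ Bx (0 : V d) (n - 1) := by
        rw [mem_Sph] at hy
        rw [mem_Bx]
        omega
      obtain ⟨z, w, hxz, hzw, hwX, hwn, _⟩ := h.first_exit hx' hy'
      refine Set.disjoint_left.1 hdisj hwX ⟨?_, z, adj_symm hzw, hxz.right_mem.2, x, hx, hxz⟩
      have h3 := hxz.right_mem.2
      rw [mem_Bx] at h3 hwn
      have := dinf_adj_le 0 hzw
      rw [mem_Sph]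
      omega
  have hm' : MeasurableSet (Arm (0 : V d) m n) := (loc_Arm (by omega)).measurableSet (finite_Bx _ _)
  have h2 := h1.trans (measureReal_mono hsub (measure_ne_top _ _))
  rw [measureReal_sdiff (arm_anti le_rfl (by omega) (by omega)) hm'] at h2
  have h3 : μ.real B ≤ η := by
    have := h2.trans hgap
    rw [mul_comm η] at this
    exact le_of_mul_le_mul_left this hck
  have h4 : {X | (ZS (0 : V d) m n X).ncard ≤ k} ⊆ B ∪ (Arm (0 : V d) m n)ᶜ := by
    intro X hX
    by_cases hne : (ZS (0 : V d) m n X).Nonempty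
    · exact .inl ⟨hne, hX⟩
    · right
      rintro ⟨x, hx, y, hy, h⟩
      have hy' : y ∉ Bx (0 : V d) (n - 1) := by
        rw [mem_Sph] at hy
        rw [mem_Bx]
        omega
      obtain ⟨z, w, hxz, hzw, hwX, hwn, _⟩ := h.first_exit (Bx_mono 0 (by omega) hx) hy'
      refine hne ⟨w, ?_, z, adj_symm hzw, hxz.right_mem.2, x, hx, hxz⟩
      have h3 := hxz.right_mem.2
      rw [mem_Bx] at h3 hwn
      have := dinf_adj_le 0 hzw
      rw [mem_Sph]
      omega
  refine (measureReal_mono h4 (measure_ne_top _ _)).trans ((measureReal_union_le _ _).trans ?_)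
  rw [probReal_compl_eq_one_sub hm']
  have := hA n (by omega)
  linarith

/-- Every piece of a large sphere is touched many times by the cluster of the central box. -/
theorem Good.face_many (hμ : Good μ ℓ c) (hd : 0 < d) {θ : ℝ} (hθ : 0 < θ)
    (hA : ∀ n, θ ≤ μ.real (Arm (0 : V d) 0 n)) {η : ℝ} (hη : 0 < η) (m₀ : ℕ) :
    ∃ m, m₀ ≤ m ∧ ∀ k n₀, ∃ n, n₀ ≤ n ∧ ∀ b i σ,
      μ.real {X | (ZS (b : V d) m n X ∩ Face b n i σ).ncard ≤ k} ≤ η := by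
  have := hμ.prob
  set N := Fintype.card (Fin d × (Fin d → ℤˣ)) with hN
  have hN0 : N ≠ 0 := by
    have : Nonempty (Fin d) := ⟨⟨0, hd⟩⟩
    exact Fintype.card_ne_zero
  obtain ⟨m, hm, hm'⟩ := hμ.arm_high hd hθ hA (show 0 < η ^ N / 2 by positivity) m₀
  refine ⟨m, hm, fun k n₀ => ?_⟩
  obtain ⟨n, hn, hn'⟩ := hμ.ZS_few (by positivity) hm' (N * k) n₀
  refine ⟨n, hn, fun b i σ => ?_⟩
  have h1 := hμ.fkg_finset (finite_Bx (0 : V d) (n - 1)) Finset.univ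
    (fun f : Fin d × (Fin d → ℤˣ) => {X | (ZS (0 : V d) m n X ∩ Face 0 n f.1 f.2).ncard ≤ k})
    (fun f => loc_ZS 0 m n fun Z => (Z ∩ Face 0 n f.1 f.2).ncard ≤ k)
    (fun f => dec_ZS_face _ _ _ _ _ _)
  simp_rw [← hμ.face_eq b m n k i _ σ _] at h1
  rw [Finset.prod_const, Finset.card_univ, ← hN] at h1
  have h2 : μ.real (⋂ f ∈ (Finset.univ : Finset (Fin d × (Fin d → ℤˣ))),
      {X | (ZS (0 : V d) m n X ∩ Face 0 n f.1 f.2).ncard ≤ k}) ≤ η ^ N := by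
    refine (measureReal_mono ?_ (measure_ne_top _ _)).trans (hn'.trans_eq (by ring))
    intro X hX
    simp only [Set.mem_iInter, Finset.mem_univ, true_implies, Set.mem_ofPred_eq] at hX
    refine ncard_le_union_of_le (t := fun f : Fin d × (Fin d → ℤˣ) => Face 0 n f.1 f.2) ?_ hX
      ((finite_Sph 0 n).subset ZS_subset)
    intro z hz
    obtain ⟨i, σ, h⟩ := exists_face hd (ZS_subset hz)
    exact Set.mem_iUnion.2 ⟨(i, σ), h⟩
  exact le_of_pow_le_pow_left₀ hN0 hη.le (h1.trans h2)

end faces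

end

section

/-- The law `μ` of a percolation configuration together with independent sprinkled fields indexed
by `ι`, of density at least `t`. -/
structure Ext {d : ℕ} {ι : Type*} (Q : Measure (Set (V d ⊕ ι × V d))) (μ : Measure (Set (V d)))
    (ℓ : ℕ) (c t : ℝ) : Prop where
  prob : IsProbabilityMeasure Q
  marg : ∀ S A, S.Finite → Loc S A → Q.real {Y | Sum.inl ⁻¹' Y ∈ A} = μ.real A
  sep : ∀ S T : Set (V d ⊕ ι × V d), S.Finite → T.Finite →
    (∀ x y, Sum.inl x ∈ S → Sum.inl y ∈ T → ℓ < dinf x y) →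
    (∀ p, Sum.inr p ∈ S → Sum.inr p ∉ T) → Sep Q S T
  close : ∀ (S : Set (V d ⊕ ι × V d)) (Z : Set (V d)) (A : Set (Set (V d ⊕ ι × V d))),
    S.Finite → Z.Finite → Loc S A → (∀ z ∈ Z, Sum.inl z ∉ S) →
    c ^ Z.ncard * Q.real A ≤ Q.real (A ∩ {Y | Disjoint Y (Sum.inl '' Z)})
  seeds : ∀ Z : Set (ι × V d), Z.Finite → t ^ Z.ncard ≤ Q.real {Y | Sum.inr '' Z ⊆ Y}
  t_pos : 0 < t

section step

variable {d : ℕ} {ι : Type*}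

/-- The percolation part of an extended configuration. -/
def Xf (Y : Set (V d ⊕ ι × V d)) : Set (V d) := Set.preimage Sum.inl Y

/-- The sprinkled field of index `i`. -/
def Fd (i : ι) (Y : Set (V d ⊕ ι × V d)) : Set (V d) := {x | Sum.inr (i, x) ∈ Y}

theorem Bx_union_subset_card (M r : ℕ) (x : ℕ → V d) :
    (⋃ i ∈ Finset.range M, Bx (x i) r).ncard ≤ M * (2 * r + 1) ^ d := by
  induction M with
  | zero => simp
  | succ M ih =>
    rw [Finset.range_add_one, Finset.set_biUnion_insert]
    refine (Set.ncard_union_le _ _).trans ?_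
    rw [ncard_Bx]
    linarith

theorem exists_separated (r M : ℕ) (w : Set (V d))
    (hw : M * (2 * r + 1) ^ d < w.ncard) :
    ∃ x : ℕ → V d, ∀ i < M, x i ∈ w ∧ ∀ j < i, r < dinf (x j) (x i) := by
  induction M with
  | zero => exact ⟨fun _ => 0, fun i hi => absurd hi (Nat.not_lt_zero i)⟩
  | succ M ih =>
    obtain ⟨x, hx⟩ := ih (lt_of_le_of_lt (Nat.mul_le_mul_right _ (Nat.le_succ M)) hw)
    obtain ⟨y, hy, hy'⟩ : ∃ y ∈ w, y ∉ ⋃ i ∈ Finset.range M, Bx (x i) r := by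
      by_contra! h
      have h1 := Set.ncard_le_ncard (show w ⊆ _ from h)
        (Set.Finite.biUnion (Finset.finite_toSet _) fun i _ => finite_Bx _ _)
      have h2 := Bx_union_subset_card M r x
      have h3 : M * (2 * r + 1) ^ d ≤ (M + 1) * (2 * r + 1) ^ d :=
        Nat.mul_le_mul_right _ (Nat.le_succ M)
      omega
    refine ⟨fun i => if i < M then x i else y, fun i hi => ?_⟩
    rcases Nat.lt_succ_iff_lt_or_eq.1 hi with h | rfl
    · simp only [h, if_true]
      refine ⟨(hx i h).1, fun j hj => ?_⟩
      rw [if_pos (hj.trans h)]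
      exact (hx i h).2 j hj
    · simp only [lt_irrefl, if_false]
      refine ⟨hy, fun j hj => ?_⟩
      rw [if_pos hj]
      by_contra hc
      exact hy' (Set.mem_iUnion₂.2 ⟨j, Finset.mem_range.2 hj, not_lt.1 hc⟩)

variable {Q : Measure (Set (V d ⊕ ι × V d))} {μ : Measure (Set (V d))} {ℓ : ℕ} {c t : ℝ}

theorem loc_seed (i : ι) (z : V d) (r : ℕ) :
    Loc (Sum.inr '' ((fun x => (i, x)) '' Bx z r)) {Y : Set (V d ⊕ ι × V d) | Bx z r ⊆ Fd i Y} := by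
  refine loc_of_iff (fun Y => Bx z r ⊆ Fd i Y) fun Y => ?_
  simp only [Set.mem_ofPred_eq]
  constructor
  · intro h x hx
    exact ⟨h hx, _, ⟨x, hx, rfl⟩, rfl⟩
  · intro h x hx
    exact (h hx).1

theorem Ext.seed_prob (h : Ext Q μ ℓ c t) (i : ι) (z : V d) (r : ℕ) :
    t ^ (2 * r + 1) ^ d ≤ Q.real {Y | Bx z r ⊆ Fd i Y} := by
  have := h.prob
  have h1 := h.seeds ((fun x => (i, x)) '' Bx z r) ((finite_Bx z r).image _)
  rw [Set.ncard_image_of_injective _ (Prod.mk_right_injective i), ncard_Bx] at h1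
  refine h1.trans (measureReal_mono ?_)
  intro Y hY x hx
  exact hY ⟨_, ⟨x, hx, rfl⟩, rfl⟩

/-- Among many points, one is the center of a sprinkled box. -/
theorem Ext.seeds_fixed (h : Ext Q μ ℓ c t) {β : ℝ} (hβ : 0 < β) (r : ℕ) :
    ∃ K : ℕ, ∀ (w : Set (V d)), w.Finite → K < w.ncard → ∀ i,
      Q.real {Y | ∀ z ∈ w, ¬ Bx z r ⊆ Fd i Y} ≤ β := by
  have := h.prob
  set p := t ^ (2 * r + 1) ^ d with hp
  have hp0 : 0 < p := pow_pos h.t_pos _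
  by_cases hι : IsEmpty ι
  · exact ⟨0, fun w _ _ i => (hι.false i).elim⟩
  rw [not_isEmpty_iff] at hι
  obtain ⟨i₀⟩ := hι
  have hp1 : p ≤ 1 := (h.seed_prob i₀ 0 r).trans measureReal_le_one
  obtain ⟨M, hM⟩ : ∃ M : ℕ, (1 - p) ^ M < β := exists_pow_lt_of_lt_one hβ (by linarith)
  refine ⟨M * (2 * (2 * r) + 1) ^ d, fun w hw hK i => ?_⟩
  obtain ⟨x, hx⟩ := exists_separated (2 * r) M w hK
  set S : ℕ → Set (V d ⊕ ι × V d) := fun k => Sum.inr '' ((fun x => (i, x)) '' Bx (x k) r)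
  have hSf : ∀ k, (S k).Finite := fun k => ((finite_Bx _ _).image _).image _
  have h1 : Q.real (⋂ k ∈ Finset.range M, {Y | Bx (x k) r ⊆ Fd i Y}ᶜ) ≤ β := by
    rw [real_biInter_eq_prod S _ (fun k => (loc_seed i (x k) r).compl)]
    · refine (Finset.prod_le_prod (g := fun _ => 1 - p) (fun i _ => measureReal_nonneg)
        fun k _ => ?_).trans ?_
      · rw [probReal_compl_eq_one_sub ((loc_seed i (x k) r).measurableSet (hSf k))]
        have := h.seed_prob i (x k) r
        linarith
      · rw [Finset.prod_const, Finset.card_range]; exact hM.le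
    · intro k hk
      refine h.sep _ _ (Set.Finite.biUnion (Finset.finite_toSet _) fun k _ => hSf k) (hSf k) ?_ ?_
      · rintro y z hy ⟨_, _, hz⟩
        exact absurd hz (by simp)
      · rintro ⟨i', y⟩ hy hy'
        simp only [Set.mem_iUnion, Finset.mem_range, exists_prop] at hy
        obtain ⟨j, hj, _, ⟨u, hu, rfl⟩, hu'⟩ := hy
        obtain ⟨_, ⟨v, hv, rfl⟩, hv'⟩ := hy'
        have e1 : u = y := by have := Sum.inr.inj hu'; exact (Prod.mk.inj this).2
        have e2 : v = y := by have := Sum.inr.inj hv'; exact (Prod.mk.inj this).2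
        subst e1 e2
        have h1 := (hx k hk).2 j hj
        have h2 := dinf_triangle (x j) v (x k)
        rw [mem_Bx] at hu hv
        rw [dinf_comm v (x k)] at h2
        omega
  refine (measureReal_mono ?_ (measure_ne_top _ _)).trans h1
  intro Y hY
  simp only [Set.mem_iInter, Finset.mem_range]
  exact fun k hk => hY _ (hx k hk).1

/-- Conditioning on a finitely valued function measurable with respect to finitely many sites. -/
theorem real_le_of_fibers {J τ : Type*} {ν : Measure (Set J)} [IsProbabilityMeasure ν] {S : Set J}
    (hS : S.Finite) (W : Set J → τ) (hW : ∀ X, W X = W (X ∩ S)) (E : τ → Set (Set J))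
    (T : Set J) (hE : ∀ w, Loc T (E w)) (hsep : Sep ν S T) {β : ℝ}
    (hβ : ∀ w, ν.real (E w) ≤ β) {A : Set (Set J)} (hA : Loc S A) :
    ν.real {X | X ∈ A ∧ X ∈ E (W X)} ≤ β * ν.real A := by
  have hfin : (W '' S.powerset).Finite := hS.powerset.image W
  have hmem : ∀ X, W X ∈ hfin.toFinset := fun X => by
    rw [Set.Finite.mem_toFinset, hW]; exact ⟨_, Set.inter_subset_right, rfl⟩
  have hL : ∀ w, Loc S (A ∩ {X | W X = w}) := fun w =>
    hA.inter (loc_of_iff (fun X => W X = w) fun X => by rw [Set.mem_ofPred_eq, hW X])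
  have e1 : {X | X ∈ A ∧ X ∈ E (W X)} = ⋃ w ∈ hfin.toFinset, (A ∩ {X | W X = w}) ∩ E w := by
    ext X
    simp only [Set.mem_iUnion, Set.mem_inter_iff, Set.mem_ofPred_eq, exists_prop]
    exact ⟨fun h => ⟨_, hmem X, ⟨h.1, rfl⟩, h.2⟩, fun ⟨w, _, h, h'⟩ => ⟨h.1, h.2 ▸ h'⟩⟩
  have e2 : A = ⋃ w ∈ hfin.toFinset, A ∩ {X | W X = w} := by
    ext X
    simp only [Set.mem_iUnion, Set.mem_inter_iff, Set.mem_ofPred_eq, exists_prop]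
    exact ⟨fun h => ⟨_, hmem X, h, rfl⟩, fun ⟨w, _, h⟩ => h.1⟩
  rw [e1]
  refine (measureReal_biUnion_finset_le _ _).trans ?_
  have e3 : ν.real A = ∑ w ∈ hfin.toFinset, ν.real (A ∩ {X | W X = w}) := by
    conv_lhs => rw [e2]
    exact measureReal_biUnion_finset
      (fun w _ w' _ hne => Set.disjoint_left.2 fun X hX hX' => hne (hX.2.symm.trans hX'.2))
      fun w _ => (hL w).measurableSet hS
  rw [e3, Finset.mul_sum]
  refine Finset.sum_le_sum fun w _ => ?_
  rw [hsep _ _ (hL w) (hE w), mul_comm]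
  exact mul_le_mul_of_nonneg_right (hβ w) measureReal_nonneg

theorem Ext.seeds_random (h : Ext Q μ ℓ c t) {β : ℝ} {r K : ℕ}
    (hK : ∀ (w : Set (V d)), w.Finite → K < w.ncard → ∀ i,
      Q.real {Y | ∀ z ∈ w, ¬ Bx z r ⊆ Fd i Y} ≤ β)
    {S : Set (V d ⊕ ι × V d)} (hS : S.Finite) {T : Set (V d)} (hT : T.Finite) (i : ι)
    (hi : ∀ x, Sum.inr (i, x) ∉ S) (W : Set (V d ⊕ ι × V d) → Set (V d))
    (hW : ∀ Y, W Y = W (Y ∩ S)) (hWT : ∀ Y, W Y ⊆ T) (hβ : 0 ≤ β) :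
    Q.real {Y | K < (W Y).ncard ∧ ∀ z ∈ W Y, ¬ Bx z r ⊆ Fd i Y} ≤ β := by
  have := h.prob
  have hTf : (⋃ z ∈ T, Bx z r).Finite := hT.biUnion fun z _ => finite_Bx _ _
  set T' : Set (V d ⊕ ι × V d) := Sum.inr '' ((fun x => (i, x)) '' ⋃ z ∈ T, Bx z r)
  have hT' : T'.Finite := (hTf.image _).image _
  have key := real_le_of_fibers (ν := Q) hS W hW
    (fun w => {Y | w ⊆ T ∧ K < w.ncard ∧ ∀ z ∈ w, ¬ Bx z r ⊆ Fd i Y}) T' ?_ ?_ (β := β) ?_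
    (A := Set.univ) (fun _ _ _ _ => trivial)
  · rw [probReal_univ, mul_one] at key
    refine (measureReal_mono ?_ (measure_ne_top _ _)).trans key
    intro Y hY
    exact ⟨trivial, hWT Y, hY.1, hY.2⟩
  · intro w
    by_cases hw : w ⊆ T ∧ K < w.ncard
    · have : {Y : Set (V d ⊕ ι × V d) | w ⊆ T ∧ K < w.ncard ∧ ∀ z ∈ w, ¬ Bx z r ⊆ Fd i Y} =
          ⋂ z : w, {Y | Bx z.1 r ⊆ Fd i Y}ᶜ := by
        ext Y
        simp [hw]
      rw [this]
      refine Loc.iInter fun z => (loc_seed i z.1 r).compl.mono ?_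
      refine Set.image_mono (Set.image_mono ?_)
      exact Set.subset_biUnion_of_mem (u := fun z => Bx z r) (hw.1 z.2)
    · intro Y Y' _ hY
      exact absurd ⟨hY.1, hY.2.1⟩ hw
  · refine h.sep _ _ hS hT' ?_ ?_
    · rintro x y _ ⟨_, _, hz⟩
      exact absurd hz (by simp)
    · rintro p hp ⟨_, ⟨x, _, rfl⟩, hx⟩
      rw [← hx] at hp
      exact hi x hp
  · intro w
    by_cases hw : w ⊆ T ∧ K < w.ncard
    · refine (measureReal_mono ?_ (measure_ne_top _ _)).trans (hK w (hT.subset hw.1) hw.2 i)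
      exact fun Y hY => hY.2.2
    · convert hβ
      convert measureReal_empty
      ext Y
      simp only [Set.mem_ofPred_eq, Set.mem_empty_iff_false, iff_false]
      exact fun hY => hw ⟨hY.1, hY.2.1⟩

/-- Points at distance at most `ρ` from `C`. -/
def Nb (ρ : ℕ) (C : Set (V d)) : Set (V d) := {x | ∃ y ∈ C, dinf x y ≤ ρ}

theorem subset_Nb (ρ : ℕ) (C : Set (V d)) : C ⊆ Nb ρ C := fun x hx => ⟨x, hx, by simp⟩

/-- The region reached from `C` in one exploration step. -/
def StepEv (ρ m n : ℕ) (b : V d) (F : Set (V d)) (C : Set (V d)) (i₁ i₂ : ι) :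
    Set (Set (V d ⊕ ι × V d)) :=
  {Y | ∃ y ∈ Sph b n ∩ F, ∃ x ∈ C, ∀ v ∈ Bx y m,
    Cn (C ∪ (((Xf Y \ Nb ρ C) ∪ Fd i₁ Y ∪ Fd i₂ Y) ∩ Bx b (2 * n))) x v}

theorem Ext.step (h : Ext Q μ ℓ c t) (hμ : Good μ ℓ c) (hd : 0 < d) {θ : ℝ} (hθ : 0 < θ)
    (hA : ∀ n, θ ≤ μ.real (Arm (0 : V d) 0 n)) {ε : ℝ} (hε : 0 < ε) (ρ : ℕ) :
    ∃ m, ρ + 1 ≤ m ∧ ∀ n₀, ∃ n, n₀ ≤ n ∧ ∀ b i σ C i₁ i₂, Bx b m ⊆ C → i₁ ≠ i₂ →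
      Q.real (StepEv ρ m n b (Face b n i σ) C i₁ i₂)ᶜ ≤ ε := by
  have := h.prob
  obtain ⟨K, hK⟩ := h.seeds_fixed (show 0 < ε / 3 by positivity) ρ
  have hcK : 0 < c ^ K := pow_pos hμ.c_pos K
  set η := c ^ K * ε / 3 with hη
  have hη0 : 0 < η := by positivity
  obtain ⟨m, hm, hm'⟩ := hμ.face_many hd hθ hA hη0 (ρ + 1)
  obtain ⟨k, hk⟩ := h.seeds_fixed hη0 m
  refine ⟨m, hm, fun n₀ => ?_⟩
  obtain ⟨n, hn, hn'⟩ := hm' k (max n₀ (m + ρ + 1))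
  have hnm : m + ρ + 1 ≤ n := (le_max_right _ _).trans hn
  refine ⟨n, (le_max_left _ _).trans hn, fun b i σ C i₁ i₂ hbC hi => ?_⟩
  set F := Face b n i σ
  -- `H`: some point of the face is seeded
  set H : Set (Set (V d ⊕ ι × V d)) := {Y | ∃ y ∈ ZS b m n (Xf Y) ∩ F, Bx y m ⊆ Fd i₁ Y} with hH
  have hHc : Q.real Hᶜ ≤ 2 * η := by
    have h1 := h.seeds_random hk (S := Sum.inl '' Bx b (n - 1)) ((finite_Bx _ _).image _)
      (finite_Sph b n) i₁ (by simp) (fun Y => ZS b m n (Xf Y) ∩ F) (fun Y => by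
        congr 1
        rw [ZS_inter, ZS_inter (Xf (Y ∩ _))]
        congr 1
        ext x
        simp [Xf]) (fun Y => Set.inter_subset_left.trans ZS_subset) hη0.le
    have h2 := h.marg (Bx b (n - 1)) {X | (ZS b m n X ∩ F).ncard ≤ k} (finite_Bx _ _)
      (loc_ZS b m n fun Z => (Z ∩ F).ncard ≤ k)
    have h3 := hn' b i σ
    rw [← h2] at h3
    refine (measureReal_mono ?_ (measure_ne_top _ _)).trans
      ((measureReal_union_le _ _).trans (by rw [two_mul]; exact add_le_add h3 h1))
    intro Y hY
    by_cases hc : (ZS b m n (Xf Y) ∩ F).ncard ≤ k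
    · exact .inl hc
    · exact .inr ⟨not_le.1 hc, fun z hz hs => hY ⟨z, hz, hs⟩⟩
  set S₀ : Set (V d ⊕ ι × V d) := Sum.inl '' (Bx b (n - 1) \ Nb ρ C) ∪
    Sum.inr '' ((fun x => (i₁, x)) '' Bx b (n + m)) with hS₀
  have hS₀f : S₀.Finite := (((finite_Bx _ _).subset Set.sdiff_subset).image _).union
    (((finite_Bx _ _).image _).image _)
  set direct : Set (Set (V d ⊕ ι × V d)) :=
    {Y | ∃ y ∈ Sph b n ∩ F, Bx y m ⊆ Fd i₁ Y ∧ ∃ v ∈ Bx y m, v ∈ C} with hdirect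
  set Z : Set (V d ⊕ ι × V d) → Set (V d) := fun Y => {z | z ∈ Nb ρ C ∩ Bx b (n - 1) ∧
    ∃ w', adj z w' ∧ ∃ w, Cn ((Xf Y ∩ Bx b (n - 1)) \ Nb ρ C) w' w ∧
      ∃ y ∈ Sph b n ∩ F, adj y w ∧ Bx y m ⊆ Fd i₁ Y} with hZdef
  have hseedS : ∀ Y, ∀ y ∈ Sph b n ∩ F, (Bx y m ⊆ Fd i₁ Y ↔ Bx y m ⊆ Fd i₁ (Y ∩ S₀)) := by
    intro Y y hy
    constructor
    · intro hs x hx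
      refine ⟨hs hx, .inr ⟨_, ⟨x, ?_, rfl⟩, rfl⟩⟩
      exact Bx_subset (by rw [mem_Sph.1 hy.1]) hx
    · intro hs x hx
      exact (hs hx).1
  have hZloc : ∀ Y, Z Y = Z (Y ∩ S₀) := by
    intro Y
    have e : (Xf Y ∩ Bx b (n - 1)) \ Nb ρ C = (Xf (Y ∩ S₀) ∩ Bx b (n - 1)) \ Nb ρ C := by
      ext x
      simp only [Set.mem_sdiff, Set.mem_inter_iff, Xf, Set.mem_preimage, hS₀, Set.mem_union,
        Set.mem_image, Sum.inl.injEq, exists_eq_right, reduceCtorEq, and_false]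
      tauto
    ext z
    simp only [hZdef, Set.mem_ofPred_eq]
    rw [e]
    refine and_congr_right fun _ => exists_congr fun w' => and_congr_right fun _ =>
      exists_congr fun w => and_congr_right fun _ => exists_congr fun y =>
      and_congr_right fun hy => and_congr_right fun _ => hseedS Y y hy
  have hZT : ∀ Y, Z Y ⊆ Nb ρ C ∩ Bx b (n - 1) := fun Y z hz => hz.1
  have hTf : (Nb ρ C ∩ Bx b (n - 1)).Finite := (finite_Bx _ _).subset Set.inter_subset_right
  have hdl : Loc S₀ direct := by
    refine loc_of_iff (· ∈ direct) fun Y => ?_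
    simp only [hdirect, Set.mem_ofPred_eq]
    refine exists_congr fun y => and_congr_right fun hy => and_congr_left fun _ => hseedS Y y hy
  -- few exit points
  have hE1 : c ^ K * Q.real (directᶜ ∩ {Y | (Z Y).ncard ≤ K}) ≤ 2 * η := by
    have h1 := close_random (μ := Q) (c := c) (k := K) hS₀f (hTf.image Sum.inl) hμ.c_pos.le hμ.c_le
      (fun Z' A hZ' hA' => by
        obtain ⟨Z'', hsub, rfl⟩ := Set.subset_image_iff.1 hZ'
        rw [Set.ncard_image_of_injective _ Sum.inl_injective]
        refine h.close S₀ Z'' A hS₀f (hTf.subset hsub) hA' ?_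
        rintro z hz (⟨x, hx, hxz⟩ | ⟨x, _, hxz⟩)
        · rw [Sum.inl.inj hxz] at hx
          exact hx.2 (hsub hz).1
        · exact absurd hxz (by simp)) (fun Y => Sum.inl '' Z Y) (fun Y => by rw [← hZloc])
      (fun Y => Set.image_mono (hZT Y))
      (B := directᶜ ∩ {Y | (Z Y).ncard ≤ K})
      (hdl.compl.inter (loc_of_iff (fun Y => (Z Y).ncard ≤ K) fun Y => by
        rw [Set.mem_ofPred_eq, hZloc]))
      (fun Y hY => by
        rw [Set.ncard_image_of_injective _ Sum.inl_injective]; exact hY.2)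
    refine h1.trans ((measureReal_mono ?_ (measure_ne_top _ _)).trans hHc)
    rintro Y ⟨⟨hnd, _⟩, hdisj⟩ ⟨y, ⟨⟨hyS, w, hyw, hw, x, hx, hxw⟩, hyF⟩, hseed⟩
    by_cases hwC : w ∈ Nb ρ C
    · obtain ⟨v, hv, hwv⟩ := hwC
      refine hnd ⟨y, ⟨hyS, hyF⟩, hseed, v, ?_, hv⟩
      rw [mem_Bx]
      have t1 := dinf_triangle y w v
      have t2 := dinf_of_adj hyw
      omega
    · obtain ⟨z, w', hxz, hz, hzw', hw'w⟩ := hxw.last_exit (subset_Nb ρ C (hbC hx)) hwC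
      refine Set.disjoint_left.1 hdisj (hxz.right_mem.1 : Sum.inl z ∈ Y) ⟨z, ?_, rfl⟩
      exact ⟨⟨hz, hxz.right_mem.2⟩, w', hzw', w, hw'w, y, ⟨hyS, hyF⟩, hyw, hseed⟩
  have hE2 := h.seeds_random hK hS₀f hTf i₂ (by
    rintro x (⟨y, _, hy⟩ | ⟨_, ⟨y, _, rfl⟩, hy⟩)
    · exact absurd hy (by simp)
    · exact hi (Prod.mk.inj (Sum.inr.inj hy)).1) Z hZloc hZT (by positivity)
  have hsub : (StepEv ρ m n b F C i₁ i₂)ᶜ ⊆ (directᶜ ∩ {Y | (Z Y).ncard ≤ K}) ∪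
      {Y | K < (Z Y).ncard ∧ ∀ z ∈ Z Y, ¬ Bx z ρ ⊆ Fd i₂ Y} := by
    intro Y hY
    by_contra hc
    simp only [Set.mem_union, not_or, Set.mem_inter_iff, Set.mem_compl_iff, Set.mem_ofPred_eq,
      not_and, not_forall, not_not, not_le] at hc
    obtain ⟨hc1, hc2⟩ := hc
    have hBox : ∀ y ∈ Sph b n ∩ F, Bx y m ⊆ Bx b (2 * n) := fun y hy =>
      Bx_subset (by rw [mem_Sph.1 hy.1]; omega)
    by_cases hd' : Y ∈ direct
    · obtain ⟨y, hy, hs, v, hv, hvC⟩ := hd'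
      refine hY ⟨y, hy, v, hvC, fun v' hv' => (Bx_connected hv hv').mono ?_⟩
      exact fun u hu => .inr ⟨.inl (.inr (hs hu)), hBox y hy hu⟩
    · obtain ⟨z, ⟨⟨⟨v, hv, hzv⟩, hzB⟩, w', hzw', w, hw'w, y, hy, hyw, hs⟩, hz⟩ := hc2 (hc1 hd')
      refine hY ⟨y, hy, v, hv, fun v' hv' => ?_⟩
      have p1 : Cn (C ∪ (((Xf Y \ Nb ρ C) ∪ Fd i₁ Y ∪ Fd i₂ Y) ∩ Bx b (2 * n))) v z := by
        refine (Bx_connected_center (mem_Bx.2 hzv)).mono fun u hu => ?_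
        refine .inr ⟨.inr (hz hu), Bx_subset (y := z) ?_ hu⟩
        rw [mem_Bx] at hzB
        omega
      have p2 : Cn (C ∪ (((Xf Y \ Nb ρ C) ∪ Fd i₁ Y ∪ Fd i₂ Y) ∩ Bx b (2 * n))) w' w :=
        hw'w.mono fun u hu => .inr ⟨.inl (.inl ⟨hu.1.1, hu.2⟩), Bx_mono b (by omega) hu.1.2⟩
      have p3 : Cn (C ∪ (((Xf Y \ Nb ρ C) ∪ Fd i₁ Y ∪ Fd i₂ Y) ∩ Bx b (2 * n))) y v' :=
        (Bx_connected (self_mem_Bx y m) hv').mono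
          fun u hu => .inr ⟨.inl (.inr (hs hu)), hBox y hy hu⟩
      exact p1.trans ((p2.head p1.right_mem hzw').trans (p3.head p2.right_mem (adj_symm hyw)))
  refine (measureReal_mono hsub (measure_ne_top _ _)).trans ((measureReal_union_le _ _).trans ?_)
  have h4 : Q.real (directᶜ ∩ {Y | (Z Y).ncard ≤ K}) ≤ 2 * ε / 3 := by
    refine le_of_mul_le_mul_left (hE1.trans_eq ?_) hcK
    rw [hη]; ring
  linarith

end step

end

section

section explore

variable {d : ℕ} {M : Type*}

/-- The region available after attempting the macroscopic edges of `A`. -/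
def Reg (G : M × M → Set (V d)) (base Λ : Set (V d)) (A : Finset (M × M))
    (Y : Set (V d ⊕ ((M × M) × Bool) × V d)) : Set (V d) :=
  (Xf Y ∪ base ∪ ⋃ e ∈ A, (Fd (e, false) Y ∪ Fd (e, true) Y) ∩ G e) ∩ Λ

/-- The explored cluster. -/
def Clu (G : M × M → Set (V d)) (base Λ : Set (V d)) (A : Finset (M × M))
    (Y : Set (V d ⊕ ((M × M) × Bool) × V d)) : Set (V d) :=
  {x | ∃ y ∈ base, Cn (Reg G base Λ A Y) y x}

variable {G : M × M → Set (V d)} {base Λ : Set (V d)}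

theorem Reg_mono {A A' : Finset (M × M)} (h : A ⊆ A') (Y : Set (V d ⊕ ((M × M) × Bool) × V d)) :
    Reg G base Λ A Y ⊆ Reg G base Λ A' Y :=
  Set.inter_subset_inter_left _ (Set.union_subset_union_right _ (Set.biUnion_subset_biUnion_left h))

theorem Clu_mono {A A' : Finset (M × M)} (h : A ⊆ A') (Y : Set (V d ⊕ ((M × M) × Bool) × V d)) :
    Clu G base Λ A Y ⊆ Clu G base Λ A' Y := fun _ ⟨y, hy, hx⟩ => ⟨y, hy, hx.mono (Reg_mono h Y)⟩

theorem Clu_subset {A : Finset (M × M)} {Y : Set (V d ⊕ ((M × M) × Bool) × V d)} :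
    Clu G base Λ A Y ⊆ Λ := fun _ ⟨_, _, hx⟩ => hx.right_mem.2

theorem base_subset_Clu (hb : base ⊆ Λ) {A : Finset (M × M)}
    {Y : Set (V d ⊕ ((M × M) × Bool) × V d)} : base ⊆ Clu G base Λ A Y :=
  fun y hy => ⟨y, hy, .refl ⟨.inl (.inr hy), hb hy⟩⟩

/-- Sites determining whether the explored cluster is `C`. -/
def CluS (Λ : Set (V d)) (A : Finset (M × M)) (C : Set (V d)) :
    Set (V d ⊕ ((M × M) × Bool) × V d) :=
  Sum.inl '' (Nb 1 C ∩ Λ) ∪ Sum.inr '' (((A : Set (M × M)) ×ˢ Set.univ) ×ˢ Λ)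

theorem finite_CluS (hΛ : Λ.Finite) (A : Finset (M × M)) (C : Set (V d)) :
    (CluS Λ A C).Finite :=
  ((hΛ.subset Set.inter_subset_right).image _).union
    ((((A.finite_toSet).prod Set.finite_univ).prod hΛ).image _)

theorem CluS_mono {A A' : Finset (M × M)} (hA : A ⊆ A') {C C' : Set (V d)} (hC : C ⊆ C') :
    CluS Λ A C ⊆ CluS Λ A' C' := by
  refine Set.union_subset_union (Set.image_mono (Set.inter_subset_inter_left _ ?_))
    (Set.image_mono (Set.prod_mono_left (Set.prod_mono_left (Finset.coe_subset.2 hA))))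
  rintro x ⟨y, hy, h⟩
  exact ⟨y, hC hy, h⟩

theorem mem_inter_congr {J : Type*} {S Y Y' : Set J} (h : Y ∩ S = Y' ∩ S) {x : J} (hx : x ∈ S) :
    x ∈ Y ↔ x ∈ Y' := by
  have := Set.ext_iff.1 h x
  simpa [hx] using this

theorem loc_Clu (hb : base ⊆ Λ) (A : Finset (M × M)) (C : Set (V d)) :
    Loc (CluS Λ A C) {Y | Clu G base Λ A Y = C} := by
  intro Y Y' hYY hY
  rw [Set.mem_ofPred_eq] at *
  have hreg : ∀ x ∈ Nb 1 C, (x ∈ Reg G base Λ A Y ↔ x ∈ Reg G base Λ A Y') := by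
    intro x hx
    unfold Reg
    simp only [Set.mem_inter_iff, Set.mem_union, Set.mem_iUnion, exists_prop]
    refine and_congr_left fun hΛ => or_congr (or_congr_left ?_) (exists_congr fun e =>
      and_congr_right fun he => and_congr_left fun _ => or_congr ?_ ?_)
    · exact mem_inter_congr hYY (.inl ⟨x, ⟨hx, hΛ⟩, rfl⟩)
    · exact mem_inter_congr hYY (.inr ⟨((e, false), x), ⟨⟨he, trivial⟩, hΛ⟩, rfl⟩)
    · exact mem_inter_congr hYY (.inr ⟨((e, true), x), ⟨⟨he, trivial⟩, hΛ⟩, rfl⟩)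
  apply Set.Subset.antisymm
  · rintro x ⟨y, hy, hx⟩
    by_contra hxC
    have hyC : y ∈ C := hY ▸ base_subset_Clu hb hy
    obtain ⟨z, w, h1, h2, h3, h4, _⟩ := hx.first_exit hyC hxC
    have hwN : w ∈ Nb 1 C := ⟨z, h1.right_mem.2, dinf_of_adj (adj_symm h2)⟩
    have hz : z ∈ Clu G base Λ A Y := hY ▸ h1.right_mem.2
    obtain ⟨y', hy', hz'⟩ := hz
    exact h4 (hY ▸ ⟨y', hy', hz'.step h2 ((hreg w hwN).2 h3)⟩)
  · intro x hx
    rw [← hY] at hx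
    obtain ⟨y, hy, hx⟩ := hx
    refine ⟨y, hy, hx.in_cluster.mono ?_⟩
    intro z hz
    have hz' : Cn (Reg G base Λ A Y) y z := hz
    have hzC : z ∈ C := hY ▸ ⟨y, hy, hz'⟩
    exact (hreg z (subset_Nb 1 C hzC)).1 hz'.right_mem

open Classical in
/-- The next edge to attempt. -/
noncomputable def nextE (Ed : Finset (M × M)) (sd : M → Set (V d) → Prop) (A : Finset (M × M))
    (C : Set (V d)) : Option (M × M) :=
  if h : ∃ e, e ∈ Ed ∧ e ∉ A ∧ sd e.1 C ∧ ¬ sd e.2 C then some h.choose else none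

theorem nextE_some {Ed : Finset (M × M)} {sd : M → Set (V d) → Prop} {A : Finset (M × M)}
    {C : Set (V d)} {e : M × M} (h : nextE Ed sd A C = some e) :
    e ∈ Ed ∧ e ∉ A ∧ sd e.1 C ∧ ¬ sd e.2 C := by
  unfold nextE at h
  split_ifs at h with h'
  rw [Option.some.injEq] at h
  rw [← h]
  exact h'.choose_spec

theorem nextE_none {Ed : Finset (M × M)} {sd : M → Set (V d) → Prop} {A : Finset (M × M)}
    {C : Set (V d)} (h : nextE Ed sd A C = none) {e : M × M} (he : e ∈ Ed) (h1 : sd e.1 C)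
    (h2 : ¬ sd e.2 C) : e ∈ A := by
  unfold nextE at h
  split_ifs at h with h'
  by_contra hc
  exact h' ⟨e, he, hc, h1, h2⟩

open Classical in
/-- The set of attempted edges after at most `k` further steps of the exploration. -/
noncomputable def run (G : M × M → Set (V d)) (base Λ : Set (V d)) (Ed : Finset (M × M))
    (sd : M → Set (V d) → Prop) (Y : Set (V d ⊕ ((M × M) × Bool) × V d)) :
    ℕ → Finset (M × M) → Finset (M × M)
  | 0, A => A
  | k + 1, A => match nextE Ed sd A (Clu G base Λ A Y) with
    | none => A
    | some e => run G base Λ Ed sd Y k (insert e A)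

variable {Ed : Finset (M × M)} {sd : M → Set (V d) → Prop}

open Classical in
theorem subset_run (Y : Set (V d ⊕ ((M × M) × Bool) × V d)) (k : ℕ) (A : Finset (M × M)) :
    A ⊆ run G base Λ Ed sd Y k A := by
  induction k generalizing A with
  | zero => exact subset_rfl
  | succ k ih =>
    unfold run
    split
    · exact subset_rfl
    · exact (Finset.subset_insert _ _).trans (ih _)

open Classical in
theorem run_halts (Y : Set (V d ⊕ ((M × M) × Bool) × V d)) (k : ℕ) (A : Finset (M × M))
    (hk : (Ed \ A).card ≤ k) :
    nextE Ed sd (run G base Λ Ed sd Y k A) (Clu G base Λ (run G base Λ Ed sd Y k A) Y) = none := by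
  induction k generalizing A with
  | zero =>
    by_contra h
    obtain ⟨e, he⟩ := Option.ne_none_iff_exists'.1 h
    obtain ⟨h1, h2, _⟩ := nextE_some he
    have h2 : e ∉ A := h2
    have : (Ed \ A).card ≠ 0 := Finset.card_ne_zero_of_mem (Finset.mem_sdiff.2 ⟨h1, h2⟩)
    omega
  | succ k ih =>
    rw [run]
    cases h : nextE Ed sd A (Clu G base Λ A Y) with
    | none => exact h
    | some e =>
      obtain ⟨h1, h2, _⟩ := nextE_some h
      refine ih _ ?_
      have : (Ed \ insert e A).card < (Ed \ A).card := by
        refine Finset.card_lt_card (Finset.ssubset_iff_subset_ne.2 ⟨Finset.sdiff_subset_sdiff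
          subset_rfl (Finset.subset_insert _ _), fun heq => ?_⟩)
        have : e ∈ Ed \ insert e A := heq ▸ Finset.mem_sdiff.2 ⟨h1, h2⟩
        simp at this
      omega

variable {Q : Measure (Set (V d ⊕ ((M × M) × Bool) × V d))} {μ : Measure (Set (V d))} {ℓ : ℕ}
  {c t : ℝ}

open Classical in
theorem Ext.explore (hQ : Ext Q μ ℓ c t) (hb : base ⊆ Λ) (hΛ : Λ.Finite) {ρ : ℕ} (hρ : ℓ < ρ)
    {ε : ℝ} (hε : 0 ≤ ε) (hsd : ∀ v C C', C ⊆ C' → sd v C → sd v C')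
    (hstep : ∀ e ∈ Ed, ∀ C, base ⊆ C → sd e.1 C → ∃ (T : Set (V d ⊕ ((M × M) × Bool) × V d)) (B : _),
      T.Finite ∧ Loc T B ∧ (∀ x, Sum.inl x ∈ T → x ∉ Nb ρ C) ∧ (∀ p, Sum.inr p ∈ T → p.1.1 = e) ∧
      Q.real Bᶜ ≤ ε ∧ ∀ Y ∈ B, ∀ A, e ∈ A → C ⊆ Clu G base Λ A Y → sd e.2 (Clu G base Λ A Y))
    (F : Finset (M × M)) (k : ℕ) (A : Finset (M × M)) (C : Set (V d))
    (E : Set (Set (V d ⊕ ((M × M) × Bool) × V d))) (hE : Loc (CluS Λ A C) E)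
    (hEC : ∀ Y ∈ E, Clu G base Λ A Y = C) :
    Q.real (E ∩ {Y | F ⊆ run G base Λ Ed sd Y k A ∧
      ∀ e ∈ F, ¬ sd e.2 (Clu G base Λ (run G base Λ Ed sd Y k A) Y)}) ≤
      ε ^ (F \ A).card * Q.real E := by
  have := hQ.prob
  induction k generalizing A C E with
  | zero =>
    by_cases hFA : F ⊆ A
    · rw [Finset.sdiff_eq_empty_iff_subset.2 hFA, Finset.card_empty, pow_zero, one_mul]
      exact measureReal_mono Set.inter_subset_left
    · refine (measureReal_mono (s₂ := ∅) ?_ (measure_ne_top _ _)).trans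
        (measureReal_empty.trans_le (mul_nonneg (pow_nonneg hε _) measureReal_nonneg))
      exact fun Y h => hFA h.2.1
  | succ k ih =>
    cases hn : nextE Ed sd A C with
    | none =>
      by_cases hFA : F ⊆ A
      · rw [Finset.sdiff_eq_empty_iff_subset.2 hFA, Finset.card_empty, pow_zero, one_mul]
        exact measureReal_mono Set.inter_subset_left
      · refine (measureReal_mono (s₂ := ∅) ?_ (measure_ne_top _ _)).trans
          (measureReal_empty.trans_le (mul_nonneg (pow_nonneg hε _) measureReal_nonneg))
        rintro Y ⟨hY, h, _⟩
        rw [run, hEC Y hY, hn] at h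
        exact hFA h
    | some e =>
      obtain ⟨he1, he2, he3, he4⟩ := nextE_some hn
      rcases Set.eq_empty_or_nonempty E with rfl | ⟨Y₀, hY₀⟩
      · simp
      have hbC : base ⊆ C := by rw [← hEC Y₀ hY₀]; exact base_subset_Clu hb
      obtain ⟨T, B, hT, hTB, hTX, hTF, hB, hBsd⟩ := hstep e he1 C hbC he3
      set A' := insert e A with hA'
      have hAA : A ⊆ A' := Finset.subset_insert _ _
      set p : Set (V d) → Prop := fun C' => C ⊆ C' ∧ (e ∈ F → ¬ sd e.2 C') with hp
      set P : Finset (Set (V d)) := hΛ.powerset.toFinset.filter p with hP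
      set E' : Set (V d) → Set (Set (V d ⊕ ((M × M) × Bool) × V d)) :=
        fun C' => E ∩ {Y | Clu G base Λ A' Y = C'} with hE'
      have hE'L : ∀ C' ∈ P, Loc (CluS Λ A' C') (E' C') := fun C' hC' =>
        (hE.mono (CluS_mono hAA (Finset.mem_filter.1 hC').2.1)).inter (loc_Clu hb A' C')
      have hsub : E ∩ {Y | F ⊆ run G base Λ Ed sd Y (k + 1) A ∧
          ∀ e ∈ F, ¬ sd e.2 (Clu G base Λ (run G base Λ Ed sd Y (k + 1) A) Y)} ⊆
          ⋃ C' ∈ P, (E' C' ∩ {Y | F ⊆ run G base Λ Ed sd Y k A' ∧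
            ∀ e ∈ F, ¬ sd e.2 (Clu G base Λ (run G base Λ Ed sd Y k A') Y)}) := by
        rintro Y ⟨hY, h1, h2⟩
        rw [run, hEC Y hY, hn] at h1 h2
        refine Set.mem_iUnion₂.2 ⟨Clu G base Λ A' Y, ?_, ⟨hY, rfl⟩, h1, h2⟩
        refine Finset.mem_filter.2 ⟨?_, ?_, fun heF hs => h2 e heF ?_⟩
        · rw [Set.Finite.mem_toFinset]; exact Clu_subset
        · rw [← hEC Y hY]; exact Clu_mono hAA Y
        · exact hsd _ _ _ (Clu_mono (subset_run Y k A') Y) hs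
      refine (measureReal_mono hsub (measure_ne_top _ _)).trans
        ((measureReal_biUnion_finset_le _ _).trans ?_)
      refine (Finset.sum_le_sum fun C' hC' => ih A' C' (E' C') (hE'L C' hC') fun Y hY => hY.2).trans ?_
      rw [← Finset.mul_sum, ← measureReal_biUnion_finset
        (fun w _ w' _ hne => Set.disjoint_left.2 fun X hX hX' => hne (hX.2.symm.trans hX'.2))
        fun w hw => (hE'L w hw).measurableSet (finite_CluS hΛ _ _)]
      by_cases heF : e ∈ F
      · have hcard : (F \ A).card = (F \ A').card + 1 := by
          rw [hA', ← Finset.card_insert_of_notMem (a := e) (by simp)]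
          congr 1
          ext x
          simp only [Finset.mem_sdiff, Finset.mem_insert, not_or]
          by_cases hx : x = e
          · simp [hx, heF, he2]
          · simp [hx]
        rw [hcard, pow_succ, mul_assoc]
        refine mul_le_mul_of_nonneg_left ?_ (pow_nonneg hε _)
        have hsep : Sep Q (CluS Λ A C) T := by
          refine hQ.sep _ _ (finite_CluS hΛ _ _) hT ?_ ?_
          · rintro x y (⟨x', ⟨⟨z, hz, hxz⟩, _⟩, hx'⟩ | ⟨_, _, hx'⟩) hy
            · rw [Sum.inl.injEq] at hx'
              subst hx'
              have h1 := hTX y hy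
              by_contra hc
              refine h1 ⟨z, hz, ?_⟩
              have := dinf_triangle y x' z
              rw [dinf_comm y x'] at this
              omega
            · exact absurd hx' (by simp)
          · rintro q (⟨_, _, hx'⟩ | ⟨q', ⟨hq', _⟩, hx'⟩) hqT
            · exact absurd hx' (by simp)
            · rw [Sum.inr.injEq] at hx'
              subst hx'
              have h1 := hTF _ hqT
              have h2 : q'.1.1 ∈ A := hq'.1
              rw [h1] at h2
              exact he2 h2
        refine (measureReal_mono (s₂ := E ∩ Bᶜ) ?_ (measure_ne_top _ _)).trans ?_
        · intro Y hY
          obtain ⟨C', hC', hYE, hYC⟩ := Set.mem_iUnion₂.1 hY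
          have hYC : Clu G base Λ A' Y = C' := hYC
          have hpC := (Finset.mem_filter.1 hC').2
          refine ⟨hYE, fun hYB => hpC.2 heF ?_⟩
          rw [← hYC]
          exact hBsd Y hYB A' (Finset.mem_insert_self _ _) (hYC ▸ hpC.1)
        · rw [hsep _ _ hE hTB.compl, mul_comm]
          exact mul_le_mul_of_nonneg_right hB measureReal_nonneg
      · have hcard : F \ A' = F \ A := by
          ext x
          simp only [hA', Finset.mem_sdiff, Finset.mem_insert, not_or]
          refine and_congr_right fun hx => ⟨fun h => h.2, fun h => ⟨?_, h⟩⟩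
          rintro rfl
          exact heF hx
        rw [hcard]
        refine mul_le_mul_of_nonneg_left (measureReal_mono ?_ (measure_ne_top _ _)) (pow_nonneg hε _)
        exact Set.iUnion₂_subset fun C' _ => Set.inter_subset_left

open Classical in
/-- A fixed set of edges with distinct indices is unlikely to be attempted without success. -/
theorem Ext.explore_all (hQ : Ext Q μ ℓ c t) (hb : base ⊆ Λ) (hΛ : Λ.Finite) {ρ : ℕ} (hρ : ℓ < ρ)
    {ε : ℝ} (hε : 0 ≤ ε) (hsd : ∀ v C C', C ⊆ C' → sd v C → sd v C')
    (hstep : ∀ e ∈ Ed, ∀ C, base ⊆ C → sd e.1 C → ∃ (T : Set (V d ⊕ ((M × M) × Bool) × V d)) (B : _),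
      T.Finite ∧ Loc T B ∧ (∀ x, Sum.inl x ∈ T → x ∉ Nb ρ C) ∧ (∀ p, Sum.inr p ∈ T → p.1.1 = e) ∧
      Q.real Bᶜ ≤ ε ∧ ∀ Y ∈ B, ∀ A, e ∈ A → C ⊆ Clu G base Λ A Y → sd e.2 (Clu G base Λ A Y))
    (F : Finset (M × M)) (k : ℕ) :
    Q.real {Y | F ⊆ run G base Λ Ed sd Y k ∅ ∧
      ∀ e ∈ F, ¬ sd e.2 (Clu G base Λ (run G base Λ Ed sd Y k ∅) Y)} ≤ ε ^ F.card := by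
  have := hQ.prob
  set P := hΛ.powerset.toFinset
  have hL : ∀ C, Loc (CluS Λ ∅ C) {Y | Clu G base Λ ∅ Y = C} := fun C => loc_Clu hb ∅ C
  refine (measureReal_mono (s₂ := ⋃ C ∈ P, ({Y | Clu G base Λ ∅ Y = C} ∩
    {Y | F ⊆ run G base Λ Ed sd Y k ∅ ∧
      ∀ e ∈ F, ¬ sd e.2 (Clu G base Λ (run G base Λ Ed sd Y k ∅) Y)})) ?_ (measure_ne_top _ _)).trans
      ((measureReal_biUnion_finset_le _ _).trans
        ((Finset.sum_le_sum fun C _ => hQ.explore hb hΛ hρ hε hsd hstep F k ∅ C _ (hL C)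
          fun Y hY => hY).trans ?_))
  · intro Y hY
    exact Set.mem_iUnion₂.2 ⟨Clu G base Λ ∅ Y, by simp only [P, Set.Finite.mem_toFinset]; exact Clu_subset,
      rfl, hY⟩
  · rw [← Finset.mul_sum, ← measureReal_biUnion_finset
        (fun w _ w' _ hne => Set.disjoint_left.2 fun X hX hX' => hne (hX.symm.trans hX'))
        fun w _ => (hL w).measurableSet (finite_CluS hΛ _ _), Finset.sdiff_empty]
    exact mul_le_of_le_one_right (pow_nonneg hε _) measureReal_le_one

end explore

end

section

/-! ### Planar duality on the macroscopic lattice -/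

/-- Nearest-neighbour adjacency on `ℕ × ℕ`. -/
def Adj4 (p q : ℕ × ℕ) : Prop :=
  (p.1 = q.1 ∧ (p.2 = q.2 + 1 ∨ q.2 = p.2 + 1)) ∨ (p.2 = q.2 ∧ (p.1 = q.1 + 1 ∨ q.1 = p.1 + 1))

/-- Star-adjacency on `ℕ × ℕ`. -/
def Adj8 (p q : ℕ × ℕ) : Prop :=
  p.1 ≤ q.1 + 1 ∧ q.1 ≤ p.1 + 1 ∧ p.2 ≤ q.2 + 1 ∧ q.2 ≤ p.2 + 1

theorem Adj4.symm {p q : ℕ × ℕ} (h : Adj4 p q) : Adj4 q p := by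
  unfold Adj4 at *; omega

/-- Unseeded points of the rectangle with a seeded neighbour. -/
def DualBd (N K : ℕ) (s : ℕ × ℕ → Prop) : Set (ℕ × ℕ) :=
  {p | p.1 ≤ N ∧ p.2 ≤ K ∧ ¬ s p ∧ ∃ q : ℕ × ℕ, q.1 ≤ N ∧ q.2 ≤ K ∧ Adj4 q p ∧ s q}

theorem parity_sum (N K : ℕ) (s w : ℕ → ℕ → ZMod 2)
    (hs0 : ∀ j ≤ K, s 0 j = 1) (hsN : ∀ j ≤ K, s N j = 0)
    (hsw : ∀ a j, a ≤ N → j ≤ K → s a j * w a j = 0)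
    (hr0 : ∀ a < N, s a 0 * w (a + 1) 0 + s (a + 1) 0 * w a 0 = s a 0 + s (a + 1) 0)
    (hrK : ∀ a ≤ N, w a K = 0)
    (hsq : ∀ a j, a < N → j < K → (w a j = 0 ∧ w (a + 1) j = 0 ∧ w a (j + 1) = 0 ∧
      w (a + 1) (j + 1) = 0) ∨
      (s a j * w (a + 1) j + s (a + 1) j * w a j = s a j + s (a + 1) j ∧
      s a (j + 1) * w (a + 1) (j + 1) + s (a + 1) (j + 1) * w a (j + 1) =
        s a (j + 1) + s (a + 1) (j + 1) ∧
      s a j * w a (j + 1) + s a (j + 1) * w a j = s a j + s a (j + 1) ∧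
      s (a + 1) j * w (a + 1) (j + 1) + s (a + 1) (j + 1) * w (a + 1) j =
        s (a + 1) j + s (a + 1) (j + 1))) : False := by
  set h : ℕ → ZMod 2 := fun j => ∑ a ∈ Finset.range N,
    (s a j * w (a + 1) j + s (a + 1) j * w a j) with hh
  set v : ℕ → ℕ → ZMod 2 := fun j a => s a j * w a (j + 1) + s a (j + 1) * w a j with hv
  have two : (2 : ZMod 2) = 0 := by decide
  have tel : ∀ f : ℕ → ZMod 2, ∑ a ∈ Finset.range N, (f a + f (a + 1)) = f 0 + f N := by
    intro f
    clear * - two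
    induction N with
    | zero => simp; linear_combination (-f 0) * two
    | succ N ih => rw [Finset.sum_range_succ, ih]; linear_combination f N * two
  have hstep : ∀ j < K, h j = h (j + 1) := by
    intro j hj
    have h1 : h j + h (j + 1) + ∑ a ∈ Finset.range N, (v j a + v j (a + 1)) = 0 := by
      simp only [hh, hv]
      rw [← Finset.sum_add_distrib, ← Finset.sum_add_distrib]
      refine Finset.sum_eq_zero fun a ha => ?_
      rcases hsq a j (Finset.mem_range.1 ha) hj with ⟨q1, q2, q3, q4⟩ | ⟨q1, q2, q3, q4⟩
      · simp [q1, q2, q3, q4]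
      · rw [q1, q2, q3, q4]
        linear_combination (s a j + s (a + 1) j + s a (j + 1) + s (a + 1) (j + 1)) * two
    rw [tel] at h1
    have h2 : v j 0 = 0 := by
      have e1 := hsw 0 j (Nat.zero_le _) hj.le
      have e2 := hsw 0 (j + 1) (Nat.zero_le _) hj
      rw [hs0 _ hj.le, one_mul] at e1
      rw [hs0 _ hj, one_mul] at e2
      simp [hv, e1, e2]
    have h3 : v j N = 0 := by simp [hv, hsN _ hj.le, hsN (j + 1) hj]
    rw [h2, h3] at h1
    linear_combination h1 - h (j + 1) * two
  have hK : ∀ j ≤ K, h 0 = h j := by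
    intro j hj
    induction j with
    | zero => rfl
    | succ j ih => rw [ih (by omega), hstep j (by omega)]
  have e0 : h 0 = 1 := by
    simp only [hh]
    rw [Finset.sum_congr rfl fun a ha => hr0 a (Finset.mem_range.1 ha), tel (fun a => s a 0),
      hs0 0 (Nat.zero_le _), hsN 0 (Nat.zero_le _), add_zero]
  have eK : h K = 0 := by
    simp only [hh]
    refine Finset.sum_eq_zero fun a ha => ?_
    rw [Finset.mem_range] at ha
    rw [hrK _ ha.le, hrK (a + 1) ha]; simp
  rw [hK K le_rfl, eK] at e0
  exact absurd e0 (by decide)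

theorem exists_dual_path (N K : ℕ) (s : ℕ × ℕ → Prop) (hs0 : ∀ j ≤ K, s (0, j))
    (hsN : ∀ j ≤ K, ¬ s (N, j)) :
    ∃ x y, x.2 = 0 ∧ y.2 = K ∧ Rch Adj8 (DualBd N K s) x y := by
  classical
  by_contra hcon
  push Not at hcon
  set w : ℕ × ℕ → Prop := fun p => ∃ x, x.2 = 0 ∧ Rch Adj8 (DualBd N K s) x p with hw
  have hwD : ∀ p, w p → p ∈ DualBd N K s := fun p ⟨x, _, h⟩ => h.right_mem
  have hadj : ∀ p q, w p → q ∈ DualBd N K s → Adj8 p q → w q :=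
    fun p q ⟨x, hx, h⟩ hq hpq => ⟨x, hx, h.step hpq hq⟩
  -- an edge crossing from seeded to unseeded is cut as soon as its unseeded end is reached
  have cut : ∀ p q : ℕ × ℕ, p.1 ≤ N → p.2 ≤ K → q.1 ≤ N → q.2 ≤ K → Adj4 p q →
      (p ∈ DualBd N K s → w p) → (q ∈ DualBd N K s → w q) →
      (if s p then (1 : ZMod 2) else 0) * (if w q then 1 else 0) +
        (if s q then 1 else 0) * (if w p then 1 else 0) =
      (if s p then 1 else 0) + (if s q then 1 else 0) := by
    intro p q hp1 hp2 hq1 hq2 hpq hwp hwq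
    by_cases hp : s p <;> by_cases hq : s q
    · have h1 : ¬ w p := fun h => (hwD p h).2.2.1 hp
      have h2 : ¬ w q := fun h => (hwD q h).2.2.1 hq
      simp only [hp, hq, h1, h2, if_true, if_false]; decide
    · have h1 : ¬ w p := fun h => (hwD p h).2.2.1 hp
      have h2 : w q := hwq ⟨hq1, hq2, hq, p, hp1, hp2, hpq, hp⟩
      simp [hp, hq, h1, h2]
    · have h1 : ¬ w q := fun h => (hwD q h).2.2.1 hq
      have h2 : w p := hwp ⟨hp1, hp2, hp, q, hq1, hq2, hpq.symm, hq⟩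
      simp [hp, hq, h1, h2]
    · simp [hp, hq]
  refine parity_sum N K (fun a j => if s (a, j) then 1 else 0) (fun a j => if w (a, j) then 1 else 0)
    (fun j hj => if_pos (hs0 j hj)) (fun j hj => if_neg (hsN j hj)) ?_ ?_ ?_ ?_
  · intro a j _ _
    by_cases h : w (a, j)
    · simp [(hwD _ h).2.2.1]
    · simp [h]
  · intro a ha
    exact cut (a, 0) (a + 1, 0) ha.le (Nat.zero_le _) ha (Nat.zero_le _) (by simp [Adj4])
      (fun h => ⟨_, rfl, .refl h⟩) (fun h => ⟨_, rfl, .refl h⟩)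
  · intro a _
    exact if_neg fun ⟨x, hx, h⟩ => hcon x (a, K) hx rfl h
  · intro a j ha hj
    by_cases h : w (a, j) ∨ w (a + 1, j) ∨ w (a, j + 1) ∨ w (a + 1, j + 1)
    · right
      have key : ∃ p, w p ∧ ∀ q : ℕ × ℕ, a ≤ q.1 → q.1 ≤ a + 1 → j ≤ q.2 → q.2 ≤ j + 1 → Adj8 p q := by
        rcases h with h | h | h | h <;> refine ⟨_, h, fun q _ _ _ _ => ?_⟩ <;>
          simp only [Adj8] <;> omega
      obtain ⟨p, hp, hpq⟩ := key
      have hq : ∀ q : ℕ × ℕ, a ≤ q.1 → q.1 ≤ a + 1 → j ≤ q.2 → q.2 ≤ j + 1 → q ∈ DualBd N K s → w q :=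
        fun q h1 h2 h3 h4 hD => hadj p q hp hD (hpq q h1 h2 h3 h4)
      refine ⟨cut _ _ ?_ ?_ ?_ ?_ ?_ (hq _ ?_ ?_ ?_ ?_) (hq _ ?_ ?_ ?_ ?_),
        cut _ _ ?_ ?_ ?_ ?_ ?_ (hq _ ?_ ?_ ?_ ?_) (hq _ ?_ ?_ ?_ ?_),
        cut _ _ ?_ ?_ ?_ ?_ ?_ (hq _ ?_ ?_ ?_ ?_) (hq _ ?_ ?_ ?_ ?_),
        cut _ _ ?_ ?_ ?_ ?_ ?_ (hq _ ?_ ?_ ?_ ?_) (hq _ ?_ ?_ ?_ ?_)⟩ <;>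
        first | omega | simp [Adj4]
    · left
      push Not at h
      simp [h]

/-! ### Counting dual paths -/

open Classical in
/-- The nearest neighbours of a point. -/
noncomputable def nb4 (v : ℕ × ℕ) : Finset (ℕ × ℕ) :=
  {(v.1 + 1, v.2), (v.1 - 1, v.2), (v.1, v.2 + 1), (v.1, v.2 - 1)}

theorem mem_nb4 {q v : ℕ × ℕ} (h : Adj4 q v) : q ∈ nb4 v := by
  obtain ⟨a, b⟩ := q
  obtain ⟨a', b'⟩ := v
  simp only [nb4, Finset.mem_insert, Finset.mem_singleton, Prod.mk.injEq, Adj4] at *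
  omega

theorem card_nb4 (v : ℕ × ℕ) : (nb4 v).card ≤ 4 := Finset.card_le_four

/-- The star-neighbours of a point, including itself. -/
def nb8 (v : ℕ × ℕ) : Finset (ℕ × ℕ) :=
  Finset.Icc (v.1 - 1) (v.1 + 1) ×ˢ Finset.Icc (v.2 - 1) (v.2 + 1)

theorem mem_nb8 {q v : ℕ × ℕ} (h : Adj8 q v) : q ∈ nb8 v := by
  simp only [nb8, Finset.mem_product, Finset.mem_Icc, Adj8] at *
  omega

theorem card_nb8 (v : ℕ × ℕ) : (nb8 v).card ≤ 9 := by
  rw [nb8, Finset.card_product, Nat.card_Icc, Nat.card_Icc]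
  exact Nat.mul_le_mul (show _ ≤ 3 by omega) (show _ ≤ 3 by omega)

open Classical in
/-- Edge sets attached to star-paths of `k` points starting at `v`. -/
noncomputable def EL : ℕ → ℕ × ℕ → Finset (Finset ((ℕ × ℕ) × (ℕ × ℕ)))
  | 0, _ => {∅}
  | k + 1, v => (nb4 v ×ˢ nb8 v).biUnion fun p => (EL k p.2).image (insert (p.1, v))

theorem card_EL (k : ℕ) (v : ℕ × ℕ) : (EL k v).card ≤ 36 ^ k := by
  classical
  induction k generalizing v with
  | zero => simp [EL]
  | succ k ih =>
    rw [EL]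
    refine Finset.card_biUnion_le.trans ((Finset.sum_le_card_nsmul _ _ (36 ^ k) fun p _ =>
      Finset.card_image_le.trans (ih p.2)).trans ?_)
    rw [smul_eq_mul, pow_succ, mul_comm (36 ^ k), Finset.card_product]
    exact Nat.mul_le_mul_right _ (Nat.mul_le_mul (card_nb4 v) (card_nb8 v))

theorem exists_EL {f : ℕ × ℕ → ℕ × ℕ} (k : ℕ) {S : Set (ℕ × ℕ)} (hf : ∀ v ∈ S, Adj4 (f v) v)
    {x y : ℕ × ℕ} (h : Rch Adj8 S x y) (hk : x.2 + k ≤ y.2) :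
    ∃ F ∈ EL (k + 1) y, F.card = k + 1 ∧ ∀ e ∈ F, e.2 ∈ S ∧ e.1 = f e.2 := by
  classical
  induction k generalizing S y with
  | zero =>
    refine ⟨{(f y, y)}, ?_, by simp, ?_⟩
    · rw [EL]
      refine Finset.mem_biUnion.2 ⟨(f y, y), Finset.mem_product.2
        ⟨mem_nb4 (hf y h.right_mem), mem_nb8 ?_⟩, ?_⟩
      · simp [Adj8]
      · simp [EL]
    · intro e he
      rw [Finset.mem_singleton] at he
      rw [he]
      exact ⟨h.right_mem, rfl⟩
  | succ k ih =>
    have hne : x ≠ y := by rintro rfl; omega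
    obtain ⟨z, w, h1, h2, h3, h4, _⟩ := h.first_exit (C := {y}ᶜ) hne (by simp)
    rw [Set.mem_compl_iff, not_not] at h4
    obtain rfl : w = y := h4
    obtain ⟨F, hF, hc, hFS⟩ := ih (fun v hv => hf v hv.1) h1 (by have := h2.2.2.2; omega)
    refine ⟨insert (f w, w) F, ?_, ?_, ?_⟩
    · rw [EL]
      exact Finset.mem_biUnion.2 ⟨(f w, z), Finset.mem_product.2
        ⟨mem_nb4 (hf w h3), mem_nb8 h2⟩, Finset.mem_image_of_mem _ hF⟩
    · rw [Finset.card_insert_of_notMem, hc]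
      intro hm
      exact (hFS _ hm).1.2 rfl
    · intro e he
      rcases Finset.mem_insert.1 he with rfl | he
      · exact ⟨h3, rfl⟩
      · exact ⟨(hFS e he).1.1, (hFS e he).2⟩

end

section

section macroscopic

variable {d : ℕ}

/-- The lattice point associated with a macroscopic point. -/
def ctr (d n : ℕ) (v : ℕ × ℕ) : V d := fun i => if i.val = 0 then n * v.1 else if i.val = 1 then n * v.2 else 0

/-- The macroscopic point `v` is seeded in `C`. -/
def Sd (m n : ℕ) (v : ℕ × ℕ) (C : Set (V d)) : Prop := ∃ b, dinf b (ctr d n v) ≤ n ∧ Bx b m ⊆ C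

theorem ctr_step (hd : 2 ≤ d) (n : ℕ) {u v : ℕ × ℕ} (h : Adj4 u v) :
    ∃ (i : Fin d) (s : ℤˣ), ctr d n v i - ctr d n u i = s * n ∧
      ∀ j, j ≠ i → ctr d n v j = ctr d n u j := by
  have h0 : 0 < d := by omega
  have h1 : 1 < d := by omega
  have hne : ∀ {a : ℕ} (ha : a < d) {j : Fin d}, j ≠ ⟨a, ha⟩ → j.val ≠ a :=
    fun ha j hj hc => hj (Fin.ext hc)
  rcases h with ⟨e1, e2 | e2⟩ | ⟨e1, e2 | e2⟩
  · refine ⟨⟨1, h1⟩, -1, ?_, fun j hj => ?_⟩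
    · simp [ctr, e2]; ring
    · simp [ctr, e1, hne h1 hj]
  · refine ⟨⟨1, h1⟩, 1, ?_, fun j hj => ?_⟩
    · simp [ctr, e2]; ring
    · simp [ctr, e1, hne h1 hj]
  · refine ⟨⟨0, h0⟩, -1, ?_, fun j hj => ?_⟩
    · simp [ctr, e2]; ring
    · simp [ctr, e1, hne h0 hj]
  · refine ⟨⟨0, h0⟩, 1, ?_, fun j hj => ?_⟩
    · simp [ctr, e2]; ring
    · simp [ctr, e1, hne h0 hj]

theorem exists_steering (hd : 2 ≤ d) {n : ℕ} {u v : ℕ × ℕ} (h : Adj4 u v) {b : V d}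
    (hb : dinf b (ctr d n u) ≤ n) :
    ∃ i σ, ∀ y ∈ Sph b n ∩ Face b n i σ, dinf y (ctr d n v) ≤ n := by
  obtain ⟨i, s, h1, h2⟩ := ctr_step hd n h
  refine ⟨i, fun j => if j = i then s else if b j ≤ ctr d n u j then 1 else -1, ?_⟩
  rintro y ⟨hy1, hy2, hy3⟩
  rw [dinf_le_iff] at *
  intro j
  have hbj := hb j
  have hyj : (b j - y j).natAbs ≤ n := hy1 ▸ natAbs_le_dinf b y j
  have hy4 := hy3 j
  by_cases hj : j = i
  · subst hj
    beta_reduce at hy2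
    rw [if_pos rfl] at hy2
    have hs : (s : ℤ) * s = 1 := by rw [← Units.val_mul, Int.units_mul_self, Units.val_one]
    have : y j - b j = s * n := by rw [← hy2, ← mul_assoc, hs, one_mul]
    omega
  · simp only [if_neg hj] at hy4
    rw [h2 j hj]
    split_ifs at hy4
    · simp only [Units.val_one, one_mul] at hy4
      omega
    · simp only [Units.val_neg, Units.val_one] at hy4
      omega

open Classical in
theorem run_subset {M : Type*} {G : M × M → Set (V d)} {base Λ : Set (V d)} {Ed : Finset (M × M)}
    {sd : M → Set (V d) → Prop} (Y : Set (V d ⊕ ((M × M) × Bool) × V d)) (k : ℕ)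
    {A : Finset (M × M)} (hA : A ⊆ Ed) : run G base Λ Ed sd Y k A ⊆ Ed := by
  induction k generalizing A with
  | zero => exact hA
  | succ k ih =>
    unfold run
    split
    · exact hA
    · rename_i e he
      exact ih (Finset.insert_subset (nextE_some he).1 hA)

variable {ι : Type*}

theorem loc_StepEv (ρ m n : ℕ) (b : V d) (F C : Set (V d)) (i₁ i₂ : ι) :
    Loc (Sum.inl '' (Bx b (2 * n) \ Nb ρ C) ∪ Sum.inr '' (({i₁, i₂} : Set ι) ×ˢ Bx b (2 * n)))
      (StepEv ρ m n b F C i₁ i₂) := by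
  intro Y Y' h hY
  have key : C ∪ (((Xf Y \ Nb ρ C) ∪ Fd i₁ Y ∪ Fd i₂ Y) ∩ Bx b (2 * n)) =
      C ∪ (((Xf Y' \ Nb ρ C) ∪ Fd i₁ Y' ∪ Fd i₂ Y') ∩ Bx b (2 * n)) := by
    ext x
    refine or_congr_right (and_congr_left fun hx => or_congr (or_congr
      (and_congr_left fun hN => ?_) ?_) ?_)
    · exact mem_inter_congr h (.inl ⟨x, ⟨hx, hN⟩, rfl⟩)
    · exact mem_inter_congr h (.inr ⟨(i₁, x), ⟨.inl rfl, hx⟩, rfl⟩)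
    · exact mem_inter_congr h (.inr ⟨(i₂, x), ⟨.inr rfl, hx⟩, rfl⟩)
  unfold StepEv at *
  rw [Set.mem_ofPred_eq] at *
  rwa [← key]

/-- The total sprinkled set. -/
def Zs (n : ℕ) (Y : Set (V d ⊕ (((ℕ × ℕ) × (ℕ × ℕ)) × Bool) × V d)) : Set (V d) :=
  ⋃ e ∈ {e : (ℕ × ℕ) × (ℕ × ℕ) | Adj4 e.1 e.2},
    (Fd (e, false) Y ∪ Fd (e, true) Y) ∩ Bx (ctr d n e.1) (3 * n)

variable {Q : Measure (Set (V d ⊕ (((ℕ × ℕ) × (ℕ × ℕ)) × Bool) × V d))} {μ : Measure (Set (V d))}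
  {ℓ : ℕ} {c t : ℝ}

open Classical in
/-- The sprinkled cluster of a wired box crosses a long strip. -/
theorem Ext.crossing (h : Ext Q μ ℓ c t) (hμ : Good μ ℓ c) (hd : 2 ≤ d) {θ : ℝ} (hθ : 0 < θ)
    (hA : ∀ n, θ ≤ μ.real (Arm (0 : V d) 0 n)) :
    ∃ m n, 0 < n ∧ ∀ N K u, n * K + m ≤ u →
      Q.real {Y | ∃ x ∈ Bx (0 : V d) u, ∃ y, n * N ≤ dinf 0 y + n ∧
        Cn (Xf Y ∪ Bx 0 u ∪ Zs n Y) x y}ᶜ ≤ (N + 1) * (1 / 2) ^ (K + 1) := by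
  have := h.prob
  obtain ⟨m, hm, hm'⟩ := h.step hμ (by omega) hθ hA (show (0 : ℝ) < 1 / 72 by norm_num) (ℓ + 1)
  obtain ⟨n, hn, hstep⟩ := hm' 1
  refine ⟨m, n, hn, fun N K u hu => ?_⟩
  set Ed : Finset ((ℕ × ℕ) × (ℕ × ℕ)) :=
    ((Finset.range (N + 1) ×ˢ Finset.range (K + 1)) ×ˢ
      (Finset.range (N + 1) ×ˢ Finset.range (K + 1))).filter fun e => Adj4 e.1 e.2 with hEd
  have mem_Ed : ∀ p q : ℕ × ℕ, p.1 ≤ N → p.2 ≤ K → q.1 ≤ N → q.2 ≤ K → Adj4 p q → (p, q) ∈ Ed := by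
    intro p q h1 h2 h3 h4 h5
    simp only [hEd, Finset.mem_filter, Finset.mem_product, Finset.mem_range]
    exact ⟨⟨⟨by omega, by omega⟩, by omega, by omega⟩, h5⟩
  set G : (ℕ × ℕ) × (ℕ × ℕ) → Set (V d) := fun e => Bx (ctr d n e.1) (3 * n) with hG
  set base := Bx (0 : V d) u with hbase
  set Λ : Set (V d) := base ∪ ⋃ e ∈ Ed, G e with hΛ
  have hΛf : Λ.Finite := (finite_Bx _ _).union (Ed.finite_toSet.biUnion fun e _ => finite_Bx _ _)
  have hb : base ⊆ Λ := Set.subset_union_left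
  have hsd : ∀ v (C C' : Set (V d)), C ⊆ C' → Sd m n v C → Sd m n v C' :=
    fun v C C' hC ⟨b, h1, h2⟩ => ⟨b, h1, h2.trans hC⟩
  have hst : ∀ e ∈ Ed, ∀ C, base ⊆ C → Sd m n e.1 C →
      ∃ (T : Set (V d ⊕ (((ℕ × ℕ) × (ℕ × ℕ)) × Bool) × V d)) (B : _),
      T.Finite ∧ Loc T B ∧ (∀ x, Sum.inl x ∈ T → x ∉ Nb (ℓ + 1) C) ∧
      (∀ p, Sum.inr p ∈ T → p.1.1 = e) ∧ Q.real Bᶜ ≤ 1 / 72 ∧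
      ∀ Y ∈ B, ∀ A, e ∈ A → C ⊆ Clu G base Λ A Y → Sd m n e.2 (Clu G base Λ A Y) := by
    rintro e he C _ ⟨b, hb1, hb2⟩
    have hee : Adj4 e.1 e.2 := (Finset.mem_filter.1 he).2
    obtain ⟨i, σ, hσ⟩ := exists_steering hd hee hb1
    refine ⟨_, _, ?_, loc_StepEv (ℓ + 1) m n b (Face b n i σ) C (e, false) (e, true), ?_, ?_,
      hstep b i σ C (e, false) (e, true) hb2 (by simp), ?_⟩
    · exact (((finite_Bx _ _).subset Set.sdiff_subset).image _).union
        ((((Set.finite_singleton _).insert _).prod (finite_Bx _ _)).image _)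
    · rintro x (⟨x', hx', h'⟩ | ⟨_, _, h'⟩)
      · rw [Sum.inl.injEq] at h'
        exact h' ▸ hx'.2
      · exact absurd h' (by simp)
    · rintro p (⟨_, _, h'⟩ | ⟨p', ⟨hp', _⟩, h'⟩)
      · exact absurd h' (by simp)
      · rw [Sum.inr.injEq] at h'
        subst h'
        rcases hp' with hp' | hp'
        · rw [hp']
        · rw [Set.mem_singleton_iff] at hp'
          rw [hp']
    · rintro Y ⟨y, hy, x, hxC, hxy⟩ A heA hCA
      refine ⟨y, hσ y hy, fun v hv => ?_⟩
      obtain ⟨z, hz, hzx⟩ := hCA hxC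
      refine ⟨z, hz, hzx.trans ((hxy v hv).mono ?_)⟩
      have hsub : Bx b (2 * n) ⊆ G e := Bx_subset (by rw [dinf_comm]; omega)
      have hGL : G e ⊆ Λ := (Set.subset_biUnion_of_mem (u := G) (show e ∈ (Ed : Set _) from he)).trans
        Set.subset_union_right
      rintro w (hw | ⟨hw, hwb⟩)
      · obtain ⟨z', _, hz'⟩ := hCA hw
        exact hz'.right_mem
      · refine ⟨?_, hGL (hsub hwb)⟩
        rcases hw with (hw | hw) | hw
        · exact .inl (.inl hw.1)
        · exact .inr (Set.mem_iUnion₂.2 ⟨e, heA, .inl hw, hsub hwb⟩)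
        · exact .inr (Set.mem_iUnion₂.2 ⟨e, heA, .inr hw, hsub hwb⟩)
  have hall := fun F => h.explore_all (G := G) hb hΛf (Nat.lt_succ_self ℓ) (by norm_num) hsd hst F
    Ed.card
  set W : Finset ((ℕ × ℕ) × (ℕ × ℕ)) → Set (Set (V d ⊕ (((ℕ × ℕ) × (ℕ × ℕ)) × Bool) × V d)) :=
    fun F => {Y | F ⊆ run G base Λ Ed (Sd m n) Y Ed.card ∅ ∧
      ∀ e ∈ F, ¬ Sd m n e.2 (Clu G base Λ (run G base Λ Ed (Sd m n) Y Ed.card ∅) Y)} with hW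
  set PF : ℕ → Finset (Finset ((ℕ × ℕ) × (ℕ × ℕ))) :=
    fun a => (EL (K + 1) (a, K)).filter fun F => F.card = K + 1 with hPF
  refine (measureReal_mono (s₂ := ⋃ a ∈ Finset.range (N + 1), ⋃ F ∈ PF a, W F) ?_
    (measure_ne_top _ _)).trans ?_
  · intro Y hY
    rw [Set.mem_compl_iff, Set.mem_ofPred_eq] at hY
    set A := run G base Λ Ed (Sd m n) Y Ed.card ∅ with hAdef
    set C := Clu G base Λ A Y with hC
    have hhalt : nextE Ed (Sd m n) A C = none := run_halts Y Ed.card ∅ (by simp)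
    have hReg : Reg G base Λ A Y ⊆ Xf Y ∪ Bx 0 u ∪ Zs n Y := by
      rintro x ⟨(hx | hx), _⟩
      · exact .inl hx
      · obtain ⟨e, he, hx⟩ := Set.mem_iUnion₂.1 hx
        refine .inr (Set.mem_iUnion₂.2 ⟨e, ?_, hx⟩)
        exact (Finset.mem_filter.1 (run_subset Y Ed.card (Finset.empty_subset _) he)).2
    have hs0 : ∀ j ≤ K, Sd m n (0, j) C := by
      intro j hj
      refine ⟨ctr d n (0, j), by simp, (Bx_subset (x := 0) (m := u) ?_).trans (base_subset_Clu hb)⟩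
      have : dinf 0 (ctr d n (0, j)) ≤ n * K := by
        rw [dinf_le_iff]
        intro i
        have : n * j ≤ n * K := Nat.mul_le_mul_left n hj
        simp only [ctr]
        split_ifs
        · simp
        · simp [Int.natAbs_mul]; exact this
        · simp
      omega
    have hsN : ∀ j ≤ K, ¬ Sd m n (N, j) C := by
      rintro j _ ⟨b, hb1, hb2⟩
      obtain ⟨x, hx, hxb⟩ := hb2 (self_mem_Bx b m)
      refine hY ⟨x, hx, b, ?_, hxb.mono hReg⟩
      have h1 := dinf_triangle 0 b (ctr d n (N, j))
      have h2 := natAbs_le_dinf 0 (ctr d n (N, j)) ⟨0, by omega⟩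
      simp [ctr, Int.natAbs_mul] at h2
      omega
    obtain ⟨x, y, hx, hy, hxy⟩ := exists_dual_path N K (fun v => Sd m n v C) hs0 hsN
    choose! f hf1 hf2 hf3 hf4 using fun v (hv : v ∈ DualBd N K (fun v => Sd m n v C)) => hv.2.2.2
    obtain ⟨F, hF1, hF2, hF3⟩ := exists_EL K hf3 hxy (by omega)
    refine Set.mem_iUnion₂.2 ⟨y.1, Finset.mem_range.2 (Nat.lt_succ_of_le hxy.right_mem.1),
      Set.mem_iUnion₂.2 ⟨F, ?_, fun e he => ?_, fun e he => (hF3 e he).1.2.2.1⟩⟩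
    · rw [hPF, ← hy]
      exact Finset.mem_filter.2 ⟨by rw [hy]; simpa [← hy] using hF1, by rw [hF2, hy]⟩
    · obtain ⟨q1, q2⟩ := hF3 e he
      have e1 : e = (f e.2, e.2) := Prod.ext q2 rfl
      refine nextE_none hhalt ?_ ?_ q1.2.2.1
      · rw [e1]
        exact mem_Ed _ _ (hf1 _ q1) (hf2 _ q1) q1.1 q1.2.1 (hf3 _ q1)
      · rw [q2]; exact hf4 _ q1
  · refine (measureReal_biUnion_finset_le _ _).trans ?_
    have hone : ∀ a ∈ Finset.range (N + 1), Q.real (⋃ F ∈ PF a, W F) ≤ (1 / 2) ^ (K + 1) := by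
      intro a _
      refine (measureReal_biUnion_finset_le _ _).trans ((Finset.sum_le_card_nsmul _ _
        ((1 / 72 : ℝ) ^ (K + 1)) fun F hF => ?_).trans ?_)
      · have := hall F
        rwa [(Finset.mem_filter.1 hF).2] at this
      · have h1 : ((PF a).card : ℝ) ≤ 36 ^ (K + 1) := by
          exact_mod_cast (Finset.card_filter_le _ _).trans (card_EL (K + 1) (a, K))
        rw [nsmul_eq_mul]
        refine (mul_le_mul_of_nonneg_right h1 (by positivity)).trans_eq ?_
        rw [← mul_pow]
        norm_num
    refine (Finset.sum_le_card_nsmul _ _ _ hone).trans_eq ?_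
    simp

end macroscopic

end

section

section product

variable {K : Type*}

/-- The event depends only on the coordinates in `s`. -/
def DepOn (s : Finset K) (A : Set (K → ℝ)) : Prop :=
  ∀ ω ω' : K → ℝ, (∀ k ∈ s, ω k = ω' k) → ω ∈ A → ω' ∈ A

variable {s t : Finset K} {A B : Set (K → ℝ)}

theorem DepOn.mono (h : DepOn s A) (hst : s ⊆ t) : DepOn t A := fun ω ω' hω =>
  h ω ω' fun k hk => hω k (hst hk)

theorem DepOn.inter (h : DepOn s A) (h' : DepOn s B) : DepOn s (A ∩ B) := fun ω ω' hω hA =>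
  ⟨h ω ω' hω hA.1, h' ω ω' hω hA.2⟩

theorem DepOn.compl (h : DepOn s A) : DepOn s Aᶜ := fun ω ω' hω hA hA' =>
  hA (h ω' ω (fun k hk => (hω k hk).symm) hA')

theorem DepOn.mem_iff (h : DepOn s A) {ω ω' : K → ℝ} (hω : ∀ k ∈ s, ω k = ω' k) :
    ω ∈ A ↔ ω' ∈ A := ⟨h ω ω' hω, h ω' ω fun k hk => (hω k hk).symm⟩

variable {m : K → Measure ℝ} [∀ k, IsProbabilityMeasure (m k)]

theorem DepOn.exists_preimage (h : DepOn s A) (hA : MeasurableSet A) :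
    ∃ A' : Set (s → ℝ), MeasurableSet A' ∧ A = (fun ω (i : s) => ω i) ⁻¹' A' := by
  classical
  let ext : (s → ℝ) → K → ℝ := fun v k => if hk : k ∈ s then v ⟨k, hk⟩ else 0
  have hm : Measurable ext := by
    refine measurable_pi_lambda _ fun k => ?_
    by_cases hk : k ∈ s
    · simp only [ext, hk, dif_pos]; exact measurable_pi_apply _
    · simp only [ext, hk, dif_neg, not_false_eq_true]; exact measurable_const
  refine ⟨ext ⁻¹' A, hm hA, ?_⟩
  ext ω
  refine h.mem_iff fun k hk => ?_
  simp [ext, hk]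

theorem DepOn.indep (hs : DepOn s A) (ht : DepOn t B) (hst : Disjoint s t)
    (hA : MeasurableSet A) (hB : MeasurableSet B) :
    (Measure.infinitePi m).real (A ∩ B) =
      (Measure.infinitePi m).real A * (Measure.infinitePi m).real B := by
  obtain ⟨A', hA', rfl⟩ := hs.exists_preimage hA
  obtain ⟨B', hB', rfl⟩ := ht.exists_preimage hB
  have h1 : iIndepFun (fun (i : K) (ω : K → ℝ) => ω i) (Measure.infinitePi m) :=
    iIndepFun_infinitePi (P := m) (X := fun _ x => x) fun _ => measurable_id
  have h2 := h1.indepFun_finset s t hst fun i => measurable_pi_apply i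
  have := h2.measure_inter_preimage_eq_mul A' B' hA' hB'
  simp only [measureReal_def, ← ENNReal.toReal_mul]
  rw [this]

theorem depOn_biInter {J : Type*} [DecidableEq K] {D : Finset J} {N : J → Finset K}
    {F : J → Set (K → ℝ)}
    (h : ∀ j ∈ D, DepOn (N j) (F j)) : DepOn (D.biUnion N) (⋂ j ∈ D, F j) := by
  intro ω ω' hω hF
  simp only [mem_iInter] at hF ⊢
  exact fun j hj => h j hj ω ω' (fun k hk => hω k (Finset.mem_biUnion.2 ⟨j, hj, hk⟩)) (hF j hj)

theorem indep_biInter {J : Type*} {D : Finset J} {N : J → Finset K}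
    {F : J → Set (K → ℝ)} (hF : ∀ j ∈ D, MeasurableSet (F j)) (h : ∀ j ∈ D, DepOn (N j) (F j))
    (hN : ∀ i ∈ D, ∀ j ∈ D, i ≠ j → Disjoint (N i) (N j)) :
    (Measure.infinitePi m).real (⋂ j ∈ D, F j) = ∏ j ∈ D, (Measure.infinitePi m).real (F j) := by
  classical
  induction D using Finset.induction_on with
  | empty => simp
  | insert a D ha ih =>
    rw [Finset.set_biInter_insert, Finset.prod_insert ha, ← ih
      (fun j hj => hF j (Finset.mem_insert_of_mem hj))
      (fun j hj => h j (Finset.mem_insert_of_mem hj))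
      (fun i hi j hj => hN i (Finset.mem_insert_of_mem hi) j (Finset.mem_insert_of_mem hj))]
    refine (h a (Finset.mem_insert_self _ _)).indep
      (depOn_biInter fun j hj => h j (Finset.mem_insert_of_mem hj)) ?_
      (hF a (Finset.mem_insert_self _ _))
      (Finset.measurableSet_biInter _ fun j hj => hF j (Finset.mem_insert_of_mem hj))
    rw [Finset.disjoint_biUnion_right]
    exact fun j hj => hN a (Finset.mem_insert_self _ _) j (Finset.mem_insert_of_mem hj)
      fun e => ha (e ▸ hj)

variable [DecidableEq K]

theorem measurable_updateAt (i : K) :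
    Measurable fun p : (K → ℝ) × ℝ => Function.update p.1 i p.2 := by
  refine measurable_pi_lambda _ fun k => ?_
  by_cases hk : k = i
  · subst hk; simpa using measurable_snd
  · simp only [Function.update_of_ne hk]
    exact (measurable_pi_apply k).comp measurable_fst

/-- Resampling one coordinate preserves the product measure. -/
theorem map_update (i : K) :
    ((Measure.infinitePi m).prod (m i)).map (fun p => Function.update p.1 i p.2) =
      Measure.infinitePi m := by
  refine Measure.eq_infinitePi _ fun s t ht => ?_
  rw [Measure.map_apply (measurable_updateAt i)
    (MeasurableSet.pi s.countable_toSet fun k _ => ht k)]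
  have : (fun p : (K → ℝ) × ℝ => Function.update p.1 i p.2) ⁻¹' Set.pi s t =
      (Set.pi (s.erase i : Finset K) t) ×ˢ (if i ∈ s then t i else univ) := by
    ext p
    simp only [mem_preimage, Set.mem_pi, mem_prod, Finset.mem_coe, Finset.mem_erase]
    constructor
    · intro h
      refine ⟨fun k hk => by simpa [Function.update_of_ne hk.1] using h k hk.2, ?_⟩
      split_ifs with hi
      · simpa using h i hi
      · trivial
    · rintro ⟨h1, h2⟩ k hk
      by_cases hki : k = i
      · subst hki; simpa [hk] using h2
      · simpa [Function.update_of_ne hki] using h1 k ⟨hki, hk⟩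
  rw [this, Measure.prod_prod, Measure.infinitePi_pi _ (fun k _ => ht k)]
  split_ifs with hi
  · exact Finset.prod_erase_mul _ _ hi
  · rw [measure_univ, mul_one, Finset.erase_eq_of_notMem hi]

/-- Averaging over one coordinate. -/
noncomputable def avg (m : K → Measure ℝ) (i : K) (f : (K → ℝ) → ℝ) (ω : K → ℝ) : ℝ :=
  ∫ e, f (Function.update ω i e) ∂(m i)

theorem measurable_avg (i : K) {f : (K → ℝ) → ℝ} (hf : Measurable f) :
    Measurable (avg m i f) := by
  have : StronglyMeasurable (fun p : (K → ℝ) × ℝ => f (Function.update p.1 i p.2)) :=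
    (hf.comp (measurable_updateAt i)).stronglyMeasurable
  exact this.integral_prod_right.measurable

theorem measurable_update_right (i : K) (ω : K → ℝ) :
    Measurable fun e : ℝ => Function.update ω i e :=
  (measurable_updateAt i).comp measurable_prodMk_left

theorem integrable_of_unit {Ω : Type*} [MeasurableSpace Ω] {ν : Measure Ω} [IsFiniteMeasure ν]
    {f : Ω → ℝ} (hf : Measurable f) (h0 : ∀ ω, 0 ≤ f ω) (h1 : ∀ ω, f ω ≤ 1) : Integrable f ν :=
  Integrable.of_bound hf.aestronglyMeasurable 1
    (ae_of_all _ fun ω => by rw [Real.norm_eq_abs, abs_of_nonneg (h0 ω)]; exact h1 ω)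

theorem integral_avg (i : K) {f : (K → ℝ) → ℝ} (hf : Measurable f) (h0 : ∀ ω, 0 ≤ f ω)
    (h1 : ∀ ω, f ω ≤ 1) :
    ∫ ω, avg m i f ω ∂(Measure.infinitePi m) = ∫ ω, f ω ∂(Measure.infinitePi m) := by
  conv_rhs => rw [← map_update (m := m) i]
  rw [integral_map (measurable_updateAt i).aemeasurable hf.aestronglyMeasurable,
    integral_prod (fun p : (K → ℝ) × ℝ => f (Function.update p.1 i p.2))
      (integrable_of_unit (hf.comp (measurable_updateAt i)) (fun _ => h0 _) fun _ => h1 _)]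
  rfl

/-- Chebyshev's association inequality on the line. -/
theorem chebyshev_assoc {ν : Measure ℝ} [IsProbabilityMeasure ν] {f g : ℝ → ℝ} (hf : Measurable f)
    (hg : Measurable g) (f0 : ∀ x, 0 ≤ f x) (f1 : ∀ x, f x ≤ 1) (g0 : ∀ x, 0 ≤ g x)
    (g1 : ∀ x, g x ≤ 1) (hfa : Antitone f) (hga : Antitone g) :
    (∫ x, f x ∂ν) * ∫ x, g x ∂ν ≤ ∫ x, f x * g x ∂ν := by
  have hfi : Integrable f ν := integrable_of_unit hf f0 f1
  have hgi : Integrable g ν := integrable_of_unit hg g0 g1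
  have hfg : Integrable (fun x => f x * g x) ν := integrable_of_unit (hf.mul hg)
    (fun x => mul_nonneg (f0 x) (g0 x)) fun x => mul_le_one₀ (f1 x) (g0 x) (g1 x)
  have key : ∀ y, f y * ∫ x, g x ∂ν + g y * ∫ x, f x ∂ν ≤ (∫ x, f x * g x ∂ν) + f y * g y := by
    intro y
    have h : 0 ≤ ∫ x, (f x - f y) * (g x - g y) ∂ν := by
      refine integral_nonneg fun x => ?_
      rcases le_total x y with h | h
      · exact mul_nonneg (sub_nonneg.2 (hfa h)) (sub_nonneg.2 (hga h))
      · exact mul_nonneg_of_nonpos_of_nonpos (sub_nonpos.2 (hfa h)) (sub_nonpos.2 (hga h))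
    have i1 : Integrable (fun x => f x * g x - f y * g x) ν := hfg.sub (hgi.const_mul _)
    have i2 : Integrable (fun x => f x * g x - f y * g x - g y * f x) ν :=
      i1.sub (hfi.const_mul _)
    have e : ∀ x, (f x - f y) * (g x - g y) = f x * g x - f y * g x - g y * f x + f y * g y :=
      fun x => by ring
    simp only [e] at h
    rw [integral_add i2 (integrable_const _), integral_sub i1 (hfi.const_mul _),
      integral_sub hfg (hgi.const_mul _), integral_const_mul, integral_const_mul] at h
    simp at h
    linarith
  have := integral_mono (μ := ν) ((hfi.mul_const _).add (hgi.mul_const _))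
    ((integrable_const _).add hfg) key
  simp only [Pi.add_apply] at this
  rw [integral_add (hfi.mul_const _) (hgi.mul_const _), integral_mul_const, integral_mul_const,
    integral_add (integrable_const _) hfg] at this
  simp at this
  linarith [mul_comm (∫ x, f x ∂ν) (∫ x, g x ∂ν)]

theorem avg_nonneg {m : K → Measure ℝ} (i : K) {f : (K → ℝ) → ℝ} (h0 : ∀ ω, 0 ≤ f ω) (ω : K → ℝ) :
    0 ≤ avg m i f ω :=
  integral_nonneg fun _ => h0 _

theorem avg_le_one (i : K) {f : (K → ℝ) → ℝ} (hf : Measurable f) (h0 : ∀ ω, 0 ≤ f ω)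
    (h1 : ∀ ω, f ω ≤ 1) (ω : K → ℝ) : avg m i f ω ≤ 1 := by
  have := integral_mono (μ := m i) (integrable_of_unit
    (hf.comp (measurable_update_right i ω)) (fun _ => h0 _) fun _ => h1 _)
    (integrable_const (1 : ℝ)) fun _ => h1 _
  simpa [avg] using this

theorem antitone_avg (i : K) {f : (K → ℝ) → ℝ} (hf : Measurable f) (h0 : ∀ ω, 0 ≤ f ω)
    (h1 : ∀ ω, f ω ≤ 1) (hfa : Antitone f) : Antitone (avg m i f) := fun ω ω' hω =>
  integral_mono (integrable_of_unit (hf.comp (measurable_update_right i ω')) (fun _ => h0 _)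
    fun _ => h1 _) (integrable_of_unit (hf.comp (measurable_update_right i ω)) (fun _ => h0 _)
    fun _ => h1 _) fun _ => hfa (update_le_update_iff.2 ⟨le_rfl, fun k _ => hω k⟩)

/-- Harris' inequality for functions of finitely many coordinates. -/
theorem harris (s : Finset K) : ∀ {f g : (K → ℝ) → ℝ}, Measurable f → Measurable g →
    (∀ x, 0 ≤ f x) → (∀ x, f x ≤ 1) → (∀ x, 0 ≤ g x) → (∀ x, g x ≤ 1) → Antitone f → Antitone g →
    (∀ ω ω', (∀ k ∈ s, ω k = ω' k) → f ω = f ω') → (∀ ω ω', (∀ k ∈ s, ω k = ω' k) → g ω = g ω') →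
    (∫ ω, f ω ∂(Measure.infinitePi m)) * ∫ ω, g ω ∂(Measure.infinitePi m) ≤
      ∫ ω, f ω * g ω ∂(Measure.infinitePi m) := by
  induction s using Finset.induction_on with
  | empty =>
    intro f g _ _ _ _ _ _ _ _ hfs hgs
    have e1 : f = fun _ => f 0 := funext fun ω => hfs ω 0 (by simp)
    have e2 : g = fun _ => g 0 := funext fun ω => hgs ω 0 (by simp)
    rw [e1, e2]; simp
  | insert i s hi ih =>
    intro f g hf hg f0 f1 g0 g1 hfa hga hfs hgs
    have dep : ∀ {f : (K → ℝ) → ℝ}, (∀ ω ω', (∀ k ∈ insert i s, ω k = ω' k) → f ω = f ω') →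
        ∀ ω ω', (∀ k ∈ s, ω k = ω' k) → avg m i f ω = avg m i f ω' := by
      intro f hfs ω ω' h
      refine integral_congr_ae (ae_of_all _ fun e => hfs _ _ fun k hk => ?_)
      by_cases hki : k = i
      · subst hki; simp
      · simp only [Function.update_of_ne hki]
        exact h k (Finset.mem_of_mem_insert_of_ne hk hki)
    have h := ih (measurable_avg i hf) (measurable_avg i hg) (avg_nonneg (m := m) i f0)
      (avg_le_one i hf f0 f1) (avg_nonneg (m := m) i g0) (avg_le_one i hg g0 g1)
      (antitone_avg i hf f0 f1 hfa) (antitone_avg i hg g0 g1 hga) (dep hfs) (dep hgs)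
    rw [integral_avg i hf f0 f1, integral_avg i hg g0 g1] at h
    refine h.trans ?_
    have fg0 : ∀ ω, 0 ≤ f ω * g ω := fun ω => mul_nonneg (f0 ω) (g0 ω)
    have fg1 : ∀ ω, f ω * g ω ≤ 1 := fun ω => mul_le_one₀ (f1 ω) (g0 ω) (g1 ω)
    rw [← integral_avg i (f := fun ω => f ω * g ω) (hf.mul hg) fg0 fg1]
    refine integral_mono (integrable_of_unit ((measurable_avg i hf).mul (measurable_avg i hg))
      (fun ω => mul_nonneg (avg_nonneg i f0 ω) (avg_nonneg i g0 ω))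
      fun ω => mul_le_one₀ (avg_le_one i hf f0 f1 ω) (avg_nonneg i g0 ω) (avg_le_one i hg g0 g1 ω))
      (integrable_of_unit (measurable_avg i (hf.mul hg)) (avg_nonneg i fg0)
        (avg_le_one i (hf.mul hg) fg0 fg1)) fun ω => ?_
    have mono : Monotone fun e : ℝ => Function.update ω i e := fun a b hab =>
      update_le_update_iff.2 ⟨hab, fun _ _ => le_rfl⟩
    exact chebyshev_assoc (hf.comp (measurable_update_right i ω))
      (hg.comp (measurable_update_right i ω)) (fun _ => f0 _) (fun _ => f1 _) (fun _ => g0 _)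
      (fun _ => g1 _) (hfa.comp_monotone mono) (hga.comp_monotone mono)

theorem harris_events (hs : DepOn s A) (hs' : DepOn s B) (hA : MeasurableSet A)
    (hB : MeasurableSet B) (hA' : IsLowerSet A) (hB' : IsLowerSet B) :
    (Measure.infinitePi m).real A * (Measure.infinitePi m).real B ≤
      (Measure.infinitePi m).real (A ∩ B) := by
  have anti : ∀ {A : Set (K → ℝ)}, IsLowerSet A → Antitone (A.indicator (1 : (K → ℝ) → ℝ)) := by
    intro A hA ω ω' h
    by_cases h' : ω' ∈ A
    · rw [indicator_of_mem h', indicator_of_mem (hA h h')]; exact le_rfl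
    · rw [indicator_of_notMem h']
      exact indicator_nonneg (fun _ _ => zero_le_one) _
  have dep : ∀ {A : Set (K → ℝ)}, DepOn s A → ∀ ω ω', (∀ k ∈ s, ω k = ω' k) →
      A.indicator (1 : (K → ℝ) → ℝ) ω = A.indicator 1 ω' := by
    intro A hA ω ω' h
    by_cases h' : ω ∈ A
    · rw [indicator_of_mem h', indicator_of_mem ((hA.mem_iff h).1 h')]; rfl
    · rw [indicator_of_notMem h', indicator_of_notMem (fun h'' => h' ((hA.mem_iff h).2 h''))]
  have le1 : ∀ (A : Set (K → ℝ)) ω, A.indicator (1 : (K → ℝ) → ℝ) ω ≤ 1 := fun A ω =>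
    indicator_le' (fun _ _ => le_rfl) (fun _ _ => zero_le_one) ω
  have ge0 : ∀ (A : Set (K → ℝ)) ω, 0 ≤ A.indicator (1 : (K → ℝ) → ℝ) ω := fun A ω =>
    indicator_nonneg (fun _ _ => zero_le_one) ω
  have := harris (m := m) s (measurable_one.indicator hA) (measurable_one.indicator hB) (ge0 A)
    (le1 A) (ge0 B) (le1 B) (anti hA') (anti hB') (dep hs) (dep hs')
  rw [integral_indicator_one hA, integral_indicator_one hB] at this
  refine this.trans (le_of_eq ?_)
  rw [← integral_indicator_one (hA.inter hB), inter_indicator_one]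
  rfl

end product

end

section

/-- A random subset of `J` driven by independent coordinates, each site having private noise
which may force its state. -/
structure Mdl (K J : Type*) where
  /-- the site is open -/
  st : J → Set (K → ℝ)
  /-- the site is forced to be open -/
  fo : J → Set (K → ℝ)
  /-- the site is forced to be closed -/
  fc : J → Set (K → ℝ)
  /-- the coordinates read by the state -/
  N : J → Finset K
  /-- the private coordinates -/
  ν : J → Finset K
  mst : ∀ j, MeasurableSet (st j)
  mfo : ∀ j, MeasurableSet (fo j)
  mfc : ∀ j, MeasurableSet (fc j)
  dst : ∀ j, DepOn (N j) (st j)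
  dfo : ∀ j, DepOn (ν j) (fo j)
  dfc : ∀ j, DepOn (ν j) (fc j)
  fo_sub : ∀ j, fo j ⊆ st j
  fc_dis : ∀ j, Disjoint (fc j) (st j)
  ν_sub : ∀ j, ν j ⊆ N j
  dis : ∀ i j, i ≠ j → Disjoint (ν i) (N j)

/-- The two-sided pivotal event at a site. -/
def Piv {J : Type*} (A : Set (Set J)) (y : J) : Set (Set J) :=
  {X | X ∪ {y} ∈ A ∧ X \ {y} ∉ A}

theorem loc_subst {J : Type*} {S : Set J} {A : Set (Set J)} (h : Loc S A) (D w : Set J) :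
    Loc (S \ D) {X | X \ D ∪ w ∩ D ∈ A} := by
  intro X X' hX hA
  refine h _ _ ?_ hA
  ext j
  have := Set.ext_iff.1 hX j
  simp only [mem_inter_iff, Set.mem_sdiff, mem_union] at this ⊢
  tauto

theorem loc_Piv {J : Type*} {S : Set J} {A : Set (Set J)} (h : Loc S A) (y : J) :
    Loc (S \ {y}) (Piv A y) := by
  intro X X' hX hA
  have e1 : (X ∪ {y}) ∩ S = (X' ∪ {y}) ∩ S := by
    ext j
    have := Set.ext_iff.1 hX j
    simp only [mem_inter_iff, Set.mem_sdiff, mem_union, mem_singleton_iff] at this ⊢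
    tauto
  have e2 : (X \ {y}) ∩ S = (X' \ {y}) ∩ S := by
    ext j
    have := Set.ext_iff.1 hX j
    simp only [mem_inter_iff, Set.mem_sdiff, mem_singleton_iff] at this ⊢
    tauto
  exact ⟨h _ _ e1 hA.1, fun h' => hA.2 (h _ _ e2.symm h')⟩

namespace Mdl

variable {K J : Type*} (M : Mdl K J)

/-- The configuration. -/
def cf (ω : K → ℝ) : Set J := {j | ω ∈ M.st j}

theorem measurable_cf : Measurable M.cf := by
  refine measurable_set_iff.2 fun j => ?_
  exact measurable_to_prop (by simpa [preimage, cf] using M.mst j)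

theorem measurableSet_cf {S : Set J} (hS : S.Finite) {A : Set (Set J)} (h : Loc S A) :
    MeasurableSet (M.cf ⁻¹' A) := M.measurable_cf (h.measurableSet hS)

theorem depOn_cf [DecidableEq K] {S : Finset J} {A : Set (Set J)} (h : Loc (S : Set J) A) :
    DepOn (S.biUnion M.N) (M.cf ⁻¹' A) := by
  intro ω ω' hω hA
  refine h _ _ ?_ hA
  ext j
  simp only [mem_inter_iff, Finset.mem_coe, cf]
  refine and_congr_left fun hj => (M.dst j).mem_iff fun k hk => hω k ?_
  exact Finset.mem_biUnion.2 ⟨j, hj, hk⟩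

open Classical in
/-- The noise forces the pattern `w` on `D`. -/
def frc (D : Finset J) (w : Set J) : Set (K → ℝ) :=
  ⋂ j ∈ D, if j ∈ w then M.fo j else M.fc j

theorem cf_frc {D : Finset J} {w : Set J} {ω : K → ℝ} (h : ω ∈ M.frc D w) :
    M.cf ω ∩ D = w ∩ D := by
  ext j
  simp only [mem_inter_iff, Finset.mem_coe]
  refine and_congr_left fun hj => ?_
  simp only [frc, mem_iInter] at h
  have := h j hj
  split_ifs at this with hw
  · exact ⟨fun _ => hw, fun _ => M.fo_sub j this⟩
  · exact ⟨fun h' => ((M.fc_dis j).le_bot ⟨this, h'⟩).elim, fun h' => (hw h').elim⟩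

theorem measurableSet_frc (D : Finset J) (w : Set J) : MeasurableSet (M.frc D w) := by
  refine Finset.measurableSet_biInter _ fun j _ => ?_
  split_ifs
  exacts [M.mfo j, M.mfc j]

theorem depOn_frc [DecidableEq K] (D : Finset J) (w : Set J) :
    DepOn (D.biUnion M.ν) (M.frc D w) := by
  refine depOn_biInter fun j _ => ?_
  split_ifs
  exacts [M.dfo j, M.dfc j]

variable {m : K → Measure ℝ} [∀ k, IsProbabilityMeasure (m k)]

theorem frc_prob {D : Finset J} {c : ℝ} (hc : 0 ≤ c)
    (h1 : ∀ j ∈ D, c ≤ (Measure.infinitePi m).real (M.fo j))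
    (h2 : ∀ j ∈ D, c ≤ (Measure.infinitePi m).real (M.fc j)) (w : Set J) :
    c ^ D.card ≤ (Measure.infinitePi m).real (M.frc D w) := by
  classical
  rw [frc, indep_biInter (N := M.ν), ← Finset.prod_const]
  · refine Finset.prod_le_prod (fun _ _ => hc) fun j hj => ?_
    split_ifs
    exacts [h1 j hj, h2 j hj]
  · intro j _
    split_ifs
    exacts [M.mfo j, M.mfc j]
  · intro j _
    split_ifs
    exacts [M.dfo j, M.dfc j]
  · exact fun i _ j _ hij => (M.dis i j hij).mono_right (M.ν_sub j)

theorem close_prob {D : Finset J} {c : ℝ} (hc : 0 ≤ c)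
    (h2 : ∀ j ∈ D, c ≤ (Measure.infinitePi m).real (M.fc j)) :
    c ^ D.card ≤ (Measure.infinitePi m).real (M.frc D ∅) := by
  classical
  rw [frc, indep_biInter (N := M.ν), ← Finset.prod_const]
  · refine Finset.prod_le_prod (fun _ _ => hc) fun j hj => ?_
    simpa using h2 j hj
  · intro j _
    simpa using M.mfc j
  · intro j _
    simpa using M.dfc j
  · exact fun i _ j _ hij => (M.dis i j hij).mono_right (M.ν_sub j)

theorem frc_indep {B : Set (K → ℝ)} {s : Finset K} (hB : MeasurableSet B) (hs : DepOn s B)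
    {D : Finset J} (hD : ∀ j ∈ D, Disjoint s (M.ν j)) (w : Set J) :
    (Measure.infinitePi m).real (B ∩ M.frc D w) =
      (Measure.infinitePi m).real B * (Measure.infinitePi m).real (M.frc D w) := by
  classical
  exact hs.indep (M.depOn_frc D w) ((Finset.disjoint_biUnion_right _ _ _).2 hD) hB
    (M.measurableSet_frc D w)

/-- Events read on disjoint coordinate sets are independent. -/
theorem cf_indep {S T : Set J} (hS : S.Finite) (hT : T.Finite) {A B : Set (Set J)} (hA : Loc S A)
    (hB : Loc T B) (h : ∀ i ∈ S, ∀ j ∈ T, Disjoint (M.N i) (M.N j)) :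
    (Measure.infinitePi m).real (M.cf ⁻¹' A ∩ M.cf ⁻¹' B) =
      (Measure.infinitePi m).real (M.cf ⁻¹' A) * (Measure.infinitePi m).real (M.cf ⁻¹' B) := by
  classical
  obtain ⟨S, rfl⟩ := hS.exists_finset_coe
  obtain ⟨T, rfl⟩ := hT.exists_finset_coe
  refine (M.depOn_cf hA).indep (M.depOn_cf hB) ?_ (M.measurableSet_cf S.finite_toSet hA)
    (M.measurableSet_cf T.finite_toSet hB)
  rw [Finset.disjoint_biUnion_left]
  intro i hi
  rw [Finset.disjoint_biUnion_right]
  exact fun j hj => h i hi j hj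

theorem slice (D : Finset J) {G : Set (K → ℝ)} (hG : MeasurableSet G) :
    (Measure.infinitePi m).real G =
      ∑ w ∈ D.powerset, (Measure.infinitePi m).real (G ∩ {ω | M.cf ω ∩ D = w}) := by
  have hm : ∀ w : Finset J, MeasurableSet (G ∩ {ω | M.cf ω ∩ D = w}) := fun w =>
    hG.inter (M.measurable_cf (measurableSet_atom D.finite_toSet (w : Set J)))
  rw [← measureReal_biUnion_finset _ fun w _ => hm w]
  · congr 1
    ext ω
    simp only [mem_iUnion, mem_inter_iff, exists_prop]
    refine ⟨fun h => ?_, fun ⟨_, _, h, _⟩ => h⟩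
    classical
    refine ⟨D.filter (· ∈ M.cf ω), by simp, h, ?_⟩
    ext j
    simp [and_comm]
  · intro w _ w' _ hw
    refine Set.disjoint_left.2 fun ω h1 h2 => hw ?_
    exact Finset.coe_injective (h1.2.symm.trans h2.2)

/-- Forcing the noise on `D`, jointly with an event `E` which the rest does not see. -/
theorem force_le [DecidableEq K] {S : Set J} (hS : S.Finite) {A : Set (Set J)} (hA : Loc S A)
    {D : Finset J} {c : ℝ} (hc : 0 ≤ c)
    (h1 : ∀ j ∈ D, c ≤ (Measure.infinitePi m).real (M.fo j))
    (h2 : ∀ j ∈ D, c ≤ (Measure.infinitePi m).real (M.fc j)) (w : Set J) {E : Set (K → ℝ)}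
    {e : Finset K} (hE : MeasurableSet E) (he : DepOn e E) (heD : ∀ j ∈ D, Disjoint e (M.ν j))
    (heS : ∀ j ∈ S \ D, Disjoint e (M.N j)) :
    (Measure.infinitePi m).real E * c ^ D.card *
        (Measure.infinitePi m).real (M.cf ⁻¹' {X | X \ D ∪ w ∩ D ∈ A}) ≤
      (Measure.infinitePi m).real (E ∩ M.cf ⁻¹' A ∩ {ω | M.cf ω ∩ D = w ∩ D}) := by
  classical
  have hSD : (S \ D).Finite := hS.subset Set.sdiff_subset
  obtain ⟨T, hT⟩ := hSD.exists_finset_coe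
  have hloc : Loc (T : Set J) {X | X \ D ∪ w ∩ D ∈ A} := hT ▸ loc_subst hA D w
  have hm := M.measurableSet_cf T.finite_toSet hloc
  have hd := M.depOn_cf hloc
  have hTD : ∀ i ∈ T, ∀ j ∈ D, i ≠ j := by
    rintro i hi j hj rfl
    exact (hT ▸ Finset.mem_coe.2 hi : i ∈ S \ (D : Set J)).2 hj
  have i1 := he.indep hd (by
    rw [Finset.disjoint_biUnion_right]
    exact fun j hj => heS j (hT ▸ Finset.mem_coe.2 hj)) hE hm (m := m)
  have i2 := M.frc_indep (m := m) (hE.inter hm)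
    ((he.mono Finset.subset_union_left).inter (hd.mono Finset.subset_union_right)) (D := D) (by
      intro j hj
      rw [Finset.disjoint_union_left, Finset.disjoint_biUnion_left]
      exact ⟨heD j hj, fun i hi => (M.dis j i (hTD i hi j hj).symm).symm⟩) w
  calc _ = (Measure.infinitePi m).real E *
        (Measure.infinitePi m).real (M.cf ⁻¹' {X | X \ D ∪ w ∩ D ∈ A}) * c ^ D.card := by ring
    _ ≤ (Measure.infinitePi m).real E *
        (Measure.infinitePi m).real (M.cf ⁻¹' {X | X \ D ∪ w ∩ D ∈ A}) *
          (Measure.infinitePi m).real (M.frc D w) :=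
        mul_le_mul_of_nonneg_left (M.frc_prob hc h1 h2 w) (by positivity)
    _ ≤ _ := by
        rw [← i1, ← i2]
        refine measureReal_mono ?_ (measure_ne_top _ _)
        rintro ω ⟨⟨h, h'⟩, h''⟩
        have h3 := M.cf_frc h''
        refine ⟨⟨h, ?_⟩, h3⟩
        have h4 : M.cf ω \ D ∪ w ∩ D = M.cf ω := by
          rw [← h3]; exact Set.sdiff_union_inter _ _
        have h5 : M.cf ω \ D ∪ w ∩ D ∈ A := h'
        rwa [h4] at h5

/-- Conditional finite energy. -/
theorem finite_energy [DecidableEq K] {S : Set J} (hS : S.Finite) {A : Set (Set J)} (hA : Loc S A)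
    {D : Finset J} {c : ℝ} (hc : 0 ≤ c)
    (h1 : ∀ j ∈ D, c ≤ (Measure.infinitePi m).real (M.fo j))
    (h2 : ∀ j ∈ D, c ≤ (Measure.infinitePi m).real (M.fc j)) {E : Set (K → ℝ)}
    {e : Finset K} (hE : MeasurableSet E) (he : DepOn e E) (heD : ∀ j ∈ D, Disjoint e (M.ν j))
    (heS : ∀ j ∈ S \ D, Disjoint e (M.N j)) :
    (Measure.infinitePi m).real E * c ^ D.card * (Measure.infinitePi m).real (M.cf ⁻¹' A) ≤
      (Measure.infinitePi m).real (E ∩ M.cf ⁻¹' A) := by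
  rw [M.slice D (hE.inter (M.measurableSet_cf hS hA)), M.slice D (M.measurableSet_cf hS hA),
    Finset.mul_sum]
  refine Finset.sum_le_sum fun w hw => ?_
  have hwD : (w : Set J) ∩ D = w := inter_eq_left.2 (Finset.coe_subset.2 (Finset.mem_powerset.1 hw))
  have := M.force_le hS hA hc h1 h2 w hE he heD heS
  rw [hwD] at this
  refine le_trans (mul_le_mul_of_nonneg_left (measureReal_mono ?_ (measure_ne_top _ _))
    (by positivity)) this
  rintro ω ⟨h, h'⟩
  have h3 : M.cf ω ∩ D = w := h'
  change M.cf ω \ D ∪ w ∈ A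
  rw [← h3, Set.sdiff_union_inter]
  exact h

/-- Joint pivotality of a finite set is controlled by pivotality of its points. -/
theorem joint_piv {S : Set J} (hS : S.Finite) {A : Set (Set J)} (hA : Loc S A)
    {D : Finset J} {c : ℝ} (hc : 0 ≤ c)
    (h1 : ∀ j ∈ D, c ≤ (Measure.infinitePi m).real (M.fo j))
    (h2 : ∀ j ∈ D, c ≤ (Measure.infinitePi m).real (M.fc j)) :
    c ^ D.card * (Measure.infinitePi m).real (M.cf ⁻¹' {X | X ∪ D ∈ A ∧ X \ D ∉ A}) ≤
      ∑ y ∈ D, (Measure.infinitePi m).real (M.cf ⁻¹' Piv A y) := by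
  classical
  have hsub : M.cf ⁻¹' {X | X ∪ D ∈ A ∧ X \ D ∉ A} ⊆
      ⋃ y ∈ D, ⋃ w ∈ D.powerset, M.cf ⁻¹' {X | X \ D ∪ w ∩ D ∈ Piv A y} := by
    rintro ω ⟨ha, hb⟩
    set X := M.cf ω
    have hne : (D.powerset.filter fun w : Finset J => X \ D ∪ w ∈ A).Nonempty :=
      ⟨D, by simpa using ha⟩
    obtain ⟨w, hw, hmin⟩ := Finset.exists_min_image _ Finset.card hne
    simp only [Finset.mem_filter, Finset.mem_powerset] at hw hmin
    have hwne : w.Nonempty := by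
      by_contra h
      rw [Finset.not_nonempty_iff_eq_empty] at h
      subst h
      simp only [Finset.coe_empty, union_empty] at hw
      exact hb hw.2
    obtain ⟨y, hy⟩ := hwne
    simp only [mem_iUnion, exists_prop]
    refine ⟨y, hw.1 hy, w, Finset.mem_powerset.2 hw.1, ?_⟩
    have hwD : (w : Set J) ∩ D = w := inter_eq_left.2 (Finset.coe_subset.2 hw.1)
    change X \ D ∪ w ∩ D ∈ Piv A y
    rw [hwD]
    refine ⟨?_, fun h => ?_⟩
    · rw [union_eq_left.2]
      · exact hw.2
      · simpa using Or.inr hy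
    · have e : (X \ D ∪ w) \ {y} = X \ D ∪ (w.erase y : Finset J) := by
        ext j
        simp only [Set.mem_sdiff, mem_union, mem_singleton_iff, Finset.mem_coe, Finset.mem_erase]
        constructor
        · rintro ⟨h | h, h'⟩
          · exact Or.inl h
          · exact Or.inr ⟨h', h⟩
        · rintro (h | h)
          · exact ⟨Or.inl h, fun e => h.2 (e ▸ hw.1 hy)⟩
          · exact ⟨Or.inr h.2, h.1⟩
      rw [e] at h
      have := hmin _ ⟨(Finset.erase_subset _ _).trans hw.1, h⟩
      exact absurd this (not_le.2 (Finset.card_erase_lt_of_mem hy))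
  calc _ ≤ c ^ D.card * ∑ y ∈ D, ∑ w ∈ D.powerset,
        (Measure.infinitePi m).real (M.cf ⁻¹' {X | X \ D ∪ w ∩ D ∈ Piv A y}) := by
        refine mul_le_mul_of_nonneg_left ?_ (by positivity)
        refine (measureReal_mono hsub (measure_ne_top _ _)).trans ?_
        refine (measureReal_biUnion_finset_le _ _).trans (Finset.sum_le_sum fun y _ => ?_)
        exact measureReal_biUnion_finset_le _ _
    _ ≤ _ := by
        rw [Finset.mul_sum]
        refine Finset.sum_le_sum fun y _ => ?_
        rw [M.slice D (M.measurableSet_cf hS ((loc_Piv hA y).mono Set.sdiff_subset)),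
          Finset.mul_sum]
        refine Finset.sum_le_sum fun w hw => ?_
        have hwD : (w : Set J) ∩ D = w :=
          inter_eq_left.2 (Finset.coe_subset.2 (Finset.mem_powerset.1 hw))
        have := M.force_le (m := m) hS ((loc_Piv hA y).mono Set.sdiff_subset) hc h1 h2 w
          MeasurableSet.univ (e := ∅) (fun _ _ _ _ => trivial) (by simp) (by simp)
        rw [hwD] at this
        simpa [hwD] using this

end Mdl

end

section

/-- Labels of the auxiliary Bernoulli fields. -/
abbrev FI := ((ℕ × ℕ) × (ℕ × ℕ)) × Bool

/-- Coordinates: Gaussians, the noise variable and the field variables at each site. -/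
abbrev Kc (d L : ℕ) := V d × ((Fin (L + 1) × Fin d) ⊕ Option FI)

noncomputable instance (d L : ℕ) : DecidableEq (Kc d L) := Classical.decEq _

/-- The uniform law on the unit interval. -/
noncomputable def unif : Measure ℝ := volume.restrict (Icc (0 : ℝ) 1)

instance : IsProbabilityMeasure unif := ⟨by simp [unif]⟩

/-- The law of each coordinate. -/
noncomputable def mc (d L : ℕ) (k : Kc d L) : Measure ℝ :=
  Sum.elim (fun _ => gaussianReal 0 1) (fun _ => unif) k.2

instance (d L : ℕ) (k : Kc d L) : IsProbabilityMeasure (mc d L k) := by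
  rcases k with ⟨x, k | k⟩
  · exact inferInstanceAs (IsProbabilityMeasure (gaussianReal 0 1))
  · exact inferInstanceAs (IsProbabilityMeasure unif)

/-- The canonical product measure. -/
noncomputable def PP (d L : ℕ) : Measure (Kc d L → ℝ) := Measure.infinitePi (mc d L)

instance (d L : ℕ) : IsProbabilityMeasure (PP d L) := by unfold PP; infer_instance

theorem unif_Iic {u : ℝ} (h0 : 0 ≤ u) (h1 : u ≤ 1) : unif.real (Iic u) = u := by
  have : Iic u ∩ Icc (0 : ℝ) 1 = Icc 0 u := by
    ext x; simp only [mem_inter_iff, mem_Iic, mem_Icc]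
    constructor
    · rintro ⟨a, b, -⟩; exact ⟨b, a⟩
    · rintro ⟨a, b⟩; exact ⟨b, a, b.trans h1⟩
  rw [unif, measureReal_restrict_apply measurableSet_Iic, this]
  simp [h0]

theorem unif_Ici {u : ℝ} (h0 : 0 ≤ u) (h1 : u ≤ 1) : unif.real (Ici u) = 1 - u := by
  have : Ici u ∩ Icc (0 : ℝ) 1 = Icc u 1 := by
    ext x; simp only [mem_inter_iff, mem_Ici, mem_Icc]
    constructor
    · rintro ⟨a, -, b⟩; exact ⟨a, b⟩
    · rintro ⟨a, b⟩; exact ⟨a, h0.trans a, b⟩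
  rw [unif, measureReal_restrict_apply measurableSet_Ici, this]
  simp [h1]

theorem unif_Ioo {u v : ℝ} (h0 : 0 ≤ u) (h1 : v ≤ 1) (huv : u ≤ v) :
    unif.real (Ioo u v) = v - u := by
  have : Ioo u v ∩ Icc (0 : ℝ) 1 = Ioo u v := by
    refine inter_eq_left.2 fun x hx => ⟨h0.trans hx.1.le, hx.2.le.trans h1⟩
  rw [unif, measureReal_restrict_apply measurableSet_Ioo, this]
  simp [huv]

theorem PP_eval {d L : ℕ} (x : V d) (o : Option FI) {s : Set ℝ} (hs : MeasurableSet s) :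
    (PP d L).real {ω | ω (x, Sum.inr o) ∈ s} = unif.real s := by
  have := measurePreserving_eval_infinitePi (mc d L) (x, Sum.inr o)
  rw [measureReal_def, measureReal_def]
  congr 1
  exact this.measure_preimage hs.nullMeasurableSet

theorem depOn_eval {K : Type*} (k : K) (s : Set ℝ) : DepOn {k} {ω : K → ℝ | ω k ∈ s} := by
  intro ω ω' h hω
  have := h k (Finset.mem_singleton_self k)
  rw [Set.mem_ofPred_eq] at hω ⊢
  rwa [← this]

theorem measurableSet_eval {K : Type*} (k : K) {s : Set ℝ} (hs : MeasurableSet s) :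
    MeasurableSet {ω : K → ℝ | ω k ∈ s} := measurable_pi_apply k hs

section gauss

variable {d L : ℕ}

/-- The box as a finite set. -/
noncomputable def bxF (x : V d) (r : ℕ) : Finset (V d) := (finite_Bx x r).toFinset

theorem mem_bxF {x y : V d} {r : ℕ} : y ∈ bxF x r ↔ dinf x y ≤ r := by
  simp [bxF, Bx]

theorem card_bxF (x : V d) (r : ℕ) : (bxF x r).card = (2 * r + 1) ^ d := by
  rw [← ncard_Bx x r, bxF, Set.ncard_eq_toFinset_card _ (finite_Bx x r)]

/-- The Gaussian field with moving-average weights `a` of range `r`. -/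
noncomputable def phi (a : V d → V d × (Fin (L + 1) × Fin d) → ℝ) (r : ℕ) (x : V d)
    (ω : Kc d L → ℝ) : ℝ :=
  ∑ p ∈ bxF x r ×ˢ Finset.univ, a x p * ω (p.1, Sum.inl p.2)

/-- The Gaussian coordinates seen by a site. -/
noncomputable def gN (L : ℕ) (r : ℕ) (x : V d) : Finset (Kc d L) :=
  (bxF x r ×ˢ (Finset.univ : Finset (Fin (L + 1) × Fin d))).image fun p => (p.1, Sum.inl p.2)

/-- The noise and field coordinates at a site. -/
noncomputable def nN (L : ℕ) (F : V d → Finset FI) (x : V d) : Finset (Kc d L) :=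
  insert (x, Sum.inr none) ((F x).image fun i => (x, Sum.inr (some i)))

variable (a : V d → V d × (Fin (L + 1) × Fin d) → ℝ) (r : ℕ) (x y : V d)

theorem measurable_phi : Measurable (phi a r x) :=
  Finset.measurable_sum _ fun _ _ => (measurable_pi_apply _).const_mul _

theorem depOn_phi (s : Set ℝ) : DepOn (gN L r x) (phi a r x ⁻¹' s) := by
  intro ω ω' h hω
  have : phi a r x ω = phi a r x ω' := by
    refine Finset.sum_congr rfl fun p hp => ?_
    rw [h _ (Finset.mem_image_of_mem _ hp)]
  rw [mem_preimage] at hω ⊢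
  rwa [← this]

theorem mem_gN {k : Kc d L} : k ∈ gN L r x ↔ dinf x k.1 ≤ r ∧ ∃ τ, k.2 = Sum.inl τ := by
  obtain ⟨z, k⟩ := k
  simp only [gN, Finset.mem_image, Finset.mem_product, mem_bxF, Finset.mem_univ, and_true,
    Prod.mk.injEq, Prod.exists]
  constructor
  · rintro ⟨z', τ, τ', h, rfl, rfl⟩; exact ⟨h, _, _, rfl⟩
  · rintro ⟨h, τ, τ', rfl⟩; exact ⟨z, τ, τ', h, rfl, rfl⟩

theorem mem_nN {F : V d → Finset FI} {k : Kc d L} :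
    k ∈ nN L F x ↔ k.1 = x ∧ (k.2 = Sum.inr none ∨ ∃ i ∈ F x, k.2 = Sum.inr (some i)) := by
  obtain ⟨z, k⟩ := k
  simp only [nN, Finset.mem_insert, Finset.mem_image, Prod.mk.injEq]
  constructor
  · rintro (⟨rfl, rfl⟩ | ⟨i, hi, rfl, rfl⟩)
    · exact ⟨rfl, Or.inl rfl⟩
    · exact ⟨rfl, Or.inr ⟨i, hi, rfl⟩⟩
  · rintro ⟨rfl, rfl | ⟨i, hi, rfl⟩⟩
    · exact Or.inl ⟨rfl, rfl⟩
    · exact Or.inr ⟨i, hi, rfl, rfl⟩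

variable {x y} {r}

theorem disjoint_gN (h : 2 * r < dinf x y) : Disjoint (gN L r x) (gN L r y) := by
  refine Finset.disjoint_left.2 fun k h1 h2 => ?_
  rw [mem_gN] at h1 h2
  have := dinf_triangle x k.1 y
  have := dinf_comm k.1 y
  omega

theorem disjoint_nN_gN (F : V d → Finset FI) : Disjoint (nN L F x) (gN L r y) := by
  refine Finset.disjoint_left.2 fun k h1 h2 => ?_
  rw [mem_gN] at h2
  rw [mem_nN] at h1
  obtain ⟨-, τ, h⟩ := h2
  rw [h] at h1
  simp at h1

theorem disjoint_nN (F F' : V d → Finset FI) (h : x ≠ y) : Disjoint (nN L F x) (nN L F' y) := by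
  refine Finset.disjoint_left.2 fun k h1 h2 => ?_
  rw [mem_nN] at h1 h2
  exact h (h1.1.symm.trans h2.1)

end gauss

section hyb

variable {d L : ℕ}

/-- Data of a sprinkled noised level set: the level at each site, and extra opening events. -/
structure Spr (d L : ℕ) where
  /-- level -/
  lev : V d → ℝ
  /-- opening event -/
  ζ : V d → Set (Kc d L → ℝ)
  /-- fields used by the opening event -/
  F : V d → Finset FI
  mζ : ∀ x, MeasurableSet (ζ x)
  dζ : ∀ x, DepOn ((F x).image fun i => (x, Sum.inr (some i))) (ζ x)

/-- The noised level set as a site model. -/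
noncomputable def hyb (a : V d → V d × (Fin (L + 1) × Fin d) → ℝ) (r : ℕ) {δ : ℝ}
    (hδ : δ ∈ Ioo (0 : ℝ) 1) (s : Spr d L) : Mdl (Kc d L) (V d) where
  st x := {ω | 1 - δ / 2 ≤ ω (x, Sum.inr none) ∨ (δ / 2 < ω (x, Sum.inr none) ∧
    ω (x, Sum.inr none) < 1 - δ / 2 ∧ s.lev x ≤ phi a r x ω)} ∪ s.ζ x
  fo x := {ω | ω (x, Sum.inr none) ∈ Ici (1 - δ / 2)}
  fc x := {ω | ω (x, Sum.inr none) ∈ Iic (δ / 2)} ∩ (s.ζ x)ᶜ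
  N x := gN L r x ∪ nN L s.F x
  ν x := nN L s.F x
  mst x := by
    have h : Measurable fun ω : Kc d L → ℝ => ω (x, Sum.inr none) := measurable_pi_apply _
    exact ((measurableSet_le measurable_const h).union ((measurableSet_lt measurable_const h).inter
      ((measurableSet_lt h measurable_const).inter
        (measurableSet_le measurable_const (measurable_phi a r x))))).union (s.mζ x)
  mfo x := measurableSet_eval _ measurableSet_Ici
  mfc x := (measurableSet_eval _ measurableSet_Iic).inter (s.mζ x).compl
  dst x := by
    intro ω ω' h hω
    have h1 : ω (x, Sum.inr none) = ω' (x, Sum.inr none) :=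
      h _ (Finset.mem_union_right _ (Finset.mem_insert_self _ _))
    rcases hω with hω | hω
    · left
      have h2 : s.lev x ≤ phi a r x ω → s.lev x ≤ phi a r x ω' :=
        (depOn_phi a r x (Ici (s.lev x)) ω ω' fun k hk => h k (Finset.mem_union_left _ hk))
      rw [Set.mem_ofPred_eq] at hω ⊢
      rw [← h1]
      tauto
    · exact Or.inr (s.dζ x ω ω' (fun k hk => h k (Finset.mem_union_right _
        (Finset.mem_insert_of_mem hk))) hω)
  dfo x := (depOn_eval _ _).mono (by simp [nN])
  dfc x := ((depOn_eval _ _).mono (by simp [nN])).inter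
    ((s.dζ x).compl.mono (Finset.subset_insert _ _))
  fo_sub x ω hω := Or.inl (Or.inl hω)
  fc_dis x := by
    refine Set.disjoint_left.2 fun ω h h' => ?_
    have h1 : ω (x, Sum.inr none) ≤ δ / 2 := h.1
    rcases h' with (h' | h') | h'
    · have := hδ.2; linarith
    · exact absurd h'.1 (not_lt.2 h1)
    · exact h.2 h'
  ν_sub x := Finset.subset_union_right
  dis x y h := by
    rw [Finset.disjoint_union_right]
    exact ⟨disjoint_nN_gN _, disjoint_nN _ _ h⟩

variable (a : V d → V d × (Fin (L + 1) × Fin d) → ℝ) (r : ℕ) {δ : ℝ}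
    (hδ : δ ∈ Ioo (0 : ℝ) 1) (s : Spr d L)

theorem hyb_fo (x : V d) : δ / 4 ≤ (PP d L).real ((hyb a r hδ s).fo x) := by
  have := hδ.1
  have := hδ.2
  change _ ≤ (PP d L).real {ω | ω (x, Sum.inr none) ∈ Ici (1 - δ / 2)}
  rw [PP_eval _ _ measurableSet_Ici, unif_Ici (by linarith) (by linarith)]
  linarith

theorem depOn_img_disjoint {L : ℕ} (F : V d → Finset FI) (x : V d) :
    Disjoint ({(x, Sum.inr none)} : Finset (Kc d L))
      ((F x).image fun i => (x, Sum.inr (some i))) := by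
  simp

theorem hyb_fc (x : V d) (h : (PP d L).real (s.ζ x) ≤ 1 / 2) :
    δ / 4 ≤ (PP d L).real ((hyb a r hδ s).fc x) := by
  have := hδ.1
  have := hδ.2
  have e : (PP d L).real ((hyb a r hδ s).fc x) =
      (PP d L).real {ω | ω (x, Sum.inr none) ∈ Iic (δ / 2)} * (PP d L).real (s.ζ x)ᶜ :=
    (depOn_eval _ _).indep (s.dζ x).compl (depOn_img_disjoint s.F x)
      (measurableSet_eval _ measurableSet_Iic) (s.mζ x).compl
  rw [e, PP_eval _ _ measurableSet_Iic, unif_Iic (by linarith) (by linarith),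
    probReal_compl_eq_one_sub (s.mζ x)]
  nlinarith

/-- Switch the sites of `Z` to the level `h'` and remove their sprinkling. -/
noncomputable def Spr.switch (s : Spr d L) (h' : ℝ) (Z : Set (V d)) : Spr d L where
  lev x := by classical exact if x ∈ Z then h' else s.lev x
  ζ x := {ω | x ∉ Z ∧ ω ∈ s.ζ x}
  F := s.F
  mζ x := by
    by_cases hx : x ∈ Z
    · simp [hx]
    · simpa [hx] using s.mζ x
  dζ x ω ω' h hω := ⟨hω.1, s.dζ x ω ω' h hω.2⟩

/-- The plain level set. -/
def Spr.plain (h : ℝ) : Spr d L where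
  lev _ := h
  ζ _ := ∅
  F _ := ∅
  mζ _ := MeasurableSet.empty
  dζ _ _ _ _ hω := hω

open Classical in
/-- Sprinkling a little is dominated by lowering the level. -/
theorem sprinkle {h h' p t : ℝ} (hlev : ∀ x, s.lev x = h) (hh : h' < h)
    (hphi : ∀ x, p ≤ (PP d L).real (phi a r x ⁻¹' Ico h' h)) (ht : t ≤ 1 / 2)
    (htp : t ≤ (1 - δ) * p / 2 * (δ / 4) ^ (2 * (2 * r) + 1) ^ d)
    (hζ : ∀ x, (PP d L).real (s.ζ x) ≤ t) {S : Finset (V d)} {A : Set (Set (V d))}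
    (hA : Loc (S : Set (V d)) A) (hi : Inc A) :
    (PP d L).real ((hyb a r hδ s).cf ⁻¹' A) ≤
      (PP d L).real ((hyb a r hδ (Spr.plain h')).cf ⁻¹' A) := by
  have hδ0 := hδ.1
  have hδ1 := hδ.2
  have step : ∀ (Z : Finset (V d)) (y : V d), y ∉ Z →
      (PP d L).real ((hyb a r hδ (s.switch h' Z)).cf ⁻¹' A) ≤
        (PP d L).real ((hyb a r hδ (s.switch h' (insert y Z : Finset (V d)))).cf ⁻¹' A) := by
    intro Z y hy
    set M := hyb a r hδ (s.switch h' Z) with hM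
    set M' := hyb a r hδ (s.switch h' (insert y Z : Finset (V d))) with hM'
    have hne : ∀ x ω, x ≠ y → (x ∈ M.cf ω ↔ x ∈ M'.cf ω) := by
      intro x ω hx
      simp [hM, hM', Mdl.cf, hyb, Spr.switch, hx]
    have hyM : ∀ ω, y ∈ M.cf ω ↔ (1 - δ / 2 ≤ ω (y, Sum.inr none) ∨ (δ / 2 < ω (y, Sum.inr none) ∧
        ω (y, Sum.inr none) < 1 - δ / 2 ∧ h ≤ phi a r y ω)) ∨ ω ∈ s.ζ y := by
      intro ω
      simp [hM, Mdl.cf, hyb, Spr.switch, hy, hlev]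
    have hyM' : ∀ ω, y ∈ M'.cf ω ↔ (1 - δ / 2 ≤ ω (y, Sum.inr none) ∨
        (δ / 2 < ω (y, Sum.inr none) ∧ ω (y, Sum.inr none) < 1 - δ / 2 ∧ h' ≤ phi a r y ω)) := by
      intro ω
      simp [hM', Mdl.cf, hyb, Spr.switch]
    have hfo : ∀ x, δ / 4 ≤ (PP d L).real (M.fo x) := fun x => hyb_fo a r hδ _ x
    have hfc : ∀ x, δ / 4 ≤ (PP d L).real (M.fc x) := fun x => hyb_fc a r hδ _ x
      ((measureReal_mono (fun ω hω => hω.2) (measure_ne_top _ _)).trans ((hζ x).trans ht))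
    have hpivL := loc_Piv hA y
    have hSy : ((S : Set (V d)) \ {y}).Finite := S.finite_toSet.subset Set.sdiff_subset
    have hpm : MeasurableSet (M.cf ⁻¹' Piv A y) := M.measurableSet_cf hSy hpivL
    have hAm := M.measurableSet_cf S.finite_toSet hA
    have hAm' := M'.measurableSet_cf S.finite_toSet hA
    -- the loss
    have loss : (PP d L).real (M.cf ⁻¹' A \ M'.cf ⁻¹' A) ≤
        t * (PP d L).real (M.cf ⁻¹' Piv A y) := by
      have e := (s.dζ y).indep (m := mc d L) (M.depOn_cf (S := S.erase y) (A := Piv A y)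
        (by rwa [Finset.coe_erase])) (by
          rw [Finset.disjoint_biUnion_right]
          intro x hx
          rw [Finset.mem_erase] at hx
          exact (M.dis y x hx.1.symm).mono_left (Finset.subset_insert _ _)) (s.mζ y) hpm
      refine le_trans ?_ (mul_le_mul_of_nonneg_right (hζ y) measureReal_nonneg)
      refine le_trans (measureReal_mono ?_ (measure_ne_top _ _)) e.le
      rintro ω ⟨h1, h2⟩
      have hsub : M.cf ω \ {y} ⊆ M'.cf ω := fun x hx => (hne x ω hx.2).1 hx.1
      have hyin : y ∈ M.cf ω := by
        by_contra hyn
        exact h2 (hi _ _ (fun x hx => hsub ⟨hx, fun e => hyn (e ▸ hx)⟩) h1)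
      have hyin' : y ∉ M'.cf ω := by
        intro hyn
        refine h2 (hi _ _ (fun x hx => ?_) h1)
        by_cases hxy : x = y
        · rwa [hxy]
        · exact hsub ⟨hx, hxy⟩
      refine ⟨?_, hi _ _ subset_union_left h1, fun h3 => h2 (hi _ _ hsub h3)⟩
      rw [hyM'] at hyin'
      rcases (hyM ω).1 hyin with h4 | h4
      · exfalso
        apply hyin'
        rcases h4 with h4 | h4
        · exact Or.inl h4
        · exact Or.inr ⟨h4.1, h4.2.1, hh.le.trans h4.2.2⟩
      · exact h4
    -- the gain
    set E : Set (Kc d L → ℝ) := (phi a r y ⁻¹' Ico h' h ∩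
      {ω | ω (y, Sum.inr none) ∈ Ioo (δ / 2) (1 - δ / 2)}) ∩ (s.ζ y)ᶜ with hE
    have hEm : MeasurableSet E := ((measurable_phi a r y measurableSet_Ico).inter
      (measurableSet_eval _ measurableSet_Ioo)).inter (s.mζ y).compl
    have d1 := depOn_phi a r y (Ico h' h)
    have d2 : DepOn {(y, Sum.inr none)}
      {ω : Kc d L → ℝ | ω (y, Sum.inr none) ∈ Ioo (δ / 2) (1 - δ / 2)} := depOn_eval _ _
    have d3 := (s.dζ y).compl
    have hEd : DepOn (gN L r y ∪ nN L s.F y) E :=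
      ((d1.mono Finset.subset_union_left).inter (d2.mono (by
        intro k hk
        rw [Finset.mem_singleton] at hk
        subst hk
        exact Finset.mem_union_right _ (Finset.mem_insert_self _ _)))).inter
        (d3.mono fun k hk => Finset.mem_union_right _ (Finset.mem_insert_of_mem hk))
    have hEp : (1 - δ) * p / 2 ≤ (PP d L).real E := by
      have e1 : (PP d L).real E = (PP d L).real (phi a r y ⁻¹' Ico h' h ∩
          {ω | ω (y, Sum.inr none) ∈ Ioo (δ / 2) (1 - δ / 2)}) * (PP d L).real (s.ζ y)ᶜ := by
        refine ((d1.mono Finset.subset_union_left).inter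
          (d2.mono Finset.subset_union_right)).indep d3 ?_
          ((measurable_phi a r y measurableSet_Ico).inter
            (measurableSet_eval _ measurableSet_Ioo)) (s.mζ y).compl
        rw [Finset.disjoint_union_left]
        refine ⟨?_, depOn_img_disjoint s.F y⟩
        exact ((disjoint_nN_gN s.F).mono_left (Finset.subset_insert _ _)).symm
      have e2 := d1.indep (m := mc d L) d2 (by
        refine ((disjoint_nN_gN (x := y) s.F).mono_left ?_).symm
        intro k hk
        rw [Finset.mem_singleton] at hk
        subst hk
        exact Finset.mem_insert_self _ _) (measurable_phi a r y measurableSet_Ico)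
        (measurableSet_eval _ measurableSet_Ioo)
      change (PP d L).real _ = (PP d L).real _ * (PP d L).real _ at e2
      rw [PP_eval _ _ measurableSet_Ioo, unif_Ioo (by linarith) (by linarith) (by linarith)] at e2
      rw [e1, e2, probReal_compl_eq_one_sub (s.mζ y)]
      have h5 := hphi y
      have h6 : 1 / 2 ≤ 1 - (PP d L).real (s.ζ y) := by linarith [hζ y]
      calc (1 - δ) * p / 2 = p * (1 - δ / 2 - δ / 2) * (1 / 2) := by ring
        _ ≤ _ := mul_le_mul (mul_le_mul_of_nonneg_right h5 (by linarith)) h6 (by norm_num)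
          (mul_nonneg measureReal_nonneg (by linarith))
    set D : Finset (V d) := (S.filter fun x => x ≠ y ∧ dinf y x ≤ 2 * r) with hD
    have hDc : D.card ≤ (2 * (2 * r) + 1) ^ d := by
      rw [← card_bxF y (2 * r)]
      refine Finset.card_le_card fun x hx => ?_
      rw [mem_bxF]
      exact (Finset.mem_filter.1 hx).2.2
    have fe := M.finite_energy (m := mc d L) hSy hpivL (D := D) (c := δ / 4) (by linarith)
      (fun x _ => hfo x) (fun x _ => hfc x) hEm hEd (by
        intro x hx
        rw [Finset.disjoint_union_left]
        exact ⟨(disjoint_nN_gN _).symm, disjoint_nN _ _ (Finset.mem_filter.1 hx).2.1.symm⟩) (by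
        rintro x ⟨⟨hx, hxy⟩, hxD⟩
        have hxy' : x ≠ y := hxy
        have hfar : 2 * r < dinf y x := by
          by_contra h
          exact hxD (Finset.mem_coe.2 (Finset.mem_filter.2 ⟨hx, hxy', not_lt.1 h⟩))
        change Disjoint _ (gN L r x ∪ nN L s.F x)
        rw [Finset.disjoint_union_left, Finset.disjoint_union_right, Finset.disjoint_union_right]
        exact ⟨⟨disjoint_gN hfar, (disjoint_nN_gN _).symm⟩, disjoint_nN_gN _,
          disjoint_nN _ _ hxy'.symm⟩)
    have gain : t * (PP d L).real (M.cf ⁻¹' Piv A y) ≤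
        (PP d L).real (M'.cf ⁻¹' A \ M.cf ⁻¹' A) := by
      have h7 : (δ / 4) ^ (2 * (2 * r) + 1) ^ d ≤ (δ / 4) ^ D.card :=
        pow_le_pow_of_le_one (by linarith) (by linarith) hDc
      refine le_trans (mul_le_mul_of_nonneg_right (htp.trans ?_) measureReal_nonneg)
        (fe.trans (measureReal_mono ?_ (measure_ne_top _ _)))
      · exact mul_le_mul hEp h7 (by positivity) measureReal_nonneg
      · rintro ω ⟨⟨⟨h1, h2⟩, h3⟩, h4⟩
        have hyin : y ∉ M.cf ω := by
          rw [hyM]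
          rintro ((h5 | h5) | h5)
          · exact absurd h2.2 (not_lt.2 h5)
          · exact absurd h1.2 (not_lt.2 h5.2.2)
          · exact h3 h5
        have hyin' : y ∈ M'.cf ω := (hyM' ω).2 (Or.inr ⟨h2.1, h2.2, h1.1⟩)
        refine ⟨hi _ _ ?_ h4.1, fun h5 => h4.2 ?_⟩
        · rintro x (hx | hx)
          · exact (hne x ω fun e => hyin (e ▸ hx)).1 hx
          · rw [mem_singleton_iff] at hx; rwa [hx]
        · rwa [Set.sdiff_singleton_eq_self hyin]
    have e1 := measureReal_inter_add_sdiff (μ := PP d L) (s := M.cf ⁻¹' A) hAm'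
    have e2 := measureReal_inter_add_sdiff (μ := PP d L) (s := M'.cf ⁻¹' A) hAm
    rw [inter_comm] at e2
    linarith
  have all : ∀ Z : Finset (V d), (PP d L).real ((hyb a r hδ s).cf ⁻¹' A) ≤
      (PP d L).real ((hyb a r hδ (s.switch h' Z)).cf ⁻¹' A) := by
    intro Z
    induction Z using Finset.induction_on with
    | empty =>
      refine le_of_eq ?_
      congr 2
      funext ω
      ext x
      simp [Mdl.cf, hyb, Spr.switch]
    | insert y Z hy ih => exact ih.trans (step Z y hy)
  refine (all S).trans (le_of_eq ?_)
  congr 1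
  ext ω
  have : (hyb a r hδ (s.switch h' S)).cf ω ∩ S = (hyb a r hδ (Spr.plain h')).cf ω ∩ S := by
    ext x
    simp only [mem_inter_iff, Finset.mem_coe]
    refine and_congr_left fun hx => ?_
    simp [Mdl.cf, hyb, Spr.switch, Spr.plain, hx]
  exact ⟨fun h => hA _ _ this h, fun h => hA _ _ this.symm h⟩

end hyb

end

section

namespace Mdl

variable {K J : Type*} (M : Mdl K J) {m : K → Measure ℝ} [∀ k, IsProbabilityMeasure (m k)]

theorem disjoint_N_ν [DecidableEq K] {S D : Finset J} (h : Disjoint (S : Set J) D) :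
    ∀ j ∈ D, Disjoint (S.biUnion M.N) (M.ν j) := by
  intro j hj
  rw [Finset.disjoint_biUnion_left]
  exact fun i hi => (M.dis j i fun e => Set.disjoint_left.1 h (Finset.mem_coe.2 hi)
    (e ▸ Finset.mem_coe.2 hj)).symm

theorem close_ge {S Z : Set J} {A : Set (Set J)} (hS : S.Finite) (hZ : Z.Finite) (hA : Loc S A)
    (hSZ : Disjoint S Z) {c : ℝ} (hc : 0 ≤ c)
    (h2 : ∀ j ∈ Z, c ≤ (Measure.infinitePi m).real (M.fc j)) :
    c ^ Z.ncard * (Measure.infinitePi m).real (M.cf ⁻¹' A) ≤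
      (Measure.infinitePi m).real (M.cf ⁻¹' (A ∩ {X | Disjoint X Z})) := by
  classical
  obtain ⟨S, rfl⟩ := hS.exists_finset_coe
  obtain ⟨Z, rfl⟩ := hZ.exists_finset_coe
  rw [ncard_coe_finset, mul_comm]
  refine (mul_le_mul_of_nonneg_left (M.close_prob hc h2) measureReal_nonneg).trans ?_
  rw [← M.frc_indep (M.measurableSet_cf hS hA) (M.depOn_cf hA) (M.disjoint_N_ν hSZ)]
  refine measureReal_mono (fun ω hω => ⟨hω.1, ?_⟩) (measure_ne_top _ _)
  have := M.cf_frc hω.2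
  rw [empty_inter] at this
  exact Set.disjoint_iff_inter_eq_empty.2 this

theorem open_ge {S Z : Set J} {A : Set (Set J)} (hS : S.Finite) (hZ : Z.Finite) (hA : Loc S A)
    (hSZ : Disjoint S Z) {c : ℝ} (hc : 0 ≤ c)
    (h1 : ∀ j ∈ Z, c ≤ (Measure.infinitePi m).real (M.fo j))
    (h2 : ∀ j ∈ Z, c ≤ (Measure.infinitePi m).real (M.fc j)) :
    c ^ Z.ncard * (Measure.infinitePi m).real (M.cf ⁻¹' A) ≤
      (Measure.infinitePi m).real (M.cf ⁻¹' (A ∩ {X | Z ⊆ X})) := by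
  classical
  obtain ⟨S, rfl⟩ := hS.exists_finset_coe
  obtain ⟨Z, rfl⟩ := hZ.exists_finset_coe
  rw [ncard_coe_finset, mul_comm]
  refine (mul_le_mul_of_nonneg_left (M.frc_prob hc h1 h2 univ) measureReal_nonneg).trans ?_
  rw [← M.frc_indep (M.measurableSet_cf hS hA) (M.depOn_cf hA) (M.disjoint_N_ν hSZ)]
  refine measureReal_mono (fun ω hω => ⟨hω.1, ?_⟩) (measure_ne_top _ _)
  have := M.cf_frc hω.2
  rw [univ_inter] at this
  exact inter_eq_right.1 this

end Mdl

variable {d L : ℕ} (a : V d → V d × (Fin (L + 1) × Fin d) → ℝ) (r : ℕ) {δ : ℝ}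
    (hδ : δ ∈ Ioo (0 : ℝ) 1)

/-- The law of the noised level set. -/
noncomputable def muh (h : ℝ) : Measure (Set (V d)) :=
  (PP d L).map (hyb a r hδ (Spr.plain h)).cf

instance (h : ℝ) : IsProbabilityMeasure (muh a r hδ h) :=
  Measure.isProbabilityMeasure_map (Mdl.measurable_cf _).aemeasurable

theorem muh_real (h : ℝ) {S : Set (V d)} {A : Set (Set (V d))} (hS : S.Finite) (hA : Loc S A) :
    (muh a r hδ h).real A = (PP d L).real ((hyb a r hδ (Spr.plain h)).cf ⁻¹' A) :=
  map_measureReal_apply (Mdl.measurable_cf _) (hA.measurableSet hS)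

theorem plain_N_disjoint (h : ℝ) {x y : V d} (hxy : 2 * r < dinf x y) :
    Disjoint ((hyb a r hδ (Spr.plain (L := L) h)).N x) ((hyb a r hδ (Spr.plain h)).N y) := by
  change Disjoint (gN L r x ∪ nN L _ x) (gN L r y ∪ nN L _ y)
  rw [Finset.disjoint_union_left, Finset.disjoint_union_right, Finset.disjoint_union_right]
  have hne : x ≠ y := by rintro rfl; rw [dinf_self] at hxy; omega
  exact ⟨⟨disjoint_gN hxy, (disjoint_nN_gN _).symm⟩, disjoint_nN_gN _, disjoint_nN _ _ hne⟩

theorem plain_mono (ha : ∀ x p, 0 ≤ a x p) (h : ℝ) {ω ω' : Kc d L → ℝ} (hω : ω ≤ ω') :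
    (hyb a r hδ (Spr.plain h)).cf ω ⊆ (hyb a r hδ (Spr.plain h)).cf ω' := by
  rintro x (hx | hx)
  · left
    have h1 := hω (x, Sum.inr none)
    have h2 : phi a r x ω ≤ phi a r x ω' :=
      Finset.sum_le_sum fun p _ => mul_le_mul_of_nonneg_left (hω _) (ha _ _)
    rcases hx with hx | ⟨hx1, hx2, hx3⟩
    · exact Or.inl (hx.trans h1)
    · rcases le_or_gt (1 - δ / 2) (ω' (x, Sum.inr none)) with h3 | h3
      · exact Or.inl h3
      · exact Or.inr ⟨hx1.trans_le h1, h3, hx3.trans h2⟩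
  · exact hx.elim

theorem good_muh (ha : ∀ x p, 0 ≤ a x p) (h : ℝ)
    (hinv : ∀ e : V d ≃ V d, LIso e → ∀ S A, S.Finite → Loc S A →
      (muh a r hδ h).real {X | e '' X ∈ A} = (muh a r hδ h).real A) :
    Good (muh a r hδ h) (2 * r) (δ / 4) where
  prob := inferInstance
  inv := hinv
  sep S T hS hT hST A B hA hB := by
    have hU := hS.union hT
    rw [muh_real a r hδ h hS hA, muh_real a r hδ h hT hB, muh_real a r hδ h hU
      ((hA.mono subset_union_left).inter (hB.mono subset_union_right))]
    exact Mdl.cf_indep _ hS hT hA hB fun i hi j hj => plain_N_disjoint a r hδ h (hST i hi j hj)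
  fkg S A B hS hA hB hAd hBd := by
    rw [muh_real a r hδ h hS hA, muh_real a r hδ h hS hB, muh_real a r hδ h hS (hA.inter hB)]
    obtain ⟨S, rfl⟩ := hS.exists_finset_coe
    exact harris_events (Mdl.depOn_cf _ hA) (Mdl.depOn_cf _ hB) (Mdl.measurableSet_cf _ hS hA)
      (Mdl.measurableSet_cf _ hS hB)
      (fun ω ω' hω h' => hAd _ _ (plain_mono a r hδ ha h hω) h')
      (fun ω ω' hω h' => hBd _ _ (plain_mono a r hδ ha h hω) h')
  c_pos := by linarith [hδ.1]
  c_le := by linarith [hδ.2]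
  close S Z A hS hZ hA hSZ := by
    rw [muh_real a r hδ h hS hA, muh_real a r hδ h (hS.union hZ)
      ((hA.mono subset_union_left).inter (loc_of_iff (fun X => Disjoint X Z) fun X => ?_))]
    · exact Mdl.close_ge _ hS hZ hA hSZ (by linarith [hδ.1]) fun j _ => hyb_fc a r hδ _ j
        (by simp [Spr.plain])
    · rw [Set.mem_ofPred_eq, Set.disjoint_left, Set.disjoint_left]
      exact ⟨fun h x hx => h hx.1, fun h x hx hz => h ⟨hx, Or.inr hz⟩ hz⟩
  opens S Z A hS hZ hA hSZ := by
    rw [muh_real a r hδ h hS hA, muh_real a r hδ h (hS.union hZ)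
      ((hA.mono subset_union_left).inter (loc_of_iff (fun X => Z ⊆ X) fun X => ?_))]
    · exact Mdl.open_ge _ hS hZ hA hSZ (by linarith [hδ.1]) (fun j _ => hyb_fo a r hδ _ j)
        fun j _ => hyb_fc a r hδ _ j (by simp [Spr.plain])
    · rw [Set.mem_ofPred_eq]
      exact ⟨fun h x hx => ⟨h hx, Or.inr hx⟩, fun h x hx => (h hx).1⟩

/-- The level set together with the auxiliary Bernoulli fields. -/
noncomputable def emd (h t : ℝ) : Mdl (Kc d L) (V d ⊕ FI × V d) where
  st := Sum.elim (hyb a r hδ (Spr.plain h)).st fun p =>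
    {ω | ω (p.2, Sum.inr (some p.1)) ∈ Ici (1 - t)}
  fo := Sum.elim (hyb a r hδ (Spr.plain h)).fo fun p =>
    {ω | ω (p.2, Sum.inr (some p.1)) ∈ Ici (1 - t)}
  fc := Sum.elim (hyb a r hδ (Spr.plain h)).fc fun _ => ∅
  N := Sum.elim (hyb a r hδ (Spr.plain h)).N fun p => {(p.2, Sum.inr (some p.1))}
  ν := Sum.elim (hyb a r hδ (Spr.plain h)).ν fun p => {(p.2, Sum.inr (some p.1))}
  mst j := by
    rcases j with x | p
    exacts [Mdl.mst _ x, measurableSet_eval _ measurableSet_Ici]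
  mfo j := by
    rcases j with x | p
    exacts [Mdl.mfo _ x, measurableSet_eval _ measurableSet_Ici]
  mfc j := by
    rcases j with x | p
    exacts [Mdl.mfc _ x, MeasurableSet.empty]
  dst j := by
    rcases j with x | p
    exacts [Mdl.dst _ x, depOn_eval _ _]
  dfo j := by
    rcases j with x | p
    exacts [Mdl.dfo _ x, depOn_eval _ _]
  dfc j := by
    rcases j with x | p
    exacts [Mdl.dfc _ x, fun _ _ _ h => h]
  fo_sub j := by
    rcases j with x | p
    exacts [Mdl.fo_sub _ x, Subset.rfl]
  fc_dis j := by
    rcases j with x | p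
    exacts [Mdl.fc_dis _ x, empty_disjoint _]
  ν_sub j := by
    rcases j with x | p
    exacts [Mdl.ν_sub _ x, Finset.Subset.refl _]
  dis i j hij := by
    rcases i with x | p <;> rcases j with y | q
    · exact Mdl.dis _ x y fun e => hij (e ▸ rfl)
    · simp [hyb, mem_nN, Spr.plain]
    · simp [hyb, mem_nN, mem_gN, Spr.plain]
    · simp only [Sum.elim_inr, Finset.disjoint_singleton_left, Finset.mem_singleton]
      intro e
      simp only [Prod.mk.injEq, Sum.inr.injEq, Option.some.injEq] at e
      exact hij (congrArg Sum.inr (Prod.ext e.2 e.1))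

/-- The law of the extended configuration. -/
noncomputable def Qh (h t : ℝ) : Measure (Set (V d ⊕ FI × V d)) :=
  (PP d L).map (emd a r hδ h t).cf

theorem Qh_real (h t : ℝ) {A : Set (Set (V d ⊕ FI × V d))} (hA : MeasurableSet A) :
    (Qh a r hδ h t).real A = (PP d L).real ((emd a r hδ h t).cf ⁻¹' A) :=
  map_measureReal_apply (Mdl.measurable_cf _) hA

theorem ext_Qh (h : ℝ) {t : ℝ} (ht : 0 < t) (ht1 : t ≤ 1) :
    Ext (Qh a r hδ h t) (muh a r hδ h) (2 * r) (δ / 4) t where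
  prob := Measure.isProbabilityMeasure_map (Mdl.measurable_cf _).aemeasurable
  marg S A hS hA := by
    have hL : Loc (Sum.inl '' S : Set (V d ⊕ FI × V d)) {Y | Sum.inl ⁻¹' Y ∈ A} := by
      intro Y Y' hY h
      refine hA _ _ ?_ h
      ext x
      have := Set.ext_iff.1 hY (Sum.inl x)
      simpa using this
    rw [muh_real a r hδ h hS hA, Qh_real a r hδ h t (hL.measurableSet (hS.image _))]
    rfl
  sep S T hS hT h1 h2 A B hA hB := by
    rw [Qh_real a r hδ h t (hA.measurableSet hS), Qh_real a r hδ h t (hB.measurableSet hT),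
      Qh_real a r hδ h t ((hA.measurableSet hS).inter (hB.measurableSet hT))]
    refine Mdl.cf_indep _ hS hT hA hB fun i hi j hj => ?_
    rcases i with x | p <;> rcases j with y | q
    · exact plain_N_disjoint a r hδ h (h1 x y hi hj)
    · simp [emd, hyb, mem_nN, mem_gN, Spr.plain]
    · simp [emd, hyb, mem_nN, mem_gN, Spr.plain]
    · simp only [emd, Sum.elim_inr, Finset.disjoint_singleton_left, Finset.mem_singleton]
      intro e
      simp only [Prod.mk.injEq, Sum.inr.injEq, Option.some.injEq] at e
      exact h2 p hi (by rwa [show p = q from Prod.ext e.2 e.1])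
  close S Z A hS hZ hA hSZ := by
    have hL : Loc (Sum.inl '' Z : Set (V d ⊕ FI × V d)) {Y | Disjoint Y (Sum.inl '' Z)} :=
      loc_of_iff (fun X => Disjoint X (Sum.inl '' Z)) fun X => by
        rw [Set.mem_ofPred_eq, Set.disjoint_left, Set.disjoint_left]
        exact ⟨fun h x hx => h hx.1, fun h x hx hz => h ⟨hx, hz⟩ hz⟩
    have hZi := hZ.image (Sum.inl : V d → V d ⊕ FI × V d)
    rw [Qh_real a r hδ h t (hA.measurableSet hS),
      Qh_real a r hδ h t ((hA.measurableSet hS).inter (hL.measurableSet hZi)),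
      ← Set.ncard_image_of_injective Z (Sum.inl_injective (β := FI × V d))]
    refine Mdl.close_ge _ hS hZi hA ?_ (by linarith [hδ.1]) ?_
    · rw [Set.disjoint_right]
      rintro _ ⟨z, hz, rfl⟩
      exact hSZ z hz
    · rintro _ ⟨z, _, rfl⟩
      exact hyb_fc a r hδ _ z (by simp [Spr.plain])
  seeds Z hZ := by
    have hZi := hZ.image (Sum.inr : FI × V d → V d ⊕ FI × V d)
    have hL : Loc (Sum.inr '' Z : Set (V d ⊕ FI × V d)) {Y | Sum.inr '' Z ⊆ Y} :=
      loc_of_iff (fun X => Sum.inr '' Z ⊆ X) fun X => by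
        rw [Set.mem_ofPred_eq]
        exact ⟨fun h x hx => ⟨h hx, hx⟩, fun h x hx => (h hx).1⟩
    rw [Qh_real a r hδ h t (hL.measurableSet hZi)]
    obtain ⟨Z, rfl⟩ := hZ.exists_finset_coe
    have e := indep_biInter (m := mc d L) (D := Z)
      (N := fun p : FI × V d => {((p.2, Sum.inr (some p.1)) : Kc d L)})
      (F := fun p => {ω | ω (p.2, Sum.inr (some p.1)) ∈ Ici (1 - t)})
      (fun p _ => measurableSet_eval _ measurableSet_Ici) (fun p _ => depOn_eval _ _) (by
        intro p _ q _ hpq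
        simp only [Finset.disjoint_singleton_left, Finset.mem_singleton]
        intro e
        simp only [Prod.mk.injEq, Sum.inr.injEq, Option.some.injEq] at e
        exact hpq (Prod.ext e.2 e.1))
    have e2 : ∀ p : FI × V d, (Measure.infinitePi (mc d L)).real
        {ω | ω (p.2, Sum.inr (some p.1)) ∈ Ici (1 - t)} = t := fun p =>
      (PP_eval p.2 (some p.1) measurableSet_Ici).trans
        (by rw [unif_Ici (by linarith) (by linarith)]; ring)
    simp only [e2, Finset.prod_const] at e
    rw [ncard_coe_finset, ← e]
    refine measureReal_mono (fun ω hω => ?_) (measure_ne_top _ _)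
    rintro _ ⟨p, hp, rfl⟩
    simp only [mem_iInter] at hω
    exact hω p hp
  t_pos := ht

end

section

theorem tendsto_logcbrt : Tendsto (fun R : ℕ => Real.log R ^ ((1 : ℝ) / 3)) atTop atTop :=
  (tendsto_rpow_atTop (by norm_num)).comp (Real.tendsto_log_atTop.comp tendsto_natCast_atTop_atTop)

theorem tendsto_ufn : Tendsto (fun R : ℕ => ufn R) atTop atTop :=
  Real.tendsto_exp_atTop.comp tendsto_logcbrt

/-- Stretched exponential scales beat every power. -/
theorem tendsto_pow_mul_half_ufn (D m n : ℕ) (hn : 0 < n) :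
    Tendsto (fun R : ℕ => (R : ℝ) ^ D * (1 / 2 : ℝ) ^ ((⌊ufn R⌋₊ - m) / n)) atTop (nhds 0) := by
  have hn' : (0 : ℝ) < n := Nat.cast_pos.2 hn
  have hl2 : 0 < Real.log 2 := Real.log_pos (by norm_num)
  set c : ℝ := Real.log 2 / n with hc
  have hcpos : 0 < c := div_pos hl2 hn'
  set C : ℝ := Real.exp (c * (1 + m) + Real.log 2) with hC
  have h1 : Tendsto (fun s : ℝ => C * Real.exp (-s ^ 3)) atTop (nhds 0) := by
    have : Tendsto (fun s : ℝ => Real.exp (-s ^ 3)) atTop (nhds 0) :=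
      Real.tendsto_exp_neg_atTop_nhds_zero.comp (tendsto_pow_atTop (by norm_num))
    simpa using this.const_mul C
  have h2 : ∀ᶠ s : ℝ in atTop, (D + 1) / c ≤ Real.exp s / s ^ 3 :=
    (Real.tendsto_exp_div_pow_atTop 3).eventually_ge_atTop _
  refine squeeze_zero' (Eventually.of_forall fun R => by positivity) ?_ (h1.comp tendsto_logcbrt)
  filter_upwards [tendsto_logcbrt.eventually h2, tendsto_logcbrt.eventually_gt_atTop 0,
    eventually_ge_atTop 1] with R hR hs hR1
  set s := Real.log R ^ ((1 : ℝ) / 3) with hsdef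
  have hR0 : (0 : ℝ) < R := by exact_mod_cast hR1
  have hlog : s ^ 3 = Real.log R := by
    have : 0 ≤ Real.log R := Real.log_nonneg (by exact_mod_cast hR1)
    rw [hsdef, ← Real.rpow_natCast, ← Real.rpow_mul this]; norm_num
  have hu : ufn R = Real.exp s := rfl
  set k := (⌊ufn R⌋₊ - m) / n with hk
  have hk1 : (ufn R - 1 - m) / n - 1 ≤ k := by
    have e1 := Nat.lt_floor_add_one (ufn R)
    have e2 : ⌊ufn R⌋₊ < n * (k + 1) + m := by
      have := Nat.lt_mul_div_succ (⌊ufn R⌋₊ - m) hn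
      rw [← hk] at this
      omega
    have e3 : (⌊ufn R⌋₊ : ℝ) < n * (k + 1) + m := by exact_mod_cast e2
    rw [sub_le_iff_le_add, div_le_iff₀ hn']
    linarith
  have e1 : (R : ℝ) ^ D = Real.exp (D * s ^ 3) := by
    rw [hlog, Real.exp_nat_mul, Real.exp_log hR0]
  have e2 : (1 / 2 : ℝ) ^ k = Real.exp (-(Real.log 2 * k)) := by
    rw [one_div, inv_pow, Real.exp_neg, mul_comm, Real.exp_nat_mul, Real.exp_log (by norm_num)]
  rw [e1, e2, ← Real.exp_add]
  simp only [Function.comp]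
  rw [hC, ← Real.exp_add]
  apply Real.exp_le_exp.2
  rw [div_le_div_iff₀ hcpos (by positivity), ← hu] at hR
  have e3 : Real.log 2 * ((ufn R - 1 - m) / n - 1) ≤ Real.log 2 * k :=
    mul_le_mul_of_nonneg_left hk1 hl2.le
  have e4 : Real.log 2 * ((ufn R - 1 - m) / n - 1) = c * ufn R - (c * (1 + m) + Real.log 2) := by
    rw [hc]; field_simp; ring
  nlinarith

section seeds

variable {d : ℕ}

/-- The labels whose field may open the site `x`. -/
noncomputable def lab (n : ℕ) (x : V d) (i₀ i₁ : Fin d) : Finset FI :=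
  (((((Finset.Icc (x i₀ / n - 4) (x i₀ / n + 4)).image Int.toNat) ×ˢ
    ((Finset.Icc (x i₁ / n - 4) (x i₁ / n + 4)).image Int.toNat)) ×ˢ
    (((Finset.Icc (x i₀ / n - 4) (x i₀ / n + 4)).image Int.toNat) ×ˢ
    ((Finset.Icc (x i₁ / n - 4) (x i₁ / n + 4)).image Int.toNat))) ×ˢ Finset.univ)

theorem card_lab (n : ℕ) (x : V d) (i₀ i₁ : Fin d) : (lab n x i₀ i₁).card ≤ 9 ^ 4 * 2 := by
  have h : ∀ q : ℤ, ((Finset.Icc (q - 4) (q + 4)).image Int.toNat).card ≤ 9 := by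
    intro q
    refine Finset.card_image_le.trans ?_
    rw [Int.card_Icc]; omega
  rw [lab, Finset.card_product, Finset.card_product, Finset.card_product]
  have h0 := h (x i₀ / n)
  have h1 := h (x i₁ / n)
  have e : (Finset.univ : Finset Bool).card = 2 := rfl
  rw [e]
  refine Nat.mul_le_mul_right 2 ?_
  calc _ ≤ (9 * 9) * (9 * 9) := Nat.mul_le_mul (Nat.mul_le_mul h0 h1) (Nat.mul_le_mul h0 h1)
    _ = _ := by norm_num

theorem mem_lab {n : ℕ} (hn : 0 < n) (x : V d) {i₀ i₁ : Fin d} (h0 : i₀.val = 0) (h1 : i₁.val = 1)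
    {e : (ℕ × ℕ) × (ℕ × ℕ)} (he : Adj4 e.1 e.2) (hx : x ∈ Bx (ctr d n e.1) (3 * n)) (b : Bool) :
    (e, b) ∈ lab n x i₀ i₁ := by
  have hn' : (0 : ℤ) < n := by exact_mod_cast hn
  rw [mem_Bx] at hx
  have key : ∀ (i : Fin d) (v : ℕ), ctr d n e.1 i = n * v →
      x i / n - 3 ≤ v ∧ (v : ℤ) ≤ x i / n + 3 := by
    intro i v hv
    have hi := (natAbs_le_dinf (ctr d n e.1) x i).trans hx
    rw [hv] at hi
    have e1 := Int.mul_ediv_self_le (x := x i) hn'.ne'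
    have e2 := Int.lt_mul_ediv_self_add (x := x i) hn'
    have h3 : ((n : ℤ) * v - x i) ≤ 3 * n ∧ -(3 * n : ℤ) ≤ (n : ℤ) * v - x i := by
      have : ((n : ℤ) * v - x i).natAbs ≤ 3 * n := hi
      omega
    constructor
    · by_contra hc
      have : (v : ℤ) + 1 ≤ x i / n - 3 := by omega
      nlinarith
    · by_contra hc
      have : x i / n + 4 ≤ (v : ℤ) := by omega
      nlinarith
  have k0 := key i₀ e.1.1 (by simp [ctr, h0])
  have k1 := key i₁ e.1.2 (by simp [ctr, h1])
  have mem : ∀ (q : ℤ) (w : ℕ), q - 4 ≤ w → (w : ℤ) ≤ q + 4 →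
      w ∈ (Finset.Icc (q - 4) (q + 4)).image Int.toNat := by
    intro q w h h'
    exact Finset.mem_image.2 ⟨w, Finset.mem_Icc.2 ⟨h, h'⟩, Int.toNat_natCast w⟩
  simp only [Adj4] at he
  simp only [lab, Finset.mem_product, Finset.mem_univ, and_true]
  refine ⟨⟨mem _ _ ?_ ?_, mem _ _ ?_ ?_⟩, mem _ _ ?_ ?_, mem _ _ ?_ ?_⟩ <;> omega

variable {L : ℕ}

/-- Sprinkling by all the fields that may open a site. -/
noncomputable def sprZ (h t : ℝ) (n : ℕ) (i₀ i₁ : Fin d) : Spr d L where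
  lev _ := h
  ζ x := ⋃ i ∈ lab n x i₀ i₁, {ω | ω (x, Sum.inr (some i)) ∈ Ici (1 - t)}
  F x := lab n x i₀ i₁
  mζ x := Finset.measurableSet_biUnion _ fun _ _ => measurableSet_eval _ measurableSet_Ici
  dζ x ω ω' hω h := by
    simp only [mem_iUnion] at h ⊢
    obtain ⟨i, hi, h⟩ := h
    exact ⟨i, hi, depOn_eval _ _ ω ω' (fun k hk => by
      rw [Finset.mem_singleton] at hk
      exact hω _ (hk ▸ Finset.mem_image_of_mem _ hi)) h⟩

theorem sprZ_le (h : ℝ) {t : ℝ} (ht : 0 ≤ t) (ht1 : t ≤ 1) (n : ℕ) (i₀ i₁ : Fin d) (x : V d) :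
    (PP d L).real ((sprZ h t n i₀ i₁).ζ x) ≤ (9 ^ 4 * 2) * t := by
  refine (measureReal_biUnion_finset_le _ _).trans ?_
  have : ∀ i : FI, (PP d L).real {ω | ω (x, Sum.inr (some i)) ∈ Ici (1 - t)} = t := fun i => by
    rw [PP_eval _ _ measurableSet_Ici, unif_Ici (by linarith) (by linarith)]; ring
  simp only [this, Finset.sum_const, nsmul_eq_mul]
  exact mul_le_mul_of_nonneg_right (by exact_mod_cast card_lab n x i₀ i₁) ht

variable (a : V d → V d × (Fin (L + 1) × Fin d) → ℝ) (r : ℕ) {δ : ℝ}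
    (hδ : δ ∈ Ioo (0 : ℝ) 1)

/-- Percolation at a level forces fast decay of disconnection at lower levels. -/
theorem tilde_of_perc (hd : 2 ≤ d) {h h' p θ : ℝ} (hμ : Good (muh a r hδ h) (2 * r) (δ / 4))
    (hh : h' < h) (hp : 0 < p)
    (hphi : ∀ x, p ≤ (PP d L).real (phi a r x ⁻¹' Ico h' h)) (hθ : 0 < θ)
    (hA : ∀ n, θ ≤ (muh a r hδ h).real (Arm 0 0 n)) {ε : ℝ} (hε : 0 < ε) :
    ∃ R : ℕ, 1 ≤ R ∧ (R : ℝ) ^ d * (muh a r hδ h').real (Arm 0 ⌊ufn R⌋₊ R)ᶜ < ε := by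
  have hδ0 := hδ.1
  have hδ1 := hδ.2
  set q : ℝ := (1 - δ) * p / 2 * (δ / 4) ^ (2 * (2 * r) + 1) ^ d with hq
  have hq0 : 0 < q := by
    have : 0 < 1 - δ := by linarith
    positivity
  set t : ℝ := min (1 / 2) q / (9 ^ 4 * 2) with ht
  have hm0 : 0 < min (1 / 2) q := lt_min (by norm_num) hq0
  have ht0 : 0 < t := by positivity
  have ht2 : (9 ^ 4 * 2) * t = min (1 / 2) q := by rw [ht]; field_simp
  have ht1 : t ≤ 1 := by
    have := min_le_left (1 / 2) q
    nlinarith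
  obtain ⟨m, n, hn, hcr⟩ := (ext_Qh a r hδ h ht0 ht1).crossing hμ hd hθ hA
  have hn' : (0 : ℝ) < n := Nat.cast_pos.2 hn
  have lim := (tendsto_pow_mul_half_ufn (d + 1) (m + 1) n hn).eventually_lt_const
    (show 0 < ε / 4 by positivity)
  have hex : ∃ R : ℕ, (R : ℝ) ^ (d + 1) * (1 / 2 : ℝ) ^ ((⌊ufn R⌋₊ - (m + 1)) / n) < ε / 4 ∧
      (m + 1 : ℝ) ≤ ufn R ∧ Real.exp 8 ≤ R ∧ 1 ≤ R :=
    (lim.and ((tendsto_ufn.eventually_ge_atTop _).and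
      ((tendsto_natCast_atTop_atTop.eventually_ge_atTop _).and (eventually_ge_atTop 1)))).exists
  obtain ⟨R, h1, h2, h3, hR1⟩ := hex
  refine ⟨R, hR1, ?_⟩
  set u := ⌊ufn R⌋₊ with hu
  have hmu : m + 1 ≤ u := Nat.le_floor (by exact_mod_cast h2)
  have huR : u ≤ R := by
    have e1 : (u : ℝ) ≤ ufn R := Nat.floor_le (ufn_pos _).le
    have e2 := ufn_le h3
    have e3 := ufn_pos R
    have : (u : ℝ) ≤ R := by linarith
    exact_mod_cast this
  set K := (u - (m + 1)) / n with hK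
  have hKu : n * K + m ≤ u - 1 := by
    have := Nat.mul_div_le (u - (m + 1)) n
    rw [← hK] at this
    omega
  have hc := hcr (R / n + 2) K (u - 1) hKu
  have hRn : R + n ≤ n * (R / n + 2) := by
    have := Nat.lt_mul_div_succ R hn
    have e : n * (R / n + 2) = n * (R / n + 1) + n := by ring
    omega
  set i₀ : Fin d := ⟨0, by omega⟩
  set i₁ : Fin d := ⟨1, by omega⟩
  set s : Spr d L := sprZ h t n i₀ i₁ with hs
  have hloc := loc_Arm (a := (0 : V d)) huR
  have hfin := finite_Bx (0 : V d) R
  have hlocc : Loc (Bx (0 : V d) R) (Arm (0 : V d) u R)ᶜ := hloc.compl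
  obtain ⟨S, hS⟩ := hfin.exists_finset_coe
  have spr := sprinkle a r hδ s (fun _ => rfl) hh hphi (t := min (1 / 2) q) (min_le_left _ _)
    (min_le_right _ _) (fun x => (sprZ_le h ht0.le ht1 n i₀ i₁ x).trans ht2.le)
    (S := S) (by rw [hS]; exact hloc) inc_Arm
  have key : (PP d L).real ((hyb a r hδ s).cf ⁻¹' (Arm 0 u R)ᶜ) ≤
      ((R / n + 2 : ℕ) + 1) * (1 / 2) ^ (K + 1) := by
    refine le_trans ?_ hc
    set G : Set (Set (V d ⊕ FI × V d)) := {Y | ∃ x ∈ Bx (0 : V d) (u - 1), ∃ y,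
      n * (R / n + 2) ≤ dinf 0 y + n ∧ Cn (Xf Y ∪ Bx 0 (u - 1) ∪ Zs n Y) x y} with hG
    refine le_trans (b := (PP d L).real ((emd a r hδ h t).cf ⁻¹' Gᶜ)) ?_ ?_
    · refine measureReal_mono (fun ω hω hG' => hω ?_) (measure_ne_top _ _)
      obtain ⟨x, hx, y, hy, hxy⟩ := hG'
      have hyR : R ≤ dinf 0 y := by omega
      have hyu : y ∉ Bx (0 : V d) (u - 1) := by
        rw [mem_Bx]; omega
      obtain ⟨z, w, -, hz, hzw, hwy⟩ := hxy.last_exit hx hyu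
      have hw : w ∈ Bx (0 : V d) u := by
        rw [mem_Bx] at hz ⊢
        have := dinf_adj_le 0 hzw
        omega
      refine (arm_iff huR).2 (arm_of_conn hw huR hyR (hwy.mono ?_))
      rintro v ⟨(hv | hv) | hv, hv'⟩
      · rcases (show v ∈ (hyb a r hδ (Spr.plain h)).cf ω from hv) with hv | hv
        exacts [Or.inl hv, hv.elim]
      · exact absurd hv hv'
      · right
        simp only [Zs, mem_iUnion] at hv
        obtain ⟨e, he, hv1, hv2⟩ := hv
        simp only [hs, sprZ, mem_iUnion]
        rcases hv1 with hv1 | hv1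
        · exact ⟨(e, false), mem_lab hn v rfl rfl he hv2 _, hv1⟩
        · exact ⟨(e, true), mem_lab hn v rfl rfl he hv2 _, hv1⟩
    · have : IsProbabilityMeasure (Qh a r hδ h t) :=
        Measure.isProbabilityMeasure_map (Mdl.measurable_cf _).aemeasurable
      exact ENNReal.toReal_mono (measure_ne_top _ _)
        (Measure.le_map_apply (Mdl.measurable_cf _).aemeasurable _)
  have fin : (muh a r hδ h').real (Arm 0 u R)ᶜ ≤ ((R / n + 2 : ℕ) + 1) * (1 / 2) ^ (K + 1) := by
    refine le_trans ?_ key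
    rw [muh_real a r hδ h' hfin hlocc, preimage_compl, preimage_compl,
      probReal_compl_eq_one_sub (Mdl.measurableSet_cf _ hfin hloc),
      probReal_compl_eq_one_sub (Mdl.measurableSet_cf _ hfin hloc)]
    linarith
  have hRn2 : ((R / n + 2 : ℕ) + 1 : ℝ) ≤ 4 * R := by
    have e1 : R / n ≤ R := Nat.div_le_self _ _
    have e2 : R / n + 2 + 1 ≤ 4 * R := by omega
    exact_mod_cast e2
  calc (R : ℝ) ^ d * (muh a r hδ h').real (Arm 0 u R)ᶜ
      ≤ (R : ℝ) ^ d * ((4 * R) * (1 / 2) ^ (K + 1)) :=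
        mul_le_mul_of_nonneg_left (fin.trans (mul_le_mul_of_nonneg_right hRn2 (by positivity)))
          (by positivity)
    _ = 2 * ((R : ℝ) ^ (d + 1) * (1 / 2) ^ K) := by ring
    _ < ε := by linarith

end seeds

end

section

section osss

variable {K : Type*} [DecidableEq K]

/-- An adaptive exploration of the coordinates in `J`: the next queried coordinate is a function of
the queried ones. -/
structure Expl (K : Type*) [DecidableEq K] where
  /-- next query -/
  nxt : Finset K → (K → ℝ) → Option K
  /-- coordinates that may be queried -/
  J : Finset K
  mem_J : ∀ {A x i}, nxt A x = some i → i ∈ J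
  notMem : ∀ {A x i}, nxt A x = some i → i ∉ A
  dep : ∀ {A x x'}, (∀ k ∈ A, x k = x' k) → nxt A x = nxt A x'
  meas : ∀ A o, MeasurableSet {x | nxt A x = o}

variable (T : Expl K)

/-- The set of coordinates queried in `k` steps, starting with `A`. -/
noncomputable def Expl.rev : ℕ → Finset K → (K → ℝ) → Finset K
  | 0, A, _ => A
  | k + 1, A, x => match T.nxt A x with
    | none => A
    | some i => Expl.rev k (insert i A) x

variable {T}

theorem Expl.rev_none {A : Finset K} {x : K → ℝ} (h : T.nxt A x = none) (k : ℕ) :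
    T.rev k A x = A := by
  cases k with
  | zero => rfl
  | succ k => rw [Expl.rev, h]

theorem Expl.rev_some {A : Finset K} {x : K → ℝ} {i : K} (h : T.nxt A x = some i) (k : ℕ) :
    T.rev (k + 1) A x = T.rev k (insert i A) x := by rw [Expl.rev, h]

theorem Expl.subset_rev (k : ℕ) (A : Finset K) (x : K → ℝ) : A ⊆ T.rev k A x := by
  induction k generalizing A with
  | zero => exact Finset.Subset.refl _
  | succ k ih =>
    cases h : T.nxt A x with
    | none => rw [T.rev_none h]
    | some i => rw [T.rev_some h]; exact (Finset.subset_insert _ _).trans (ih _)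

theorem Expl.rev_subset (k : ℕ) {A : Finset K} (hA : A ⊆ T.J) (x : K → ℝ) : T.rev k A x ⊆ T.J := by
  induction k generalizing A with
  | zero => exact hA
  | succ k ih =>
    cases h : T.nxt A x with
    | none => rwa [T.rev_none h]
    | some i => rw [T.rev_some h]; exact ih (Finset.insert_subset (T.mem_J h) hA)

theorem Expl.rev_stops (k : ℕ) (A : Finset K) (x : K → ℝ) :
    T.nxt (T.rev k A x) x = none ∨ A.card + k ≤ (T.rev k A x).card := by
  induction k generalizing A with
  | zero => exact Or.inr le_rfl
  | succ k ih =>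
    cases h : T.nxt A x with
    | none => left; rwa [T.rev_none h]
    | some i =>
      rw [T.rev_some h]
      refine (ih _).imp_right fun h' => ?_
      rw [Finset.card_insert_of_notMem (T.notMem h)] at h'
      omega

theorem Expl.rev_final (x : K → ℝ) : T.nxt (T.rev (T.J.card + 1) ∅ x) x = none := by
  refine (T.rev_stops (T.J.card + 1) ∅ x).resolve_right fun h => ?_
  have := Finset.card_le_card (T.rev_subset (T.J.card + 1) (Finset.empty_subset _) x)
  omega

theorem Expl.rev_congr (k : ℕ) (A : Finset K) {x x' : K → ℝ}
    (h : ∀ i ∈ T.rev k A x, x i = x' i) : T.rev k A x' = T.rev k A x := by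
  induction k generalizing A with
  | zero => rfl
  | succ k ih =>
    have e : T.nxt A x = T.nxt A x' := T.dep fun i hi => h i (T.subset_rev _ _ _ hi)
    cases h' : T.nxt A x with
    | none => rw [T.rev_none h', T.rev_none (e ▸ h')]
    | some i =>
      rw [T.rev_some h'] at h
      rw [T.rev_some h', T.rev_some (e ▸ h')]
      exact ih _ h

/-- Invariants along the exploration. -/
theorem Expl.rev_induct {x : K → ℝ} {p : Finset K → Prop}
    (hp : ∀ A i, p A → T.nxt A x = some i → p (insert i A)) (k : ℕ) {A : Finset K} (hA : p A) :
    p (T.rev k A x) := by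
  induction k generalizing A with
  | zero => exact hA
  | succ k ih =>
    cases h : T.nxt A x with
    | none => rwa [T.rev_none h]
    | some i => rw [T.rev_some h]; exact ih (hp A i hA h)

theorem Expl.measurableSet_rev [Countable K] (k : ℕ) (A : Finset K) (j : K) :
    MeasurableSet {x | j ∈ T.rev k A x} := by
  induction k generalizing A with
  | zero => exact MeasurableSet.const (j ∈ A)
  | succ k ih =>
    have : {x | j ∈ T.rev (k + 1) A x} = ({x | T.nxt A x = none} ∩ {_x | j ∈ A}) ∪
        ⋃ i, {x | T.nxt A x = some i} ∩ {x | j ∈ T.rev k (insert i A) x} := by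
      ext x
      simp only [Set.mem_ofPred_eq, mem_union, mem_inter_iff, mem_iUnion]
      cases h : T.nxt A x with
      | none => simp [T.rev_none h]
      | some i => simp [T.rev_some h]
    rw [this]
    exact ((T.meas _ _).inter (MeasurableSet.const _)).union
      (MeasurableSet.iUnion fun i => (T.meas _ _).inter (ih _))

variable (T) in
/-- Replace the queried coordinates of `y` by those of `x`. -/
noncomputable def Expl.mix (k : ℕ) (A : Finset K) (x y : K → ℝ) : K → ℝ :=
  fun j => if j ∈ T.rev k A x ∧ j ∉ A then x j else y j

theorem Expl.mix_eq {A : Finset K} {x : K → ℝ} {k : ℕ} (h : T.rev k A x = A) (y : K → ℝ) :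
    T.mix k A x y = y := by
  funext j
  simp [Expl.mix, h]

theorem Expl.mix_some {A : Finset K} {x : K → ℝ} {i : K} (h : T.nxt A x = some i) (k : ℕ)
    (y : K → ℝ) : T.mix (k + 1) A x y = Function.update (T.mix k (insert i A) x y) i (x i) := by
  funext j
  have hi := T.subset_rev k (insert i A) x (Finset.mem_insert_self i A)
  have hiA := T.notMem h
  by_cases hj : j = i
  · subst hj
    simp [Expl.mix, T.rev_some h, hi, hiA]
  · simp [Expl.mix, T.rev_some h, hj]

theorem Expl.measurable_mix [Countable K] (k : ℕ) (A : Finset K) :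
    Measurable fun p : (K → ℝ) × (K → ℝ) => T.mix k A p.1 p.2 := by
  refine measurable_pi_lambda _ fun j => ?_
  simp only [Expl.mix]
  refine Measurable.ite ?_ ((measurable_pi_apply j).comp measurable_fst)
    ((measurable_pi_apply j).comp measurable_snd)
  exact measurable_fst ((T.measurableSet_rev k A j).inter (MeasurableSet.const _))

theorem piecewise_update {A : Finset K} {i : K} (hi : i ∉ A) (v x : K → ℝ) (e : ℝ) :
    A.piecewise v (Function.update x i e) = (insert i A).piecewise (Function.update v i e) x := by
  funext j
  by_cases hj : j = i
  · subst hj; simp [Finset.piecewise, hi]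
  · simp [Finset.piecewise, hj]

theorem measurable_piecewise (A : Finset K) (v : K → ℝ) :
    Measurable fun x : K → ℝ => A.piecewise v x := by
  refine measurable_pi_lambda _ fun j => ?_
  by_cases hj : j ∈ A
  · simp [hj]
  · simpa [hj] using measurable_pi_apply j

variable {m : K → Measure ℝ} [∀ k, IsProbabilityMeasure (m k)]

theorem measurable_update_fst (i : K) (e : ℝ) :
    Measurable fun x : K → ℝ => Function.update x i e :=
  (measurable_updateAt i).comp measurable_prodMk_right

theorem resample (i : K) {S : Set ((K → ℝ) × (K → ℝ))} (hS : MeasurableSet S) :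
    (((Measure.infinitePi m)).prod (Measure.infinitePi m)) S = ∫⁻ e, (((Measure.infinitePi m)).prod (Measure.infinitePi m)) {p | (Function.update p.1 i e, p.2) ∈ S} ∂(m i) := by
  have hm : Measurable fun x => ((Measure.infinitePi m)) (Prod.mk x ⁻¹' S) := measurable_measure_prodMk_left hS
  have e : ∫⁻ x, ((Measure.infinitePi m)) (Prod.mk x ⁻¹' S) ∂(Measure.infinitePi m) = ∫⁻ x, ((Measure.infinitePi m)) (Prod.mk x ⁻¹' S)
      ∂((((Measure.infinitePi m)).prod (m i)).map fun p => Function.update p.1 i p.2) := by rw [map_update]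
  rw [Measure.prod_apply hS, e, lintegral_map hm (measurable_updateAt i), lintegral_prod_symm
    (fun a : (K → ℝ) × ℝ => ((Measure.infinitePi m)) (Prod.mk (Function.update a.1 i a.2) ⁻¹' S))
    (hm.comp (measurable_updateAt i)).aemeasurable]
  refine lintegral_congr fun e => ?_
  have hS' : MeasurableSet {p : (K → ℝ) × (K → ℝ) | (Function.update p.1 i e, p.2) ∈ S} :=
    (((measurable_update_fst i e).comp measurable_fst).prodMk measurable_snd) hS
  rw [Measure.prod_apply hS']
  rfl

theorem resample_one (i : K) {S : Set (K → ℝ)} (hS : MeasurableSet S) :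
    ((Measure.infinitePi m)) S = ∫⁻ e, ((Measure.infinitePi m)) {x | Function.update x i e ∈ S} ∂(m i) := by
  nth_rewrite 1 [← map_update (m := m) i]
  rw [Measure.map_apply (measurable_updateAt i) hS,
    Measure.prod_apply_symm (measurable_updateAt i hS)]
  rfl

variable [Countable K]

theorem Expl.mix_law (k : ℕ) (A : Finset K) (v : K → ℝ) {F : Set (K → ℝ)} (hF : MeasurableSet F) :
    (((Measure.infinitePi m)).prod (Measure.infinitePi m)) {p | T.mix k A (A.piecewise v p.1) p.2 ∈ F} = ((Measure.infinitePi m)) F := by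
  induction k generalizing A v F with
  | zero =>
    have : {p : (K → ℝ) × (K → ℝ) | T.mix 0 A (A.piecewise v p.1) p.2 ∈ F} = univ ×ˢ F := by
      ext p; simp [Expl.mix_eq (k := 0) rfl]
    rw [this, Measure.prod_prod, measure_univ, one_mul]
  | succ k ih =>
    cases h : T.nxt A v with
    | none =>
      have : {p : (K → ℝ) × (K → ℝ) | T.mix (k + 1) A (A.piecewise v p.1) p.2 ∈ F} = univ ×ˢ F := by
        ext p
        have e : T.nxt A (A.piecewise v p.1) = none := by
          rw [← h]; exact T.dep fun j hj => by simp [hj]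
        simp [Expl.mix_eq (T.rev_none e _)]
      rw [this, Measure.prod_prod, measure_univ, one_mul]
    | some i =>
      have e : ∀ x : K → ℝ, T.nxt A (A.piecewise v x) = some i := fun x => by
        rw [← h]; exact T.dep fun j hj => by simp [hj]
      have hi := T.notMem h
      have hm := ((T.measurable_mix (k + 1) A).comp
        (((measurable_piecewise A v).comp measurable_fst).prodMk measurable_snd)) hF
      refine (resample i hm).trans ?_
      rw [resample_one i hF]
      refine lintegral_congr fun b => ?_
      refine Eq.trans ?_ (ih (insert i A) (Function.update v i b) (measurable_update_fst i b hF))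
      congr 1
      ext p
      simp only [Set.mem_ofPred_eq, mem_preimage, Function.comp]
      rw [Expl.mix_some (e _), piecewise_update hi]
      simp

variable (m) in
/-- The influence of a coordinate. -/
noncomputable def inf (F : Set (K → ℝ)) (i : K) : ENNReal :=
  (((Measure.infinitePi m)).prod (m i)) {p | Xor (Function.update p.1 i p.2 ∈ F) (p.1 ∈ F)}

theorem measurableSet_xor {Ω : Type*} [MeasurableSpace Ω] {A B : Set Ω} (hA : MeasurableSet A)
    (hB : MeasurableSet B) : MeasurableSet {x | Xor (x ∈ A) (x ∈ B)} :=
  (hA.inter hB.compl).union (hB.inter hA.compl)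

/-- The inequality of O'Donnell, Saks, Schramm and Servedio, before specialization. -/
theorem Expl.osss_aux (k : ℕ) (A : Finset K) (v : K → ℝ) {F : Set (K → ℝ)} (hF : MeasurableSet F) :
    (((Measure.infinitePi m)).prod (Measure.infinitePi m)) {p | Xor (T.mix k A (A.piecewise v p.1) p.2 ∈ F) (p.2 ∈ F)} ≤
      ∑ j ∈ T.J, ((Measure.infinitePi m)) {x | j ∈ T.rev k A (A.piecewise v x) \ A} * inf m F j := by
  induction k generalizing A v with
  | zero => simp [Expl.mix_eq (k := 0) rfl, xor_self]
  | succ k ih =>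
    cases h : T.nxt A v with
    | none =>
      have e : ∀ x : K → ℝ, T.nxt A (A.piecewise v x) = none := fun x => by
        rw [← h]; exact T.dep fun j hj => by simp [hj]
      simp [Expl.mix_eq (T.rev_none (e _) _), xor_self]
    | some i =>
      have e : ∀ x : K → ℝ, T.nxt A (A.piecewise v x) = some i := fun x => by
        rw [← h]; exact T.dep fun j hj => by simp [hj]
      have hi := T.notMem h
      have mmix := (T.measurable_mix (k + 1) A).comp
        (((measurable_piecewise A v).comp measurable_fst).prodMk measurable_snd)
      set q : ℝ → K → ENNReal := fun b j =>
        ((Measure.infinitePi m)) {x | j ∈ T.rev k (insert i A) ((insert i A).piecewise (Function.update v i b) x) \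
          insert i A} with hq
      have hmeas : ∀ j, MeasurableSet {p : (K → ℝ) × ℝ |
          j ∈ T.rev k (insert i A) ((insert i A).piecewise (Function.update v i p.2) p.1) \
          insert i A} := by
        intro j
        have e2 : Measurable fun p : (K → ℝ) × ℝ =>
            (insert i A).piecewise (Function.update v i p.2) p.1 := by
          simp only [← piecewise_update hi]
          exact (measurable_piecewise A v).comp (measurable_updateAt i)
        simp only [Finset.mem_sdiff]
        exact (e2 (T.measurableSet_rev k (insert i A) j)).inter (MeasurableSet.const _)
      have hqm : ∀ j, Measurable fun b => q b j := fun j => measurable_measure_prodMk_right (hmeas j)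
      have hqi : ∀ b, q b i = 0 := fun b => by simp [hq]
      have hpj : ∀ j, j ≠ i → ((Measure.infinitePi m)) {x | j ∈ T.rev (k + 1) A (A.piecewise v x) \ A} =
          ∫⁻ b, q b j ∂(m i) := by
        intro j hj
        rw [resample_one i]
        · refine lintegral_congr fun b => ?_
          have e3 : ∀ x : K → ℝ, T.rev (k + 1) A (A.piecewise v (Function.update x i b)) =
              T.rev k (insert i A) ((insert i A).piecewise (Function.update v i b) x) := fun x => by
            rw [T.rev_some (e _), piecewise_update hi]
          simp only [hq, Set.mem_ofPred_eq, Finset.mem_sdiff, Finset.mem_insert, hj, false_or]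
          simp only [e3]
        · simp only [Finset.mem_sdiff]
          exact (measurable_piecewise A v (T.measurableSet_rev (k + 1) A j)).inter
            (MeasurableSet.const _)
      have hpi : ((Measure.infinitePi m)) {x | i ∈ T.rev (k + 1) A (A.piecewise v x) \ A} = 1 := by
        have : {x : K → ℝ | i ∈ T.rev (k + 1) A (A.piecewise v x) \ A} = univ := by
          refine eq_univ_of_forall fun x => ?_
          rw [Set.mem_ofPred_eq, T.rev_some (e _), Finset.mem_sdiff]
          exact ⟨T.subset_rev _ _ _ (Finset.mem_insert_self _ _), hi⟩
        rw [this, measure_univ]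
      have xm := measurableSet_xor (measurable_updateAt i hF) (measurable_fst hF)
      have bound : ∀ b, (((Measure.infinitePi m)).prod (Measure.infinitePi m)) {p | (Function.update p.1 i b, p.2) ∈
          {p : (K → ℝ) × (K → ℝ) | Xor (T.mix (k + 1) A (A.piecewise v p.1) p.2 ∈ F) (p.2 ∈ F)}} ≤
          ((Measure.infinitePi m)) {x | Xor (Function.update x i b ∈ F) (x ∈ F)} + ∑ j ∈ T.J, q b j * inf m F j := by
        intro b
        have law := T.mix_law (m := m) k (insert i A) (Function.update v i b)
          (F := {x | Xor (Function.update x i b ∈ F) (x ∈ F)})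
          (measurableSet_xor (measurable_update_fst i b hF) hF)
        rw [← law]
        refine le_trans (measure_mono fun p hp => ?_)
          ((measure_union_le _ _).trans (add_le_add_right (ih _ _) _))
        simp only [Set.mem_ofPred_eq] at hp
        rw [Expl.mix_some (e _), piecewise_update hi] at hp
        simp only [Finset.piecewise_insert_self, Function.update_self] at hp
        simp only [mem_union, Set.mem_ofPred_eq]
        unfold Xor at *
        tauto
      refine (resample i (measurableSet_xor (mmix hF) (measurable_snd hF))).le.trans ?_
      refine (lintegral_mono bound).trans ?_
      rw [lintegral_add_right _ (Finset.measurable_sum _ fun j _ => (hqm j).mul_const _),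
        lintegral_finsetSum _ fun j _ => (hqm j).mul_const _]
      have e1 : ∫⁻ b, ((Measure.infinitePi m)) {x | Xor (Function.update x i b ∈ F) (x ∈ F)} ∂(m i) = inf m F i := by
        unfold inf
        exact (Measure.prod_apply_symm xm).symm
      rw [e1, ← Finset.add_sum_erase _ _ (T.mem_J h), ← Finset.add_sum_erase _ _ (T.mem_J h), hpi]
      simp only [hqi, zero_mul, lintegral_zero, zero_add, one_mul]
      refine add_le_add_right (Finset.sum_le_sum fun j hj => ?_) _
      rw [hpj j (Finset.mem_erase.1 hj).1, lintegral_mul_const _ (hqm j)]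

/-- The inequality of O'Donnell, Saks, Schramm and Servedio. -/
theorem Expl.osss {F : Set (K → ℝ)} (hF : MeasurableSet F)
    (hdet : ∀ x y, (∀ i ∈ T.rev (T.J.card + 1) ∅ x, x i = y i) → (x ∈ F ↔ y ∈ F)) :
    2 * (((Measure.infinitePi m)).real F * (1 - ((Measure.infinitePi m)).real F)) ≤
      ∑ j ∈ T.J, ((Measure.infinitePi m)).real {x | j ∈ T.rev (T.J.card + 1) ∅ x} * (inf m F j).toReal := by
  have h := T.osss_aux (m := m) (T.J.card + 1) ∅ 0 hF
  have hfin : ∀ j, inf m F j ≠ ⊤ := fun j => measure_ne_top _ _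
  have h1 : {p : (K → ℝ) × (K → ℝ) | Xor (T.mix (T.J.card + 1) ∅
      ((∅ : Finset K).piecewise 0 p.1) p.2 ∈ F) (p.2 ∈ F)} = (F ×ˢ Fᶜ) ∪ (Fᶜ ×ˢ F) := by
    ext p
    have : T.mix (T.J.card + 1) ∅ p.1 p.2 ∈ F ↔ p.1 ∈ F :=
      (hdet p.1 _ fun i hi => by simp [Expl.mix, hi]).symm
    simp only [Set.mem_ofPred_eq, Finset.piecewise_empty, this, mem_union, mem_prod, mem_compl_iff,
      Xor]
    tauto
  rw [h1] at h
  have h2 := ENNReal.toReal_mono (ENNReal.sum_ne_top.2 fun j _ =>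
    ENNReal.mul_ne_top (measure_ne_top _ _) (hfin j)) h
  rw [ENNReal.toReal_sum fun j _ => ENNReal.mul_ne_top (measure_ne_top _ _) (hfin j)] at h2
  simp only [ENNReal.toReal_mul, Finset.sdiff_empty, Finset.piecewise_empty] at h2
  refine le_trans (le_of_eq ?_) h2
  change _ = (((Measure.infinitePi m)).prod (Measure.infinitePi m)).real _
  rw [measureReal_union _ (hF.compl.prod hF), measureReal_prod_prod, measureReal_prod_prod,
    probReal_compl_eq_one_sub hF]
  · ring
  · exact Set.disjoint_left.2 fun p h h' => h'.1 h.1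

end osss

end

section

namespace Mdl

variable {K J : Type*} (M : Mdl K J) (r : J → J → Prop) (Λ : Finset J) (Z : Set J)

/-- The sites of `Λ` whose state is determined by the coordinates in `A`. -/
def det (A : Finset K) : Set J := {z | z ∈ Λ ∧ M.N z ⊆ A}

/-- The sites of `Λ` in `Z` or adjacent to the part of `X` connected to `Z`. -/
def act (X : Set J) : Set J := {y | y ∈ Λ ∧ (y ∈ Z ∨ ∃ u ∈ Z, ∃ z, Rch r X u z ∧ r z y)}

open Classical in
/-- An unexplored coordinate read by a site of `Y`. -/
noncomputable def pick (A : Finset K) (Y : Set J) : Option K :=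
  if h : ∃ k, k ∉ A ∧ ∃ y ∈ Y, k ∈ M.N y then some h.choose else none

variable {M} in
theorem pick_some {A : Finset K} {Y : Set J} {k : K} (h : M.pick A Y = some k) :
    k ∉ A ∧ ∃ y ∈ Y, k ∈ M.N y := by
  unfold pick at h
  split_ifs at h with h'
  rw [Option.some.injEq] at h
  rw [← h]
  exact h'.choose_spec

variable {M} in
theorem pick_none {A : Finset K} {Y : Set J} (h : M.pick A Y = none) {y : J} (hy : y ∈ Y) :
    M.N y ⊆ A := by
  unfold pick at h
  split_ifs at h with h'
  intro k hk
  by_contra hA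
  exact h' ⟨k, hA, y, hy, hk⟩

theorem cf_det {A : Finset K} {x x' : K → ℝ} (h : ∀ k ∈ A, x k = x' k) :
    M.cf x ∩ M.det Λ A = M.cf x' ∩ M.det Λ A := by
  ext j
  exact and_congr_left fun hj => (M.dst j).mem_iff fun k hk => h k (hj.2 hk)

variable [DecidableEq K]

/-- The exploration of the clusters of `Z` in `Λ`. -/
noncomputable def explore : Expl K where
  nxt A x := M.pick A (act r Λ Z (M.cf x ∩ M.det Λ A))
  J := Λ.biUnion M.N
  mem_J h := by
    obtain ⟨-, y, hy, hk⟩ := pick_some h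
    exact Finset.mem_biUnion.2 ⟨y, hy.1, hk⟩
  notMem h := (pick_some h).1
  dep h := by simp only [M.cf_det Λ h]
  meas A o := by
    have hL : Loc (M.det Λ A) {X | M.pick A (act r Λ Z (X ∩ M.det Λ A)) = o} := by
      intro X X' hX h
      rw [Set.mem_ofPred_eq] at h ⊢
      rwa [← hX]
    exact M.measurableSet_cf (Λ.finite_toSet.subset fun z hz => hz.1) hL

/-- The explored coordinates. -/
noncomputable def revd (x : K → ℝ) : Finset K :=
  (M.explore r Λ Z).rev ((M.explore r Λ Z).J.card + 1) ∅ x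

theorem revd_act {x : K → ℝ} {y : J}
    (hy : y ∈ act r Λ Z (M.cf x ∩ M.det Λ (M.revd r Λ Z x))) : M.N y ⊆ M.revd r Λ Z x :=
  pick_none ((M.explore r Λ Z).rev_final x) hy

theorem revd_cluster {x : K → ℝ} {u w : J} (hu : u ∈ Z) (h : Rch r (M.cf x ∩ Λ) u w) :
    Rch r (M.cf x ∩ M.det Λ (M.revd r Λ Z x)) u w := by
  induction h with
  | refl h => exact .refl ⟨h.1, h.2, M.revd_act r Λ Z ⟨h.2, Or.inl hu⟩⟩
  | step _ hzw hw ih =>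
    exact .step ih hzw ⟨hw.1, hw.2, M.revd_act r Λ Z ⟨hw.2, Or.inr ⟨u, hu, _, ih, hzw⟩⟩⟩

theorem mem_revd {x : K → ℝ} {k : K} (hk : k ∈ M.revd r Λ Z x) :
    ∃ y ∈ act r Λ Z (M.cf x ∩ Λ), k ∈ M.N y := by
  have := (M.explore r Λ Z).rev_induct (x := x)
    (p := fun A => ∀ k ∈ A, ∃ y ∈ act r Λ Z (M.cf x ∩ Λ), k ∈ M.N y) (fun A i hA hi j hj => by
      rcases Finset.mem_insert.1 hj with rfl | hj
      · obtain ⟨-, y, hy, hk⟩ := pick_some hi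
        refine ⟨y, ⟨hy.1, hy.2.imp_right ?_⟩, hk⟩
        rintro ⟨u, hu, z, hz, hzy⟩
        exact ⟨u, hu, z, hz.mono fun v hv => ⟨hv.1, hv.2.1⟩, hzy⟩
      · exact hA j hj) ((M.explore r Λ Z).J.card + 1) (A := ∅) (by simp)
  exact this k hk

variable {m : K → Measure ℝ} [∀ k, IsProbabilityMeasure (m k)]

/-- The influence of a coordinate is bounded by the pivotality of the sites reading it. -/
theorem inf_le {A : Set (Set J)} (hL : Loc (Λ : Set J) A) (hi : Inc A) {c : ℝ} (hc : 0 ≤ c)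
    (h1 : ∀ j, c ≤ (Measure.infinitePi m).real (M.fo j))
    (h2 : ∀ j, c ≤ (Measure.infinitePi m).real (M.fc j)) (k : K) [DecidablePred fun y => k ∈ M.N y] :
    c ^ (Λ.filter fun y => k ∈ M.N y).card * (inf m (M.cf ⁻¹' A) k).toReal ≤
      ∑ y ∈ Λ.filter fun y => k ∈ M.N y, (Measure.infinitePi m).real (M.cf ⁻¹' Piv A y) := by
  set D := Λ.filter fun y => k ∈ M.N y with hD
  refine le_trans (mul_le_mul_of_nonneg_left ?_ (by positivity))
    (M.joint_piv Λ.finite_toSet hL (D := D) hc (fun j _ => h1 j) fun j _ => h2 j)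
  set B := M.cf ⁻¹' {X | X ∪ D ∈ A ∧ X \ D ∉ A} with hB
  refine ENNReal.toReal_mono (measure_ne_top _ _) ?_
  have e : ((Measure.infinitePi m).prod (m k)) (B ×ˢ univ) = (Measure.infinitePi m) B := by
    rw [Measure.prod_prod, measure_univ, mul_one]
  rw [inf, ← e]
  refine measure_mono fun p hp => ⟨?_, mem_univ _⟩
  have loc : ∀ z ∈ Λ, z ∉ D → (z ∈ M.cf (Function.update p.1 k p.2) ↔ z ∈ M.cf p.1) := by
    intro z hz hzD
    refine (M.dst z).mem_iff fun i hi => ?_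
    have : i ≠ k := by
      rintro rfl
      exact hzD (Finset.mem_filter.2 ⟨hz, hi⟩)
    simp [this]
  have up : M.cf (Function.update p.1 k p.2) ∩ Λ ⊆ M.cf p.1 ∪ D := by
    rintro z ⟨hz, hzΛ⟩
    by_cases hzD : z ∈ D
    · exact Or.inr hzD
    · exact Or.inl ((loc z hzΛ hzD).1 hz)
  have dn : (M.cf p.1 \ D) ∩ Λ ⊆ M.cf (Function.update p.1 k p.2) := by
    rintro z ⟨⟨hz, hzD⟩, hzΛ⟩
    exact (loc z hzΛ hzD).2 hz
  have cut : ∀ X, X ∈ A ↔ X ∩ Λ ∈ A := fun X =>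
    ⟨fun h => hL _ _ (by rw [inter_assoc, inter_self]) h,
      fun h => hL _ _ (by rw [inter_assoc, inter_self]) h⟩
  rcases hp with ⟨hp1, hp2⟩ | ⟨hp1, hp2⟩
  · exact ⟨hi _ _ up ((cut _).1 hp1), fun h => hp2 (hi _ _ Set.sdiff_subset h)⟩
  · exact ⟨hi _ _ subset_union_left hp1, fun h => hp2 (hi _ _ dn ((cut _).1 h))⟩

variable [Countable K]

/-- The exploration inequality for an event determined by the clusters of `Z`. -/
theorem osss_explore {A : Set (Set J)} {a : J} {T : Set J}
    (hA : ∀ X, X ∈ A ↔ ∃ u ∈ Z, Rch r (X ∩ Λ) u a ∧ ∃ v ∈ T, Rch r (X ∩ Λ) u v) :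
    2 * ((Measure.infinitePi m).real (M.cf ⁻¹' A) *
        (1 - (Measure.infinitePi m).real (M.cf ⁻¹' A))) ≤
      ∑ j ∈ Λ.biUnion M.N, (Measure.infinitePi m).real {x | j ∈ M.revd r Λ Z x} *
        (inf m (M.cf ⁻¹' A) j).toReal := by
  have hL : Loc (Λ : Set J) A := by
    intro X X' hX h
    rw [hA] at h ⊢
    rwa [← hX]
  refine (M.explore r Λ Z).osss (M.measurableSet_cf Λ.finite_toSet hL) ?_
  have key : ∀ x y, (∀ i ∈ M.revd r Λ Z x, x i = y i) → x ∈ M.cf ⁻¹' A → y ∈ M.cf ⁻¹' A := by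
    intro x y h hx
    obtain ⟨u, hu, h1, v, hv, h2⟩ := (hA _).1 hx
    have sub : M.cf x ∩ M.det Λ (M.revd r Λ Z x) ⊆ M.cf y ∩ Λ := by
      rw [M.cf_det Λ h]
      exact fun z hz => ⟨hz.1, hz.2.1⟩
    exact (hA _).2 ⟨u, hu, (M.revd_cluster r Λ Z hu h1).mono sub, v, hv,
      (M.revd_cluster r Λ Z hu h2).mono sub⟩
  intro x y h
  refine ⟨key x y h, key y x ?_⟩
  have e : M.revd r Λ Z y = M.revd r Λ Z x := (M.explore r Λ Z).rev_congr _ _ h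
  rw [e]
  exact fun i hi => (h i hi).symm

end Mdl

end

section

section bern

variable {J : Type*} [DecidableEq J]

/-- The expectation of `F` over a Bernoulli subset of `S` with parameter `t`. -/
noncomputable def bern (t : ℝ) (S : Finset J) (F : Finset J → ℝ) : ℝ :=
  ∑ Z ∈ S.powerset, t ^ Z.card * (1 - t) ^ (S \ Z).card * F Z

theorem bern_insert (t : ℝ) {S : Finset J} {y : J} (hy : y ∉ S) (F : Finset J → ℝ) :
    bern t (insert y S) F = (1 - t) * bern t S F + t * bern t S fun Z => F (insert y Z) := by
  unfold bern
  rw [Finset.sum_powerset_insert hy, Finset.mul_sum, Finset.mul_sum]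
  congr 1
  · refine Finset.sum_congr rfl fun Z hZ => ?_
    have hyZ : y ∉ Z := fun h => hy (Finset.mem_powerset.1 hZ h)
    rw [Finset.insert_sdiff_of_notMem _ hyZ, Finset.card_insert_of_notMem fun h =>
      hy (Finset.mem_sdiff.1 h).1]
    ring
  · refine Finset.sum_congr rfl fun Z hZ => ?_
    have hyZ : y ∉ Z := fun h => hy (Finset.mem_powerset.1 hZ h)
    have : insert y S \ insert y Z = S \ Z := by
      ext x
      simp only [Finset.mem_sdiff, Finset.mem_insert, not_or]
      constructor
      · rintro ⟨rfl | h, h1, h2⟩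
        exacts [absurd rfl h1, ⟨h, h2⟩]
      · rintro ⟨h1, h2⟩
        exact ⟨Or.inr h1, fun e => hy (e ▸ h1), h2⟩
    rw [this, Finset.card_insert_of_notMem hyZ]
    ring

theorem bern_sub (t : ℝ) (S : Finset J) (F G : Finset J → ℝ) :
    bern t S (fun Z => F Z - G Z) = bern t S F - bern t S G := by
  simp only [bern, mul_sub, Finset.sum_sub_distrib]

theorem bern_mul (t c : ℝ) (S : Finset J) (F : Finset J → ℝ) :
    bern t S (fun Z => c * F Z) = c * bern t S F := by
  simp only [bern, Finset.mul_sum]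
  exact Finset.sum_congr rfl fun Z _ => by ring

theorem bern_mono {t : ℝ} (h0 : 0 ≤ t) (h1 : t ≤ 1) {S : Finset J} {F G : Finset J → ℝ}
    (h : ∀ Z ⊆ S, F Z ≤ G Z) : bern t S F ≤ bern t S G :=
  Finset.sum_le_sum fun Z hZ => mul_le_mul_of_nonneg_left (h Z (Finset.mem_powerset.1 hZ))
    (mul_nonneg (pow_nonneg h0 _) (pow_nonneg (by linarith) _))

theorem bern_map {J' : Type*} [DecidableEq J'] (t : ℝ) (S : Finset J) (f : J ↪ J')
    (F : Finset J' → ℝ) : bern t (S.map f) F = bern t S fun Z => F (Z.map f) := by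
  induction S using Finset.induction_on generalizing F with
  | empty => simp [bern]
  | insert y S hy ih =>
    rw [Finset.map_insert, bern_insert t (by simpa using hy), bern_insert t hy, ih, ih]
    simp only [Finset.map_insert]

/-- Russo's formula. -/
theorem bern_hasDerivAt (t : ℝ) (S : Finset J) (F : Finset J → ℝ) :
    HasDerivAt (fun t => bern t S F)
      (∑ y ∈ S, bern t (S.erase y) fun Z => F (insert y Z) - F Z) t := by
  induction S using Finset.induction_on generalizing F with
  | empty => simpa [bern] using hasDerivAt_const t (F ∅)
  | insert y S hy ih =>
    have e : (fun t => bern t (insert y S) F) =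
        fun t => (1 - t) * bern t S F + t * bern t S fun Z => F (insert y Z) :=
      funext fun t => bern_insert t hy F
    rw [e]
    refine ((((hasDerivAt_id t).const_sub 1).mul (ih F)).add
      ((hasDerivAt_id t).mul (ih fun Z => F (insert y Z)))).congr_deriv ?_
    rw [Finset.sum_insert hy, Finset.erase_insert hy, bern_sub]
    have : ∀ x ∈ S, (bern t ((insert y S).erase x) fun Z => F (insert x Z) - F Z) =
        (1 - t) * (bern t (S.erase x) fun Z => F (insert x Z) - F Z) +
        t * (bern t (S.erase x) fun Z => F (insert y (insert x Z)) - F (insert y Z)) := by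
      intro x hx
      have hxy : y ≠ x := fun e => hy (e ▸ hx)
      rw [Finset.erase_insert_of_ne hxy, bern_insert t fun h => hy (Finset.mem_of_mem_erase h)]
      simp only [Finset.insert_comm x y]
    rw [Finset.sum_congr rfl this, Finset.sum_add_distrib, ← Finset.mul_sum, ← Finset.mul_sum]
    simp only [id]
    ring

end bern

variable {d L : ℕ}

/-- The field used for sprinkling. -/
def fi0 : FI := (((0, 0), (0, 0)), false)

/-- Independent sprinkling with density `t`. -/
noncomputable def Spr.indep (h t : ℝ) : Spr d L where
  lev _ := h
  ζ x := {ω | ω (x, Sum.inr (some fi0)) ∈ Ici (1 - t)}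
  F _ := {fi0}
  mζ _ := measurableSet_eval _ measurableSet_Ici
  dζ x := (depOn_eval _ _).mono (by simp)

theorem Spr.indep_ζ (h : ℝ) {t : ℝ} (h0 : 0 ≤ t) (h1 : t ≤ 1) (x : V d) :
    (PP d L).real ((Spr.indep h t).ζ x) = t := by
  change (PP d L).real {ω | ω (x, Sum.inr (some fi0)) ∈ Ici (1 - t)} = t
  rw [PP_eval _ _ measurableSet_Ici, unif_Ici (by linarith) (by linarith)]
  ring

variable (a : V d → V d × (Fin (L + 1) × Fin d) → ℝ) (r : ℕ) {δ : ℝ}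
    (hδ : δ ∈ Ioo (0 : ℝ) 1)

theorem indep_cf (h t : ℝ) (ω : Kc d L → ℝ) :
    (hyb a r hδ (Spr.indep h t)).cf ω =
      (hyb a r hδ (Spr.plain h)).cf ω ∪ {x | ω ∈ (Spr.indep h t).ζ x} := by
  ext x
  simp [Mdl.cf, hyb, Spr.indep, Spr.plain]

theorem loc_union {J : Type*} {S : Set J} {A : Set (Set J)} (hA : Loc S A) (Z : Set J) :
    Loc S {X | X ∪ Z ∈ A} := fun X X' hX h =>
  hA _ _ (by rw [union_inter_distrib_right, union_inter_distrib_right, hX]) h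

open Classical in
theorem indep_real (h : ℝ) {t : ℝ} (h0 : 0 ≤ t) (h1 : t ≤ 1) {S : Finset (V d)}
    {A : Set (Set (V d))} (hA : Loc (S : Set (V d)) A) :
    (PP d L).real ((hyb a r hδ (Spr.indep h t)).cf ⁻¹' A) =
      bern t S fun Z => (muh a r hδ h).real {X | X ∪ Z ∈ A} := by
  set M := hyb a r hδ (Spr.indep (L := L) h t) with hM
  set M' := hyb a r hδ (Spr.plain (L := L) h) with hM'
  set ζ := (Spr.indep (d := d) (L := L) h t).ζ with hζ
  set G : Finset (V d) → V d → Set (Kc d L → ℝ) := fun Z x => if x ∈ Z then ζ x else (ζ x)ᶜ with hG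
  have mG : ∀ Z x, MeasurableSet (G Z x) := fun Z x => by
    simp only [hG]
    split_ifs
    exacts [(Spr.indep h t).mζ x, ((Spr.indep h t).mζ x).compl]
  have dG : ∀ Z x, DepOn {(x, Sum.inr (some fi0))} (G Z x) := fun Z x => by
    simp only [hG]
    split_ifs
    exacts [depOn_eval _ _, (depOn_eval _ _).compl]
  have mA : ∀ Z : Finset (V d), MeasurableSet (M'.cf ⁻¹' {X | X ∪ Z ∈ A}) := fun Z =>
    M'.measurableSet_cf S.finite_toSet (loc_union hA _)
  have split : M.cf ⁻¹' A = ⋃ Z ∈ S.powerset, M'.cf ⁻¹' {X | X ∪ Z ∈ A} ∩ ⋂ x ∈ S, G Z x := by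
    ext ω
    simp only [mem_iUnion, mem_inter_iff, mem_iInter, mem_preimage, exists_prop,
      Finset.mem_powerset, Set.mem_ofPred_eq]
    have cut : ∀ Z : Finset (V d), (∀ x ∈ S, ω ∈ G Z x) → (M.cf ω ∈ A ↔ M'.cf ω ∪ Z ∈ A) := by
      intro Z hZ
      have : M.cf ω ∩ S = (M'.cf ω ∪ Z) ∩ S := by
        rw [hM, indep_cf]
        ext x
        simp only [mem_inter_iff, mem_union, Finset.mem_coe, Set.mem_ofPred_eq]
        refine and_congr_left fun hx => or_congr_right ?_
        have := hZ x hx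
        simp only [hG] at this
        split_ifs at this with hxZ
        exacts [⟨fun _ => hxZ, fun _ => this⟩, ⟨fun h => absurd h this, fun h => absurd h hxZ⟩]
      exact ⟨hA _ _ this, hA _ _ this.symm⟩
    constructor
    · intro hω
      have hZ : ∀ x ∈ S, ω ∈ G (S.filter fun x => ω ∈ ζ x) x := by
        intro x hx
        simp only [hG, Finset.mem_filter, hx, true_and]
        split_ifs with h
        exacts [h, h]
      exact ⟨_, Finset.filter_subset _ _, (cut _ hZ).1 hω, hZ⟩
    · rintro ⟨Z, -, h1, h2⟩
      exact (cut Z h2).2 h1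
  rw [split, measureReal_biUnion_finset]
  · refine Finset.sum_congr rfl fun Z hZ => ?_
    rw [Finset.mem_powerset] at hZ
    have e1 := (M'.depOn_cf (loc_union hA (Z : Set (V d)))).indep (m := mc d L)
      (depOn_biInter fun x (_ : x ∈ S) => dG Z x) (by
        rw [Finset.disjoint_biUnion_left]
        intro x _
        rw [Finset.disjoint_biUnion_right]
        intro y _
        simp [hM', hyb, mem_nN, mem_gN, Spr.plain]) (mA Z)
        (Finset.measurableSet_biInter _ fun x _ => mG Z x)
    have e2 := indep_biInter (m := mc d L) (D := S) (fun x _ => mG Z x) (fun x _ => dG Z x) (by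
      intro x _ y _ hxy
      simp only [Finset.disjoint_singleton_left, Finset.mem_singleton]
      intro e
      exact hxy (Prod.ext_iff.1 e).1)
    have e3 : ∀ x, (Measure.infinitePi (mc d L)).real (G Z x) = if x ∈ Z then t else 1 - t := by
      intro x
      simp only [hG]
      split_ifs
      · exact Spr.indep_ζ h h0 h1 x
      · rw [probReal_compl_eq_one_sub ((Spr.indep h t).mζ x)]
        exact congrArg _ (Spr.indep_ζ h h0 h1 x)
    have e4 : S.filter (· ∈ Z) = Z := by
      ext x; simp only [Finset.mem_filter, and_iff_right_iff_imp]; exact fun h => hZ h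
    have e5 : S.filter (· ∉ Z) = S \ Z := by
      ext x; simp
    simp only [e3, Finset.prod_ite, Finset.prod_const, e4, e5] at e2
    beta_reduce
    rw [muh_real a r hδ h S.finite_toSet (loc_union hA _), mul_comm, ← e2]
    exact e1
  · intro Z hZ Z' hZ' hne
    refine Set.disjoint_left.2 fun ω h1 h2 => hne ?_
    have k1 := h1.2
    have k2 := h2.2
    simp only [mem_iInter, hG] at k1 k2
    rw [Finset.mem_coe, Finset.mem_powerset] at hZ hZ'
    ext x
    constructor
    · intro hx
      have := k1 x (hZ hx)
      rw [if_pos hx] at this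
      by_contra hx'
      have h3 := k2 x (hZ hx)
      rw [if_neg hx'] at h3
      exact h3 this
    · intro hx
      have := k2 x (hZ' hx)
      rw [if_pos hx] at this
      by_contra hx'
      have h3 := k1 x (hZ' hx)
      rw [if_neg hx'] at h3
      exact h3 this
  · exact fun Z _ => (mA Z).inter (Finset.measurableSet_biInter _ fun x _ => mG Z x)

theorem indep_arm_eq (h : ℝ) {t : ℝ} (h0 : 0 ≤ t) (h1 : t ≤ 1)
    (hμ : Good (muh a r hδ h) (2 * r) (δ / 4)) (z : V d) {n m : ℕ} (hnm : n ≤ m) :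
    (PP d L).real ((hyb a r hδ (Spr.indep h t)).cf ⁻¹' Arm z n m) =
      (PP d L).real ((hyb a r hδ (Spr.indep h t)).cf ⁻¹' Arm 0 n m) := by
  classical
  set e : V d ≃ V d := Equiv.addLeft z with he
  have hS : ((bxF (0 : V d) m).map e.toEmbedding : Finset (V d)) = bxF z m := by
    ext y
    simp only [Finset.mem_map_equiv, mem_bxF]
    rw [← (LIso.addLeft z).dinf_eq]
    simp [he]
  have hc : ∀ x : V d, ((bxF x m : Finset (V d)) : Set (V d)) = Bx x m := fun x => by simp [bxF]
  rw [indep_real a r hδ h h0 h1 (S := bxF z m) (by rw [hc]; exact loc_Arm hnm),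
    indep_real a r hδ h h0 h1 (S := bxF 0 m) (by rw [hc]; exact loc_Arm hnm), ← hS, bern_map]
  congr 1
  funext Z
  rw [← hμ.inv e (LIso.addLeft z) (Bx z m) _ (finite_Bx z m) (loc_union (loc_Arm hnm) _)]
  congr 1
  ext X
  have := (LIso.addLeft z).arm_iff (a := 0) (n := n) (m := m) (X := X ∪ Z)
  simp only [Set.mem_ofPred_eq]
  rw [← this, image_union]
  simp [he]

end

section

theorem sum_range_dist_le {f : ℕ → ℝ} (hf : ∀ i, 0 ≤ f i) {a n : ℕ} (ha : a ≤ n) (hn : 1 ≤ n) :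
    ∑ k ∈ Finset.range n, f ((a - k) + (k - a) - 1) ≤ 3 * ∑ i ∈ Finset.range n, f i := by
  have shift : ∀ m : ℕ, ∑ i ∈ Finset.range m, f (i - 1) ≤ f 0 + ∑ i ∈ Finset.range m, f i := by
    intro m
    cases m with
    | zero => simpa using hf 0
    | succ m =>
      rw [Finset.sum_range_succ', Finset.sum_range_succ]
      simp only [Nat.add_sub_cancel, Nat.zero_sub]
      linarith [hf m]
  have sub : ∀ m ≤ n, ∑ i ∈ Finset.range m, f i ≤ ∑ i ∈ Finset.range n, f i := fun m hm =>
    Finset.sum_le_sum_of_subset_of_nonneg (Finset.range_mono hm) fun i _ _ => hf i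
  have h0 : f 0 ≤ ∑ i ∈ Finset.range n, f i := by simpa using sub 1 hn
  rw [← Finset.sum_range_add_sum_Ico _ ha, Finset.sum_Ico_eq_sum_range]
  have e1 : ∑ k ∈ Finset.range a, f ((a - k) + (k - a) - 1) = ∑ i ∈ Finset.range a, f i := by
    rw [← Finset.sum_range_reflect]
    refine Finset.sum_congr rfl fun k hk => ?_
    rw [Finset.mem_range] at hk
    congr 1
    omega
  have e2 : ∑ k ∈ Finset.range (n - a), f ((a - (a + k)) + (a + k - a) - 1) =
      ∑ k ∈ Finset.range (n - a), f (k - 1) := by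
    refine Finset.sum_congr rfl fun k _ => ?_
    congr 1
    omega
  rw [e1, e2]
  linarith [sub a ha, sub (n - a) (Nat.sub_le _ _), shift (n - a)]

variable {d : ℕ}

theorem arm_iff_through {n k : ℕ} (hk : k ≤ n) (X : Set (V d)) :
    X ∈ Arm 0 0 n ↔ ∃ u ∈ Sph (0 : V d) k, Rch adj (X ∩ (bxF (0 : V d) n : Finset (V d))) u 0 ∧
      ∃ v ∈ Sph (0 : V d) n, Rch adj (X ∩ (bxF (0 : V d) n : Finset (V d))) u v := by
  have hc : ((bxF (0 : V d) n : Finset (V d)) : Set (V d)) = Bx 0 n := by simp [bxF]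
  rw [hc]
  constructor
  · intro h
    obtain ⟨x, hx, y, hy, h⟩ := (arm_iff (Nat.zero_le n)).1 h
    obtain rfl : 0 = x := dinf_eq_zero.1 (Nat.le_zero.1 hx)
    have hy' : dinf 0 y = n := hy
    obtain ⟨w, h1, h2, h3⟩ := Cn.first_hit (n := k) 0 h (by simp [dinf_self]) (by omega)
    exact ⟨w, h2, Cn.symm (h1.mono inter_subset_left), y, hy, h3⟩
  · rintro ⟨u, -, h1, v, hv, h2⟩
    exact ⟨0, self_mem_Bx 0 0, v, hv, ((Cn.symm h1).trans h2).mono inter_subset_left⟩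

namespace Mdl

variable {K : Type*} [DecidableEq K] [Countable K] (M : Mdl K (V d)) {m : K → Measure ℝ}
  [∀ k, IsProbabilityMeasure (m k)]

open Classical in
/-- The averaged exploration inequality for the one-arm event. -/
theorem osss_arm {c B : ℝ} (hc : 0 < c) (hc1 : c ≤ 1) (h1 : ∀ j, c ≤ ((Measure.infinitePi m)).real (M.fo j))
    (h2 : ∀ j, c ≤ ((Measure.infinitePi m)).real (M.fc j)) {n M₁ M₂ : ℕ}
    (hM₁ : ∀ k, ((bxF (0 : V d) n).filter fun y => k ∈ M.N y).card ≤ M₁)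
    (hM₂ : ∀ y, (M.N y).card ≤ M₂)
    (hB : ∀ y ∈ bxF (0 : V d) n, ∑ k ∈ Finset.range n,
      ((Measure.infinitePi m)).real {x | y ∈ act adj (bxF (0 : V d) n) (Sph 0 k) (M.cf x ∩ (bxF (0 : V d) n))} ≤ B) :
    c ^ M₁ * (n * (2 * (((Measure.infinitePi m)).real (M.cf ⁻¹' Arm 0 0 n) *
        (1 - ((Measure.infinitePi m)).real (M.cf ⁻¹' Arm 0 0 n))))) ≤
      M₁ * B * (M₂ * ∑ y ∈ bxF (0 : V d) n, ((Measure.infinitePi m)).real (M.cf ⁻¹' Piv (Arm 0 0 n) y)) := by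
  set Λ := bxF (0 : V d) n with hΛ
  set A : Set (Set (V d)) := Arm 0 0 n with hA
  set J := Λ.biUnion M.N with hJ
  have hL : Loc (Λ : Set (V d)) A := by
    rw [show (Λ : Set (V d)) = Bx 0 n by simp [hΛ, bxF]]
    exact loc_Arm (Nat.zero_le n)
  set I : K → ℝ := fun j => (inf m (M.cf ⁻¹' A) j).toReal with hI
  have hI0 : ∀ j, 0 ≤ I j := fun j => ENNReal.toReal_nonneg
  set D : K → Finset (V d) := fun j => Λ.filter fun y => j ∈ M.N y with hD
  have hB0 : 0 ≤ B := by
    have h0 : (0 : V d) ∈ Λ := mem_bxF.2 (by simp [dinf_self])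
    exact le_trans (Finset.sum_nonneg fun _ _ => measureReal_nonneg) (hB 0 h0)
  have rev_le : ∀ j, ∑ k ∈ Finset.range n,
      ((Measure.infinitePi m)).real {x | j ∈ M.revd adj Λ (Sph 0 k) x} ≤ M₁ * B := by
    intro j
    have s1 : ∀ k, ((Measure.infinitePi m)).real {x | j ∈ M.revd adj Λ (Sph 0 k) x} ≤
        ∑ y ∈ D j, ((Measure.infinitePi m)).real {x | y ∈ act adj Λ (Sph 0 k) (M.cf x ∩ Λ)} := by
      intro k
      refine le_trans (measureReal_mono ?_ (measure_ne_top _ _)) (measureReal_biUnion_finset_le _ _)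
      intro x hx
      obtain ⟨y, hy, hj⟩ := M.mem_revd adj Λ (Sph 0 k) hx
      simp only [mem_iUnion]
      exact ⟨y, Finset.mem_filter.2 ⟨hy.1, hj⟩, hy⟩
    refine (Finset.sum_le_sum fun k _ => s1 k).trans ?_
    rw [Finset.sum_comm]
    refine (Finset.sum_le_sum fun y hy => hB y (Finset.mem_filter.1 hy).1).trans ?_
    rw [Finset.sum_const, nsmul_eq_mul]
    exact mul_le_mul_of_nonneg_right (by exact_mod_cast hM₁ j) hB0
  have main : (n : ℝ) * (2 * (((Measure.infinitePi m)).real (M.cf ⁻¹' A) * (1 - ((Measure.infinitePi m)).real (M.cf ⁻¹' A)))) ≤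
      ∑ j ∈ J, M₁ * B * I j := by
    have s2 : ∀ k ∈ Finset.range n, 2 * (((Measure.infinitePi m)).real (M.cf ⁻¹' A) * (1 - ((Measure.infinitePi m)).real (M.cf ⁻¹' A))) ≤
        ∑ j ∈ J, ((Measure.infinitePi m)).real {x | j ∈ M.revd adj Λ (Sph 0 k) x} * I j := fun k hk =>
      M.osss_explore adj Λ (Sph 0 k) (arm_iff_through (Finset.mem_range.1 hk).le)
    have s3 := Finset.sum_le_sum s2
    rw [Finset.sum_const, Finset.card_range, nsmul_eq_mul, Finset.sum_comm] at s3
    refine s3.trans (Finset.sum_le_sum fun j _ => ?_)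
    rw [← Finset.sum_mul]
    exact mul_le_mul_of_nonneg_right (rev_le j) (hI0 j)
  have inf_j : ∀ j, c ^ M₁ * I j ≤ ∑ y ∈ D j, ((Measure.infinitePi m)).real (M.cf ⁻¹' Piv A y) := fun j =>
    (mul_le_mul_of_nonneg_right (pow_le_pow_of_le_one hc.le hc1 (hM₁ j)) (hI0 j)).trans
      (M.inf_le Λ hL inc_Arm hc.le h1 h2 j)
  calc c ^ M₁ * _ ≤ c ^ M₁ * ∑ j ∈ J, M₁ * B * I j := mul_le_mul_of_nonneg_left main (by positivity)
    _ = M₁ * B * ∑ j ∈ J, c ^ M₁ * I j := by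
      rw [Finset.mul_sum, Finset.mul_sum]
      exact Finset.sum_congr rfl fun j _ => by ring
    _ ≤ M₁ * B * ∑ j ∈ J, ∑ y ∈ D j, ((Measure.infinitePi m)).real (M.cf ⁻¹' Piv A y) :=
      mul_le_mul_of_nonneg_left (Finset.sum_le_sum fun j _ => inf_j j) (by positivity)
    _ ≤ _ := by
      refine mul_le_mul_of_nonneg_left ?_ (by positivity)
      have : ∀ j ∈ J, ∑ y ∈ D j, ((Measure.infinitePi m)).real (M.cf ⁻¹' Piv A y) =
          ∑ y ∈ Λ, if j ∈ M.N y then ((Measure.infinitePi m)).real (M.cf ⁻¹' Piv A y) else 0 := fun j _ => by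
        simp only [hD, Finset.sum_filter]
      rw [Finset.sum_congr rfl this, Finset.sum_comm, Finset.mul_sum]
      refine Finset.sum_le_sum fun y _ => ?_
      rw [← Finset.sum_filter, Finset.sum_const, nsmul_eq_mul]
      refine mul_le_mul_of_nonneg_right ?_ measureReal_nonneg
      have : (J.filter fun j => j ∈ M.N y).card ≤ (M.N y).card :=
        Finset.card_le_card fun j hj => (Finset.mem_filter.1 hj).2
      exact_mod_cast this.trans (hM₂ y)

end Mdl

theorem act_subset_arm {n k : ℕ} {y : V d} {X : Set (V d)}
    (h : 2 ≤ (dinf 0 y - k) + (k - dinf 0 y))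
    (hy : y ∈ Mdl.act adj (bxF (0 : V d) n) (Sph 0 k) (X ∩ (bxF (0 : V d) n : Finset (V d)))) :
    ∃ z ∈ bxF y 1, X ∈ Arm z 0 ((dinf 0 y - k) + (k - dinf 0 y) - 1) := by
  rcases hy.2 with hy | ⟨u, hu, z, huz, hzy⟩
  · have : dinf 0 y = k := hy
    omega
  · have hu' : dinf 0 u = k := hu
    have h1 : dinf y z ≤ 1 := dinf_of_adj (adj_symm hzy)
    refine ⟨z, mem_bxF.2 h1, (arm_iff (Nat.zero_le _)).2
      (arm_of_conn (self_mem_Bx z 0) (Nat.zero_le _) ?_ (Cn.symm (huz.mono inter_subset_left)))⟩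
    have t1 := dinf_triangle 0 y z
    have t2 := dinf_triangle 0 z y
    have t3 := dinf_triangle 0 z u
    have t4 := dinf_triangle 0 u z
    rw [dinf_comm z y] at t2
    rw [dinf_comm u z] at t4
    omega

end

section

variable {d L : ℕ} (a : V d → V d × (Fin (L + 1) × Fin d) → ℝ) (r : ℕ) {δ : ℝ}
    (hδ : δ ∈ Ioo (0 : ℝ) 1)

theorem coe_bxF (x : V d) (n : ℕ) : ((bxF x n : Finset (V d)) : Set (V d)) = Bx x n := by
  simp [bxF]

open Classical in
/-- The one-arm probability for the level set with independent sprinkling of density `t`. -/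
noncomputable def thet (h : ℝ) (n : ℕ) (t : ℝ) : ℝ :=
  bern t (bxF (0 : V d) n) fun Z => (muh a r hδ h).real {X | X ∪ Z ∈ Arm 0 0 n}

theorem thet_eq (h : ℝ) (n : ℕ) {t : ℝ} (h0 : 0 ≤ t) (h1 : t ≤ 1) :
    thet a r hδ h n t = (PP d L).real ((hyb a r hδ (Spr.indep h t)).cf ⁻¹' Arm 0 0 n) := by
  classical
  have := indep_real a r hδ h h0 h1 (S := bxF (0 : V d) n) (A := Arm 0 0 n)
    (by rw [coe_bxF]; exact loc_Arm (Nat.zero_le n))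
  rw [this, thet]

theorem thet_zero (h : ℝ) (n : ℕ) : thet a r hδ h n 0 = (muh a r hδ h).real (Arm 0 0 n) := by
  unfold thet bern
  rw [Finset.sum_eq_single ∅]
  · simp
  · intro Z _ hZ
    rw [zero_pow (by simpa using hZ)]
    simp
  · simp

theorem thet_nonneg (h : ℝ) (n : ℕ) {t : ℝ} (h0 : 0 ≤ t) (h1 : t ≤ 1) :
    0 ≤ thet a r hδ h n t := by
  rw [thet_eq a r hδ h n h0 h1]
  exact measureReal_nonneg

theorem thet_anti (h : ℝ) {n m : ℕ} (hnm : n ≤ m) {t : ℝ} (h0 : 0 ≤ t) (h1 : t ≤ 1) :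
    thet a r hδ h m t ≤ thet a r hδ h n t := by
  rw [thet_eq a r hδ h n h0 h1, thet_eq a r hδ h m h0 h1]
  exact measureReal_mono (preimage_mono (arm_anti le_rfl (Nat.zero_le n) hnm)) (measure_ne_top _ _)

theorem thet_le_one (h : ℝ) (n : ℕ) {t : ℝ} (h0 : 0 ≤ t) (h1 : t ≤ 1) :
    thet a r hδ h n t ≤ 1 := by
  rw [thet_eq a r hδ h n h0 h1]
  exact measureReal_le_one

theorem zero_mem_of_arm {n : ℕ} {X : Set (V d)} (h : X ∈ Arm 0 0 n) : (0 : V d) ∈ X := by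
  obtain ⟨x, hx, y, -, h⟩ := h
  obtain rfl : 0 = x := dinf_eq_zero.1 (Nat.le_zero.1 hx)
  exact h.left_mem

theorem mem_arm_zero {X : Set (V d)} {z : V d} (h : z ∈ X) : X ∈ Arm z 0 0 :=
  ⟨z, self_mem_Bx z 0, z, dinf_self z, Rch.refl h⟩

theorem thet_zero_ge (h : ℝ) {t : ℝ} (h0 : 0 ≤ t) (h1 : t ≤ 1) :
    δ / 4 ≤ thet a r hδ h 0 t := by
  rw [thet_eq a r hδ h 0 h0 h1]
  refine (hyb_fo a r hδ (Spr.indep h t) 0).trans (measureReal_mono ?_ (measure_ne_top _ _))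
  intro ω hω
  exact mem_arm_zero ((hyb a r hδ (Spr.indep h t)).fo_sub 0 hω)

theorem thet_le_close (h : ℝ) (n : ℕ) {t : ℝ} (h0 : 0 ≤ t) (h1 : t ≤ 1 / 2) :
    thet a r hδ h n t ≤ 1 - δ / 4 := by
  rw [thet_eq a r hδ h n h0 (by linarith)]
  set M := hyb a r hδ (Spr.indep (d := d) (L := L) h t) with hM
  have h2 := hyb_fc a r hδ (Spr.indep (d := d) (L := L) h t) 0
    (by rw [Spr.indep_ζ h h0 (by linarith)]; exact h1)
  have h3 : (PP d L).real (M.cf ⁻¹' Arm 0 0 n) ≤ (PP d L).real (M.fc 0)ᶜ :=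
    measureReal_mono (fun ω hω hf => Set.disjoint_left.1 (M.fc_dis 0) hf (zero_mem_of_arm hω))
      (measure_ne_top _ _)
  rw [probReal_compl_eq_one_sub (M.mfc 0)] at h3
  linarith

open Classical in
theorem piv_le_russo {h : ℝ} (hμ : Good (muh a r hδ h) (2 * r) (δ / 4)) {t : ℝ} (h0 : 0 ≤ t)
    (h1 : t ≤ 1) {S : Finset (V d)} {A : Set (Set (V d))} (hA : Loc (S : Set (V d)) A)
    (hi : Inc A) (y : V d) :
    δ / 4 * (PP d L).real ((hyb a r hδ (Spr.indep h t)).cf ⁻¹' Piv A y) ≤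
      bern t (S.erase y) fun Z => (muh a r hδ h).real {X | X ∪ (insert y Z : Finset (V d)) ∈ A} -
        (muh a r hδ h).real {X | X ∪ Z ∈ A} := by
  have hP : Loc ((S.erase y : Finset (V d)) : Set (V d)) (Piv A y) := by
    rw [Finset.coe_erase]
    exact loc_Piv hA y
  rw [indep_real a r hδ h h0 h1 hP, ← bern_mul]
  refine bern_mono h0 h1 fun Z hZ => ?_
  have h2 := hμ.close _ {y} _ (S.erase y).finite_toSet (finite_singleton y) (loc_union hP Z)
    (by simp)
  rw [ncard_singleton, pow_one] at h2
  have mZ : ∀ Z : Finset (V d), MeasurableSet {X : Set (V d) | X ∪ Z ∈ A} := fun Z =>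
    Loc.measurableSet S.finite_toSet (loc_union hA _)
  have hyZ : y ∉ Z := fun hy => (Finset.mem_erase.1 (hZ hy)).1 rfl
  have sub : {X : Set (V d) | X ∪ Z ∈ A} ⊆ {X | X ∪ (insert y Z : Finset (V d)) ∈ A} := fun X hX =>
    hi (X ∪ Z) _ (union_subset_union_right X (Finset.coe_subset.2 (Finset.subset_insert y Z))) hX
  rw [← measureReal_sdiff sub (mZ Z)]
  refine h2.trans (measureReal_mono ?_ (measure_ne_top _ _))
  rintro X ⟨⟨hX1, hX2⟩, hXy⟩
  have hyX : y ∉ X := by simpa using hXy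
  refine ⟨?_, fun hX => hX2 ?_⟩
  · have : X ∪ (insert y Z : Finset (V d)) = X ∪ Z ∪ {y} := by
      rw [Finset.coe_insert, union_assoc, union_singleton]
    rw [Set.mem_ofPred_eq, this]
    exact hX1
  · rwa [Set.sdiff_singleton_eq_self]
    simp [hyX, hyZ]

open Classical in
theorem card_filter_N_le (s : Spr d L) (n : ℕ) (k : Kc d L) :
    ((bxF (0 : V d) n).filter fun y => k ∈ (hyb a r hδ s).N y).card ≤ (2 * r + 1) ^ d := by
  rw [← card_bxF k.1 r]
  refine Finset.card_le_card fun y hy => ?_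
  rcases Finset.mem_union.1 (Finset.mem_filter.1 hy).2 with h | h
  · rw [mem_bxF, dinf_comm]
    exact ((mem_gN r y).1 h).1
  · have : k.1 = y := by
      rcases Finset.mem_insert.1 h with rfl | h
      · rfl
      · obtain ⟨i, -, rfl⟩ := Finset.mem_image.1 h
        rfl
    rw [mem_bxF, this, dinf_self]
    exact Nat.zero_le _

theorem card_N_le (h t : ℝ) (y : V d) : ((hyb a r hδ (Spr.indep (L := L) h t)).N y).card ≤
    (2 * r + 1) ^ d * ((L + 1) * d) + 2 := by
  refine (Finset.card_union_le _ _).trans (Nat.add_le_add ?_ ?_)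
  · rw [gN, ← card_bxF y r]
    refine Finset.card_image_le.trans ?_
    simp [Finset.card_product]
  · refine (Finset.card_insert_le _ _).trans (Nat.add_le_add_right ?_ 1)
    exact Finset.card_image_le

theorem act_prob_le {h : ℝ} (hμ : Good (muh a r hδ h) (2 * r) (δ / 4)) {t : ℝ} (h0 : 0 ≤ t)
    (h1 : t ≤ 1) (n k : ℕ) (y : V d) :
    (PP d L).real {x | y ∈ Mdl.act adj (bxF (0 : V d) n) (Sph 0 k)
      ((hyb a r hδ (Spr.indep h t)).cf x ∩ (bxF (0 : V d) n : Finset (V d)))} ≤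
      3 ^ d / (δ / 4) * thet a r hδ h ((dinf 0 y - k) + (k - dinf 0 y) - 1) t := by
  set M := hyb a r hδ (Spr.indep (d := d) (L := L) h t) with hM
  have hδ0 := hδ.1
  have hδ1 := hδ.2
  set i := (dinf 0 y - k) + (k - dinf 0 y) with hi
  have h3 : (1 : ℝ) ≤ 3 ^ d := one_le_pow₀ (by norm_num)
  rcases le_or_gt 2 i with h2 | h2
  · refine le_trans (measureReal_mono (s₂ := ⋃ z ∈ bxF y 1, M.cf ⁻¹' Arm z 0 (i - 1)) ?_
      (measure_ne_top _ _)) ((measureReal_biUnion_finset_le _ _).trans ?_)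
    · intro x hx
      obtain ⟨z, hz, hx⟩ := act_subset_arm h2 hx
      simp only [mem_iUnion]
      exact ⟨z, hz, hx⟩
    · rw [Finset.sum_congr rfl fun z _ => indep_arm_eq a r hδ h h0 h1 hμ z (Nat.zero_le (i - 1)),
        Finset.sum_const, card_bxF, nsmul_eq_mul, ← thet_eq a r hδ h (i - 1) h0 h1]
      refine mul_le_mul_of_nonneg_right ?_ (thet_nonneg a r hδ h _ h0 h1)
      rw [le_div_iff₀ (by linarith)]
      push_cast
      norm_num
      nlinarith
  · have hi0 : i - 1 = 0 := by omega
    rw [hi0]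
    refine measureReal_le_one.trans ?_
    have h4 := thet_zero_ge (d := d) a r hδ h h0 h1
    rw [div_mul_eq_mul_div, le_div_iff₀ (by linarith)]
    nlinarith

theorem osss_arith {c cm m₁ m₂ b n θ S D Q : ℝ} (hc : 0 < c) (hcm : 0 < cm) (hm₁ : 0 ≤ m₁)
    (hm₂ : 0 ≤ m₂) (hb : 0 ≤ b) (hn : 0 ≤ n) (hθ0 : 0 ≤ θ) (hθ1 : θ ≤ 1 - c) (hS : 0 ≤ S)
    (hQ : c * Q ≤ D) (key : cm * (n * (2 * (θ * (1 - θ)))) ≤ m₁ * (b * (3 * S)) * (m₂ * Q)) :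
    n * θ ≤ m₁ * (b * 3) * m₂ / c / (cm * (2 * c)) * S * D := by
  have low : cm * (2 * c) * (n * θ) ≤ cm * (n * (2 * (θ * (1 - θ)))) := by
    have h1 : c * θ ≤ θ * (1 - θ) := by nlinarith
    have h2 : n * (2 * (c * θ)) ≤ n * (2 * (θ * (1 - θ))) := by gcongr
    have h3 := mul_le_mul_of_nonneg_left h2 hcm.le
    linarith
  have up : m₁ * (b * (3 * S)) * (m₂ * Q) ≤ m₁ * (b * 3) * m₂ / c * S * D := by
    have : m₁ * (b * (3 * S)) * (m₂ * Q) = m₁ * (b * 3) * m₂ / c * S * (c * Q) := by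
      field_simp
    rw [this]
    exact mul_le_mul_of_nonneg_left hQ (by positivity)
  have fin := low.trans (key.trans up)
  rw [mul_comm, ← le_div_iff₀ (by positivity)] at fin
  refine fin.trans (le_of_eq ?_)
  ring

/-- The differential inequality for the sprinkled one-arm probability. -/
theorem thet_diff_ineq {h : ℝ} (hμ : Good (muh a r hδ h) (2 * r) (δ / 4)) :
    ∃ K : ℝ, 0 < K ∧ ∀ n : ℕ, 1 ≤ n → ∀ t : ℝ, 0 ≤ t → t ≤ 1 / 2 →
      ∃ D : ℝ, HasDerivAt (thet a r hδ h n) D t ∧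
        n * thet a r hδ h n t ≤ K * (∑ i ∈ Finset.range n, thet a r hδ h i t) * D := by
  classical
  have hδ0 := hδ.1
  have hδ1 := hδ.2
  set c := δ / 4 with hc
  have hc0 : 0 < c := by rw [hc]; linarith
  set M₁ := (2 * r + 1) ^ d with hM₁
  set M₂ := (2 * r + 1) ^ d * ((L + 1) * d) + 2 with hM₂
  have hM₁0 : (0 : ℝ) < M₁ := by rw [hM₁]; positivity
  have hM₂0 : (0 : ℝ) < M₂ := by rw [hM₂]; positivity
  refine ⟨M₁ * (3 ^ d / c * 3) * M₂ / c / (c ^ M₁ * (2 * c)), by positivity, ?_⟩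
  intro n hn t h0 h1
  have h1' : t ≤ 1 := by linarith
  set M := hyb a r hδ (Spr.indep (d := d) (L := L) h t) with hM
  set A : Set (Set (V d)) := Arm 0 0 n with hA
  have hLoc : Loc ((bxF (0 : V d) n : Finset (V d)) : Set (V d)) A := by
    rw [coe_bxF]
    exact loc_Arm (Nat.zero_le n)
  set Sn := ∑ i ∈ Finset.range n, thet a r hδ h i t with hSn
  refine ⟨_, bern_hasDerivAt t _ _, ?_⟩
  set D := ∑ y ∈ bxF (0 : V d) n, bern t ((bxF (0 : V d) n).erase y) _ with hD
  have rus : c * ∑ y ∈ bxF (0 : V d) n, (PP d L).real (M.cf ⁻¹' Piv A y) ≤ D := by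
    rw [Finset.mul_sum]
    exact Finset.sum_le_sum fun y _ => piv_le_russo a r hδ hμ h0 h1' hLoc inc_Arm y
  have hB : ∀ y ∈ bxF (0 : V d) n, ∑ k ∈ Finset.range n,
      (PP d L).real {x | y ∈ Mdl.act adj (bxF (0 : V d) n) (Sph 0 k)
        (M.cf x ∩ (bxF (0 : V d) n : Finset (V d)))} ≤ 3 ^ d / c * (3 * Sn) := by
    intro y hy
    refine (Finset.sum_le_sum fun k _ => act_prob_le a r hδ hμ h0 h1' n k y).trans ?_
    rw [← Finset.mul_sum]
    exact mul_le_mul_of_nonneg_left (sum_range_dist_le (f := fun i => thet a r hδ h i t)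
      (fun i => thet_nonneg a r hδ h i h0 h1') (mem_bxF.1 hy) hn) (by positivity)
  have key := M.osss_arm (m := mc d L) hc0 (by rw [hc]; linarith) (hyb_fo a r hδ _)
    (fun j => hyb_fc a r hδ _ j (by rw [Spr.indep_ζ h h0 h1']; exact h1))
    (card_filter_N_le a r hδ _ n) (card_N_le a r hδ h t) hB
  change c ^ M₁ * (n * (2 * ((PP d L).real (M.cf ⁻¹' Arm 0 0 n) *
    (1 - (PP d L).real (M.cf ⁻¹' Arm 0 0 n))))) ≤ M₁ * (3 ^ d / c * (3 * Sn)) * (M₂ *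
      ∑ y ∈ bxF (0 : V d) n, (PP d L).real (M.cf ⁻¹' Piv (Arm 0 0 n) y)) at key
  rw [← thet_eq a r hδ h n h0 h1'] at key
  set θ := thet a r hδ h n t with hθ
  have hθ0 : 0 ≤ θ := thet_nonneg a r hδ h n h0 h1'
  have hθ1 : θ ≤ 1 - c := thet_le_close a r hδ h n h0 h1
  have hSn0 : 0 ≤ Sn := Finset.sum_nonneg fun i _ => thet_nonneg a r hδ h i h0 h1'
  set Q := ∑ y ∈ bxF (0 : V d) n, (PP d L).real (M.cf ⁻¹' Piv (Arm 0 0 n) y) with hQ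
  exact osss_arith hc0 (pow_pos hc0 _) hM₁0.le hM₂0.le (by positivity) (Nat.cast_nonneg n) hθ0 hθ1 hSn0
    rus key

end

section

theorem mul_sub_le_of_hasDerivAt {f f' : ℝ → ℝ} {a b C : ℝ} (hab : a ≤ b)
    (hf : ∀ u ∈ Icc a b, HasDerivAt f (f' u) u) (hC : ∀ u ∈ Icc a b, C ≤ f' u) :
    C * (b - a) ≤ f b - f a := by
  refine (convex_Icc a b).mul_sub_le_image_sub_of_le_deriv
    (fun u hu => (hf u hu).continuousAt.continuousWithinAt)
    (fun u hu => (hf u (interior_subset hu)).differentiableAt.differentiableWithinAt)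
    (fun u hu => ?_) a (left_mem_Icc.2 hab) b (right_mem_Icc.2 hab) hab
  rw [(hf u (interior_subset hu)).deriv]
  exact hC u (interior_subset hu)

theorem eventually_log_le_sqrt {A B s : ℝ} (hs : 0 < s) :
    ∃ N : ℕ, ∀ n : ℕ, N ≤ n → A * Real.log (2 * n + 1) + B ≤ s * Real.sqrt n := by
  have h1 : (fun x : ℝ => |A| * (Real.log 3 + Real.log x) + |B|) =o[atTop]
      fun x : ℝ => x ^ (1 / 2 : ℝ) := by
    have hc : ∀ C : ℝ, (fun _ : ℝ => C) =o[atTop] fun x : ℝ => x ^ (1 / 2 : ℝ) := fun C =>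
      Asymptotics.isLittleO_const_left.2 (Or.inr
        (tendsto_norm_atTop_atTop.comp (tendsto_rpow_atTop (by norm_num))))
    exact (((hc _).add (isLittleO_log_rpow_atTop (by norm_num))).const_mul_left _).add (hc _)
  have h2 := (tendsto_natCast_atTop_atTop (R := ℝ)).eventually (h1.bound hs)
  obtain ⟨N, hN⟩ := eventually_atTop.1 h2
  refine ⟨max N 1, fun n hn => ?_⟩
  have hn1 : (1 : ℝ) ≤ n := by exact_mod_cast (le_max_right N 1).trans hn
  have h3 := hN n ((le_max_left _ _).trans hn)
  rw [← Real.sqrt_eq_rpow, Real.norm_of_nonneg (Real.sqrt_nonneg _)] at h3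
  refine le_trans ?_ ((Real.le_norm_self _).trans h3)
  have h4 : Real.log (2 * n + 1) ≤ Real.log 3 + Real.log n := by
    rw [← Real.log_mul (by norm_num) (by positivity)]
    exact Real.log_le_log (by positivity) (by linarith)
  have h5 : 0 ≤ Real.log (2 * n + 1) := Real.log_nonneg (by linarith)
  have h6 := mul_le_mul_of_nonneg_right (le_abs_self A) h5
  have h7 := mul_le_mul_of_nonneg_left h4 (abs_nonneg A)
  linarith [le_abs_self B]

theorem sum_Icc_inv_le (n : ℕ) : ∑ i ∈ Finset.Icc 1 n, (1 : ℝ) / i ≤ 1 + Real.log n := by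
  have := harmonic_le_one_add_log n
  rw [harmonic_eq_sum_Icc] at this
  push_cast at this
  simpa using this

/-- The sharpness dichotomy extracted from the differential inequality. -/
theorem sharp_of_diff_ineq {θ : ℕ → ℝ → ℝ} {K κ : ℝ} {d : ℕ} (hK : 0 < K) (hκ : 0 < κ)
    (h0 : ∀ n t, 0 ≤ t → t ≤ 1 / 2 → 0 ≤ θ n t) (h1 : ∀ n t, 0 ≤ t → t ≤ 1 / 2 → θ n t ≤ 1)
    (hanti : ∀ n m, n ≤ m → ∀ t, 0 ≤ t → t ≤ 1 / 2 → θ m t ≤ θ n t)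
    (hdiff : ∀ n : ℕ, 1 ≤ n → ∀ t, 0 ≤ t → t ≤ 1 / 2 → ∃ D, HasDerivAt (θ n) D t ∧
      n * θ n t ≤ K * (∑ i ∈ Finset.range n, θ i t) * D)
    (hpos : ∀ t, 0 ≤ t → t ≤ 1 / 2 → 0 < θ 0 t)
    (hmono0 : ∀ s t, 0 ≤ s → s ≤ t → t ≤ 1 / 2 → θ 0 s ≤ θ 0 t)
    (hlow : ∀ n : ℕ, 1 ≤ n → κ / (2 * n + 1) ^ d ≤ θ n 0) {t₀ : ℝ} (ht0 : 0 < t₀)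
    (ht1 : t₀ ≤ 1 / 2) : ∃ κ' : ℝ, 0 < κ' ∧ ∀ n, κ' ≤ θ n t₀ := by
  set S : ℕ → ℝ → ℝ := fun n t => ∑ i ∈ Finset.range n, θ i t with hS
  have hSpos : ∀ n, 1 ≤ n → ∀ t, 0 ≤ t → t ≤ 1 / 2 → 0 < S n t := fun n hn t a b =>
    Finset.sum_pos' (fun i _ => h0 i t a b) ⟨0, Finset.mem_range.2 hn, hpos t a b⟩
  have hdiff' : ∀ n t, 1 ≤ n → 0 ≤ t → t ≤ 1 / 2 → ∃ D, HasDerivAt (θ n) D t ∧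
      n * θ n t ≤ K * S n t * D := fun n t hn a b => hdiff n hn t a b
  choose! D hD hDi using hdiff'
  have hDi' : ∀ n t, 1 ≤ n → 0 ≤ t → t ≤ 1 / 2 → n * θ n t / (K * S n t) ≤ D n t := by
    intro n t hn a b
    rw [div_le_iff₀ (mul_pos hK (hSpos n hn t a b)), mul_comm (D n t)]
    exact hDi n t hn a b
  have hmono : ∀ n s t, 0 ≤ s → s ≤ t → t ≤ 1 / 2 → θ n s ≤ θ n t := by
    intro n s t hs hst ht
    rcases Nat.eq_zero_or_pos n with rfl | hn
    · exact hmono0 s t hs hst ht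
    have := mul_sub_le_of_hasDerivAt (C := 0) hst
      (fun u hu => hD n u hn (hs.trans hu.1) (hu.2.trans ht))
      (fun u hu => le_trans (div_nonneg (mul_nonneg (Nat.cast_nonneg n)
        (h0 n u (hs.trans hu.1) (hu.2.trans ht))) (mul_pos hK (hSpos n hn u (hs.trans hu.1)
        (hu.2.trans ht))).le) (hDi' n u hn (hs.trans hu.1) (hu.2.trans ht)))
    linarith
  have hSmono : ∀ n s t, 0 ≤ s → s ≤ t → t ≤ 1 / 2 → S n s ≤ S n t := fun n s t a b c =>
    Finset.sum_le_sum fun i _ => hmono i s t a b c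
  have hθpos : ∀ n t, 1 ≤ n → 0 ≤ t → t ≤ 1 / 2 → 0 < θ n t := fun n t hn a b =>
    lt_of_lt_of_le (by positivity) ((hlow n hn).trans (hmono n 0 t le_rfl a b))
  set s := t₀ / 2 with hs
  have hs0 : 0 < s := by rw [hs]; linarith
  have hs1 : s ≤ 1 / 2 := by rw [hs]; linarith
  have grow : ∀ n : ℕ, 1 ≤ n →
      s * n ≤ S n s * (K * d * Real.log (2 * n + 1) + K * -Real.log κ) := by
    intro n hn
    have hn0 : (0 : ℝ) < n := by exact_mod_cast hn
    have hSs := hSpos n hn s hs0.le hs1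
    have hlog := mul_sub_le_of_hasDerivAt (C := n / (K * S n s)) hs0.le
      (f := fun u => Real.log (θ n u)) (f' := fun u => D n u / θ n u)
      (fun u hu => (hD n u hn hu.1 (hu.2.trans hs1)).log (hθpos n u hn hu.1 (hu.2.trans hs1)).ne')
      (fun u hu => by
        have a := hu.1
        have b := hu.2.trans hs1
        have hSu := hSpos n hn u a b
        rw [le_div_iff₀ (hθpos n u hn a b)]
        refine le_trans ?_ (hDi' n u hn a b)
        rw [div_mul_eq_mul_div]
        exact div_le_div_of_nonneg_left (mul_nonneg hn0.le (h0 n u a b)) (mul_pos hK hSu)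
          (mul_le_mul_of_nonneg_left (hSmono n u s a hu.2 hs1) hK.le))
    have up : Real.log (θ n s) ≤ 0 := Real.log_nonpos (h0 n s hs0.le hs1) (h1 n s hs0.le hs1)
    have low : Real.log κ - d * Real.log (2 * n + 1) ≤ Real.log (θ n 0) := by
      rw [← Real.log_pow, ← Real.log_div hκ.ne' (by positivity)]
      exact Real.log_le_log (by positivity) (hlow n hn)
    have h2 : n / (K * S n s) * s ≤ d * Real.log (2 * n + 1) - Real.log κ := by
      simp only [sub_zero] at hlog
      linarith
    rw [div_mul_eq_mul_div, div_le_iff₀ (mul_pos hK hSs)] at h2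
    linarith
  obtain ⟨N, hN⟩ := eventually_log_le_sqrt (A := K * d) (B := K * -Real.log κ) hs0
  have hsqrt : ∀ n, N ≤ n → 1 ≤ n → Real.sqrt n ≤ S n s := by
    intro n hn hn1
    have hn0 : (0 : ℝ) < n := by exact_mod_cast hn1
    have h2 := (grow n hn1).trans (mul_le_mul_of_nonneg_left (hN n hn)
      (hSpos n hn1 s hs0.le hs1).le)
    have h3 : 0 < Real.sqrt n := Real.sqrt_pos.2 hn0
    have h4 : Real.sqrt n * Real.sqrt n = n := Real.mul_self_sqrt hn0.le
    have h5 : Real.sqrt n * (s * Real.sqrt n) ≤ S n s * (s * Real.sqrt n) := by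
      calc Real.sqrt n * (s * Real.sqrt n) = s * (Real.sqrt n * Real.sqrt n) := by ring
        _ = s * n := by rw [h4]
        _ ≤ _ := h2
    exact le_of_mul_le_mul_right h5 (by positivity)
  have hTder : ∀ n u, N ≤ n → s ≤ u → u ≤ t₀ →
      1 / (2 * K) * Real.log (n + 1 : ℕ) ≤ ∑ i ∈ Finset.Icc 1 n, D i u / i := by
    intro n u hn hu hut
    have a : 0 ≤ u := hs0.le.trans hu
    have b : u ≤ 1 / 2 := hut.trans ht1
    have h2 : ∀ i ∈ Finset.Icc 1 n, 1 / K * (Real.log (S (i + 1) u) - Real.log (S i u)) ≤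
        D i u / i := by
      intro i hi
      have hi1 := (Finset.mem_Icc.1 hi).1
      have hi0 : (0 : ℝ) < i := by exact_mod_cast hi1
      have hSi := hSpos i hi1 u a b
      have hSi' := hSpos (i + 1) (by omega) u a b
      have e : S (i + 1) u = S i u + θ i u := Finset.sum_range_succ _ _
      have h3 : Real.log (S (i + 1) u) - Real.log (S i u) ≤ θ i u / S i u := by
        rw [← Real.log_div hSi'.ne' hSi.ne']
        refine (Real.log_le_sub_one_of_pos (by positivity)).trans (le_of_eq ?_)
        rw [e]
        field_simp
        ring
      rw [le_div_iff₀ hi0]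
      refine le_trans ?_ (hDi' i u hi1 a b)
      calc 1 / K * (Real.log (S (i + 1) u) - Real.log (S i u)) * i
          ≤ 1 / K * (θ i u / S i u) * i := by gcongr
        _ = _ := by field_simp
    refine le_trans ?_ (Finset.sum_le_sum h2)
    rw [← Finset.mul_sum]
    have tele : ∀ n : ℕ, ∑ i ∈ Finset.Icc 1 n, (Real.log (S (i + 1) u) - Real.log (S i u)) =
        Real.log (S (n + 1) u) - Real.log (S 1 u) := by
      intro n
      induction n with
      | zero => simp
      | succ n ih => rw [Finset.sum_Icc_succ_top (by omega), ih]; ring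
    rw [tele]
    have h4 : Real.log (S 1 u) ≤ 0 := by
      have : S 1 u = θ 0 u := by simp [hS]
      rw [this]
      exact Real.log_nonpos (h0 0 u a b) (h1 0 u a b)
    have h5 : 1 / 2 * Real.log (n + 1 : ℕ) ≤ Real.log (S (n + 1) u) := by
      rw [← Real.log_rpow (by positivity), ← Real.sqrt_eq_rpow]
      exact Real.log_le_log (by positivity) ((hsqrt (n + 1) (by omega) (by omega)).trans
        (hSmono (n + 1) s u hs0.le hu b))
    calc 1 / (2 * K) * Real.log (n + 1 : ℕ) = 1 / K * (1 / 2 * Real.log (n + 1 : ℕ)) := by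
          field_simp
      _ ≤ _ := mul_le_mul_of_nonneg_left (by linarith) (by positivity)
  have hT : ∀ n, N ≤ n → t₀ / (4 * K) * Real.log (n + 1 : ℕ) ≤
      ∑ i ∈ Finset.Icc 1 n, θ i t₀ / i := by
    intro n hn
    have h2 := mul_sub_le_of_hasDerivAt (a := s) (b := t₀) (by rw [hs]; linarith)
      (f := fun u => ∑ i ∈ Finset.Icc 1 n, θ i u / i)
      (f' := fun u => ∑ i ∈ Finset.Icc 1 n, D i u / i)
      (fun u hu => HasDerivAt.fun_sum fun i hi =>
        (hD i u (Finset.mem_Icc.1 hi).1 (hs0.le.trans hu.1) (hu.2.trans ht1)).div_const _)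
      (fun u hu => hTder n u hn hu.1 hu.2)
    have h3 : 0 ≤ ∑ i ∈ Finset.Icc 1 n, θ i s / i :=
      Finset.sum_nonneg fun i _ => div_nonneg (h0 i s hs0.le hs1) (Nat.cast_nonneg i)
    have h4 : t₀ / (4 * K) * Real.log (n + 1 : ℕ) =
        1 / (2 * K) * Real.log (n + 1 : ℕ) * (t₀ - s) := by
      rw [hs]
      field_simp
      ring
    linarith
  refine ⟨t₀ / (8 * K), by positivity, fun m => ?_⟩
  by_contra! hm
  have h2 : ∀ n : ℕ, max N 1 ≤ n →
      t₀ / (8 * K) * Real.log (n + 1 : ℕ) ≤ 1 + Real.log m + t₀ / (8 * K) := by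
    intro n hn
    have hn1 : (1 : ℝ) ≤ n := by exact_mod_cast (le_max_right N 1).trans hn
    have h3 : ∀ i ∈ Finset.Icc 1 n, θ i t₀ / i ≤
        (if i ∈ Finset.Icc 1 m then (1 : ℝ) / i else 0) + t₀ / (8 * K) * (1 / i) := by
      intro i hi
      have hi1 := (Finset.mem_Icc.1 hi).1
      have hi0 : (0 : ℝ) < i := by exact_mod_cast hi1
      have p : 0 ≤ t₀ / (8 * K) * (1 / i) := by positivity
      split_ifs with him
      · have : θ i t₀ / i ≤ 1 / i := by
          gcongr
          exact h1 i t₀ ht0.le ht1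
        linarith
      · have hmi : m ≤ i := by
          by_contra hh
          exact him (Finset.mem_Icc.2 ⟨hi1, by omega⟩)
        rw [zero_add, div_eq_mul_one_div]
        exact mul_le_mul_of_nonneg_right ((hanti m i hmi t₀ ht0.le ht1).trans hm.le) (by positivity)
    have h4 := (hT n ((le_max_left _ _).trans hn)).trans (Finset.sum_le_sum h3)
    rw [Finset.sum_add_distrib, ← Finset.mul_sum, ← Finset.sum_filter] at h4
    have h5 : ∑ i ∈ (Finset.Icc 1 n).filter (· ∈ Finset.Icc 1 m), (1 : ℝ) / i ≤
        ∑ i ∈ Finset.Icc 1 m, (1 : ℝ) / i :=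
      Finset.sum_le_sum_of_subset_of_nonneg (fun i hi => (Finset.mem_filter.1 hi).2)
        fun i _ _ => by positivity
    have h6 := sum_Icc_inv_le m
    have h7 : Real.log n ≤ Real.log (n + 1 : ℕ) :=
      Real.log_le_log (by linarith) (by push_cast; linarith)
    have h8 : t₀ / (8 * K) * ∑ i ∈ Finset.Icc 1 n, (1 : ℝ) / i ≤
        t₀ / (8 * K) * (1 + Real.log (n + 1 : ℕ)) :=
      mul_le_mul_of_nonneg_left ((sum_Icc_inv_le n).trans (by linarith)) (by positivity)
    have h9 : t₀ / (4 * K) * Real.log (n + 1 : ℕ) = t₀ / (8 * K) * Real.log (n + 1 : ℕ) +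
        t₀ / (8 * K) * Real.log (n + 1 : ℕ) := by
      field_simp
      ring
    linarith
  have h3 : Tendsto (fun n : ℕ => t₀ / (8 * K) * Real.log (n + 1 : ℕ)) atTop atTop :=
    (Real.tendsto_log_atTop.comp (tendsto_natCast_atTop_atTop.comp
      (tendsto_add_atTop_nat 1))).const_mul_atTop (by positivity)
  obtain ⟨n, hn, hn'⟩ := ((h3.eventually_gt_atTop (1 + Real.log m + t₀ / (8 * K))).and
    (eventually_ge_atTop (max N 1))).exists
  exact absurd (h2 n hn') (not_le.2 hn)

variable {d L : ℕ} (a : V d → V d × (Fin (L + 1) × Fin d) → ℝ) (r : ℕ) {δ : ℝ}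
    (hδ : δ ∈ Ioo (0 : ℝ) 1)

theorem thet_mono (h : ℝ) (n : ℕ) {s t : ℝ} (h0 : 0 ≤ s) (hst : s ≤ t) (h1 : t ≤ 1) :
    thet a r hδ h n s ≤ thet a r hδ h n t := by
  rw [thet_eq a r hδ h n h0 (hst.trans h1), thet_eq a r hδ h n (h0.trans hst) h1]
  refine measureReal_mono (fun ω hω => inc_Arm _ _ ?_ hω) (measure_ne_top _ _)
  rw [indep_cf, indep_cf]
  refine union_subset_union_right _ fun x hx => ?_
  have hx' : 1 - s ≤ ω (x, Sum.inr (some fi0)) := hx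
  change 1 - t ≤ ω (x, Sum.inr (some fi0))
  linarith

/-- Below a level at which box crossings do not decay, the origin percolates. -/
theorem perc_of_crossing {h h' ε p : ℝ} (hμ : Good (muh a r hδ h) (2 * r) (δ / 4)) (hh : h' < h)
    (hp : 0 < p) (hphi : ∀ x, p ≤ (PP d L).real (phi a r x ⁻¹' Ico h' h)) (hε : 0 < ε)
    (hA : ∀ n : ℕ, 1 ≤ n → ε ≤ (muh a r hδ h).real (Arm 0 n (2 * n))) :
    ∃ θ : ℝ, 0 < θ ∧ ∀ n, θ ≤ (muh a r hδ h').real (Arm 0 0 n) := by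
  classical
  have hδ0 := hδ.1
  have hδ1 := hδ.2
  obtain ⟨K, hK, hdiff⟩ := thet_diff_ineq a r hδ hμ
  set t := min (1 / 2) ((1 - δ) * p / 2 * (δ / 4) ^ (2 * (2 * r) + 1) ^ d) with ht
  have ht0 : 0 < t := lt_min (by norm_num) (mul_pos (by nlinarith) (pow_pos (by linarith) _))
  have ht1 : t ≤ 1 / 2 := min_le_left _ _
  have hlow : ∀ n : ℕ, 1 ≤ n → ε / (2 * n + 1) ^ d ≤ thet a r hδ h n 0 := by
    intro n hn
    rw [thet_zero, div_le_iff₀ (by positivity), mul_comm]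
    refine (hA n hn).trans ((measureReal_mono (s₂ := ⋃ x ∈ bxF (0 : V d) n, Arm x 0 n) ?_
      (measure_ne_top _ _)).trans ((measureReal_biUnion_finset_le _ _).trans ?_))
    · rintro X ⟨x, hx, y, hy, hxy⟩
      simp only [mem_iUnion]
      refine ⟨x, mem_bxF.2 hx, (arm_iff (Nat.zero_le n)).2
        (arm_of_conn (self_mem_Bx x 0) (Nat.zero_le n) ?_ hxy)⟩
      have h1 : dinf 0 x ≤ n := hx
      have h2 : dinf 0 y = 2 * n := hy
      have := dinf_triangle 0 x y
      omega
    · rw [Finset.sum_congr rfl fun x _ => hμ.arm_eq x (Nat.zero_le n), Finset.sum_const, card_bxF,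
        nsmul_eq_mul]
      push_cast
      exact le_rfl
  obtain ⟨κ, hκ, hk⟩ := sharp_of_diff_ineq (θ := thet a r hδ h) (d := d) hK hε
    (fun n t u v => thet_nonneg a r hδ h n u (by linarith))
    (fun n t u v => thet_le_one a r hδ h n u (by linarith))
    (fun n m hnm t u v => thet_anti a r hδ h hnm u (by linarith)) hdiff
    (fun t u v => lt_of_lt_of_le (by linarith) (thet_zero_ge a r hδ h u (by linarith)))
    (fun s t u v w => thet_mono a r hδ h 0 u v (by linarith)) hlow ht0 ht1
  refine ⟨κ, hκ, fun n => (hk n).trans ?_⟩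
  rw [thet_eq a r hδ h n ht0.le (by linarith)]
  have hL : Loc ((bxF (0 : V d) n : Finset (V d)) : Set (V d)) (Arm 0 0 n) := by
    rw [coe_bxF]
    exact loc_Arm (Nat.zero_le n)
  refine (sprinkle a r hδ _ (fun _ => rfl) hh hphi ht1 (min_le_right _ _)
    (fun x => (Spr.indep_ζ h ht0.le (by linarith) x).le) hL inc_Arm).trans (le_of_eq ?_)
  exact (muh_real a r hδ h' (finite_Bx 0 n) (loc_Arm (Nat.zero_le n))).symm

end

section

section walk

variable {d : ℕ}

theorem lazyP_nonneg (k : ℕ) (x y : V d) : 0 ≤ lazyP d k x y := by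
  induction k generalizing x with
  | zero => unfold lazyP; split_ifs <;> norm_num
  | succ k ih =>
    unfold lazyP
    have : 0 ≤ ∑ i : Fin d, (lazyP d k (x + unitV d i) y + lazyP d k (x - unitV d i) y) :=
      Finset.sum_nonneg fun i _ => add_nonneg (ih _) (ih _)
    have := ih x
    positivity

theorem dinf_add_unitV (x : V d) (i : Fin d) : dinf x (x + unitV d i) ≤ 1 := by
  refine dinf_le_iff.2 fun j => ?_
  simp only [Pi.add_apply, unitV]
  split_ifs <;> omega

theorem dinf_sub_unitV (x : V d) (i : Fin d) : dinf x (x - unitV d i) ≤ 1 := by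
  refine dinf_le_iff.2 fun j => ?_
  simp only [Pi.sub_apply, unitV]
  split_ifs <;> omega

theorem lazyP_eq_zero {k : ℕ} {x y : V d} (h : k < dinf x y) : lazyP d k x y = 0 := by
  induction k generalizing x with
  | zero =>
    have : x ≠ y := by
      rintro rfl
      simp [dinf_self] at h
    simp [lazyP, this]
  | succ k ih =>
    unfold lazyP
    have h1 : ∀ i, lazyP d k (x + unitV d i) y = 0 := fun i => ih (by
      have := dinf_triangle x (x + unitV d i) y
      have := dinf_add_unitV x i
      omega)
    have h2 : ∀ i, lazyP d k (x - unitV d i) y = 0 := fun i => ih (by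
      have := dinf_triangle x (x - unitV d i) y
      have := dinf_sub_unitV x i
      omega)
    rw [ih (by omega)]
    simp [h1, h2]

theorem finite_support_lazyP (k : ℕ) (y : V d) : (Function.support fun z => lazyP d k z y).Finite :=
  (finite_Bx y k).subset fun z hz => by
    by_contra h
    refine hz (lazyP_eq_zero ?_)
    rw [dinf_comm]
    exact not_le.1 h

theorem LIso.lazyP_eq {e : V d ≃ V d} (he : LIso e) (k : ℕ) (x y : V d) :
    lazyP d k (e x) (e y) = lazyP d k x y := by
  obtain ⟨a, s, π, hs, h⟩ := he
  induction k generalizing x with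
  | zero => simp [lazyP]
  | succ k ih =>
    unfold lazyP
    rw [ih]
    congr 2
    rw [← Equiv.sum_comp π fun i => lazyP d k (x + unitV d i) y + lazyP d k (x - unitV d i) y]
    refine Finset.sum_congr rfl fun i _ => ?_
    have shift : ∀ c : ℤ, e (x + fun j => c * unitV d (π i) j) =
        e x + fun j => s i * c * unitV d i j := by
      intro c
      funext j
      simp only [h, Pi.add_apply, unitV, EmbeddingLike.apply_eq_iff_eq]
      by_cases hj : j = i
      · subst hj; simp; ring
      · simp [hj]
    have p1 : e (x + unitV d (π i)) = e x + fun j => s i * unitV d i j := by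
      have := shift 1
      simpa only [one_mul, mul_one] using this
    have p2 : e (x - unitV d (π i)) = e x + fun j => -s i * unitV d i j := by
      have e1 : x - unitV d (π i) = x + fun j => (-1) * unitV d (π i) j := by
        funext j; simp [sub_eq_add_neg]
      rw [e1, shift (-1)]
      simp
    rw [← ih (x + unitV d (π i)), ← ih (x - unitV d (π i)), p1, p2]
    have q1 : (e x + fun j => 1 * unitV d i j) = e x + unitV d i := by funext j; simp
    have q2 : (e x + fun j => -1 * unitV d i j) = e x - unitV d i := by
      funext j; simp [sub_eq_add_neg]
    rcases hs i with hi | hi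
    · rw [hi, q1, q2]
    · rw [hi, neg_neg, q1, q2, add_comm]

theorem LIso.covTrunc_eq {e : V d ≃ V d} (he : LIso e) (L : ℕ) (x y : V d) :
    covTrunc d L (e x) (e y) = covTrunc d L x y := by
  simp only [covTrunc, he.lazyP_eq]

/-- The `ℓ²` pairing of finitely supported functions. -/
noncomputable def pair (f g : V d → ℝ) : ℝ := ∑ᶠ z, f z * g z

/-- The transition operator of the lazy walk. -/
noncomputable def lazyOp (f : V d → ℝ) (z : V d) : ℝ :=
  1 / 2 * f z + 1 / (4 * d) * ∑ i : Fin d, (f (z + unitV d i) + f (z - unitV d i))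

theorem pair_comm (f g : V d → ℝ) : pair f g = pair g f := finsum_congr fun _ => mul_comm _ _

theorem pair_eq_sum {f g : V d → ℝ} {W : Finset (V d)} (h : Function.support f ⊆ W) :
    pair f g = ∑ z ∈ W, f z * g z :=
  finsum_eq_sum_of_support_subset _ ((Function.support_mul_subset_left f g).trans h)

theorem pair_shift (f g : V d → ℝ) (u : V d) :
    pair (fun z => f (z + u)) g = pair f fun z => g (z - u) := by
  unfold pair
  rw [← finsum_comp_equiv (f := fun z => f z * g (z - u)) (Equiv.addRight u)]
  simp

theorem pair_add {f g g' : V d → ℝ} (hf : (Function.support f).Finite) :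
    pair f (fun z => g z + g' z) = pair f g + pair f g' := by
  have h : Function.support f ⊆ hf.toFinset := by simp
  rw [pair_eq_sum h, pair_eq_sum h, pair_eq_sum h, ← Finset.sum_add_distrib]
  exact Finset.sum_congr rfl fun z _ => mul_add _ _ _

theorem pair_lazyOp {f g : V d → ℝ} (hf : (Function.support f).Finite) :
    pair f (lazyOp g) = 1 / 2 * pair f g + 1 / (4 * d) *
      ∑ i : Fin d, (pair f (fun z => g (z + unitV d i)) + pair f fun z => g (z - unitV d i)) := by
  have h : Function.support f ⊆ hf.toFinset := by simp
  simp only [pair_eq_sum h, lazyOp, ← Finset.sum_add_distrib]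
  rw [Finset.sum_comm, Finset.mul_sum, Finset.mul_sum, ← Finset.sum_add_distrib]
  refine Finset.sum_congr rfl fun z _ => ?_
  simp only [← mul_add, ← Finset.mul_sum]
  ring

theorem pair_lazyOp_symm {f g : V d → ℝ} (hf : (Function.support f).Finite)
    (hg : (Function.support g).Finite) : pair (lazyOp f) g = pair f (lazyOp g) := by
  rw [pair_comm, pair_lazyOp hf, pair_lazyOp hg, pair_comm g f]
  congr 2
  refine Finset.sum_congr rfl fun i _ => ?_
  rw [pair_comm g, pair_comm g, pair_shift]
  have := pair_shift f g (-unitV d i)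
  simp only [← sub_eq_add_neg, sub_neg_eq_add] at this
  rw [this, add_comm]

theorem pair_lazyP (j k : ℕ) (x y : V d) :
    pair (fun z => lazyP d j z x) (fun z => lazyP d k z y) = lazyP d (j + k) x y := by
  induction j generalizing k with
  | zero =>
    have : Function.support (fun z => lazyP d 0 z x) ⊆ ({x} : Finset (V d)) := fun z hz => by
      by_contra h
      exact hz (by simpa [lazyP] using h)
    rw [pair_eq_sum this, Finset.sum_singleton]
    simp [lazyP]
  | succ j ih =>
    rw [show j + 1 + k = j + (k + 1) by omega, ← ih (k + 1)]
    exact pair_lazyOp_symm (finite_support_lazyP j x) (finite_support_lazyP k y)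

theorem finite_support_shift {f : V d → ℝ} (hf : (Function.support f).Finite) (u : V d) :
    (Function.support fun z => f (z + u)).Finite :=
  Set.Finite.preimage (Equiv.addRight u).injective.injOn hf

theorem sum_pair_edge {f g : V d → ℝ} (hd : 0 < d) (hf : (Function.support f).Finite)
    (hg : (Function.support g).Finite) :
    1 / (4 * d) * ∑ i : Fin d, pair (fun z => f z + f (z + unitV d i))
      (fun z => g z + g (z + unitV d i)) = pair f (lazyOp g) := by
  have h1 : ∀ i : Fin d, pair (fun z => f z + f (z + unitV d i))
      (fun z => g z + g (z + unitV d i)) = 2 * pair f g +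
        (pair f (fun z => g (z + unitV d i)) + pair f fun z => g (z - unitV d i)) := by
    intro i
    have hg' := finite_support_shift hg (unitV d i)
    have hgg : (Function.support fun z => g z + g (z + unitV d i)).Finite :=
      (hg.union hg').subset (Function.support_add _ _)
    rw [pair_comm, pair_add hgg, pair_comm _ f, pair_add hf,
      pair_comm _ fun z => f (z + unitV d i), pair_shift, pair_add hf]
    simp only [sub_add_cancel]
    ring
  have hd' : (d : ℝ) ≠ 0 := by positivity
  rw [Finset.sum_congr rfl fun i _ => h1 i, Finset.sum_add_distrib, pair_lazyOp hf]
  simp only [Finset.sum_const, Finset.card_univ, Fintype.card_fin, nsmul_eq_mul]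
  field_simp
  ring

/-- The moving-average weights representing the truncated covariance. -/
noncomputable def wt (d L : ℕ) (x : V d) (p : V d × (Fin (L + 1) × Fin d)) : ℝ :=
  if (p.2.1 : ℕ) % 2 = 0 then lazyP d (p.2.1 / 2) p.1 x / Real.sqrt (2 * d)
  else (lazyP d (p.2.1 / 2) p.1 x + lazyP d (p.2.1 / 2) (p.1 + unitV d p.2.2) x) / Real.sqrt (8 * d)

theorem wt_nonneg (d L : ℕ) (x : V d) (p : V d × (Fin (L + 1) × Fin d)) : 0 ≤ wt d L x p := by
  unfold wt
  split_ifs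
  · exact div_nonneg (lazyP_nonneg _ _ _) (Real.sqrt_nonneg _)
  · exact div_nonneg (add_nonneg (lazyP_nonneg _ _ _) (lazyP_nonneg _ _ _)) (Real.sqrt_nonneg _)

theorem wt_eq_zero {L : ℕ} {x : V d} {p : V d × (Fin (L + 1) × Fin d)} (h : L + 1 < dinf x p.1) :
    wt d L x p = 0 := by
  have hp := p.2.1.2
  have h1 : lazyP d (p.2.1 / 2) p.1 x = 0 := lazyP_eq_zero (by rw [dinf_comm]; omega)
  have h2 : lazyP d (p.2.1 / 2) (p.1 + unitV d p.2.2) x = 0 := lazyP_eq_zero (by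
    have := dinf_triangle p.1 (p.1 + unitV d p.2.2) x
    have := dinf_add_unitV p.1 p.2.2
    rw [dinf_comm p.1 x] at *
    omega)
  simp [wt, h1, h2]

theorem sum_pair_wt (hd : 0 < d) (L : ℕ) (x y : V d) (ℓ : Fin (L + 1)) :
    ∑ i : Fin d, pair (fun z => wt d L x (z, (ℓ, i))) (fun z => wt d L y (z, (ℓ, i))) =
      1 / 2 * lazyP d ℓ x y := by
  have hd' : (0 : ℝ) < d := by exact_mod_cast hd
  have hdiv : ∀ (f g : V d → ℝ) (c : ℝ), 0 ≤ c →
      pair (fun z => f z / Real.sqrt c) (fun z => g z / Real.sqrt c) = 1 / c * pair f g := by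
    intro f g c hc
    unfold pair
    rw [← smul_eq_mul (1 / c), smul_finsum]
    refine finsum_congr fun z => ?_
    rw [smul_eq_mul, div_mul_div_comm, Real.mul_self_sqrt hc]
    ring
  by_cases h : (ℓ : ℕ) % 2 = 0
  · simp only [wt, h, if_true]
    simp only [hdiv _ _ _ (show (0 : ℝ) ≤ 2 * d by positivity)]
    rw [pair_lazyP, show (ℓ : ℕ) / 2 + ℓ / 2 = ℓ by omega]
    simp
    field_simp
  · simp only [wt, h, if_false]
    simp only [hdiv (fun z => lazyP d (ℓ / 2) z x + lazyP d (ℓ / 2) (z + unitV d _) x)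
      (fun z => lazyP d (ℓ / 2) z y + lazyP d (ℓ / 2) (z + unitV d _) y) _
      (show (0 : ℝ) ≤ 8 * d by positivity)]
    have h1 := sum_pair_edge hd (finite_support_lazyP (ℓ / 2) x) (finite_support_lazyP (ℓ / 2) y)
    have h2 : lazyOp (fun z => lazyP d (ℓ / 2) z y) = fun z => lazyP d (ℓ / 2 + 1) z y := rfl
    rw [h2, pair_lazyP, show (ℓ : ℕ) / 2 + (ℓ / 2 + 1) = ℓ by omega] at h1
    rw [← h1, ← Finset.mul_sum, ← mul_assoc]
    congr 1
    field_simp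
    norm_num

theorem sum_wt (hd : 0 < d) (L : ℕ) (x y : V d) {W : Finset (V d)} (hW : bxF x (L + 1) ⊆ W) :
    ∑ p ∈ W ×ˢ (Finset.univ : Finset (Fin (L + 1) × Fin d)), wt d L x p * wt d L y p =
      covTrunc d L x y := by
  have hs : ∀ τ, Function.support (fun z => wt d L x (z, τ)) ⊆ W := fun τ z hz => by
    refine hW (mem_bxF.2 ?_)
    by_contra h
    exact hz (wt_eq_zero (not_le.1 h))
  rw [Finset.sum_product_right, Finset.sum_congr rfl fun τ _ => (pair_eq_sum (hs τ)).symm,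
    Fintype.sum_prod_type, Finset.sum_congr rfl fun ℓ _ => sum_pair_wt hd L x y ℓ, covTrunc,
    Finset.mul_sum]
  exact Fin.sum_univ_eq_sum_range (fun ℓ => 1 / 2 * lazyP d ℓ x y) (L + 1)

theorem covTrunc_self (L : ℕ) (x : V d) : covTrunc d L x x = covTrunc d L 0 0 := by
  have := (LIso.addLeft x).covTrunc_eq L 0 0
  simpa using this

theorem covTrunc_self_pos (L : ℕ) (x : V d) : 0 < covTrunc d L x x := by
  have h1 : lazyP d 0 x x ≤ ∑ ℓ ∈ Finset.range (L + 1), lazyP d ℓ x x :=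
    Finset.single_le_sum (f := fun ℓ => lazyP d ℓ x x) (fun ℓ _ => lazyP_nonneg ℓ x x)
      (Finset.mem_range.2 (Nat.succ_pos L))
  have h2 : lazyP d 0 x x = 1 := by simp [lazyP]
  unfold covTrunc
  linarith

end walk

end

section

theorem IsCGF.comp_equiv {d : ℕ} {Ω : Type*} [MeasurableSpace Ω] {P : Measure Ω} {φ : V d → Ω → ℝ} {C : V d → V d → ℝ} (h : IsCGF P φ C)
    (e : V d ≃ V d) (he : ∀ x y, C (e x) (e y) = C x y) : IsCGF P (fun x => φ (e x)) C := by
  refine ⟨fun x => h.1 _, fun s a => ?_⟩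
  have := h.2 (s.map e.toEmbedding) fun x => a (e.symm x)
  simpa [Finset.sum_map, he] using this

section transport

variable {d : ℕ} {Ω Ω' : Type*} [MeasurableSpace Ω] [MeasurableSpace Ω'] {P : Measure Ω}
  {P' : Measure Ω'} [IsProbabilityMeasure P'] [IsProbabilityMeasure P]

/-- The finite-dimensional laws of a centered Gaussian field are determined by its covariance. -/
theorem IsCGF.map_restrict_eq {φ : V d → Ω → ℝ} {φ' : V d → Ω' → ℝ} {C : V d → V d → ℝ}
    (h : IsCGF P φ C) (h' : IsCGF P' φ' C) (s : Finset (V d)) :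
    P.map (fun ω (i : s) => φ i ω) = P'.map (fun ω (i : s) => φ' i ω) := by
  classical
  have m : Measurable (fun ω (i : s) => φ i ω) := measurable_pi_lambda _ fun i => h.1 i
  have m' : Measurable (fun ω (i : s) => φ' i ω) := measurable_pi_lambda _ fun i => h'.1 i
  have := Measure.isProbabilityMeasure_map (μ := P) m.aemeasurable
  have := Measure.isProbabilityMeasure_map (μ := P') m'.aemeasurable
  refine Measure.ext_of_charFunDual (funext fun l => ?_)
  rw [charFunDual_eq_charFun_map_one, charFunDual_eq_charFun_map_one,
    Measure.map_map l.continuous.measurable m, Measure.map_map l.continuous.measurable m']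
  have key : ∀ v : V d → ℝ, l (fun i : s => v i) =
      ∑ x ∈ s, (if hx : x ∈ s then l (Pi.single ⟨x, hx⟩ 1) else 0) * v x := by
    intro v
    rw [← Finset.sum_coe_sort s]
    have hv : (fun i : s => v i) = ∑ i : s, v i • (Pi.single i (1 : ℝ) : s → ℝ) := by
      ext j
      simp [Finset.sum_apply, Pi.single_apply]
    conv_lhs => rw [hv]
    rw [map_sum]
    refine Finset.sum_congr rfl fun i _ => ?_
    rw [map_smul, smul_eq_mul, mul_comm]
    simp
  have e : (l ∘ fun ω (i : s) => φ i ω) = fun ω => ∑ x ∈ s,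
      (if hx : x ∈ s then l (Pi.single ⟨x, hx⟩ 1) else 0) * φ x ω :=
    funext fun ω => key fun x => φ x ω
  have e' : (l ∘ fun ω (i : s) => φ' i ω) = fun ω => ∑ x ∈ s,
      (if hx : x ∈ s then l (Pi.single ⟨x, hx⟩ 1) else 0) * φ' x ω :=
    funext fun ω => key fun x => φ' x ω
  rw [e, e', h.2, h'.2]

theorem IsIIDUnif.map_restrict_eq {U : V d → Ω → ℝ} (h : IsIIDUnif P U) (s : Finset (V d)) :
    P.map (fun ω (i : s) => U i ω) = Measure.pi fun _ => unif := by
  rw [(iIndepFun_iff_map_fun_eq_pi_map fun i : s => (h.1 i).aemeasurable).1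
    (h.2.2.precomp Subtype.val_injective)]
  congr 1
  exact funext fun i => h.2.1 i

/-- The noised level set in a finite window is a function of finitely many variables. -/
theorem TdLvl_real_eq {U φ : V d → Ω → ℝ} {U' φ' : V d → Ω' → ℝ} {C : V d → V d → ℝ}
    (hφ : IsCGF P φ C) (hφ' : IsCGF P' φ' C) (hU : IsIIDUnif P U) (hU' : IsIIDUnif P' U')
    (hi : ∀ s : Finset (V d), IndepFun (fun ω (i : s) => U i ω) (fun ω (i : s) => φ i ω) P)
    (hi' : ∀ s : Finset (V d), IndepFun (fun ω (i : s) => U' i ω) (fun ω (i : s) => φ' i ω) P')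
    (δ h : ℝ) {S : Set (V d)} {A : Set (Set (V d))} (hS : S.Finite) (hA : Loc S A) :
    P.real {ω | TdLvl U φ δ h ω ∈ A} = P'.real {ω | TdLvl U' φ' δ h ω ∈ A} := by
  lift S to Finset (V d) using hS
  set G : (S → ℝ) × (S → ℝ) → Set (V d) := fun v => {x | ∃ hx : x ∈ S, 1 - δ / 2 ≤ v.1 ⟨x, hx⟩ ∨
    (δ / 2 < v.1 ⟨x, hx⟩ ∧ v.1 ⟨x, hx⟩ < 1 - δ / 2 ∧ h ≤ v.2 ⟨x, hx⟩)} with hG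
  have mG : Measurable G := by
    refine measurable_set_iff.2 fun x => ?_
    by_cases hx : x ∈ S
    · have m1 : Measurable fun v : (S → ℝ) × (S → ℝ) => v.1 ⟨x, hx⟩ :=
        (measurable_pi_apply _).comp measurable_fst
      have m2 : Measurable fun v : (S → ℝ) × (S → ℝ) => v.2 ⟨x, hx⟩ :=
        (measurable_pi_apply _).comp measurable_snd
      have : MeasurableSet {v : (S → ℝ) × (S → ℝ) | 1 - δ / 2 ≤ v.1 ⟨x, hx⟩ ∨
          (δ / 2 < v.1 ⟨x, hx⟩ ∧ v.1 ⟨x, hx⟩ < 1 - δ / 2 ∧ h ≤ v.2 ⟨x, hx⟩)} :=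
        (measurableSet_le measurable_const m1).union ((measurableSet_lt measurable_const m1).inter
          ((measurableSet_lt m1 measurable_const).inter (measurableSet_le measurable_const m2)))
      refine measurable_to_prop ?_
      convert this using 1
      ext v
      simp [hG, hx]
    · simp [hG, hx]
  have mA := hA.measurableSet S.finite_toSet
  have key : ∀ u f : V d → ℝ, TdLvl (fun x (_ : Unit) => u x) (fun x _ => f x) δ h () ∈ A ↔
      G (fun i => u i, fun i => f i) ∈ A := by
    intro u f
    rw [← loc_iff_inter hA (TdLvl _ _ δ h ())]
    have : TdLvl (fun x (_ : Unit) => u x) (fun x _ => f x) δ h () ∩ S =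
        G (fun i => u i, fun i => f i) := by
      ext x
      simp only [TdLvl, hG, mem_inter_iff, Finset.mem_coe, Set.mem_ofPred_eq, exists_prop]
      exact and_comm
    rw [this]
  have mU : Measurable fun ω (i : S) => U i ω := measurable_pi_lambda _ fun i => hU.1 i
  have mU' : Measurable fun ω (i : S) => U' i ω := measurable_pi_lambda _ fun i => hU'.1 i
  have mφ : Measurable fun ω (i : S) => φ i ω := measurable_pi_lambda _ fun i => hφ.1 i
  have mφ' : Measurable fun ω (i : S) => φ' i ω := measurable_pi_lambda _ fun i => hφ'.1 i
  have e1 := (indepFun_iff_map_prod_eq_prod_map_map mU.aemeasurable mφ.aemeasurable).1 (hi S)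
  have e2 := (indepFun_iff_map_prod_eq_prod_map_map mU'.aemeasurable mφ'.aemeasurable).1 (hi' S)
  rw [hU.map_restrict_eq, hφ.map_restrict_eq hφ'] at e1
  rw [hU'.map_restrict_eq] at e2
  have e3 : P.real {ω | TdLvl U φ δ h ω ∈ A} =
      (P.map fun ω => ((fun i : S => U i ω), (fun i : S => φ i ω))).real (G ⁻¹' A) := by
    rw [map_measureReal_apply (mU.prodMk mφ) (mG mA)]
    congr 1
    ext ω
    exact key (fun x => U x ω) fun x => φ x ω
  have e4 : P'.real {ω | TdLvl U' φ' δ h ω ∈ A} =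
      (P'.map fun ω => ((fun i : S => U' i ω), (fun i : S => φ' i ω))).real (G ⁻¹' A) := by
    rw [map_measureReal_apply (mU'.prodMk mφ') (mG mA)]
    congr 1
    ext ω
    exact key (fun x => U' x ω) fun x => φ' x ω
  rw [e3, e4, e1, e2]

end transport

section canonical

/-- Functions of disjoint sets of coordinates are independent. -/
theorem indepFun_of_disjoint {K β γ : Type*} {m : K → Measure ℝ} [∀ k, IsProbabilityMeasure (m k)]
    [MeasurableSpace β] [MeasurableSpace γ] {f : (K → ℝ) → β} {g : (K → ℝ) → γ} {s t : Finset K}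
    (hf : Measurable f) (hg : Measurable g) (hst : Disjoint s t)
    (hfs : ∀ ω ω' : K → ℝ, (∀ k ∈ s, ω k = ω' k) → f ω = f ω')
    (hgt : ∀ ω ω' : K → ℝ, (∀ k ∈ t, ω k = ω' k) → g ω = g ω') :
    IndepFun f g (Measure.infinitePi m) := by
  refine indepFun_iff_measure_inter_preimage_eq_mul.2 fun A B hA hB => ?_
  have h1 : DepOn s (f ⁻¹' A) := fun ω ω' h hω => by
    rw [mem_preimage] at hω ⊢
    rwa [← hfs ω ω' h]
  have h2 : DepOn t (g ⁻¹' B) := fun ω ω' h hω => by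
    rw [mem_preimage] at hω ⊢
    rwa [← hgt ω ω' h]
  have := h1.indep (m := m) h2 hst (hf hA) (hg hB)
  simp only [measureReal_def, ← ENNReal.toReal_mul] at this
  exact (ENNReal.toReal_eq_toReal_iff' (measure_ne_top _ _)
    (ENNReal.mul_ne_top (measure_ne_top _ _) (measure_ne_top _ _))).1 this

/-- A linear combination of independent standard Gaussian coordinates. -/
theorem map_sum_gaussian {K ι : Type*} {m : K → Measure ℝ} [∀ k, IsProbabilityMeasure (m k)]
    (κ : ι → K) (hκ : Function.Injective κ) (hm : ∀ i, m (κ i) = gaussianReal 0 1)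
    (s : Finset ι) (b : ι → ℝ) :
    (Measure.infinitePi m).map (fun ω => ∑ i ∈ s, b i * ω (κ i)) =
      gaussianReal 0 (Real.toNNReal (∑ i ∈ s, b i * b i)) := by
  classical
  induction s using Finset.induction_on with
  | empty => simp
  | insert i s hi ih =>
    have m1 : Measurable fun ω : K → ℝ => b i * ω (κ i) := (measurable_pi_apply _).const_mul _
    have m2 : Measurable fun ω : K → ℝ => ∑ j ∈ s, b j * ω (κ j) :=
      Finset.measurable_sum _ fun _ _ => (measurable_pi_apply _).const_mul _
    have ind : IndepFun (fun ω : K → ℝ => b i * ω (κ i)) (fun ω => ∑ j ∈ s, b j * ω (κ j))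
        (Measure.infinitePi m) := by
      refine indepFun_of_disjoint (s := {κ i}) (t := s.image κ) m1 m2 ?_ ?_ ?_
      · rw [Finset.disjoint_singleton_left, Finset.mem_image]
        rintro ⟨j, hj, h⟩
        exact hi (hκ h ▸ hj)
      · intro ω ω' h
        rw [h _ (Finset.mem_singleton_self _)]
      · intro ω ω' h
        exact Finset.sum_congr rfl fun j hj => by rw [h _ (Finset.mem_image_of_mem _ hj)]
    have l1 : (Measure.infinitePi m).map (fun ω => b i * ω (κ i)) =
        gaussianReal 0 (Real.toNNReal (b i * b i)) := by
      have := Measure.map_map (μ := Measure.infinitePi m) (measurable_const_mul (b i))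
        (measurable_pi_apply (κ i))
      rw [(measurePreserving_eval_infinitePi m (κ i)).map_eq, hm, gaussianReal_map_const_mul] at this
      refine this.symm.trans ?_
      congr 1
      · simp
      · ext
        simp [Real.coe_toNNReal _ (mul_self_nonneg (b i)), sq]
    have := gaussianReal_add_gaussianReal_of_indepFun ind l1 ih
    rw [← Real.toNNReal_add (mul_self_nonneg _) (Finset.sum_nonneg fun _ _ => mul_self_nonneg _),
      add_zero] at this
    rw [Finset.sum_insert hi, ← this]
    congr 1
    funext ω
    simp [Finset.sum_insert hi]

variable {d : ℕ} (L : ℕ)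

/-- The moving-average field realises the truncated covariance. -/
theorem isCGF_phi (hd : 0 < d) : IsCGF (PP d L) (phi (wt d L) (L + 1)) (covTrunc d L) := by
  classical
  refine ⟨fun x => measurable_phi _ _ _, fun s c => ?_⟩
  set W : Finset (V d) := s.biUnion fun x => bxF x (L + 1) with hW
  have hsub : ∀ x ∈ s, bxF x (L + 1) ⊆ W := fun x hx =>
    Finset.subset_biUnion_of_mem (fun x => bxF x (L + 1)) hx
  set b : V d × (Fin (L + 1) × Fin d) → ℝ := fun p => ∑ x ∈ s, c x * wt d L x p with hb
  have e1 : (fun ω => ∑ x ∈ s, c x * phi (wt d L) (L + 1) x ω) =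
      fun ω : Kc d L → ℝ => ∑ p ∈ W ×ˢ (Finset.univ : Finset (Fin (L + 1) × Fin d)),
        b p * ω (p.1, Sum.inl p.2) := by
    funext ω
    simp only [hb, Finset.sum_mul]
    rw [Finset.sum_comm]
    refine Finset.sum_congr rfl fun x hx => ?_
    rw [phi, Finset.mul_sum]
    refine (Finset.sum_subset (Finset.product_subset_product_left (hsub x hx)) ?_).trans
      (Finset.sum_congr rfl fun p _ => by ring)
    intro p _ hp
    rw [Finset.mem_product, mem_bxF] at hp
    rw [wt_eq_zero (by
      by_contra h
      exact hp ⟨not_lt.1 h, Finset.mem_univ _⟩)]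
    ring
  rw [e1, PP, map_sum_gaussian (fun p : V d × (Fin (L + 1) × Fin d) => (p.1, Sum.inl p.2))
    (fun p q h => by
      simp only [Prod.mk.injEq, Sum.inl.injEq] at h
      exact Prod.ext h.1 h.2) (fun p => rfl)]
  congr 2
  simp only [hb, Finset.sum_mul_sum]
  rw [Finset.sum_comm]
  refine Finset.sum_congr rfl fun x hx => ?_
  rw [Finset.sum_comm]
  refine Finset.sum_congr rfl fun y _ => ?_
  rw [← sum_wt hd L x y (hsub x hx), Finset.mul_sum]
  exact Finset.sum_congr rfl fun p _ => by ring

/-- The noise variables of the canonical space. -/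
def noise (x : V d) (ω : Kc d L → ℝ) : ℝ := ω (x, Sum.inr none)

theorem isIIDUnif_noise (e : V d ≃ V d) : IsIIDUnif (PP d L) fun x => noise L (e x) := by
  refine ⟨fun x => measurable_pi_apply _, fun x =>
    (measurePreserving_eval_infinitePi (mc d L) (e x, Sum.inr none)).map_eq, ?_⟩
  have h1 : iIndepFun (fun (i : Kc d L) (ω : Kc d L → ℝ) => ω i) (PP d L) :=
    iIndepFun_infinitePi (P := mc d L) (X := fun _ x => x) fun _ => measurable_id
  exact h1.precomp (g := fun x => (e x, Sum.inr none)) fun x y h => by simpa using h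

theorem indepFun_noise (a : V d → V d × (Fin (L + 1) × Fin d) → ℝ) (r : ℕ) (e : V d ≃ V d)
    (s : Finset (V d)) : IndepFun (fun ω (i : s) => noise L (e i) ω)
      (fun ω (i : s) => phi a r (e i) ω) (PP d L) := by
  refine indepFun_of_disjoint (s := s.biUnion fun x => {(e x, Sum.inr none)})
    (t := s.biUnion fun x => gN L r (e x))
    (measurable_pi_lambda _ fun i => measurable_pi_apply _)
    (measurable_pi_lambda _ fun i => measurable_phi _ _ _) ?_ ?_ ?_
  · simp only [Finset.disjoint_biUnion_left, Finset.disjoint_biUnion_right,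
      Finset.disjoint_singleton_left]
    intro x _ y _ h
    obtain ⟨τ, hτ⟩ := ((mem_gN r _).1 h).2
    simp at hτ
  · intro ω ω' h
    funext i
    exact h _ (Finset.mem_biUnion.2 ⟨i, i.2, Finset.mem_singleton_self _⟩)
  · intro ω ω' h
    funext i
    refine Finset.sum_congr rfl fun p hp => ?_
    rw [h _ (Finset.mem_biUnion.2 ⟨i, i.2, Finset.mem_image_of_mem _ hp⟩)]

variable {δ : ℝ} (hδ : δ ∈ Ioo (0 : ℝ) 1)

theorem hyb_plain_cf (a : V d → V d × (Fin (L + 1) × Fin d) → ℝ) (r : ℕ) (h : ℝ)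
    (ω : Kc d L → ℝ) :
    (hyb a r hδ (Spr.plain h)).cf ω = TdLvl (noise L) (phi a r) δ h ω := by
  ext x
  simp [Mdl.cf, hyb, Spr.plain, TdLvl, noise]

theorem good_muh_wt (hd : 0 < d) (h : ℝ) :
    Good (muh (wt d L) (L + 1) hδ h) (2 * (L + 1)) (δ / 4) := by
  refine good_muh _ _ hδ (wt_nonneg d L) h fun e he S A hS hA => ?_
  have hA' : Loc (e.symm '' S) {X | e '' X ∈ A} := by
    intro X X' hX hXA
    refine hA _ _ ?_ hXA
    have := congrArg (e '' ·) hX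
    simpa [image_inter e.injective, image_image] using this
  rw [muh_real _ _ hδ h hS hA, muh_real _ _ hδ h (hS.image _) hA']
  have e1 : (hyb (wt d L) (L + 1) hδ (Spr.plain h)).cf ⁻¹' {X | e '' X ∈ A} =
      {ω | TdLvl (fun x => noise L (e.symm x)) (fun x => phi (wt d L) (L + 1) (e.symm x)) δ h ω
        ∈ A} := by
    ext ω
    rw [mem_preimage, hyb_plain_cf, Set.mem_ofPred_eq, Set.mem_ofPred_eq, Equiv.image_eq_preimage_symm]
    rfl
  have e2 : (hyb (wt d L) (L + 1) hδ (Spr.plain h)).cf ⁻¹' A =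
      {ω | TdLvl (noise L) (phi (wt d L) (L + 1)) δ h ω ∈ A} := by
    ext ω
    rw [mem_preimage, hyb_plain_cf, Set.mem_ofPred_eq]
  rw [e1, e2]
  have hc := isCGF_phi L hd
  exact TdLvl_real_eq (hc.comp_equiv e.symm fun x y => by
      rw [← he.covTrunc_eq, e.apply_symm_apply, e.apply_symm_apply]) hc
    (isIIDUnif_noise L e.symm) (isIIDUnif_noise L (Equiv.refl _))
    (indepFun_noise L _ _ e.symm) (indepFun_noise L _ _ (Equiv.refl _)) δ h hS hA

/-- The canonical model has the law of any realisation of the noised level set. -/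
theorem muh_real_eq {Ω : Type*} [MeasurableSpace Ω] {P : Measure Ω} [IsProbabilityMeasure P]
    {φ U : V d → Ω → ℝ} (hd : 0 < d) (hφ : IsCGF P φ (covTrunc d L)) (hU : IsIIDUnif P U)
    (hind : IndepFun (proc U) (proc φ) P) (h : ℝ) {S : Set (V d)} {A : Set (Set (V d))}
    (hS : S.Finite) (hA : Loc S A) :
    P.real {ω | TdLvl U φ δ h ω ∈ A} = (muh (wt d L) (L + 1) hδ h).real A := by
  rw [muh_real _ _ hδ h hS hA]
  have e2 : (hyb (wt d L) (L + 1) hδ (Spr.plain h)).cf ⁻¹' A =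
      {ω | TdLvl (noise L) (phi (wt d L) (L + 1)) δ h ω ∈ A} := by
    ext ω
    rw [mem_preimage, hyb_plain_cf, Set.mem_ofPred_eq]
  rw [e2]
  refine TdLvl_real_eq hφ (isCGF_phi L hd) hU (isIIDUnif_noise L (Equiv.refl _)) (fun s => ?_)
    (indepFun_noise L _ _ (Equiv.refl _)) δ h hS hA
  have m : Measurable fun (v : V d → ℝ) (i : s) => v i :=
    measurable_pi_lambda _ fun i => measurable_pi_apply _
  exact hind.comp m m

theorem exists_phi_Ico_ge (hd : 0 < d) {h h' : ℝ} (hh : h' < h) :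
    ∃ p, 0 < p ∧ ∀ x : V d, p ≤ (PP d L).real (phi (wt d L) (L + 1) x ⁻¹' Ico h' h) := by
  set v := Real.toNNReal (covTrunc d L 0 0) with hv
  have hv0 : v ≠ 0 := by
    have := covTrunc_self_pos (d := d) L 0
    rw [hv, ne_eq, Real.toNNReal_eq_zero]
    exact not_le.2 this
  refine ⟨(gaussianReal 0 v).real (Ico h' h), ?_, fun x => le_of_eq ?_⟩
  · refine ENNReal.toReal_pos (fun h0 => ?_) (measure_ne_top _ _)
    have := gaussianReal_absolutelyContinuous' 0 hv0 h0
    rw [Real.volume_Ico, ENNReal.ofReal_eq_zero] at this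
    linarith
  · have := (isCGF_phi L hd).2 {x} 1
    simp only [Finset.sum_singleton, Pi.one_apply, one_mul, covTrunc_self L x] at this
    rw [← map_measureReal_apply (measurable_phi _ _ _) measurableSet_Ico, this]

end canonical

end

section

section assembly

theorem sInf_eq_sInf_of_interlace {A B : Set ℝ} (hBA : B ⊆ A)
    (hAB : ∀ x ∈ A, ∀ y, x < y → y ∈ B) : sInf A = sInf B := by
  rcases A.eq_empty_or_nonempty with rfl | ⟨x, hx⟩
  · rw [subset_empty_iff.1 hBA]
  have hB : B.Nonempty := ⟨x + 1, hAB x hx _ (by linarith)⟩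
  by_cases hb : BddBelow A
  · refine le_antisymm (csInf_le_csInf hb hB hBA) (le_csInf ⟨x, hx⟩ fun z hz => ?_)
    exact le_of_forall_gt_imp_ge_of_dense fun y hy => csInf_le (hb.mono hBA) (hAB z hz y hy)
  · have hb' : ¬ BddBelow B := fun ⟨c, hc⟩ => hb ⟨c, fun z hz =>
      le_of_forall_gt_imp_ge_of_dense fun y hy => hc (hAB z hz y hy)⟩
    rw [Real.sInf_of_not_bddBelow hb, Real.sInf_of_not_bddBelow hb']

theorem sSup_eq_sInf_of_interlace {T A : Set ℝ} (hT : ∀ x ∉ A, ∀ y < x, y ∈ T)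
    (hA : ∀ x ∈ A, ∀ y ∈ T, y ≤ x) : sSup T = sInf A := by
  have hT' : ∀ x ∉ A, ∀ y ∈ A, x ≤ y := fun x hx y hy =>
    le_of_forall_lt_imp_le_of_dense fun z hz => hA y hy z (hT x hx z hz)
  rcases A.eq_empty_or_nonempty with rfl | hne
  · have : T = univ := eq_univ_of_forall fun y => hT (y + 1) (notMem_empty _) y (by linarith)
    rw [this, Real.sInf_empty, Real.sSup_univ]
  rcases T.eq_empty_or_nonempty with rfl | hTne
  · have : A = univ := eq_univ_of_forall fun x => by
      by_contra hx
      exact hT x hx (x - 1) (by linarith)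
    rw [this, Real.sSup_empty, Real.sInf_univ]
  have hb : BddBelow A := ⟨hTne.some, fun x hx => hA x hx _ hTne.some_mem⟩
  have hb' : BddAbove T := ⟨hne.some, fun x hx => hA _ hne.some_mem x hx⟩
  refine le_antisymm (csSup_le hTne fun y hy => le_csInf hne fun x hx => hA x hx y hy) ?_
  refine le_of_forall_lt_imp_le_of_dense fun z hz => ?_
  obtain ⟨x, hzx, hx⟩ := exists_between hz
  exact le_csSup hb' (hT x (fun h => absurd (csInf_le hb h) (not_le.2 hx)) z hzx)

theorem iInf_ofReal_eq_zero_iff {f : ℕ → ℝ} :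
    (⨅ n : ℕ, ENNReal.ofReal (f (n + 1))) = 0 ↔ ∀ ε : ℝ, 0 < ε → ∃ n, 1 ≤ n ∧ f n < ε := by
  constructor
  · intro h ε hε
    have : (⨅ n : ℕ, ENNReal.ofReal (f (n + 1))) < ENNReal.ofReal ε := by
      rw [h]
      exact ENNReal.ofReal_pos.2 hε
    obtain ⟨n, hn⟩ := iInf_lt_iff.1 this
    exact ⟨n + 1, by omega, (ENNReal.ofReal_lt_ofReal_iff hε).1 hn⟩
  · intro h
    by_contra h0
    obtain ⟨ε, hε, hlt⟩ := ENNReal.lt_iff_exists_nnreal_btwn.1 (pos_iff_ne_zero.2 h0)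
    have hε' : 0 < (ε : ℝ) := by exact_mod_cast hε
    obtain ⟨n, hn, hlt'⟩ := h ε hε'
    obtain ⟨m, rfl⟩ : ∃ m, n = m + 1 := ⟨n - 1, by omega⟩
    refine absurd (iInf_le (fun n : ℕ => ENNReal.ofReal (f (n + 1))) m) (not_le.2 ?_)
    refine lt_of_le_of_lt ?_ hlt
    rw [← ENNReal.ofReal_coe_nnreal]
    exact ENNReal.ofReal_le_ofReal hlt'.le

variable {d : ℕ}

theorem loc_Arm_self (a : V d) (n m : ℕ) : Loc (Bx a m) (Arm a n m) := by
  rcases le_total n m with h | h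
  · exact loc_Arm h
  · refine loc_of_iff (fun X => ∃ y ∈ Sph a m, y ∈ X) fun X => ?_
    constructor
    · rintro ⟨x, -, y, hy, hc⟩
      exact ⟨y, hy, hc.right_mem, le_of_eq hy⟩
    · rintro ⟨y, hy, hyX, hm⟩
      exact ⟨y, le_trans hm h, y, hy, Rch.refl hyX⟩

theorem connToInf_iff (hd : 0 < d) {X : Set (V d)} :
    ConnToInf X {(0 : V d)} ↔ ∀ n, X ∈ Arm 0 0 n := by
  have e : ({(0 : V d)} : Set (V d)) = box d 0 := by
    rw [box_eq_Bx le_rfl]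
    ext x
    rw [mem_singleton_iff, mem_Bx, Nat.floor_zero, Nat.le_zero, dinf_eq_zero]
    exact eq_comm
  have e' : ∀ n : ℕ, ConnIn X {(0 : V d)} (bdry d n) ↔ X ∈ Arm 0 0 n := fun n => by
    rw [e, connIn_box_iff hd le_rfl, Nat.floor_zero]
  constructor
  · intro h n
    exact arm_anti le_rfl (Nat.zero_le _) (Nat.le_succ n) ((e' _).1 (h (n + 1) (by omega)))
  · exact fun h n _ => (e' n).2 (h n)

variable {L : ℕ} {δ : ℝ} (hδ : δ ∈ Ioo (0 : ℝ) 1) {Ω : Type*} [MeasurableSpace Ω] {P : Measure Ω}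
  [IsProbabilityMeasure P] {φ U : V d → Ω → ℝ}

theorem connToInf_null_iff (hd : 0 < d) (hφ : IsCGF P φ (covTrunc d L)) (hU : IsIIDUnif P U)
    (hind : IndepFun (proc U) (proc φ) P) (h : ℝ) :
    P {ω | ConnToInf (TdLvl U φ δ h ω) {(0 : V d)}} = 0 ↔
      ¬ ∃ θ : ℝ, 0 < θ ∧ ∀ n, θ ≤ (muh (wt d L) (L + 1) hδ h).real (Arm 0 0 n) := by
  have e : {ω | ConnToInf (TdLvl U φ δ h ω) {(0 : V d)}} =
      ⋂ n, {ω | TdLvl U φ δ h ω ∈ Arm 0 0 n} := by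
    ext ω
    simp [connToInf_iff hd]
  have hm : ∀ n, P.real {ω | TdLvl U φ δ h ω ∈ Arm 0 0 n} =
      (muh (wt d L) (L + 1) hδ h).real (Arm 0 0 n) := fun n =>
    muh_real_eq L hδ hd hφ hU hind h (finite_Bx _ _) (loc_Arm_self 0 0 n)
  have hmeas : Measurable (TdLvl U φ δ h) := by
    refine measurable_set_iff.2 fun x => measurable_to_prop ?_
    have : MeasurableSet {ω | 1 - δ / 2 ≤ U x ω ∨ (δ / 2 < U x ω ∧ U x ω < 1 - δ / 2 ∧ h ≤ φ x ω)} :=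
      (measurableSet_le measurable_const (hU.1 x)).union
        ((measurableSet_lt measurable_const (hU.1 x)).inter
          ((measurableSet_lt (hU.1 x) measurable_const).inter
            (measurableSet_le measurable_const (hφ.1 x))))
    convert this using 1
    ext ω
    simp [TdLvl]
  have hms : ∀ n, MeasurableSet {ω | TdLvl U φ δ h ω ∈ Arm 0 0 n} := fun n =>
    hmeas ((loc_Arm_self 0 0 n).measurableSet (finite_Bx _ _))
  have lim := tendsto_measure_iInter_atTop (μ := P) (fun n => (hms n).nullMeasurableSet)
    (fun n m hnm ω hω => arm_anti le_rfl (Nat.zero_le _) hnm hω) ⟨0, measure_ne_top _ _⟩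
  rw [← e] at lim
  constructor
  · rintro h0 ⟨θ, hθ, hn⟩
    rw [h0] at lim
    obtain ⟨n, hlt⟩ := (lim.eventually_lt_const (ENNReal.ofReal_pos.2 hθ)).exists
    rw [Function.comp_apply, ← ofReal_measureReal, hm, ENNReal.ofReal_lt_ofReal_iff hθ] at hlt
    exact absurd (hn n) (not_le.2 hlt)
  · intro hne
    by_contra h0
    refine hne ⟨P.real {ω | ConnToInf (TdLvl U φ δ h ω) {(0 : V d)}},
      ENNReal.toReal_pos h0 (measure_ne_top _ _), fun n => ?_⟩
    rw [← hm, e]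
    exact measureReal_mono (iInter_subset _ n) (measure_ne_top _ _)

theorem crossing_iInf_iff (hd : 0 < d) (hφ : IsCGF P φ (covTrunc d L)) (hU : IsIIDUnif P U)
    (hind : IndepFun (proc U) (proc φ) P) (h : ℝ) :
    (⨅ R : ℕ, P {ω | ConnIn (TdLvl U φ δ h ω) (box d ((R : ℝ) + 1))
      (bdry d (2 * ((R : ℝ) + 1)))}) = 0 ↔
      ∀ ε : ℝ, 0 < ε → ∃ n, 1 ≤ n ∧ (muh (wt d L) (L + 1) hδ h).real (Arm 0 n (2 * n)) < ε := by
  rw [← iInf_ofReal_eq_zero_iff]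
  refine Eq.congr_left (iInf_congr fun R => ?_)
  rw [← muh_real_eq L hδ hd hφ hU hind h (finite_Bx _ _) (loc_Arm_self 0 _ _), ofReal_measureReal]
  congr 1
  ext ω
  have := connIn_box_iff hd (X := TdLvl U φ δ h ω) (r := (R : ℝ) + 1) (by positivity) (2 * (R + 1))
  push_cast at this
  rw [Set.mem_ofPred_eq, Set.mem_ofPred_eq, this]
  have hf : ⌊(R : ℝ) + 1⌋₊ = R + 1 := by exact_mod_cast Nat.floor_natCast (R + 1)
  rw [hf]

theorem tilde_iInf_iff (hd : 0 < d) (hφ : IsCGF P φ (covTrunc d L)) (hU : IsIIDUnif P U)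
    (hind : IndepFun (proc U) (proc φ) P) (h : ℝ) :
    (⨅ R : ℕ, ENNReal.ofReal (((R : ℝ) + 1) ^ d) *
        P {ω | ¬ ConnIn (TdLvl U φ δ h ω) (box d (ufn ((R : ℝ) + 1)))
          (bdry d ((R : ℝ) + 1))}) = 0 ↔
      ∀ ε : ℝ, 0 < ε → ∃ n : ℕ, 1 ≤ n ∧
        (n : ℝ) ^ d * (muh (wt d L) (L + 1) hδ h).real (Arm 0 ⌊ufn n⌋₊ n)ᶜ < ε := by
  rw [← iInf_ofReal_eq_zero_iff (f := fun n : ℕ =>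
    (n : ℝ) ^ d * (muh (wt d L) (L + 1) hδ h).real (Arm 0 ⌊ufn n⌋₊ n)ᶜ)]
  refine Eq.congr_left (iInf_congr fun R => ?_)
  rw [← muh_real_eq L hδ hd hφ hU hind h (finite_Bx _ _) (loc_Arm_self 0 _ _).compl,
    ENNReal.ofReal_mul (by positivity), ofReal_measureReal]
  push_cast
  congr 2
  ext ω
  have := connIn_box_iff hd (X := TdLvl U φ δ h ω) (r := ufn ((R : ℝ) + 1)) (ufn_pos _).le (R + 1)
  push_cast at this
  rw [Set.mem_ofPred_eq, Set.mem_ofPred_eq, this, mem_compl_iff]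

end assembly

end

/-- Proposition 1.2: sharpness for the noised finite-range models: for all `d ≥ 3`,
`L ≥ 0` and `δ ∈ (0,1)`, `h̃(δ,L) = h_*(δ,L) = h_{**}(δ,L)`. -/
theorem sharpness_truncated (d : ℕ) (hd : 3 ≤ d) {Ω : Type*} [MeasurableSpace Ω]
    (P : Measure Ω) [IsProbabilityMeasure P] (L : ℕ) (δ : ℝ) (hδ : δ ∈ Set.Ioo (0 : ℝ) 1)
    (φL U : V d → Ω → ℝ)
    (hφ : IsCGF P φL (covTrunc d L)) (hU : IsIIDUnif P U)
    (hind : IndepFun (proc U) (proc φL) P) :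
    hTildeT d P U φL δ = hStarT d P U φL δ ∧
      hStarT d P U φL δ = hStarStarT d P U φL δ := by
  have hd0 : 0 < d := by omega
  unfold hTildeT hStarT hStarStarT
  simp only [connToInf_null_iff hδ hd0 hφ hU hind, crossing_iInf_iff hδ hd0 hφ hU hind,
    tilde_iInf_iff hδ hd0 hφ hU hind]
  have good := good_muh_wt L hδ hd0
  have hBA : ∀ h : ℝ, (∀ ε : ℝ, 0 < ε → ∃ n, 1 ≤ n ∧
      (muh (wt d L) (L + 1) hδ h).real (Arm 0 n (2 * n)) < ε) →
      ¬ ∃ θ : ℝ, 0 < θ ∧ ∀ n, θ ≤ (muh (wt d L) (L + 1) hδ h).real (Arm 0 0 n) := by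
    rintro h hB ⟨θ, hθ, hn⟩
    obtain ⟨n, -, hlt⟩ := hB θ hθ
    refine absurd ((hn (2 * n)).trans (measureReal_mono ?_ (measure_ne_top _ _))) (not_le.2 hlt)
    exact arm_anti (Nat.zero_le _) (by omega) le_rfl
  have hAB : ∀ h' h : ℝ, (¬ ∃ θ : ℝ, 0 < θ ∧ ∀ n, θ ≤
      (muh (wt d L) (L + 1) hδ h').real (Arm 0 0 n)) → h' < h →
      ∀ ε : ℝ, 0 < ε → ∃ n, 1 ≤ n ∧
        (muh (wt d L) (L + 1) hδ h).real (Arm 0 n (2 * n)) < ε := by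
    intro h' h hA hh ε hε
    by_contra! hB
    obtain ⟨p, hp, hphi⟩ := exists_phi_Ico_ge L hd0 hh
    exact hA (perc_of_crossing _ _ hδ (good h) hh hp hphi hε hB)
  constructor
  · refine sSup_eq_sInf_of_interlace (fun h hA h' hh => ?_) fun h' hA h hT => ?_
    · rw [Set.mem_ofPred_eq, not_not] at hA
      obtain ⟨θ, hθ, hn⟩ := hA
      obtain ⟨p, hp, hphi⟩ := exists_phi_Ico_ge L hd0 hh
      exact fun ε hε => tilde_of_perc _ _ hδ (by omega) (good h) hh hp hphi hθ hn hε
    · by_contra! hh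
      obtain ⟨ε, hε, hle⟩ := (good h).not_tilde hd0 (hAB h' h hA hh)
      obtain ⟨n, hn, hlt⟩ := hT ε hε
      exact absurd (hle n hn) (not_le.2 hlt)
  · exact sInf_eq_sInf_of_interlace hBA fun h' hA h hh => hAB h' h hA hh

end
end GFFperc
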